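/- Let X = C_α be the mapping cone of α = ω ∘ η. Then the Lusternik–Schnirelmann category of X equals 2: X admits a cover by three open sets each of whose inclusions into X is null-homotopic, but no such cover by two open sets. -/

import Mathlib

noncomputable section

open unitInterval Topology

/-- The `n`-sphere, modelled as the quotient of the `n`-cube `I^n` by its
boundary. -/
def Sph (n : ℕ) : Type :=
  Quot (fun x y : Fin n → I => x ∈ Cube.boundary (Fin n) ∧ y ∈ Cube.boundary (Fin n))

instance (n : ℕ) : TopologicalSpace (Sph n) := instTopologicalSpaceQuot

/-- The basepoint of `Sph n` (the image of the collapsed boundary). -/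
def sbase (n : ℕ) : Sph n := Quot.mk _ (fun _ => 0)

/-- The quotient map `I^n → Sph n`. -/
def projCube (n : ℕ) : C((Fin n → I), Sph n) := ⟨Quot.mk _, continuous_quot_mk⟩

/-- The class in the `n`-th homotopy group `π_n(X, g(base))` determined by a
map `g : Sph n → X` from the `n`-sphere. -/
def sphereClass {n : ℕ} (hn : 0 < n) {X : Type*} [TopologicalSpace X] (g : C(Sph n, X)) :
    HomotopyGroup (Fin n) X (g (sbase n)) :=
  Quotient.mk (GenLoop.Homotopic.setoid (Fin n) (g (sbase n)))
    ⟨g.comp (projCube n), by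
      intro y hy
      have hb : Quot.mk _ y = sbase n :=
        Quot.sound ⟨hy, ⟨⟨0, hn⟩, Or.inl rfl⟩⟩
      show g (Quot.mk _ y) = g (sbase n)
      rw [hb]⟩

/-- The homotopy class of `g : Sph n → X` generates the homotopy group
`π_n(X, g(base))`. -/
def GeneratesPi {n : ℕ} (hn : 0 < n) {X : Type*} [TopologicalSpace X] (g : C(Sph n, X)) : Prop :=
  haveI : Nonempty (Fin n) := ⟨⟨0, hn⟩⟩
  Subgroup.zpowers (sphereClass hn g) = ⊤

/-- The relation generating the mapping cone of `f : A → X`:  the quotient of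
`X ⊕ (A × I)` by `(a, 1) ∼ f a` and `(a, 0) ∼ (a', 0)`. -/
def coneRel {A X : Type*} [TopologicalSpace A] [TopologicalSpace X] (f : A → X) :
    X ⊕ A × I → X ⊕ A × I → Prop := fun p q =>
  (∃ a, p = Sum.inr (a, 1) ∧ q = Sum.inl (f a)) ∨
  (∃ a a', p = Sum.inr (a, 0) ∧ q = Sum.inr (a', 0))

/-- The mapping cone of a map `f : A → X`, with the quotient topology. -/
def MappingCone {A X : Type*} [TopologicalSpace A] [TopologicalSpace X] (f : A → X) : Type _ :=
  Quot (coneRel f)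

instance {A X : Type*} [TopologicalSpace A] [TopologicalSpace X] (f : A → X) :
    TopologicalSpace (MappingCone f) := instTopologicalSpaceQuot

/-- `X` admits a cover by `k` open sets, each of whose inclusions into `X` is
null-homotopic.  (Thus `cat X ≤ k - 1` in the normalized convention.) -/
def CatCover (X : Type*) [TopologicalSpace X] (k : ℕ) : Prop :=
  ∃ U : Fin k → Set X, (∀ i, IsOpen (U i)) ∧ (⋃ i, U i) = Set.univ ∧
    ∀ i, (⟨Subtype.val, continuous_subtype_val⟩ : C(U i, X)).Nullhomotopic

end

noncomputable section

namespace CatCone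

set_option linter.unusedSectionVars false

section

abbrev Coch (V : Type*) := List V → ZMod 2

variable {U V W : Type*}

def sh (a : V) (φ : Coch V) : Coch V := fun l => φ (a :: l)

def cd : Coch V → Coch V
  | _, [] => 0
  | φ, a :: l => φ l + cd (sh a φ) l

@[simp] theorem cd_nil (φ : Coch V) : cd φ [] = 0 := rfl
theorem cd_cons (φ : Coch V) (a : V) (l : List V) : cd φ (a :: l) = φ l + cd (sh a φ) l := rfl

theorem sh_cd (φ : Coch V) (a : V) : sh a (cd φ) = φ + cd (sh a φ) := rfl
theorem sh_add (φ ψ : Coch V) (a : V) : sh a (φ + ψ) = sh a φ + sh a ψ := rfl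

theorem cd_add (φ ψ : Coch V) : cd (φ + ψ) = cd φ + cd ψ := by
  funext l
  induction l generalizing φ ψ with
  | nil => simp
  | cons a l ih =>
    simp only [cd_cons, Pi.add_apply, sh_add, ih]; ring

@[simp] theorem cd_zero : cd (0 : Coch V) = 0 := by
  have := cd_add (0 : Coch V) 0
  simpa using this

theorem coch_add_self (φ : Coch V) : φ + φ = 0 := by
  funext l; exact CharTwo.add_self_eq_zero _

theorem cd_cd (φ : Coch V) : cd (cd φ) = 0 := by
  funext l
  induction l generalizing φ with
  | nil => simp
  | cons a l ih =>
    simp only [cd_cons, sh_cd, cd_add, Pi.add_apply, ih, Pi.zero_apply]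
    grind

theorem cd_sum {ι : Type*} (s : Finset ι) (φ : ι → Coch V) :
    cd (∑ i ∈ s, φ i) = ∑ i ∈ s, cd (φ i) :=
  map_sum (AddMonoidHom.mk' cd cd_add) φ s

/-- Pullback along a map of vertices. -/
def pb (f : V → W) (φ : Coch W) : Coch V := fun l => φ (l.map f)

theorem pb_add (f : V → W) (φ ψ : Coch W) : pb f (φ + ψ) = pb f φ + pb f ψ := rfl
@[simp] theorem pb_zero (f : V → W) : pb f (0 : Coch W) = 0 := rfl
theorem sh_pb (f : V → W) (φ : Coch W) (a : V) : sh a (pb f φ) = pb f (sh (f a) φ) := rfl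
theorem pb_pb (f : U → V) (g : V → W) (φ : Coch W) : pb f (pb g φ) = pb (g ∘ f) φ := by
  funext l; simp [pb]

theorem pb_comm {U' : Type*} {f : U → V} {g : V → W} {f' : U → U'} {g' : U' → W} (h : ∀ x, g (f x) = g' (f' x))
    (φ : Coch W) : pb f (pb g φ) = pb f' (pb g' φ) := by
  rw [pb_pb, pb_pb]; congr 1; exact funext h

@[simp] theorem pb_id (φ : Coch V) : pb id φ = φ := by funext l; simp [pb]

theorem cd_pb (f : V → W) (φ : Coch W) : cd (pb f φ) = pb f (cd φ) := by
  funext l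
  induction l generalizing φ with
  | nil => rfl
  | cons a l ih => simp only [cd_cons, sh_pb, ih]; rfl

/-- The prism operator of a pair of vertex maps. -/
def prism (f g : V → W) : Coch W → Coch V
  | _, [] => 0
  | φ, a :: l => φ (f a :: g a :: l.map g) + prism f g (sh (f a) φ) l

theorem prism_cons (f g : V → W) (φ : Coch W) (a : V) (l : List V) :
    prism f g φ (a :: l) = φ (f a :: g a :: l.map g) + prism f g (sh (f a) φ) l := rfl
theorem sh_prism (f g : V → W) (φ : Coch W) (a : V) :
    sh a (prism f g φ) = pb g (sh (g a) (sh (f a) φ)) + prism f g (sh (f a) φ) := rfl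

theorem prism_add (f g : V → W) (φ ψ : Coch W) : prism f g (φ + ψ) = prism f g φ + prism f g ψ := by
  funext l
  induction l generalizing φ ψ with
  | nil => simp [prism]
  | cons a l ih => simp only [prism_cons, Pi.add_apply, sh_add, ih]; ring

theorem cd_prism (f g : V → W) (φ : Coch W) :
    cd (prism f g φ) + prism f g (cd φ) = pb f φ + pb g φ := by
  funext l
  induction l generalizing φ with
  | nil => simp [prism, pb]; grind
  | cons a l ih =>
    have h1 := ih (sh (f a) φ)
    simp only [Pi.add_apply, cd_cons, prism_cons, sh_prism, cd_add, cd_pb, sh_cd, prism_add] at *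
    have h2 : cd φ (f a :: g a :: l.map g) = φ (g a :: l.map g) + φ (f a :: l.map g)
      + cd (sh (g a) (sh (f a) φ)) (l.map g) := by
      simp only [cd_cons, sh]; ring
    simp only [pb, sh, List.map_cons] at *
    grind

def cd1 (F : List V → Coch W) : List V → Coch W := fun p q => cd (fun p' => F p' q) p
def cd2 (F : List V → Coch W) : List V → Coch W := fun p => cd (F p)

/-- The cup product of a two-variable cochain (Alexander-Whitney). -/
def cupF : (List V → Coch V) → Coch V
  | _, [] => 0
  | F, a :: l => F [a] (a :: l) + cupF (fun p q => F (a :: p) q) l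

/-- The equivariant extension of the cup product to `Bool × V`. -/
def PiF : (List V → Coch V) → Coch (Bool × V)
  | _, [] => 0
  | F, (false, a) :: l => F [a] (a :: l.map Prod.snd) + PiF (fun p q => F (a :: p) q) l
  | F, (true, a) :: l => F (a :: l.map Prod.snd) [a] + PiF (fun p q => F p (a :: q)) l

theorem PiF_false (F : List V → Coch V) (l : List V) : PiF F (l.map (Prod.mk false)) = cupF F l := by
  induction l generalizing F with
  | nil => rfl
  | cons a l ih => simp [PiF, cupF, ih]

theorem PiF_add (F G : List V → Coch V) : PiF (F + G) = PiF F + PiF G := by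
  funext l
  induction l generalizing F G with
  | nil => simp [PiF]
  | cons a l ih =>
    obtain ⟨b, a⟩ := a
    cases b
    · have := ih (fun p q => F (a :: p) q) (fun p q => G (a :: p) q)
      simp only [PiF, Pi.add_apply] at *
      rw [← sub_eq_zero] at *; rw [← this]
      simp only [Pi.add_def]; ring
    · have := ih (fun p q => F p (a :: q)) (fun p q => G p (a :: q))
      simp only [PiF, Pi.add_apply] at *
      rw [← sub_eq_zero] at *; rw [← this]
      simp only [Pi.add_def]; ring

theorem PiF_flip (F : List V → Coch V) (l : List (Bool × V)) :
    PiF F (l.map (Prod.map not id)) = PiF (fun p q => F q p) l := by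
  have hc : Prod.snd ∘ Prod.map not (id : V → V) = Prod.snd := rfl
  induction l generalizing F with
  | nil => rfl
  | cons a l ih =>
    obtain ⟨b, a⟩ := a
    cases b <;> simp [PiF, ih, hc]

theorem cd_PiF (F : List V → Coch V) (l : List (Bool × V)) :
    cd (PiF F) l = PiF (cd1 F + cd2 F) l + F [] (l.map Prod.snd) + F (l.map Prod.snd) [] := by
  induction l generalizing F with
  | nil => simp [PiF]; grind
  | cons a l ih =>
    obtain ⟨b, a⟩ := a
    cases b
    · have h1 : sh (false, a) (PiF F) =
          pb Prod.snd (sh a (F [a])) + PiF (fun p q => F (a :: p) q) := rfl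
      have h2 : (fun p q => (cd1 F + cd2 F) (a :: p) q) = F + (cd1 (fun p q => F (a :: p) q) +
          cd2 (fun p q => F (a :: p) q)) := by
        funext p q
        simp only [cd1, cd2, Pi.add_apply, cd_cons]
        unfold sh; ring
      rw [cd_cons, h1, cd_add, cd_pb, Pi.add_apply, ih, PiF, h2]
      simp only [PiF_add, cd1, cd2, cd_cons, cd_nil, pb, List.map_cons, Pi.add_apply]
      clear ih; grind (ematch := 0)
    · have h1 : sh (true, a) (PiF F) =
          pb Prod.snd (sh a (fun m => F m [a])) + PiF (fun p q => F p (a :: q)) := rfl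
      have h2 : (fun p q => (cd1 F + cd2 F) p (a :: q)) = F + (cd1 (fun p q => F p (a :: q)) +
          cd2 (fun p q => F p (a :: q))) := by
        funext p q
        simp only [cd1, cd2, Pi.add_apply, cd_cons]
        unfold sh; ring
      rw [cd_cons, h1, cd_add, cd_pb, Pi.add_apply, ih, PiF, h2]
      simp only [PiF_add, cd1, cd2, cd_cons, cd_nil, pb, List.map_cons, Pi.add_apply]
      clear ih; grind (ematch := 0)

theorem pb_PiF (f : V → W) (F : List W → Coch W) (l : List (Bool × V)) :
    PiF F (l.map (Prod.map id f)) = PiF (fun p q => F (p.map f) (q.map f)) l := by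
  have hc : Prod.snd ∘ Prod.map id f = f ∘ (Prod.snd : Bool × V → V) := rfl
  induction l generalizing F with
  | nil => rfl
  | cons a l ih =>
    obtain ⟨b, a⟩ := a
    cases b <;> simp [PiF, ih, hc]

end

section
open Filter

variable {U V W : Type*}

theorem coch_apply_add_self (φ : Coch V) (l : List V) : φ l + φ l = 0 := CharTwo.add_self_eq_zero _

/-! Locality of the operators. -/

theorem cd_loc {φ : Coch V} {l : List V} (h : ∀ l', l' ⊆ l → φ l' = 0) : cd φ l = 0 := by
  induction l generalizing φ with
  | nil => rfl
  | cons a l ih =>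
    rw [cd_cons, h l (List.subset_cons_self _ _), ih, add_zero]
    intro l' hl'
    exact h _ (List.cons_subset_cons _ hl')

theorem prism_loc {f g : V → W} {φ : Coch W} {l : List V}
    (h : ∀ l', l' ⊆ l.map f ++ l.map g → φ l' = 0) : prism f g φ l = 0 := by
  induction l generalizing φ with
  | nil => rfl
  | cons a l ih =>
    rw [prism_cons, h, ih, add_zero]
    · intro l' hl'
      refine h _ ?_
      intro x hx
      rcases List.mem_cons.1 hx with rfl | hx
      · simp
      · have := hl' hx; simp only [List.mem_append, List.map_cons, List.mem_cons] at *; tauto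
    · intro x hx; simp only [List.mem_append, List.map_cons, List.mem_cons] at *; tauto

theorem PiF_loc {F : List V → Coch V} {l : List (Bool × V)}
    (h : ∀ p q, p ⊆ l.map Prod.snd → q ⊆ l.map Prod.snd → F p q = 0) : PiF F l = 0 := by
  induction l generalizing F with
  | nil => rfl
  | cons a l ih =>
    obtain ⟨b, a⟩ := a
    have key : ∀ p, p ⊆ l.map Prod.snd → a :: p ⊆ a :: l.map Prod.snd :=
      fun p hp => List.cons_subset_cons _ hp
    have k1 : [a] ⊆ a :: l.map Prod.snd := by simp
    have k2 : ∀ p : List V, p ⊆ l.map Prod.snd → p ⊆ a :: l.map Prod.snd :=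
      fun p hp => List.subset_cons_of_subset _ hp
    simp only [List.map_cons] at h
    cases b
    · rw [PiF, h _ _ k1 (List.Subset.refl _), ih (fun p q hp hq => h _ _ (key p hp) (k2 q hq)), add_zero]
    · rw [PiF, h _ _ (List.Subset.refl _) k1, ih (fun p q hp hq => h _ _ (k2 p hp) (key q hq)), add_zero]

/-! Degrees. -/

/-- `φ` is concentrated in degree `n`. -/
def Deg (n : ℤ) (φ : Coch V) : Prop := ∀ l, φ l ≠ 0 → l ≠ [] ∧ (l.length : ℤ) = n + 1

theorem Deg.nil {n : ℤ} {φ : Coch V} (h : Deg n φ) : φ [] = 0 := by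
  by_contra h'; exact (h _ h').1 rfl

theorem Deg.eq_zero {n : ℤ} {φ : Coch V} (h : Deg n φ) (hn : n < 0) : φ = 0 := by
  funext l
  by_contra h'
  obtain ⟨h1, h2⟩ := h l h'
  have := List.length_pos_iff.2 h1
  omega

theorem Deg.add {n : ℤ} {φ ψ : Coch V} (h : Deg n φ) (h' : Deg n ψ) : Deg n (φ + ψ) := by
  intro l hl
  by_cases h1 : φ l = 0
  · apply h'; intro h2; simp [h1, h2] at hl
  · exact h l h1

theorem Deg.zero {n : ℤ} : Deg n (0 : Coch V) := fun _ hl => absurd rfl hl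

theorem Deg.pb {n : ℤ} {φ : Coch W} (h : Deg n φ) (f : V → W) : Deg n (pb f φ) := by
  intro l hl
  simpa using h _ hl

theorem deg_cd_aux {m : ℕ} {φ : Coch V} (h : ∀ l, φ l ≠ 0 → l.length = m) (l : List V)
    (hl : cd φ l ≠ 0) : l.length = m + 1 := by
  induction l generalizing φ m with
  | nil => simp at hl
  | cons a l ih =>
    rw [cd_cons] at hl
    by_cases h1 : φ l = 0
    · rw [h1, zero_add] at hl
      cases m with
      | zero =>
        exfalso; apply hl
        exact cd_loc fun l' _ => by by_contra h2; simpa using h _ h2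
      | succ m => simp [ih (m := m) (fun l hl => by simpa using h _ hl) hl]
    · simp [h _ h1]

theorem Deg.cd {n : ℤ} {φ : Coch V} (h : Deg n φ) : Deg (n + 1) (cd φ) := by
  intro l hl
  by_cases hn : n < 0
  · rw [h.eq_zero hn] at hl; simp at hl
  have := deg_cd_aux (m := (n + 1).toNat) (fun l hl => by have := (h l hl).2; omega) l hl
  constructor
  · rintro rfl; simp at hl
  · omega

theorem Deg.of_eq {n m : ℤ} {φ : Coch V} (h : Deg n φ) (e : n = m) : Deg m φ := e ▸ h

theorem deg_prism_aux {m : ℕ} {f g : V → W} {φ : Coch W} (h : ∀ l, φ l ≠ 0 → l.length = m)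
    (l : List V) (hl : prism f g φ l ≠ 0) : l.length + 1 = m := by
  induction l generalizing φ m with
  | nil => exact absurd rfl hl
  | cons a l ih =>
    rw [prism_cons] at hl
    by_cases h1 : φ (f a :: g a :: l.map g) = 0
    · rw [h1, zero_add] at hl
      cases m with
      | zero =>
        exfalso; apply hl
        exact prism_loc fun l' _ => by by_contra h2; simpa using h _ h2
      | succ m => simp [ih (m := m) (fun l hl => by simpa using h _ hl) hl]
    · simpa using h _ h1

theorem Deg.prism {n : ℤ} {f g : V → W} {φ : Coch W} (h : Deg n φ) :
    Deg (n - 1) (prism f g φ) := by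
  intro l hl
  by_cases hn : n < 0
  · rw [h.eq_zero hn] at hl; exact absurd (prism_loc fun _ _ => rfl) hl
  have := deg_prism_aux (m := (n + 1).toNat) (fun l hl => by have := (h l hl).2; omega) l hl
  constructor
  · rintro rfl; exact hl rfl
  · omega

theorem deg_PiF_aux {m : ℕ} {F : List V → Coch V} (h : ∀ p q, F p q ≠ 0 → p.length + q.length = m)
    (l : List (Bool × V)) (hl : PiF F l ≠ 0) : l.length + 1 = m := by
  induction l generalizing F m with
  | nil => exact absurd rfl hl
  | cons a l ih =>
    obtain ⟨b, a⟩ := a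
    cases b
    · rw [PiF] at hl
      by_cases h1 : F [a] (a :: l.map Prod.snd) = 0
      · rw [h1, zero_add] at hl
        cases m with
        | zero =>
          exfalso; apply hl
          exact PiF_loc fun p q _ _ => by by_contra h2; have := h _ _ h2; simp at this
        | succ m =>
          simp [ih (m := m) (fun p q hl => by have := h _ _ hl; simp at this; omega) hl]
      · have := h _ _ h1; simp at this; simp; omega
    · rw [PiF] at hl
      by_cases h1 : F (a :: l.map Prod.snd) [a] = 0
      · rw [h1, zero_add] at hl
        cases m with
        | zero =>
          exfalso; apply hl
          exact PiF_loc fun p q _ _ => by by_contra h2; have := h _ _ h2; simp at this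
        | succ m =>
          simp [ih (m := m) (fun p q hl => by have := h _ _ hl; simp at this; omega) hl]
      · have := h _ _ h1; simp at this; simp; omega

/-- The exterior tensor of two cochains. -/
def tens (φ : Coch V) (ψ : Coch W) : List V → Coch W := fun p q => φ p * ψ q

theorem Deg.PiF {n m : ℤ} {φ ψ : Coch V} (hφ : Deg n φ) (hψ : Deg m ψ) :
    Deg (n + m) (PiF (tens φ ψ)) := by
  intro l hl
  have hl0 : l ≠ [] := by rintro rfl; exact hl rfl
  refine ⟨hl0, ?_⟩
  have key : ∀ p q, tens φ ψ p q ≠ 0 → (p.length : ℤ) + q.length = n + m + 2 := by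
    intro p q hpq
    have h1 := (hφ p (left_ne_zero_of_mul hpq)).2
    have h2 := (hψ q (right_ne_zero_of_mul hpq)).2
    omega
  by_cases hn : n + m + 2 < 0
  · exact absurd (PiF_loc fun p q _ _ => by by_contra h2; have := key _ _ h2; omega) hl
  have := deg_PiF_aux (m := (n + m + 2).toNat) (fun p q h => by have := key _ _ h; omega) l hl
  omega

/-! Sites. -/

/-- A filter on lists stable under passing to sublists. -/
def Her (F : Filter (List V)) : Prop :=
  ∀ p : List V → Prop, (∀ᶠ l in F, p l) → ∀ᶠ l in F, ∀ l', l' ⊆ l → p l'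

theorem Her.comap {F : Filter (List W)} (h : Her F) (f : V → W) (p : List V → Prop)
    (hp : ∀ᶠ l in comap (List.map f) F, p l) :
    ∀ᶠ l in comap (List.map f) F, ∀ l', l'.map f ⊆ l.map f → p l' := by
  rw [eventually_comap] at hp
  filter_upwards [(h _ hp).comap (List.map f)] with l hl l' hl'
  exact hl _ hl' _ rfl

theorem Her.comap' {F : Filter (List W)} (h : Her F) (f : V → W) : Her (Filter.comap (List.map f) F) :=
  fun p hp => (h.comap f p hp).mono fun _ hl l' hl' => hl l' (List.map_subset _ hl')

theorem Her.inf {F F' : Filter (List V)} (h : Her F) (h' : Her F') : Her (F ⊓ F') := by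
  intro p hp
  rw [eventually_inf] at *
  obtain ⟨s, hs, t, ht, hst⟩ := hp
  exact ⟨_, h _ hs, _, h' _ ht, fun l hl l' hl' => hst l' ⟨hl.1 l' hl', hl.2 l' hl'⟩⟩

theorem Her.sup {F F' : Filter (List V)} (h : Her F) (h' : Her F') : Her (F ⊔ F') := by
  intro p hp
  rw [eventually_sup] at *
  exact ⟨h _ hp.1, h' _ hp.2⟩

theorem her_bot : Her (⊥ : Filter (List V)) := fun _ _ => by simp
theorem her_top : Her (⊤ : Filter (List V)) := fun p h => by simp at *; intro _ l' _; exact h l'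
theorem her_principal {A : Set (List V)} (h : ∀ l ∈ A, ∀ l', l' ⊆ l → l' ∈ A) : Her (𝓟 A) := by
  intro p hp
  simp only [eventually_principal] at *
  exact fun l hl l' hl' => hp _ (h l hl l' hl')

structure Site (V : Type*) where
  F : Filter (List V)
  G : Filter (List V)
  I : Set (V → V)
  hF : Her F
  hG : Her G
  le : G ≤ F

def IsInv (I : Set (V → V)) (φ : Coch V) : Prop := ∀ i ∈ I, pb i φ = φ

structure Zc (S : Site V) (n : ℤ) (φ : Coch V) : Prop where
  deg : Deg n φ
  inv : IsInv S.I φ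
  rel : ∀ᶠ l in S.G, φ l = 0
  cl : ∀ᶠ l in S.F, cd φ l = 0

/-- Relative, invariant cochains of degree `n`. -/
structure Cc (S : Site V) (n : ℤ) (φ : Coch V) : Prop where
  deg : Deg n φ
  inv : IsInv S.I φ
  rel : ∀ᶠ l in S.G, φ l = 0

def Bd (S : Site V) (n : ℤ) (φ : Coch V) : Prop :=
  ∃ χ, Cc S (n - 1) χ ∧ ∀ᶠ l in S.F, φ l = cd χ l

/-- Two cochains are cohomologous. -/
def Coh (S : Site V) (n : ℤ) (φ ψ : Coch V) : Prop := Bd S n (φ + ψ)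

variable {S : Site V} {n m : ℤ} {φ ψ : Coch V}

theorem Zc.toCc (h : Zc S n φ) : Cc S n φ := ⟨h.deg, h.inv, h.rel⟩

theorem IsInv.add {I : Set (V → V)} {φ ψ : Coch V} (h : IsInv I φ) (h' : IsInv I ψ) : IsInv I (φ + ψ) :=
  fun i hi => by rw [pb_add, h i hi, h' i hi]

theorem IsInv.zero {I : Set (V → V)} : IsInv I (0 : Coch V) := fun _ _ => rfl

theorem IsInv.cd {I : Set (V → V)} (h : IsInv I φ) : IsInv I (cd φ) :=
  fun i hi => by rw [← cd_pb, h i hi]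

theorem Cc.add (h : Cc S n φ) (h' : Cc S n ψ) : Cc S n (φ + ψ) :=
  ⟨h.deg.add h'.deg, h.inv.add h'.inv, by
    filter_upwards [h.rel, h'.rel] with l h1 h2; simp [h1, h2]⟩

theorem Cc.zero : Cc S n 0 := ⟨Deg.zero, IsInv.zero, by simp⟩

theorem Zc.add (h : Zc S n φ) (h' : Zc S n ψ) : Zc S n (φ + ψ) :=
  ⟨h.deg.add h'.deg, h.inv.add h'.inv, (h.toCc.add h'.toCc).rel, by
    filter_upwards [h.cl, h'.cl] with l h1 h2; simp [cd_add, h1, h2]⟩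

theorem Zc.zero : Zc S n 0 := ⟨Deg.zero, IsInv.zero, by simp, by simp⟩

theorem Cc.cd (h : Cc S n φ) : Zc S (n + 1) (cd φ) :=
  ⟨h.deg.cd, h.inv.cd, by
    filter_upwards [S.hG _ h.rel] with l hl using cd_loc hl, by simp [cd_cd]⟩

theorem Cc.bd (h : Cc S n φ) : Bd S (n + 1) (CatCone.cd φ) := ⟨φ, by simpa using h, by simp⟩

theorem Cc.bd' (h : Cc S (n - 1) φ) : Bd S n (CatCone.cd φ) := ⟨φ, h, by simp⟩

theorem Cc.of_eq' (h : Cc S n φ) (e : n = m) : Cc S m φ := e ▸ h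
theorem Zc.of_eq' (h : Zc S n φ) (e : n = m) : Zc S m φ := e ▸ h
theorem Bd.of_eq' (h : Bd S n φ) (e : n = m) : Bd S m φ := e ▸ h

theorem Bd.add (h : Bd S n φ) (h' : Bd S n ψ) : Bd S n (φ + ψ) := by
  obtain ⟨χ, h1, h2⟩ := h
  obtain ⟨χ', h1', h2'⟩ := h'
  refine ⟨χ + χ', h1.add h1', ?_⟩
  filter_upwards [h2, h2'] with l a b; simp [cd_add, a, b]

theorem Bd.zero : Bd S n 0 := ⟨0, Cc.zero, by simp⟩

theorem Bd.congr (h : Bd S n φ) (e : ∀ᶠ l in S.F, φ l = ψ l) : Bd S n ψ := by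
  obtain ⟨χ, h1, h2⟩ := h
  refine ⟨χ, h1, ?_⟩
  filter_upwards [h2, e] with l a b; rw [← b, a]

theorem Coh.refl : Coh S n φ φ := by
  unfold Coh; rw [coch_add_self]; exact Bd.zero
theorem Coh.of_eq (h : φ = ψ) : Coh S n φ ψ := h ▸ Coh.refl
theorem Coh.symm (h : Coh S n φ ψ) : Coh S n ψ φ := by
  unfold Coh; rw [add_comm]; exact h
theorem add_add_cancel_mid (φ ψ χ : Coch V) : φ + ψ + (ψ + χ) = φ + χ := by
  funext l; simp only [Pi.add_apply]; grind
theorem Coh.trans {χ : Coch V} (h : Coh S n φ ψ) (h' : Coh S n ψ χ) : Coh S n φ χ := by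
  have := Bd.add h h'
  rwa [add_add_cancel_mid] at this
theorem Coh.add {φ' ψ' : Coch V} (h : Coh S n φ ψ) (h' : Coh S n φ' ψ') :
    Coh S n (φ + φ') (ψ + ψ') := by
  have := Bd.add h h'
  unfold Coh
  rwa [add_add_add_comm] at this
theorem coh_zero : Coh S n φ 0 ↔ Bd S n φ := by unfold Coh; rw [add_zero]
theorem Coh.bd (h : Coh S n φ ψ) (h' : Bd S n ψ) : Bd S n φ :=
  coh_zero.1 (h.trans (coh_zero.2 h'))
theorem Coh.sum {ι : Type*} {s : Finset ι} {f g : ι → Coch V} (h : ∀ i ∈ s, Coh S n (f i) (g i)) :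
    Coh S n (∑ i ∈ s, f i) (∑ i ∈ s, g i) := by
  classical
  induction s using Finset.induction_on with
  | empty => exact Coh.refl
  | insert a s ha ih =>
    rw [Finset.sum_insert ha, Finset.sum_insert ha]
    exact (h a (by simp)).add (ih fun i hi => h i (by simp [hi]))

theorem Zc.of_deg_neg (h : Zc S n φ) (hn : n < 0) : Bd S n φ := by
  rw [h.deg.eq_zero hn]; exact Bd.zero

/-- Morphisms of sites. -/
structure Site.Hom (S : Site V) (S' : Site W) (f : V → W) : Prop where
  tF : Tendsto (List.map f) S.F S'.F
  tG : Tendsto (List.map f) S.G S'.G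
  eqv : ∀ i ∈ S.I, (∃ i' ∈ S'.I, ∀ x, f (i x) = i' (f x)) ∨ ∀ x, f (i x) = f x

variable {S' : Site W} {f : V → W}

theorem Site.Hom.inv (h : S.Hom S' f) {φ : Coch W} (hφ : IsInv S'.I φ) : IsInv S.I (pb f φ) := by
  intro i hi
  rcases h.eqv i hi with ⟨i', hi', e⟩ | e
  · rw [pb_comm e, hφ i' hi']
  · rw [pb_pb]; congr 1; exact funext e

theorem Site.Hom.cc (h : S.Hom S' f) {φ : Coch W} (hφ : Cc S' n φ) : Cc S n (pb f φ) :=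
  ⟨hφ.deg.pb f, h.inv hφ.inv, h.tG.eventually hφ.rel⟩

theorem Site.Hom.zc (h : S.Hom S' f) {φ : Coch W} (hφ : Zc S' n φ) : Zc S n (pb f φ) :=
  ⟨hφ.deg.pb f, h.inv hφ.inv, h.tG.eventually hφ.rel, by
    rw [cd_pb]; exact h.tF.eventually hφ.cl⟩

theorem Site.Hom.bd (h : S.Hom S' f) {φ : Coch W} (hφ : Bd S' n φ) : Bd S n (pb f φ) := by
  obtain ⟨χ, h1, h2⟩ := hφ
  refine ⟨pb f χ, h.cc h1, ?_⟩
  rw [cd_pb]; exact h.tF.eventually h2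

theorem Site.Hom.coh (h : S.Hom S' f) {φ ψ : Coch W} (hφ : Coh S' n φ ψ) :
    Coh S n (pb f φ) (pb f ψ) := h.bd hφ

end

section
open Filter

variable {U V W : Type*}

/-! The head-multiplication calculus. -/

def hd (h : V → ZMod 2) : List V → ZMod 2
  | [] => 0
  | a :: _ => h a

def mulh (h : V → ZMod 2) (κ : Coch V) : Coch V := fun l => hd h l * κ l

def tcup (h : V → ZMod 2) (κ : Coch V) : Coch V
  | [] => 0
  | a :: l => (h a + hd h l) * κ l

theorem cd_smul (x : ZMod 2) (φ : Coch V) : cd (fun l => x * φ l) = fun l => x * cd φ l := by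
  funext l
  induction l generalizing φ with
  | nil => simp
  | cons a l ih =>
    have : sh a (fun l => x * φ l) = fun l => x * sh a φ l := rfl
    rw [cd_cons, cd_cons, this, ih, mul_add]

theorem cd_mulh (h : V → ZMod 2) (κ : Coch V) :
    cd (mulh h κ) + mulh h (cd κ) = tcup h κ := by
  funext l
  cases l with
  | nil => simp [mulh, hd, tcup]
  | cons a l =>
    have : sh a (mulh h κ) = fun l => h a * sh a κ l := rfl
    simp only [Pi.add_apply, cd_cons, this, cd_smul, mulh, tcup, hd]
    grind

theorem mulh_add (h : V → ZMod 2) (κ κ' : Coch V) : mulh h (κ + κ') = mulh h κ + mulh h κ' := by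
  funext l; simp [mulh, mul_add]

theorem tcup_add (h : V → ZMod 2) (κ κ' : Coch V) : tcup h (κ + κ') = tcup h κ + tcup h κ' := by
  funext l
  cases l with
  | nil => simp [tcup]
  | cons a l => simp [tcup, mul_add]

theorem cd_tcup (h : V → ZMod 2) (κ : Coch V) : cd (tcup h κ) = tcup h (cd κ) := by
  rw [← cd_mulh, ← cd_mulh, cd_add, cd_cd, cd_cd, zero_add]
  have : mulh h (0 : Coch V) = 0 := by funext l; simp [mulh]
  rw [this, add_zero]

theorem pb_mulh (f : V → W) (h : W → ZMod 2) (κ : Coch W) :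
    pb f (mulh h κ) = mulh (h ∘ f) (pb f κ) := by
  funext l; cases l <;> rfl

theorem hd_map (f : V → W) (h : W → ZMod 2) (l : List V) : hd h (l.map f) = hd (h ∘ f) l := by
  cases l <;> rfl

theorem pb_tcup (f : V → W) (h : W → ZMod 2) (κ : Coch W) :
    pb f (tcup h κ) = tcup (h ∘ f) (pb f κ) := by
  funext l
  cases l with
  | nil => rfl
  | cons a l => simp [pb, tcup, hd_map]

theorem tcup_nil (h : V → ZMod 2) (κ : Coch V) : tcup h κ [] = 0 := rfl

theorem Deg.mulh {n : ℤ} {κ : Coch V} (hκ : Deg n κ) (h : V → ZMod 2) : Deg n (mulh h κ) :=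
  fun l hl => hκ l (right_ne_zero_of_mul hl)

theorem Deg.tcup {n : ℤ} {κ : Coch V} (hκ : Deg n κ) (h : V → ZMod 2) : Deg (n + 1) (tcup h κ) := by
  rw [← cd_mulh]
  by_cases hn : n < 0
  · rw [hκ.eq_zero hn]
    have : CatCone.mulh h (0 : Coch V) = 0 := by funext l; simp [CatCone.mulh]
    simpa [this] using Deg.zero
  · exact (hκ.mulh h).cd.add (hκ.cd.mulh h)

/-! Equivariant sites. -/

/-- The free involution on `Bool × V`. -/
def flip₂ : Bool × V → Bool × V := Prod.map not id
def rz : Bool × V → Bool × V := fun x => (false, x.2)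
def bit : Bool × V → ZMod 2 := fun x => if x.1 then 1 else 0
def pz (κ : Coch (Bool × V)) : Coch (Bool × V) := prism rz id κ
/-- The coefficient-shift operator. -/
def gy (κ : Coch (Bool × V)) : Coch (Bool × V) := pz κ + pb flip₂ (pz κ)
def res (κ : Coch (Bool × V)) : Coch V := pb (Prod.mk false) κ
def cf (j : ℕ) (κ : Coch (Bool × V)) : Coch V := res (gy^[j] κ)
def gyh (κ : Coch (Bool × V)) : Coch (Bool × V) := pz κ + mulh bit (gy κ)
abbrev tc (κ : Coch (Bool × V)) : Coch (Bool × V) := tcup bit κ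

theorem flip₂_flip₂ (κ : Coch (Bool × V)) : pb flip₂ (pb flip₂ κ) = κ := by
  rw [pb_pb]
  have : (flip₂ ∘ flip₂ : Bool × V → Bool × V) = id := by funext ⟨b, x⟩; simp [flip₂]
  rw [this, pb_id]

theorem mulh_one_add {b : Coch (Bool × V)} (hb : b [] = 0) :
    mulh (bit ∘ flip₂) b = mulh bit b + b := by
  funext l
  cases l with
  | nil => simp [mulh, hd, hb]
  | cons a l =>
    obtain ⟨x, a⟩ := a
    cases x <;> simp [mulh, hd, bit, flip₂]; grind

theorem flip_mulh {b : Coch (Bool × V)} (hb : b [] = 0) (hi : pb flip₂ b = b) :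
    pb flip₂ (mulh bit b) = mulh bit b + b := by
  rw [pb_mulh, hi, mulh_one_add hb]

theorem flip_gy (κ : Coch (Bool × V)) : pb flip₂ (gy κ) = gy κ := by
  rw [gy, pb_add, flip₂_flip₂, add_comm]

theorem gy_nil (κ : Coch (Bool × V)) : gy κ [] = 0 := rfl

theorem cd_pz (κ : Coch (Bool × V)) : cd (pz κ) + pz (cd κ) = pb rz κ + κ := by
  rw [pz, pz, cd_prism, pb_id]

theorem coch_eq_of_add {a b : Coch V} (h : a + b = 0) : a = b := by
  have : a + b + b = b := by rw [h, zero_add]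
  rwa [add_assoc, coch_add_self, add_zero] at this

theorem flip_rz (κ : Coch (Bool × V)) : pb flip₂ (pb rz κ) = pb rz κ := by rw [pb_pb]; rfl

theorem cd_gy_gen (κ : Coch (Bool × V)) : cd (gy κ) + gy (cd κ) = κ + pb flip₂ κ := by
  have h := cd_pz κ
  have h2 := congrArg (pb flip₂) h
  rw [pb_add, pb_add, flip_rz, ← cd_pb] at h2
  rw [gy, gy, cd_add]
  funext l
  have h := congrFun h l
  have h2 := congrFun h2 l
  simp only [Pi.add_apply] at *
  grind

theorem cd_gy {κ : Coch (Bool × V)} (hi : pb flip₂ κ = κ) : cd (gy κ) = gy (cd κ) := by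
  apply coch_eq_of_add
  rw [cd_gy_gen, hi, coch_add_self]

theorem pz_add (κ κ' : Coch (Bool × V)) : pz (κ + κ') = pz κ + pz κ' := prism_add _ _ _ _
theorem gy_add (κ κ' : Coch (Bool × V)) : gy (κ + κ') = gy κ + gy κ' := by
  rw [gy, gy, gy, pz_add, pb_add]; abel

theorem gyh_spec {κ : Coch (Bool × V)} (hi : pb flip₂ κ = κ) :
    κ + pb rz κ = tc (gy κ) + cd (gyh κ) + gyh (cd κ) := by
  have h1 := cd_pz κ
  have h2 := cd_mulh bit (gy κ)
  rw [cd_gy hi] at h2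
  rw [gyh, gyh, tc, ← h2, cd_add]
  funext l
  have h1 := congrFun h1 l
  simp only [Pi.add_apply] at *
  grind

theorem flip_gyh (κ : Coch (Bool × V)) : pb flip₂ (gyh κ) = gyh κ := by
  rw [gyh, pb_add, flip_mulh (gy_nil κ) (flip_gy κ)]
  conv_lhs => rw [gy]
  funext l
  simp only [Pi.add_apply, gy]
  grind

theorem prism_pb (f g : V → W) {X Y : Type*} (s : W → X) (s' : V → Y) (p q : Y → X)
    (hf : ∀ x, s (f x) = p (s' x)) (hg : ∀ x, s (g x) = q (s' x)) (φ : Coch X) :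
    prism f g (pb s φ) = pb s' (prism p q φ) := by
  funext l
  induction l generalizing φ with
  | nil => rfl
  | cons a l ih =>
    rw [prism_cons, sh_pb, ih]
    simp [pb, prism_cons, hf, hg, Function.comp_def]

theorem gy_snd (a : Coch V) : gy (pb Prod.snd a) = 0 := by
  rw [gy, pz, prism_pb rz id Prod.snd Prod.snd id id (fun _ => rfl) (fun _ => rfl), pb_pb]
  exact coch_add_self _

theorem mulh_zero (κ : Coch V) : mulh (fun _ => 0) κ = 0 := by
  funext l; cases l <;> simp [mulh, hd]

theorem gy_tc {b : Coch (Bool × V)} (hi : pb flip₂ b = b) (hb : b [] = 0) :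
    gy (tc b) = b + cd (gy (mulh bit b)) + gy (mulh bit (cd b)) := by
  have h1 := cd_gy_gen (mulh bit b)
  rw [flip_mulh hb hi] at h1
  rw [tc, ← cd_mulh, gy_add]
  funext l
  have h1 := congrFun h1 l
  simp only [Pi.add_apply] at *
  grind

theorem res_snd (a : Coch V) : res (pb Prod.snd a) = a := by rw [res, pb_pb]; exact pb_id a
theorem res_tc (b : Coch (Bool × V)) : res (tc b) = 0 := by
  rw [res, tc, pb_tcup]
  funext l
  cases l with
  | nil => rfl
  | cons a l => cases l <;> simp [tcup, hd, bit]
theorem snd_res (κ : Coch (Bool × V)) : pb Prod.snd (res κ) = pb rz κ := by rw [res, pb_pb]; rfl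
theorem res_add (κ κ' : Coch (Bool × V)) : res (κ + κ') = res κ + res κ' := rfl

def Site.eqv (S : Site V) : Site (Bool × V) where
  F := comap (List.map Prod.snd) S.F
  G := comap (List.map Prod.snd) S.G
  I := insert flip₂ ((fun i => Prod.map id i) '' S.I)
  hF := S.hF.comap' _
  hG := S.hG.comap' _
  le := comap_mono S.le

variable {S : Site V} {n m : ℤ}

theorem IsInv.flip {κ : Coch (Bool × V)} (h : IsInv S.eqv.I κ) : pb flip₂ κ = κ :=
  h _ (Or.inl rfl)

theorem IsInv.eqv {κ : Coch (Bool × V)} (h : pb flip₂ κ = κ)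
    (h' : ∀ i ∈ S.I, pb (Prod.map id i) κ = κ) : IsInv S.eqv.I κ := by
  rintro _ (rfl | ⟨i, hi, rfl⟩)
  · exact h
  · exact h' i hi

theorem pb_pz (i : U → V) (κ : Coch (Bool × V)) :
    pb (Prod.map id i) (pz κ) = pz (pb (Prod.map id i) κ) :=
  (prism_pb rz id (Prod.map id i) (Prod.map id i) rz id (fun _ => rfl) (fun _ => rfl) κ).symm

theorem pb_flip_comm (i : U → V) (κ : Coch (Bool × V)) :
    pb (Prod.map id i) (pb flip₂ κ) = pb flip₂ (pb (Prod.map id i) κ) := by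
  rw [pb_pb, pb_pb]; rfl

theorem pb_gy (i : U → V) (κ : Coch (Bool × V)) :
    pb (Prod.map id i) (gy κ) = gy (pb (Prod.map id i) κ) := by
  rw [gy, pb_add, pb_flip_comm, pb_pz]; rfl

theorem pb_gyh (i : U → V) (κ : Coch (Bool × V)) :
    pb (Prod.map id i) (gyh κ) = gyh (pb (Prod.map id i) κ) := by
  rw [gyh, pb_add, pb_mulh, pb_gy, pb_pz]; rfl

theorem pb_tc (i : U → V) (κ : Coch (Bool × V)) :
    pb (Prod.map id i) (tc κ) = tc (pb (Prod.map id i) κ) := by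
  rw [tc, pb_tcup]; rfl

theorem pb_res (i : U → V) (κ : Coch (Bool × V)) :
    pb i (res κ) = res (pb (Prod.map id i) κ) := by
  rw [res, res, pb_pb, pb_pb]; rfl

theorem pb_cf (i : U → V) (j : ℕ) (κ : Coch (Bool × V)) :
    pb i (cf j κ) = cf j (pb (Prod.map id i) κ) := by
  rw [cf, pb_res, cf]
  congr 1
  exact Function.Semiconj.iterate_right (f := pb (Prod.map id i)) (pb_gy i) j κ

/-- Locality in terms of underlying points. -/
theorem pz_loc {κ : Coch (Bool × V)} {l : List (Bool × V)}
    (h : ∀ l', l'.map Prod.snd ⊆ l.map Prod.snd → κ l' = 0) : pz κ l = 0 := by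
  refine prism_loc fun l' hl' => h _ ?_
  refine List.Subset.trans (List.map_subset Prod.snd hl') ?_
  simp only [List.map_append, List.map_map]
  exact List.append_subset.2 ⟨List.Subset.refl _, List.Subset.refl _⟩

theorem snd_flip (l : List (Bool × V)) : (l.map flip₂).map Prod.snd = l.map Prod.snd := by
  simp only [List.map_map]; rfl

theorem gy_loc {κ : Coch (Bool × V)} {l : List (Bool × V)}
    (h : ∀ l', l'.map Prod.snd ⊆ l.map Prod.snd → κ l' = 0) : gy κ l = 0 := by
  have h1 := pz_loc h
  have h2 : pb flip₂ (pz κ) l = 0 := pz_loc fun l' hl' => h _ (by rwa [snd_flip] at hl')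
  rw [gy, Pi.add_apply, h1, h2, add_zero]

theorem gyh_loc {κ : Coch (Bool × V)} {l : List (Bool × V)}
    (h : ∀ l', l'.map Prod.snd ⊆ l.map Prod.snd → κ l' = 0) : gyh κ l = 0 := by
  simp [gyh, pz_loc h, mulh, gy_loc h]

theorem mulh_loc {h : V → ZMod 2} {κ : Coch V} {l : List V} (hl : κ l = 0) : mulh h κ l = 0 := by
  simp [mulh, hl]

theorem tcup_loc {h : V → ZMod 2} {κ : Coch V} {l : List V}
    (hl : ∀ l', l' ⊆ l → κ l' = 0) : tcup h κ l = 0 := by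
  cases l with
  | nil => rfl
  | cons a l => rw [tcup, hl l (List.subset_cons_self _ _), mul_zero]

theorem Deg.pz {κ : Coch (Bool × V)} (h : Deg n κ) : Deg (n - 1) (pz κ) := h.prism
theorem Deg.gy {κ : Coch (Bool × V)} (h : Deg n κ) : Deg (n - 1) (gy κ) := h.pz.add (h.pz.pb _)
theorem Deg.gyh {κ : Coch (Bool × V)} (h : Deg n κ) : Deg (n - 1) (gyh κ) := h.pz.add (h.gy.mulh _)

theorem eqv_hG {p : List (Bool × V) → Prop} (h : ∀ᶠ l in S.eqv.G, p l) :
    ∀ᶠ l in S.eqv.G, ∀ l', l'.map Prod.snd ⊆ l.map Prod.snd → p l' := S.hG.comap _ p h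
theorem eqv_hF {p : List (Bool × V) → Prop} (h : ∀ᶠ l in S.eqv.F, p l) :
    ∀ᶠ l in S.eqv.F, ∀ l', l'.map Prod.snd ⊆ l.map Prod.snd → p l' := S.hF.comap _ p h

theorem Cc.gy {κ : Coch (Bool × V)} (h : Cc S.eqv n κ) : Cc S.eqv (n - 1) (gy κ) :=
  ⟨h.deg.gy, IsInv.eqv (flip_gy _) fun i hi => by rw [pb_gy, h.inv _ (Or.inr ⟨i, hi, rfl⟩)],
    (eqv_hG h.rel).mono fun _ hl => gy_loc hl⟩

theorem Cc.gyh {κ : Coch (Bool × V)} (h : Cc S.eqv n κ) : Cc S.eqv (n - 1) (gyh κ) :=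
  ⟨h.deg.gyh, IsInv.eqv (flip_gyh _) fun i hi => by rw [pb_gyh, h.inv _ (Or.inr ⟨i, hi, rfl⟩)],
    (eqv_hG h.rel).mono fun _ hl => gyh_loc hl⟩

theorem flip_tc {b : Coch (Bool × V)} (hi : pb flip₂ b = b) (hb : b [] = 0) : pb flip₂ (tc b) = tc b := by
  rw [tc, pb_tcup, hi]
  funext l
  rcases l with _ | ⟨⟨x, a⟩, _ | ⟨⟨y, b⟩, l⟩⟩
  · rfl
  · simp [tcup, hb]
  · have : (1 : ZMod 2) + 1 = 0 := rfl
    cases x <;> cases y <;> simp [tcup, hd, bit, flip₂, this]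

theorem Cc.tc {b : Coch (Bool × V)} (h : Cc S.eqv n b) : Cc S.eqv (n + 1) (tc b) :=
  ⟨h.deg.tcup _, IsInv.eqv (flip_tc h.inv.flip h.deg.nil) fun i hi => by
      rw [pb_tc, h.inv _ (Or.inr ⟨i, hi, rfl⟩)],
    (S.eqv.hG _ h.rel).mono fun _ hl => tcup_loc hl⟩

theorem hom_mk (b : Bool) : S.Hom S.eqv (Prod.mk b) := by
  refine ⟨?_, ?_, fun i hi => Or.inl ⟨_, Or.inr ⟨i, hi, rfl⟩, fun x => rfl⟩⟩
  · exact tendsto_comap_iff.2 (by rw [show (List.map Prod.snd ∘ List.map (Prod.mk b) : List V → List V) = id from by funext l; simp]; exact tendsto_id)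
  · exact tendsto_comap_iff.2 (by rw [show (List.map Prod.snd ∘ List.map (Prod.mk b) : List V → List V) = id from by funext l; simp]; exact tendsto_id)

theorem hom_snd : S.eqv.Hom S Prod.snd := by
  refine ⟨tendsto_comap, tendsto_comap, ?_⟩
  rintro _ (rfl | ⟨i, hi, rfl⟩)
  · exact Or.inr fun _ => rfl
  · exact Or.inl ⟨i, hi, fun _ => rfl⟩

theorem Cc.res {κ : Coch (Bool × V)} (h : Cc S.eqv n κ) : Cc S n (res κ) := (hom_mk false).cc h
theorem Zc.res {κ : Coch (Bool × V)} (h : Zc S.eqv n κ) : Zc S n (res κ) := (hom_mk false).zc h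
theorem Bd.res {κ : Coch (Bool × V)} (h : Bd S.eqv n κ) : Bd S n (res κ) := (hom_mk false).bd h

theorem Zc.of_cc {φ : Coch V} (h : Cc S n φ) (h' : ∀ᶠ l in S.F, cd φ l = 0) : Zc S n φ :=
  ⟨h.deg, h.inv, h.rel, h'⟩

theorem Zc.gy {κ : Coch (Bool × V)} (h : Zc S.eqv n κ) : Zc S.eqv (n - 1) (gy κ) :=
  .of_cc h.toCc.gy (by
    rw [cd_gy h.inv.flip]
    exact (eqv_hF h.cl).mono fun _ hl => gy_loc hl)

theorem Zc.tc {κ : Coch (Bool × V)} (h : Zc S.eqv n κ) : Zc S.eqv (n + 1) (tc κ) :=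
  .of_cc h.toCc.tc (by
    rw [CatCone.tc, cd_tcup]
    exact (S.eqv.hF _ h.cl).mono fun _ hl => tcup_loc hl)

theorem Bd.gy {κ : Coch (Bool × V)} (h : Bd S.eqv n κ) : Bd S.eqv (n - 1) (gy κ) := by
  obtain ⟨χ, h1, h2⟩ := h
  refine ⟨_, h1.gy, ?_⟩
  rw [cd_gy h1.inv.flip]
  filter_upwards [eqv_hF h2] with l hl
  have : CatCone.gy (κ + cd χ) l = 0 := gy_loc fun l' hl' => by
    rw [Pi.add_apply, hl l' hl']; exact CharTwo.add_self_eq_zero _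
  rw [gy_add, Pi.add_apply] at this
  grind

theorem Bd.tc {κ : Coch (Bool × V)} (h : Bd S.eqv n κ) : Bd S.eqv (n + 1) (tc κ) := by
  obtain ⟨χ, h1, h2⟩ := h
  refine ⟨_, h1.tc.of_eq' (by ring), ?_⟩
  rw [CatCone.tc, cd_tcup]
  filter_upwards [S.eqv.hF _ h2] with l hl
  have : tcup bit (κ + cd χ) l = 0 := tcup_loc fun l' hl' => by
    rw [Pi.add_apply, hl l' hl']; exact CharTwo.add_self_eq_zero _
  rw [tcup_add, Pi.add_apply] at this
  grind

theorem Zc.decomp {κ : Coch (Bool × V)} (h : Zc S.eqv n κ) :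
    Coh S.eqv n κ (pb Prod.snd (CatCone.res κ) + CatCone.tc (CatCone.gy κ)) := by
  refine ⟨_, h.toCc.gyh, ?_⟩
  filter_upwards [eqv_hF h.cl] with l hl
  have h1 := congrFun (gyh_spec h.inv.flip) l
  have h2 := gyh_loc hl
  rw [snd_res]
  simp only [Pi.add_apply] at *
  grind

theorem Zc.gy_tc {b : Coch (Bool × V)} (h : Zc S.eqv n b) :
    Coh S.eqv n (CatCone.gy (CatCone.tc b)) b := by
  refine ⟨CatCone.gy (mulh bit b), ⟨(h.deg.mulh _).gy, ?_, ?_⟩, ?_⟩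
  · refine IsInv.eqv (flip_gy _) fun i hi => ?_
    rw [pb_gy, pb_mulh, h.inv _ (Or.inr ⟨i, hi, rfl⟩)]; rfl
  · exact (eqv_hG h.rel).mono fun l hl => gy_loc fun l' hl' => mulh_loc (hl _ hl')
  · filter_upwards [eqv_hF h.cl] with l hl
    have h1 := congrFun (CatCone.gy_tc h.inv.flip h.deg.nil) l
    have h2 : CatCone.gy (mulh bit (cd b)) l = 0 := gy_loc fun l' hl' => mulh_loc (hl _ hl')
    simp only [Pi.add_apply] at *
    grind

theorem cf_zero (κ : Coch (Bool × V)) : cf 0 κ = CatCone.res κ := rfl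
theorem cf_succ (j : ℕ) (κ : Coch (Bool × V)) : cf (j + 1) κ = cf j (gy κ) := rfl
theorem cf_add (j : ℕ) (κ κ' : Coch (Bool × V)) : cf j (κ + κ') = cf j κ + cf j κ' := by
  induction j generalizing κ κ' with
  | zero => rfl
  | succ j ih => rw [cf_succ, gy_add, ih]; rfl

theorem Zc.cf {κ : Coch (Bool × V)} (h : Zc S.eqv n κ) (j : ℕ) : Zc S (n - j) (cf j κ) := by
  induction j generalizing κ n with
  | zero => simpa [cf_zero] using h.res
  | succ j ih => simpa [cf_succ, sub_sub, add_comm] using ih h.gy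

theorem Cc.cf {κ : Coch (Bool × V)} (h : Cc S.eqv n κ) (j : ℕ) : Cc S (n - j) (cf j κ) := by
  induction j generalizing κ n with
  | zero => simpa [cf_zero] using h.res
  | succ j ih => simpa [cf_succ, sub_sub, add_comm] using ih h.gy

theorem Bd.cf {κ : Coch (Bool × V)} (h : Bd S.eqv n κ) (j : ℕ) : Bd S (n - j) (cf j κ) := by
  induction j generalizing κ n with
  | zero => simpa [cf_zero] using h.res
  | succ j ih => simpa [cf_succ, sub_sub, add_comm] using ih h.gy

theorem Coh.cf {κ κ' : Coch (Bool × V)} (h : Coh S.eqv n κ κ') (j : ℕ) :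
    Coh S (n - j) (cf j κ) (cf j κ') := by
  have := Bd.cf h j
  rwa [cf_add] at this

theorem Zc.cf_tc {b : Coch (Bool × V)} (h : Zc S.eqv n b) (j : ℕ) :
    Coh S (n - j) (CatCone.cf (j + 1) (CatCone.tc b)) (CatCone.cf j b) := h.gy_tc.cf j

theorem cd_cf {κ : Coch (Bool × V)} (h : pb flip₂ κ = κ) (j : ℕ) : cd (cf j κ) = cf j (cd κ) := by
  induction j generalizing κ with
  | zero => exact cd_pb _ _
  | succ j ih => rw [cf_succ, ih (flip_gy _), cd_gy h]; rfl

/-- Expansion of an equivariant class in powers of the polynomial generator. -/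
theorem Zc.expand {κ : Coch (Bool × V)} (h : Zc S.eqv n κ) (N : ℕ) (hN : n < N) :
    Coh S.eqv n κ (∑ j ∈ Finset.range N, CatCone.tc^[j] (pb Prod.snd (CatCone.cf j κ))) := by
  induction N generalizing κ n with
  | zero => rw [Finset.range_zero, Finset.sum_empty, coh_zero]; exact h.of_deg_neg (by simpa using hN)
  | succ N ih =>
    refine h.decomp.trans ?_
    have h1 := (ih h.gy (by push_cast at hN; omega))
    have h2 : Coh S.eqv n (CatCone.tc (CatCone.gy κ)) (tcup bit
        (∑ j ∈ Finset.range N, CatCone.tc^[j] (pb Prod.snd (CatCone.cf j (CatCone.gy κ))))) := by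
      have := Bd.tc h1
      rw [CatCone.tc, tcup_add, sub_add_cancel] at this
      exact this
    rw [Finset.sum_range_succ']
    rw [add_comm]
    refine Coh.add (h2.trans (Coh.of_eq ?_)) Coh.refl
    rw [show tcup bit = _ from rfl]
    have : ∀ s : Finset ℕ, ∀ f : ℕ → Coch (Bool × V), tcup bit (∑ j ∈ s, f j) = ∑ j ∈ s, tcup bit (f j) :=
      fun s f => map_sum (AddMonoidHom.mk' (tcup bit) (tcup_add bit)) f s
    rw [this]
    refine Finset.sum_congr rfl fun j _ => ?_
    rw [Function.iterate_succ_apply']; rfl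

end

section
open Filter

variable {U V W : Type*} {S : Site V} {n m : ℤ}

/-! The power operation. -/

/-- The total square of a cochain. -/
def pw (φ : Coch V) : Coch (Bool × V) := PiF (tens φ φ)
/-- The Steenrod operations, indexed by the power of the polynomial generator. -/
def dop (j : ℕ) (φ : Coch V) : Coch V := cf j (pw φ)

theorem PiF_nil (F : List V → Coch V) : PiF F [] = 0 := rfl
theorem tens_add_left (a b : Coch V) (c : Coch W) : tens (a + b) c = tens a c + tens b c := by
  funext p q; simp [tens, add_mul]
theorem tens_add_right (a : Coch V) (b c : Coch W) : tens a (b + c) = tens a b + tens a c := by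
  funext p q; simp [tens, mul_add]
theorem cd1_tens (a b : Coch V) : cd1 (tens a b) = tens (cd a) b := by
  funext p q
  simp only [cd1, tens, mul_comm _ (b q), cd_smul]
theorem cd2_tens (a b : Coch V) : cd2 (tens a b) = tens a (cd b) := by
  funext p q
  simp only [cd2]
  unfold tens
  simp only [cd_smul]

theorem cd_PiF_tens {a b : Coch V} (ha : a [] = 0) (hb : b [] = 0) :
    cd (PiF (tens a b)) = PiF (tens (cd a) b) + PiF (tens a (cd b)) := by
  funext l
  rw [cd_PiF, cd1_tens, cd2_tens, PiF_add]
  simp [tens, ha, hb]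

theorem flip_PiF_tens (a b : Coch V) : pb flip₂ (PiF (tens a b)) = PiF (tens b a) := by
  funext l
  show PiF _ (l.map flip₂) = _
  rw [flip₂, PiF_flip]
  congr 1; funext p q; exact mul_comm _ _

theorem flip_pw (a : Coch V) : pb flip₂ (pw a) = pw a := flip_PiF_tens a a

theorem pb_PiF_tens (i : V → W) (a b : Coch W) :
    pb (Prod.map id i) (PiF (tens a b)) = PiF (tens (pb i a) (pb i b)) := by
  funext l; exact pb_PiF _ _ _

theorem pb_pw (i : V → W) (a : Coch W) : pb (Prod.map id i) (pw a) = pw (pb i a) := pb_PiF_tens _ _ _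

theorem pb_dop (i : V → W) (j : ℕ) (a : Coch W) : pb i (dop j a) = dop j (pb i a) := by
  rw [dop, pb_cf, pb_pw]; rfl

theorem PiF_tens_loc {a b : Coch V} {l : List (Bool × V)}
    (h : (∀ p, p ⊆ l.map Prod.snd → a p = 0) ∨ (∀ p, p ⊆ l.map Prod.snd → b p = 0)) :
    PiF (tens a b) l = 0 := by
  refine PiF_loc fun p q hp hq => ?_
  rcases h with h | h
  · simp [tens, h p hp]
  · simp [tens, h q hq]

theorem pw_nil (a : Coch V) : pw a [] = 0 := rfl

theorem ev_snd {A : Filter (List V)} (hA : Her A) {φ : Coch V} (h : ∀ᶠ l in A, φ l = 0) :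
    ∀ᶠ l in comap (List.map (Prod.snd : Bool × V → V)) A, ∀ p, p ⊆ l.map Prod.snd → φ p = 0 :=
  (hA _ h).comap _

theorem Cc.pw {a : Coch V} (h : Cc S n a) : Cc S.eqv (2 * n) (pw a) :=
  ⟨(h.deg.PiF h.deg).of_eq (by ring), IsInv.eqv (flip_pw a) fun i hi => by rw [pb_pw, h.inv i hi],
    (ev_snd S.hG h.rel).mono fun _ hl => PiF_tens_loc (Or.inl hl)⟩

theorem Zc.pw {a : Coch V} (h : Zc S n a) : Zc S.eqv (2 * n) (pw a) :=
  .of_cc h.toCc.pw (by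
    filter_upwards [ev_snd S.hF h.cl] with l hl
    rw [CatCone.pw, cd_PiF_tens h.deg.nil h.deg.nil, Pi.add_apply, PiF_tens_loc (Or.inl hl),
      PiF_tens_loc (Or.inr hl), add_zero])

theorem pw_add (a b : Coch V) : pw (a + b) = pw a + pw b +
    (PiF (tens a b) + pb flip₂ (PiF (tens a b))) := by
  rw [flip_PiF_tens, pw, tens_add_left, tens_add_right, tens_add_right]
  simp only [PiF_add, pw]; abel

theorem Zc.pw_add {a b : Coch V} (ha : Zc S n a) (hb : Zc S n b) :
    Coh S.eqv (2 * n) (CatCone.pw (a + b)) (CatCone.pw a + CatCone.pw b) := by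
  rw [CatCone.pw_add]
  unfold Coh
  rw [add_comm, ← add_assoc, coch_add_self, zero_add]
  refine ⟨CatCone.gy (PiF (tens a b)), ⟨(ha.deg.PiF hb.deg).gy.of_eq (by ring), ?_, ?_⟩, ?_⟩
  · refine IsInv.eqv (flip_gy _) fun i hi => ?_
    rw [pb_gy, pb_PiF_tens, ha.inv i hi, hb.inv i hi]
  · exact (eqv_hG (S := S) ((ev_snd S.hG ha.rel).mono fun _ hl => PiF_tens_loc (Or.inl hl))).mono
      fun _ hl => gy_loc hl
  · filter_upwards [eqv_hF (ev_snd S.hF ha.cl), eqv_hF (ev_snd S.hF hb.cl)] with l h1 h2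
    rw [← cd_gy_gen, Pi.add_apply]
    have : CatCone.gy (cd (PiF (tens a b))) l = 0 := gy_loc fun l' hl' => by
      rw [cd_PiF_tens ha.deg.nil hb.deg.nil, Pi.add_apply, PiF_tens_loc (Or.inl (h1 l' hl')),
        PiF_tens_loc (Or.inr (h2 l' hl')), add_zero]
    rw [this, add_zero]

/-- The cochain relating the power operation to coboundaries. -/
def zet (χ : Coch V) : Coch (Bool × V) := PiF (tens χ (cd χ)) + mulh bit (cd (pw χ))

theorem flip_cd_pw (χ : Coch V) : pb flip₂ (cd (pw χ)) = cd (pw χ) := by rw [← cd_pb, flip_pw]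

theorem flip_zet {χ : Coch V} (h : χ [] = 0) : pb flip₂ (zet χ) = zet χ := by
  rw [zet, pb_add, flip_mulh rfl (flip_cd_pw χ), flip_PiF_tens]
  conv_lhs => rw [pw]
  rw [pw, cd_PiF_tens h h]
  funext l
  simp only [Pi.add_apply]
  grind

theorem cd_zet {χ : Coch V} (h : χ [] = 0) : pw (cd χ) = cd (zet χ) + tc (cd (pw χ)) := by
  have h1 := cd_mulh bit (cd (pw χ))
  have h0 : mulh bit (0 : Coch (Bool × V)) = 0 := by funext l; simp [mulh]
  rw [cd_cd, h0, add_zero] at h1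
  have h2 : tens χ (0 : Coch V) = 0 := by funext p q; simp [tens]
  have h3 : PiF (0 : List V → Coch V) = 0 := by
    funext l; exact PiF_loc fun _ _ _ _ => rfl
  rw [zet, cd_add, h1, cd_PiF_tens h rfl, cd_cd, h2, h3, add_zero, tc, add_assoc, coch_add_self,
    add_zero, pw]

theorem zet_rel {χ : Coch V} {A : Filter (List V)} (hA : Her A) (h0 : χ [] = 0)
    (h : ∀ᶠ l in A, cd χ l = 0) :
    ∀ᶠ l in comap (List.map (Prod.snd : Bool × V → V)) A, zet χ l = 0 := by
  filter_upwards [ev_snd hA h] with l hl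
  rw [zet, Pi.add_apply, PiF_tens_loc (Or.inr hl), mulh_loc, add_zero]
  rw [pw, cd_PiF_tens h0 h0, Pi.add_apply, PiF_tens_loc (Or.inl hl), PiF_tens_loc (Or.inr hl), add_zero]

theorem cc_zet {χ : Coch V} (h : Deg (n - 1) χ) (hi : IsInv S.I χ) (hr : ∀ᶠ l in S.G, cd χ l = 0) :
    Cc S.eqv (2 * n - 1) (zet χ) := by
  refine ⟨((h.PiF h.cd).of_eq (by ring)).add (((h.PiF h).cd.mulh _).of_eq (by ring)), ?_,
    zet_rel S.hG h.nil hr⟩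
  refine IsInv.eqv (flip_zet h.nil) fun i hi' => ?_
  rw [zet, pb_add, pb_mulh, pb_PiF_tens, ← cd_pb, ← cd_pb, pb_pw, hi i hi']; rfl

theorem pw_congr {A : Filter (List V)} (hA : Her A) {a b : Coch V} (h : ∀ᶠ l in A, a l = b l) :
    ∀ᶠ l in comap (List.map (Prod.snd : Bool × V → V)) A, pw a l = pw b l := by
  filter_upwards [ev_snd hA (φ := a + b) (h.mono fun l hl => by
    rw [Pi.add_apply, hl]; exact CharTwo.add_self_eq_zero _)] with l hl
  have : (PiF (tens a (a + b)) + PiF (tens (a + b) b)) l = 0 := by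
    rw [Pi.add_apply, PiF_tens_loc (Or.inr hl), PiF_tens_loc (Or.inl hl), add_zero]
  rw [tens_add_left, tens_add_right, PiF_add, PiF_add] at this
  simp only [Pi.add_apply, pw] at *
  grind

theorem Bd.pw {a : Coch V} (h : Bd S n a) : Bd S.eqv (2 * n) (pw a) := by
  obtain ⟨χ, h1, h2⟩ := h
  refine Bd.congr (φ := CatCone.pw (cd χ)) ?_ ((pw_congr S.hF h2).mono fun _ h => h.symm)
  have h3 : ∀ᶠ l in S.G, cd χ l = 0 := (S.hG _ h1.rel).mono fun _ hl => cd_loc hl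
  rw [cd_zet h1.deg.nil]
  refine Bd.add (cc_zet h1.deg h1.inv h3).bd' ?_
  rw [CatCone.tc, ← cd_tcup]
  exact (h1.pw.tc.of_eq' (by ring)).bd'

theorem Coh.pw {a b : Coch V} (ha : Zc S n a) (hb : Zc S n b) (h : Coh S n a b) :
    Coh S.eqv (2 * n) (pw a) (pw b) := by
  have h1 := Bd.pw h
  have h2 := (ha.pw_add hb).symm.bd h1
  exact h2

theorem Zc.dop {a : Coch V} (h : Zc S n a) (j : ℕ) : Zc S (2 * n - j) (dop j a) := h.pw.cf j
theorem Bd.dop {a : Coch V} (h : Bd S n a) (j : ℕ) : Bd S (2 * n - j) (dop j a) := h.pw.cf j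
theorem Coh.dop {a b : Coch V} (h : Coh S n a b) (ha : Zc S n a) (hb : Zc S n b) (j : ℕ) :
    Coh S (2 * n - j) (dop j a) (dop j b) := (h.pw ha hb).cf j
theorem Zc.dop_add {a b : Coch V} (ha : Zc S n a) (hb : Zc S n b) (j : ℕ) :
    Coh S (2 * n - j) (CatCone.dop j (a + b)) (CatCone.dop j a + CatCone.dop j b) := by
  have := (ha.pw_add hb).cf j
  rwa [cf_add] at this

/-- Compatibility with connecting homomorphisms. -/
theorem coh_pw_cd {χ : Coch V} (h : Deg (n - 1) χ) (hi : IsInv S.I χ)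
    (hr : ∀ᶠ l in S.G, cd χ l = 0) : Coh S.eqv (2 * n) (pw (cd χ)) (tc (cd (pw χ))) := by
  unfold Coh
  rw [cd_zet h.nil, add_assoc, coch_add_self, add_zero]
  exact (cc_zet h hi hr).bd'

theorem coh_dop_cd {χ : Coch V} (h : Deg (n - 1) χ) (hi : IsInv S.I χ)
    (hr : ∀ᶠ l in S.G, cd χ l = 0) (j : ℕ) :
    Coh S (2 * n - (j + 1)) (dop (j + 1) (cd χ)) (cd (dop j χ)) := by
  have h1 := (coh_pw_cd h hi hr).cf (j + 1)
  have hb : Zc S.eqv (2 * n - 1) (cd (pw χ)) := by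
    refine ⟨((h.PiF h).cd).of_eq (by ring), ?_, ?_, by simp [cd_cd]⟩
    · refine IsInv.cd (IsInv.eqv (flip_pw _) fun i hi' => by rw [pb_pw, hi i hi'])
    · filter_upwards [ev_snd S.hG hr] with l hl
      rw [pw, cd_PiF_tens h.nil h.nil, Pi.add_apply, PiF_tens_loc (Or.inl hl),
        PiF_tens_loc (Or.inr hl), add_zero]
  have h2 := hb.cf_tc j
  rw [dop, dop, cd_cf (flip_pw _)]
  push_cast at h1
  exact h1.trans (by convert h2 using 1; ring)

end

section
open Filter Function

/-! Acyclic models. -/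

section Acyclic
variable {E M M' : Type*} [AddCommGroup E]

/-- The canonical null-homotopy of a natural chain map vanishing on augmentations. -/
def homo (X : E → Coch M) (H : M → E → E) : E → Coch M
  | _, [] => 0
  | F, m :: l => X (H m F) (m :: l) + homo X H (H m F) l

variable {X : E → Coch M} {H : M → E → E}

theorem sh_homo (F : E) (m : M) : sh m (homo X H F) = sh m (X (H m F)) + homo X H (H m F) := rfl

theorem homo_add (Xadd : ∀ F G, X (F + G) = X F + X G) (Hadd : ∀ m F G, H m (F + G) = H m F + H m G)
    (F G : E) : homo X H (F + G) = homo X H F + homo X H G := by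
  funext l
  induction l generalizing F G with
  | nil => simp [homo]
  | cons m l ih => simp only [homo, Hadd, Xadd, ih, Pi.add_apply]; abel

theorem homo_zero (Xadd : ∀ F G, X (F + G) = X F + X G) (Hadd : ∀ m F G, H m (F + G) = H m F + H m G) :
    homo X H 0 = 0 := by
  have := homo_add Xadd Hadd 0 0
  simpa using this

theorem cd_homo {N : E → Prop} {δ : E → E} {e : M → E → E}
    (Xadd : ∀ F G, X (F + G) = X F + X G) (Hadd : ∀ m F G, H m (F + G) = H m F + H m G)
    (NH : ∀ m F, N F → N (H m F)) (Xδ : ∀ F, N F → cd (X F) = X (δ F)) (X0 : ∀ F, X F [] = 0)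
    (Hδ : ∀ m F, N F → δ (H m F) + H m (δ F) = F + e m F)
    (Xe : ∀ m F, N F → X (e m F) = 0) (He : ∀ m' m F, N F → H m' (e m F) = 0)
    {F : E} (hF : N F) : cd (homo X H F) + homo X H (δ F) = X F := by
  have X00 : X 0 = 0 := by have := Xadd 0 0; simpa using this
  have hom_e : ∀ m F, N F → homo X H (e m F) = 0 := by
    intro m F hF
    funext l
    cases l with
    | nil => rfl
    | cons m' l => rw [homo, He _ _ _ hF, X00, homo_zero Xadd Hadd]; rfl
  funext l
  induction l generalizing F with
  | nil => simp [homo, X0]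
  | cons m l ih =>
    have h1 := ih (NH m F hF)
    have h2 := congrFun (Xδ _ (NH m F hF)) (m :: l)
    rw [cd_cons] at h2
    have h3 := congrFun (congrArg X (Hδ m F hF)) (m :: l)
    have h4 := congrFun (congrArg (homo X H) (Hδ m F hF)) l
    rw [Xadd, Xadd, Xe m F hF] at h3
    rw [homo_add Xadd Hadd, homo_add Xadd Hadd, hom_e m F hF] at h4
    simp only [Pi.add_apply, cd_cons, sh_homo, cd_add, homo, Pi.zero_apply] at *
    clear ih
    grind (ematch := 0)

theorem homo_eqv {E' : Type*} [AddCommGroup E'] {X' : E' → Coch M'} {H' : M' → E' → E'} (k : M → M')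
    (σ : E' → E) (hX : ∀ F, pb k (X' F) = X (σ F)) (hH : ∀ m F, σ (H' (k m) F) = H m (σ F)) (F : E') :
    pb k (homo X' H' F) = homo X H (σ F) := by
  funext l
  induction l generalizing F with
  | nil => rfl
  | cons m l ih =>
    have h1 := ih (H' (k m) F)
    have h2 := congrFun (hX (H' (k m) F)) (m :: l)
    simp only [pb, List.map_cons, homo] at *
    rw [h1, h2, hH]

theorem homo_loc {Q : E → Prop} {F : E} (hF : Q F) {l : List M} (hH : ∀ m ∈ l, ∀ F, Q F → Q (H m F))
    (hX : ∀ F, Q F → ∀ l', l' ⊆ l → X F l' = 0) : homo X H F l = 0 := by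
  induction l generalizing F with
  | nil => rfl
  | cons m l ih =>
    have h1 := hH m (by simp) F hF
    rw [homo, hX _ h1 _ (List.Subset.refl _), zero_add]
    exact ih h1 (fun m' hm' => hH m' (by simp [hm'])) fun F hF l' hl' =>
      hX F hF l' (List.subset_cons_of_subset _ hl')

theorem homo_deg {D : ℕ → E → Prop} (hH : ∀ n m F, D (n + 1) F → D n (H m F))
    (hH0 : ∀ m F, D 0 F → X (H m F) = 0 ∧ D 0 (H m F))
    (hX : ∀ n F, D n F → ∀ l, X F l ≠ 0 → l.length = n) {n : ℕ} {F : E} (hF : D n F) (l : List M)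
    (hl : homo X H F l ≠ 0) : l.length + 1 = n := by
  induction l generalizing n F with
  | nil => exact absurd rfl hl
  | cons m l ih =>
    cases n with
    | zero =>
      have := hH0 m F hF
      rw [homo, this.1] at hl
      simp only [Pi.zero_apply, zero_add] at hl
      exact absurd (ih this.2 hl) (by omega)
    | succ n =>
      by_cases h1 : X (H m F) (m :: l) = 0
      · rw [homo, h1, zero_add] at hl
        simp [ih (hH n m F hF) hl]
      · simpa using hX n _ (hH n m F hF) _ h1

end Acyclic

/-! Contractions on functions of several list variables. -/

section Multi
variable {K V V' : Type*} [DecidableEq K]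

abbrev MF (K V : Type*) := (K → List V) → ZMod 2

def slS (a : V) (k : K) (F : MF K V) : MF K V := fun p => if p k = [] then 0 else F (update p k (a :: p k))
def slE (a : V) (k : K) (F : MF K V) : MF K V :=
  fun p => if (p k).length = 1 then F (update p k [a]) else 0
def slD (k : K) (F : MF K V) : MF K V := fun p => cd (fun q => F (update p k q)) (p k)
def NF (F : MF K V) : Prop := ∀ p k, p k = [] → F p = 0

def slH (a : V) : List K → MF K V → MF K V
  | [], _ => 0
  | k :: ks, F => slS a k F + slE a k (slH a ks F)
def sle (a : V) : List K → MF K V → MF K V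
  | [], F => F
  | k :: ks, F => slE a k (sle a ks F)

theorem slS_add (a : V) (k : K) (F G : MF K V) : slS a k (F + G) = slS a k F + slS a k G := by
  funext p; simp only [slS, Pi.add_apply]; split <;> simp
theorem slE_add (a : V) (k : K) (F G : MF K V) : slE a k (F + G) = slE a k F + slE a k G := by
  funext p; simp only [slE, Pi.add_apply]; split <;> simp
theorem slD_add (k : K) (F G : MF K V) : slD k (F + G) = slD k F + slD k G := by
  funext p; exact congrFun (cd_add (fun q => F (update p k q)) (fun q => G (update p k q))) _
theorem slH_add (a : V) (ks : List K) (F G : MF K V) : slH a ks (F + G) = slH a ks F + slH a ks G := by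
  induction ks with
  | nil => simp [slH]
  | cons k ks ih => simp only [slH, slS_add, ih, slE_add]; abel
theorem slE_zero (a : V) (k : K) : slE a k (0 : MF K V) = 0 := by funext p; simp [slE]
theorem slS_zero (a : V) (k : K) : slS a k (0 : MF K V) = 0 := by funext p; simp [slS]

theorem NF.slS {F : MF K V} (h : NF F) (a : V) (k : K) : NF (slS a k F) := by
  intro p j hj
  simp only [CatCone.slS]
  split_ifs with h1
  · rfl
  · refine h _ j ?_
    rw [update_of_ne, hj]
    rintro rfl; exact h1 hj
theorem NF.slE {F : MF K V} (h : NF F) (a : V) (k : K) : NF (slE a k F) := by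
  intro p j hj
  simp only [CatCone.slE]
  split_ifs with h1
  · refine h _ j ?_
    rw [update_of_ne, hj]
    rintro rfl; simp [hj] at h1
  · rfl
theorem NF.add {F G : MF K V} (h : NF F) (h' : NF G) : NF (F + G) := fun p k hk => by
  simp [h p k hk, h' p k hk]
theorem NF.slH {F : MF K V} (h : NF F) (a : V) (ks : List K) : NF (slH a ks F) := by
  induction ks with
  | nil => intro p k _; rfl
  | cons k ks ih => exact (h.slS a k).add (ih.slE a k)

theorem cd_ind (l : List V) : cd (fun l => if l = [] then 1 else 0) l = if l.length = 1 then 1 else 0 := by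
  cases l with
  | nil => rfl
  | cons a l =>
    rw [cd_cons]
    have : sh a (fun l : List V => if l = [] then (1 : ZMod 2) else 0) = 0 := by funext l; simp [sh]
    rw [this, cd_zero]
    cases l <;> simp

theorem cd_contr {f : Coch V} (hf : f [] = 0) (a : V) (l : List V) :
    cd (fun l => if l = [] then 0 else f (a :: l)) l + (if l = [] then 0 else cd f (a :: l)) =
      f l + if l.length = 1 then f [a] else 0 := by
  have h1 : (fun l => if l = [] then 0 else f (a :: l)) =
      sh a f + fun l => f [a] * (if l = [] then 1 else 0) := by
    funext l
    by_cases h : l = []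
    · subst h; simp [sh]; grind
    · simp [h, sh]
  rw [h1, cd_add, cd_smul, Pi.add_apply, cd_ind]
  cases l with
  | nil => simp [hf]
  | cons b l =>
    simp only [cd_cons f a]
    have := CharTwo.add_self_eq_zero (cd (sh a f) (b :: l))
    split_ifs <;> simp_all <;> grind

theorem cd_unitlen (c : ZMod 2) (l : List V) : cd (fun l => if l.length = 1 then c else 0) l = 0 := by
  have : (fun l : List V => if l.length = 1 then c else 0) =
      fun l => c * cd (fun l => if l = [] then 1 else 0) l := by
    funext l; rw [cd_ind]; split_ifs <;> simp
  rw [this, cd_smul, cd_cd]; simp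

theorem slD_slS_self {F : MF K V} (h : NF F) (a : V) (k : K) :
    slD k (slS a k F) + slS a k (slD k F) = F + slE a k F := by
  funext p
  have h1 := cd_contr (f := fun q => F (update p k q)) (h _ k (by simp)) a (p k)
  simpa [slD, slS, slE] using h1

theorem slD_slE_self {F : MF K V} (h : NF F) (a : V) (k : K) :
    slD k (slE a k F) + slE a k (slD k F) = 0 := by
  funext p
  have h1 := cd_unitlen (F (update p k [a])) (p k)
  have h2 : cd (fun q => F (update p k q)) [a] = 0 := by
    rw [cd_cons, h _ k (by simp)]; rfl
  simp [slD, slE, h1, h2]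

theorem slD_slS_ne (F : MF K V) (a : V) {j k : K} (hjk : j ≠ k) :
    slD j (slS a k F) = slS a k (slD j F) := by
  funext p
  simp only [slD, slS, update_of_ne hjk, update_of_ne hjk.symm]
  split_ifs with h
  · exact congrFun (cd_zero) _
  · simp only [update_comm hjk]

theorem slD_slE_ne (F : MF K V) (a : V) {j k : K} (hjk : j ≠ k) :
    slD j (slE a k F) = slE a k (slD j F) := by
  funext p
  simp only [slD, slE, update_of_ne hjk, update_of_ne hjk.symm]
  split_ifs with h
  · simp only [update_comm hjk]
  · exact congrFun (cd_zero) _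

theorem MF_add_self (F : MF K V) : F + F = 0 := by funext p; exact CharTwo.add_self_eq_zero _

variable [Fintype K]

def slδ (F : MF K V) : MF K V := ∑ k, slD k F

theorem slδ_add (F G : MF K V) : slδ (F + G) = slδ F + slδ G := by
  simp [slδ, slD_add, Finset.sum_add_distrib]

theorem slS_sum (a : V) (k : K) (s : Finset K) (F : K → MF K V) : slS a k (∑ j ∈ s, F j) = ∑ j ∈ s, slS a k (F j) :=
  map_sum (AddMonoidHom.mk' (slS a k) (slS_add a k)) F s
theorem slE_sum (a : V) (k : K) (s : Finset K) (F : K → MF K V) : slE a k (∑ j ∈ s, F j) = ∑ j ∈ s, slE a k (F j) :=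
  map_sum (AddMonoidHom.mk' (slE a k) (slE_add a k)) F s

theorem slδ_slS {F : MF K V} (h : NF F) (a : V) (k : K) :
    slδ (slS a k F) + slS a k (slδ F) = F + slE a k F := by
  rw [slδ, slδ, slS_sum, ← Finset.sum_add_distrib, Finset.sum_eq_single k, slD_slS_self h]
  · intro j _ hj; rw [slD_slS_ne F a hj, MF_add_self]
  · simp

theorem slδ_slE {F : MF K V} (h : NF F) (a : V) (k : K) :
    slδ (slE a k F) = slE a k (slδ F) := by
  have : slδ (slE a k F) + slE a k (slδ F) = 0 := by
    rw [slδ, slδ, slE_sum, ← Finset.sum_add_distrib]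
    refine Finset.sum_eq_zero fun j _ => ?_
    by_cases hj : j = k
    · subst hj; exact slD_slE_self h a j
    · rw [slD_slE_ne F a hj, MF_add_self]
  funext p
  have := congrFun this p
  simp only [Pi.add_apply, Pi.zero_apply] at this
  grind

theorem slδ_slH {F : MF K V} (h : NF F) (a : V) (ks : List K) :
    slδ (slH a ks F) + slH a ks (slδ F) = F + sle a ks F := by
  induction ks with
  | nil =>
    have : slδ (0 : MF K V) = 0 := by simpa using slδ_add (0 : MF K V) 0
    simp [slH, sle, MF_add_self, this]
  | cons k ks ih =>
    have h1 := slδ_slS h a k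
    have h2 := congrArg (slE a k) ih
    rw [slE_add, slE_add] at h2
    rw [slH, slH, slδ_add, slδ_slE (h.slH a ks), sle]
    funext p
    have h1 := congrFun h1 p
    have h2 := congrFun h2 p
    simp only [Pi.add_apply] at *
    grind

theorem sle_apply (a : V) (ks : List K) (F : MF K V) (p : K → List V) :
    sle a ks F p = if ∀ k ∈ ks, (p k).length = 1 then F (fun j => if j ∈ ks then [a] else p j) else 0 := by
  induction ks generalizing p with
  | nil => simp [sle]
  | cons k ks ih =>
    rw [sle, slE, ih]
    by_cases h : (p k).length = 1
    · have : ∀ j, (update p k [a] j).length = 1 ↔ (p j).length = 1 := by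
        intro j; by_cases hj : j = k
        · subst hj; simp [h]
        · simp [hj]
      simp only [h, this, List.mem_cons, forall_eq_or_imp, true_and, if_true]
      congr 2
      funext j
      by_cases hj : j = k
      · subst hj; simp
      · simp [hj]
    · simp [h]

/-- The augmentation cocycle, scaled. -/
def unitF (K V : Type*) [Fintype K] (c : ZMod 2) : MF K V := fun p => if ∀ k, (p k).length = 1 then c else 0

theorem sle_eq_unit (a : V) {ks : List K} (hk : ∀ k, k ∈ ks) (F : MF K V) :
    sle a ks F = unitF K V (F fun _ => [a]) := by
  funext p; rw [sle_apply]; simp [hk, unitF]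

theorem slH_unit (a : V) (ks : List K) (c : ZMod 2) : slH a ks (unitF K V c) = 0 := by
  induction ks with
  | nil => rfl
  | cons k ks ih =>
    rw [slH, ih, slE_zero, add_zero]
    funext p
    simp only [slS, unitF, Pi.zero_apply]
    split_ifs with h1 h2
    · rfl
    · have := h2 k
      simp at this
      exact absurd this h1
    · rfl

/-- Permutation of slots. -/
def slP (π : Equiv.Perm K) (F : MF K V) : MF K V := fun p => F (p ∘ π)

omit [Fintype K] in
theorem slH_slP (π : Equiv.Perm K) (a : V) (ks : List K) (F : MF K V) :
    slH a ks (slP π F) = slP π (slH a (ks.map π.symm) F) := by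
  induction ks with
  | nil => rfl
  | cons k ks ih =>
    rw [slH, ih, List.map_cons, slH]
    funext p
    have : ∀ q, update p k q ∘ π = update (p ∘ π) (π.symm k) q := by
      intro q; funext j
      by_cases hj : j = π.symm k
      · subst hj; simp
      · have : π j ≠ k := fun h => hj (by simp [← h])
        simp [hj, this]
    simp [slP, slS, slE, this]

/-- Pullback along a vertex map. -/
def slM (i : V → V') (F : MF K V') : MF K V := fun p => F fun k => (p k).map i

omit [Fintype K] in
theorem slH_slM (i : V → V') (a : V) (ks : List K) (F : MF K V') :
    slH a ks (slM i F) = slM i (slH (i a) ks F) := by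
  induction ks with
  | nil => rfl
  | cons k ks ih =>
    rw [slH, ih, slH]
    funext p
    have : ∀ q, (fun j => (update p k q j).map i) = update (fun j => (p j).map i) k (q.map i) := by
      intro q; funext j
      by_cases hj : j = k
      · subst hj; simp
      · simp [hj]
    simp [slM, slS, slE, this]

end Multi

end

section
open Filter Function

variable {U V W : Type*}

/-! The iterated equivariant product and its symmetry. -/

theorem PiF_smul (c : ZMod 2) (F : List V → Coch V) : PiF (fun p q => c * F p q) = fun l => c * PiF F l := by
  funext l
  induction l generalizing F with
  | nil => simp [PiF]
  | cons a l ih =>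
    obtain ⟨b, a⟩ := a
    cases b <;> simp [PiF, ih, mul_add]

theorem PiF_zero : PiF (fun _ _ => 0 : List V → Coch V) = 0 := by
  funext l; exact PiF_loc fun _ _ _ _ => rfl

theorem cd_PiF_param (A : List V → List V → Coch W) (P : List (Bool × V)) (Q : List W) :
    cd (fun Q => PiF (fun p q => A p q Q) P) Q = PiF (fun p q => cd (A p q) Q) P := by
  induction P generalizing A with
  | nil => exact congrFun cd_zero Q
  | cons a l ih =>
    obtain ⟨b, a⟩ := a
    cases b
    · simp only [PiF]
      have := congrFun (cd_add (A [a] (a :: l.map Prod.snd)) (fun Q => PiF (fun p q => A (a :: p) q Q) l)) Q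
      rw [Pi.add_apply, ih] at this
      exact this
    · simp only [PiF]
      have := congrFun (cd_add (A (a :: l.map Prod.snd) [a]) (fun Q => PiF (fun p q => A p (a :: q) Q) l)) Q
      rw [Pi.add_apply, ih] at this
      exact this

abbrev K4 := Bool × Bool

def q4 (p0 p1 q0 q1 : List V) : K4 → List V := fun k => cond k.1 (cond k.2 q1 q0) (cond k.2 p1 p0)

def psiG (F : MF K4 V) : List (Bool × V) → Coch (Bool × V) := fun P Q =>
  PiF (fun p0 p1 => PiF (fun q0 q1 => F (q4 p0 p1 q0 q1)) Q) P
def psi (F : MF K4 V) : Coch (Bool × (Bool × V)) := PiF (psiG F)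

def sw : Bool × (Bool × V) → Bool × (Bool × V) := fun x => (x.2.1, (x.1, x.2.2))
def swK : Equiv.Perm K4 := Equiv.prodComm _ _

def psi' (F : MF K4 V) : Coch (Bool × (Bool × V)) := pb sw (psi (slP swK F))

theorem upd_q4_ff (p0 p1 q0 q1 x : List V) : update (q4 p0 p1 q0 q1) (false, false) x = q4 x p1 q0 q1 := by
  funext ⟨a, b⟩; cases a <;> cases b <;> simp [q4]
theorem upd_q4_ft (p0 p1 q0 q1 x : List V) : update (q4 p0 p1 q0 q1) (false, true) x = q4 p0 x q0 q1 := by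
  funext ⟨a, b⟩; cases a <;> cases b <;> simp [q4]
theorem upd_q4_tf (p0 p1 q0 q1 x : List V) : update (q4 p0 p1 q0 q1) (true, false) x = q4 p0 p1 x q1 := by
  funext ⟨a, b⟩; cases a <;> cases b <;> simp [q4]
theorem upd_q4_tt (p0 p1 q0 q1 x : List V) : update (q4 p0 p1 q0 q1) (true, true) x = q4 p0 p1 q0 x := by
  funext ⟨a, b⟩; cases a <;> cases b <;> simp [q4]

theorem psiG_add (F G : MF K4 V) : psiG (F + G) = psiG F + psiG G := by
  funext P Q
  have h1 : ∀ p0 p1, PiF (fun q0 q1 => (F + G) (q4 p0 p1 q0 q1)) = 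
    PiF (fun q0 q1 => F (q4 p0 p1 q0 q1)) + PiF (fun q0 q1 => G (q4 p0 p1 q0 q1)) := fun p0 p1 => PiF_add _ _
  simp only [psiG, h1]
  exact congrFun (PiF_add _ _) P

theorem psi_add (F G : MF K4 V) : psi (F + G) = psi F + psi G := by
  rw [psi, psiG_add, PiF_add]; rfl

theorem psi'_add (F G : MF K4 V) : psi' (F + G) = psi' F + psi' G := by
  rw [psi', show slP swK (F + G) = slP swK F + slP swK G from rfl, psi_add]; rfl

theorem slδ_q4 (F : MF K4 V) (p0 p1 q0 q1 : List V) : slδ F (q4 p0 p1 q0 q1) =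
    (cd (fun x => F (q4 p0 p1 q0 x)) q1 + cd (fun x => F (q4 p0 p1 x q1)) q0) +
    (cd (fun x => F (q4 p0 x q0 q1)) p1 + cd (fun x => F (q4 x p1 q0 q1)) p0) := by
  simp only [slδ, Fintype.sum_prod_type, Fintype.sum_bool, Pi.add_apply, slD, upd_q4_ff, upd_q4_ft, 
    upd_q4_tf, upd_q4_tt]
  rfl

theorem cd_psi {F : MF K4 V} (h : NF F) : cd (psi F) = psi (slδ F) := by
  funext l
  rw [psi, cd_PiF]
  have e1 : psiG F [] (l.map Prod.snd) = 0 := rfl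
  have e2 : psiG F (l.map Prod.snd) [] = 0 := congrFun PiF_zero _
  rw [e1, e2, add_zero, add_zero, psi]
  congr 1
  funext P Q
  have h1 : cd1 (psiG F) P Q = PiF (fun p0 p1 => PiF (fun q0 q1 =>
      cd (fun x => F (q4 p0 x q0 q1)) p1 + cd (fun x => F (q4 x p1 q0 q1)) p0) Q) P := by
    show cd (PiF (fun p0 p1 => PiF (fun q0 q1 => F (q4 p0 p1 q0 q1)) Q)) P = _
    rw [cd_PiF]
    have a1 : ∀ p, PiF (fun q0 q1 => F (q4 [] p q0 q1)) Q = 0 := fun p =>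
      PiF_loc fun _ _ _ _ => h _ (false, false) rfl
    have a2 : ∀ p, PiF (fun q0 q1 => F (q4 p [] q0 q1)) Q = 0 := fun p =>
      PiF_loc fun _ _ _ _ => h _ (false, true) rfl
    rw [a1, a2, add_zero, add_zero]
    congr 1
    funext p0 p1
    rw [Pi.add_apply, Pi.add_apply, cd1, cd2, cd_PiF_param, cd_PiF_param, ← Pi.add_apply, ← PiF_add]
    congr 1
    funext q0 q1
    exact add_comm _ _
  have h2 : cd2 (psiG F) P Q = PiF (fun p0 p1 => PiF (fun q0 q1 =>
      cd (fun x => F (q4 p0 p1 q0 x)) q1 + cd (fun x => F (q4 p0 p1 x q1)) q0) Q) P := by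
    show cd (fun Q => PiF (fun p0 p1 => PiF (fun q0 q1 => F (q4 p0 p1 q0 q1)) Q) P) Q = _
    rw [cd_PiF_param]
    congr 1
    funext p0 p1
    rw [cd_PiF]
    have a1 : ∀ p, F (q4 p0 p1 [] p) = 0 := fun p => h _ (true, false) rfl
    have a2 : ∀ p, F (q4 p0 p1 p []) = 0 := fun p => h _ (true, true) rfl
    rw [a1, a2, add_zero, add_zero]
    congr 1
    funext q0 q1
    exact add_comm _ _
  rw [Pi.add_apply, Pi.add_apply, h1, h2, add_comm, ← Pi.add_apply, ← PiF_add, psiG]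
  congr 1
  funext p0 p1
  rw [Pi.add_apply, Pi.add_apply, ← Pi.add_apply, ← PiF_add]
  congr 1
  funext q0 q1
  exact (slδ_q4 F p0 p1 q0 q1).symm

theorem NF.slP {F : MF K4 V} (h : NF F) (π : Equiv.Perm K4) : NF (slP π F) :=
  fun p k hk => h _ (π.symm k) (by simp [hk])

theorem slδ_slP (F : MF K4 V) (π : Equiv.Perm K4) : slδ (slP π F) = slP π (slδ F) := by
  funext p
  simp only [slδ, slP, Finset.sum_apply]
  rw [← Equiv.sum_comp π]
  refine Finset.sum_congr rfl fun k _ => ?_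
  simp only [slD, comp_apply]
  have : ∀ q, update p (π k) q ∘ π = update (p ∘ π) k q := by
    intro q; exact update_comp_eq_of_injective _ π.injective _ _
  simp only [slP, this]

theorem cd_psi' {F : MF K4 V} (h : NF F) : cd (psi' F) = psi' (slδ F) := by
  rw [psi', cd_pb, cd_psi (h.slP _), slδ_slP]; rfl

theorem psi_loc {F : MF K4 V} {l : List (Bool × (Bool × V))}
    (h : ∀ p, (∀ k, p k ⊆ (l.map Prod.snd).map Prod.snd) → F p = 0) : psi F l = 0 := by
  refine PiF_loc fun P Q hP hQ => PiF_loc fun p0 p1 hp0 hp1 => PiF_loc fun q0 q1 hq0 hq1 => h _ ?_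
  have hP := List.map_subset Prod.snd hP
  have hQ := List.map_subset Prod.snd hQ
  rintro ⟨a, b⟩
  cases a <;> cases b
  · exact List.Subset.trans hp0 hP
  · exact List.Subset.trans hp1 hP
  · exact List.Subset.trans hq0 hQ
  · exact List.Subset.trans hq1 hQ

theorem sw_snd (l : List (Bool × (Bool × V))) :
    ((l.map sw).map Prod.snd).map Prod.snd = (l.map Prod.snd).map Prod.snd := by
  simp only [List.map_map]; rfl

theorem psi'_loc {F : MF K4 V} {l : List (Bool × (Bool × V))}
    (h : ∀ p, (∀ k, p k ⊆ (l.map Prod.snd).map Prod.snd) → F p = 0) : psi' F l = 0 := by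
  refine psi_loc fun p hp => h _ fun k => ?_
  have := hp (swK k)
  rwa [sw_snd] at this

theorem PiF_len {n : ℕ} {F : List V → Coch V} (h : ∀ p q, F p q ≠ 0 → p.length + q.length = n + 1)
    (l : List (Bool × V)) (hl : PiF F l ≠ 0) : l.length = n := by
  have := deg_PiF_aux h l hl
  omega

/-- Total length on which a multi-variable function is supported. -/
def MDeg (n : ℕ) (F : MF K4 V) : Prop := ∀ p, F p ≠ 0 → ∑ k, (p k).length = n

theorem psi_len {n : ℕ} {F : MF K4 V} (h : MDeg (n + 3) F) (hN : NF F) (l : List (Bool × (Bool × V)))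
    (hl : psi F l ≠ 0) : l.length = n := by
  have hF : ∀ p0 p1 q0 q1, F (q4 p0 p1 q0 q1) ≠ 0 →
      p0.length + p1.length + (q0.length + q1.length) = n + 3 ∧ 1 ≤ p0.length ∧ 1 ≤ p1.length ∧
      1 ≤ q0.length ∧ 1 ≤ q1.length := by
    intro p0 p1 q0 q1 hf
    have h0 := h _ hf
    simp [Fintype.sum_prod_type, q4] at h0
    have h1 : ∀ k, 1 ≤ (q4 p0 p1 q0 q1 k).length := fun k =>
      List.length_pos_iff.2 fun he => hf (hN _ k he)
    have a := h1 (false, false)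
    have b := h1 (false, true)
    have c := h1 (true, false)
    have d := h1 (true, true)
    simp only [q4, cond_false, cond_true] at a b c d
    refine ⟨by omega, a, b, c, d⟩
  have key : ∀ Q : List (Bool × V), ∀ p0 p1, PiF (fun q0 q1 => F (q4 p0 p1 q0 q1)) Q ≠ 0 →
      p0.length + p1.length + Q.length = n + 2 ∧ 1 ≤ p0.length ∧ 1 ≤ p1.length ∧ 1 ≤ Q.length := by
    intro Q p0 p1 h'
    have : ∃ q0 q1, F (q4 p0 p1 q0 q1) ≠ 0 := by
      by_contra hc
      push Not at hc
      exact h' (PiF_loc fun q0 q1 _ _ => hc q0 q1)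
    obtain ⟨a, b, hab⟩ := this
    have h0 := hF _ _ _ _ hab
    have := PiF_len (n := n + 2 - (p0.length + p1.length)) (fun q0 q1 hq => ?_) Q h'
    · omega
    · have := hF _ _ _ _ hq
      omega
  refine PiF_len (n := n) (fun P Q hPQ => ?_) l hl
  have : ∃ p0 p1, PiF (fun q0 q1 => F (q4 p0 p1 q0 q1)) Q ≠ 0 := by
    by_contra hc
    push Not at hc
    exact hPQ (PiF_loc fun q0 q1 _ _ => hc q0 q1)
  obtain ⟨a, b, hab⟩ := this
  have h0 := key _ _ _ hab
  have := PiF_len (n := n + 1 - Q.length) (fun q0 q1 hq => ?_) P hPQ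
  · omega
  · have := key _ _ _ hq
    omega

theorem NF_unitF (c : ZMod 2) : NF (unitF K4 V c) := fun p k hk =>
  if_neg fun h => by simpa [hk] using h k

theorem psi_unit (c : ZMod 2) (l : List (Bool × (Bool × V))) :
    psi (unitF K4 V c) l = if l.length = 1 then c else 0 := by
  split_ifs with h
  · obtain ⟨⟨s, t, x⟩, rfl⟩ := List.length_eq_one_iff.1 h
    cases s <;> cases t <;> simp [psi, psiG, PiF, unitF, q4]
  · by_contra h'
    refine h (psi_len (F := unitF K4 V c) (fun p hp => ?_) (NF_unitF c) l h')
    have : ∀ k, (p k).length = 1 := by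
      by_contra h2; exact hp (if_neg h2)
    simp [this]

theorem slP_unit (π : Equiv.Perm K4) (c : ZMod 2) : slP π (unitF K4 V c) = unitF K4 V c := by
  funext p
  simp only [slP, unitF, comp_apply]
  congr 1
  exact propext ⟨fun h k => by simpa using h (π.symm k), fun h k => h _⟩

/-- The difference of the two iterated products. -/
def psiX (F : MF K4 V) : Coch (Bool × (Bool × V)) := psi F + psi' F

theorem psiX_unit (c : ZMod 2) : psiX (unitF K4 V c) = 0 := by
  funext l
  rw [psiX, psi', slP_unit, Pi.add_apply, pb, psi_unit, psi_unit, List.length_map]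
  exact CharTwo.add_self_eq_zero _

def slots (s t : Bool) : List K4 := [(s, t), (s, !t), (!s, t), (!s, !t)]

theorem mem_slots (s t : Bool) (k : K4) : k ∈ slots s t := by
  obtain ⟨a, b⟩ := k; cases s <;> cases t <;> cases a <;> cases b <;> simp [slots]

def hH (m : Bool × (Bool × V)) (F : MF K4 V) : MF K4 V := slH m.2.2 (slots m.1 m.2.1) F

/-- The homotopy between the two iterated products. -/
def homF (F : MF K4 V) : Coch (Bool × (Bool × V)) := homo psiX hH F

theorem psiX_add (F G : MF K4 V) : psiX (F + G) = psiX F + psiX G := by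
  rw [psiX, psi_add, psi'_add, psiX, psiX]; abel

theorem homF_add (F G : MF K4 V) : homF (F + G) = homF F + homF G :=
  homo_add psiX_add (fun _ => slH_add _ _) F G

theorem psi_nil (F : MF K4 V) : psi F [] = 0 := rfl

theorem cd_homF {F : MF K4 V} (hF : NF F) : cd (homF F) + homF (slδ F) = psi F + psi' F := by
  refine cd_homo (N := NF) (δ := slδ) (e := fun m => sle m.2.2 (slots m.1 m.2.1)) psiX_add
    (fun _ => slH_add _ _) (fun m F h => h.slH _ _) (fun F h => ?_) (fun F => ?_)
    (fun m F h => slδ_slH h _ _) (fun m F h => ?_) (fun m' m F h => ?_) hF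
  · rw [psiX, cd_add, cd_psi h, cd_psi' h]; rfl
  · rfl
  · rw [sle_eq_unit _ (mem_slots _ _), psiX_unit]
  · rw [sle_eq_unit _ (mem_slots _ _)]; exact slH_unit _ _ _

end

section
open Filter Function

variable {U V W : Type*}

theorem PiF_fubini (G : List V → List V → List W → Coch W) (P : List (Bool × V)) (Q : List (Bool × W)) :
    PiF (fun p0 p1 => PiF (fun q0 q1 => G p0 p1 q0 q1) Q) P =
      PiF (fun q0 q1 => PiF (fun p0 p1 => G p0 p1 q0 q1) P) Q := by
  induction P generalizing G with
  | nil => exact (congrFun PiF_zero Q).symm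
  | cons a l ih =>
    obtain ⟨b, a⟩ := a
    cases b
    · simp only [PiF]
      rw [ih fun p => G (a :: p)]
      exact (congrFun (PiF_add (fun q0 q1 => G [a] (a :: l.map Prod.snd) q0 q1)
        (fun q0 q1 => PiF (fun p0 p1 => G (a :: p0) p1 q0 q1) l)) Q).symm
    · simp only [PiF]
      rw [ih fun p q => G p (a :: q)]
      exact (congrFun (PiF_add (fun q0 q1 => G (a :: l.map Prod.snd) [a] q0 q1)
        (fun q0 q1 => PiF (fun p0 p1 => G p0 (a :: p1) q0 q1) l)) Q).symm

def fS : Equiv.Perm K4 := ⟨Prod.map not id, Prod.map not id, by rintro ⟨a, b⟩; simp, by rintro ⟨a, b⟩; simp⟩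
def fT : Equiv.Perm K4 := ⟨Prod.map id not, Prod.map id not, by rintro ⟨a, b⟩; simp, by rintro ⟨a, b⟩; simp⟩

theorem pb_s_psi (F : MF K4 V) : pb (Prod.map not id) (psi F) = psi (slP fS F) := by
  funext l
  rw [pb, psi, PiF_flip, psi]
  congr 1
  funext P Q
  rw [psiG, PiF_fubini, psiG]
  congr 1
  funext p0 p1
  congr 1
  funext q0 q1
  simp only [slP]
  congr 1
  funext ⟨a, b⟩
  cases a <;> cases b <;> rfl

theorem pb_t_psi (F : MF K4 V) : pb (Prod.map id (Prod.map not id)) (psi F) = psi (slP fT F) := by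
  funext l
  rw [pb, psi, pb_PiF, psi]
  congr 1
  funext P Q
  have hP : ∀ (F : List V → Coch V) (l : List (Bool × V)), PiF F (l.map (Prod.map not id)) = _ := PiF_flip
  simp only [psiG, hP]
  congr 1
  funext p0 p1
  congr 1
  funext q0 q1
  simp only [slP]
  congr 1
  funext ⟨a, b⟩
  cases a <;> cases b <;> rfl

theorem pb_i_psi (i : U → V) (F : MF K4 V) :
    pb (Prod.map id (Prod.map id i)) (psi F) = psi (slM i F) := by
  funext l
  rw [pb, psi, pb_PiF, psi]
  congr 1
  funext P Q
  simp only [psiG, pb_PiF]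
  congr 1
  funext p0 p1
  congr 1
  funext q0 q1
  simp only [slM]
  congr 1
  funext ⟨a, b⟩
  cases a <;> cases b <;> rfl

theorem pb_s_psiX (F : MF K4 V) : pb (Prod.map not id) (psiX F) = psiX (slP fS F) := by
  rw [psiX, pb_add, pb_s_psi, psiX, psi', psi', pb_pb,
    show slP swK (slP fS F) = slP fT (slP swK F) from rfl, ← pb_t_psi, pb_pb]
  rfl

theorem pb_t_psiX (F : MF K4 V) : pb (Prod.map id (Prod.map not id)) (psiX F) = psiX (slP fT F) := by
  rw [psiX, pb_add, pb_t_psi, psiX, psi', psi', pb_pb,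
    show slP swK (slP fT F) = slP fS (slP swK F) from rfl, ← pb_s_psi, pb_pb]
  rfl

theorem pb_i_psiX (i : U → V) (F : MF K4 V) :
    pb (Prod.map id (Prod.map id i)) (psiX F) = psiX (slM i F) := by
  rw [psiX, pb_add, pb_i_psi, psiX, psi', psi', pb_pb,
    show slP swK (slM i F) = slM i (slP swK F) from rfl, ← pb_i_psi i (slP swK F), pb_pb]
  rfl

theorem pb_s_homF (F : MF K4 V) : pb (Prod.map not id) (homF F) = homF (slP fS F) := by
  refine homo_eqv _ _ pb_s_psiX (fun m F => ?_) F
  obtain ⟨s, t, x⟩ := m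
  rw [hH, hH, slH_slP]
  cases s <;> cases t <;> rfl

theorem pb_t_homF (F : MF K4 V) : pb (Prod.map id (Prod.map not id)) (homF F) = homF (slP fT F) := by
  refine homo_eqv _ _ pb_t_psiX (fun m F => ?_) F
  obtain ⟨s, t, x⟩ := m
  rw [hH, hH, slH_slP]
  cases s <;> cases t <;> rfl

theorem pb_i_homF (i : U → V) (F : MF K4 V) :
    pb (Prod.map id (Prod.map id i)) (homF F) = homF (slM i F) :=
  homo_eqv _ _ (pb_i_psiX i) (fun m F => (slH_slM i _ _ _).symm) F

/-- `F` vanishes on tuples of lists drawn from `S`. -/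
def VanOn (S : List V) (F : MF K4 V) : Prop := ∀ p, (∀ k, p k ⊆ S) → F p = 0

theorem VanOn.slS {S : List V} {F : MF K4 V} (h : VanOn S F) {a : V} (ha : a ∈ S) (k : K4) :
    VanOn S (slS a k F) := by
  intro p hp
  simp only [CatCone.slS]
  split_ifs
  · rfl
  · refine h _ fun j => ?_
    rcases eq_or_ne j k with rfl | hj
    · simpa using ⟨ha, hp j⟩
    · rw [update_of_ne hj]; exact hp j

theorem VanOn.slE {S : List V} {F : MF K4 V} (h : VanOn S F) {a : V} (ha : a ∈ S) (k : K4) :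
    VanOn S (slE a k F) := by
  intro p hp
  simp only [CatCone.slE]
  split_ifs
  · refine h _ fun j => ?_
    rcases eq_or_ne j k with rfl | hj
    · simpa using ha
    · rw [update_of_ne hj]; exact hp j
  · rfl

theorem VanOn.slH {S : List V} {F : MF K4 V} (h : VanOn S F) {a : V} (ha : a ∈ S) (ks : List K4) :
    VanOn S (slH a ks F) := by
  induction ks with
  | nil => intro p _; rfl
  | cons k ks ih =>
    intro p hp
    simp only [CatCone.slH, Pi.add_apply, h.slS ha k p hp, ih.slE ha k p hp, add_zero]

theorem homF_loc {F : MF K4 V} {l : List (Bool × (Bool × V))}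
    (h : VanOn ((l.map Prod.snd).map Prod.snd) F) : homF F l = 0 := by
  refine homo_loc (Q := VanOn ((l.map Prod.snd).map Prod.snd)) h (fun m hm F hF => hF.slH ?_ _)
    fun F hF l' hl' => ?_
  · exact List.mem_map_of_mem (List.mem_map_of_mem hm)
  · have hs := List.map_subset Prod.snd (List.map_subset Prod.snd hl')
    rw [psiX, Pi.add_apply, psi_loc, psi'_loc, add_zero]
    · exact fun p hp => hF p fun k => List.Subset.trans (hp k) hs
    · exact fun p hp => hF p fun k => List.Subset.trans (hp k) hs

theorem MDeg.slS {n : ℕ} {F : MF K4 V} (h : MDeg (n + 1) F) (a : V) (k : K4) : MDeg n (slS a k F) := by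
  intro p hp
  simp only [CatCone.slS] at hp
  split_ifs at hp with h1
  · exact absurd rfl hp
  · have := h _ hp
    rw [Fintype.sum_eq_add_sum_compl k] at this ⊢
    rw [update_self, List.length_cons] at this
    have h2 : ∑ i ∈ {k}ᶜ, (update p k (a :: p k) i).length = ∑ i ∈ {k}ᶜ, (p i).length :=
      Finset.sum_congr rfl fun i hi => by rw [update_of_ne (by simpa using hi)]
    omega

theorem MDeg.slE {n : ℕ} {F : MF K4 V} (h : MDeg n F) (a : V) (k : K4) : MDeg n (slE a k F) := by
  intro p hp
  simp only [CatCone.slE] at hp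
  split_ifs at hp with h1
  · have := h _ hp
    rw [Fintype.sum_eq_add_sum_compl k] at this ⊢
    rw [update_self] at this
    have h2 : ∑ i ∈ {k}ᶜ, (update p k [a] i).length = ∑ i ∈ {k}ᶜ, (p i).length :=
      Finset.sum_congr rfl fun i hi => by rw [update_of_ne (by simpa using hi)]
    simp only [List.length_singleton] at this
    omega
  · exact absurd rfl hp

theorem MDeg.add {n : ℕ} {F G : MF K4 V} (h : MDeg n F) (h' : MDeg n G) : MDeg n (F + G) := by
  intro p hp
  by_cases h1 : F p = 0
  · exact h' p fun h2 => hp (by simp [h1, h2])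
  · exact h p h1

theorem MDeg.slH {n : ℕ} {F : MF K4 V} (h : MDeg (n + 1) F) (a : V) (ks : List K4) :
    MDeg n (slH a ks F) := by
  induction ks with
  | nil => intro p hp; exact absurd rfl hp
  | cons k ks ih => exact (h.slS a k).add (ih.slE a k)

theorem MDeg.eq_zero {n : ℕ} (hn : n < 4) {F : MF K4 V} (h : MDeg n F) (hN : NF F) : F = 0 := by
  funext p
  by_contra hp
  have h1 : ∑ k : K4, 1 ≤ ∑ k, (p k).length := Finset.sum_le_sum fun k _ =>
    List.length_pos_iff.2 fun he => hp (hN _ k he)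
  have := h _ hp
  simp at h1
  omega

theorem slP_len {n : ℕ} {F : MF K4 V} (h : MDeg n F) (π : Equiv.Perm K4) : MDeg n (slP π F) := by
  intro p hp
  rw [← h _ hp]
  exact (Equiv.sum_comp π fun k => (p k).length).symm

theorem homF_len {n : ℕ} {F : MF K4 V} (h : MDeg (n + 4) F) (hN : NF F) (l : List (Bool × (Bool × V)))
    (hl : homF F l ≠ 0) : l.length = n := by
  have := homo_deg (X := psiX) (H := hH) (D := fun n F => MDeg (n + 3) F ∧ NF F) (n := n + 1) (F := F)
    (fun n m F hF => ⟨MDeg.slH (by convert hF.1 using 1) _ _, hF.2.slH _ _⟩) (fun m F hF => ?_)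
    (fun n F hF l hl => ?_) ⟨by convert h using 1, hN⟩ l hl
  · omega
  · have h0 : F = 0 := hF.1.eq_zero (by norm_num) hF.2
    have h1 : hH m F = 0 := by
      subst h0
      have := slH_add m.2.2 (slots m.1 m.2.1) (0 : MF K4 V) 0
      simpa [hH] using this
    rw [h1]
    refine ⟨?_, fun p hp => absurd rfl hp, fun _ _ _ => rfl⟩
    have := psiX_add (0 : MF K4 V) 0
    simpa using this
  · rw [psiX, Pi.add_apply] at hl
    by_cases h1 : psi F l = 0
    · have h2 : psi' F l ≠ 0 := fun h2 => hl (by rw [h1, h2, add_zero])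
      have := psi_len (slP_len hF.1 swK) (hF.2.slP _) (l.map sw) h2
      simpa using this
    · exact psi_len hF.1 hF.2 l h1

end

section
open Filter Function

variable {U V W : Type*} {S Sa Sb : Site V} {n m : ℤ}

def prod4 (a b c d : Coch V) : MF K4 V :=
  fun p => (a (p (false, false)) * b (p (false, true))) * (c (p (true, false)) * d (p (true, true)))

theorem PiF_smul' (c : ZMod 2) (F : List V → Coch V) (l : List (Bool × V)) :
    PiF (fun p q => c * F p q) l = c * PiF F l := congrFun (PiF_smul c F) l

theorem PiF_smul_right (c : ZMod 2) (F : List V → Coch V) (l : List (Bool × V)) :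
    PiF (fun p q => F p q * c) l = PiF F l * c := by
  simp only [mul_comm _ c]; exact PiF_smul' c F l

theorem psi_prod4 (a b c d : Coch V) :
    psi (prod4 a b c d) = PiF (tens (PiF (tens a b)) (PiF (tens c d))) := by
  rw [psi]
  congr 1
  funext P Q
  simp only [psiG, prod4, q4, cond_false, cond_true, PiF_smul', PiF_smul_right]
  rfl

theorem psi'_prod4 (a b c d : Coch V) :
    psi' (prod4 a b c d) = pb sw (PiF (tens (PiF (tens a c)) (PiF (tens b d)))) := by
  rw [psi', ← psi_prod4]
  congr 2
  funext p
  simp only [slP, prod4, comp_apply, swK, Equiv.prodComm_apply, Prod.swap]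
  ring

theorem q4_eta (p : K4 → List V) :
    q4 (p (false, false)) (p (false, true)) (p (true, false)) (p (true, true)) = p := by
  funext ⟨a, b⟩; cases a <;> cases b <;> rfl

theorem slδ_prod4 (a b c d : Coch V) : slδ (prod4 a b c d) =
    (prod4 a b c (cd d) + prod4 a b (cd c) d) + (prod4 a (cd b) c d + prod4 (cd a) b c d) := by
  funext p
  rw [← q4_eta p, slδ_q4]
  simp only [prod4, q4, cond_false, cond_true, Pi.add_apply]
  have r : ∀ (c : ZMod 2) (φ : Coch V) l, cd (fun q => φ q * c) l = c * cd φ l := by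
    intro c φ l; simp only [mul_comm _ c]; rw [cd_smul]
  simp only [cd_smul, r]
  ring

theorem NF_prod4 {a b c d : Coch V} (ha : a [] = 0) (hb : b [] = 0) (hc : c [] = 0) (hd : d [] = 0) :
    NF (prod4 a b c d) := by
  rintro p ⟨i, j⟩ hk
  cases i <;> cases j <;> simp [prod4, hk, ha, hb, hc, hd]

/-- `φ` vanishes on lists drawn from `l`. -/
def Van (l : List V) (φ : Coch V) : Prop := ∀ p, p ⊆ l → φ p = 0

theorem VanOn.prod4 {l : List V} {a b c d : Coch V} (h : Van l a ∨ Van l b ∨ Van l c ∨ Van l d) :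
    VanOn l (prod4 a b c d) := by
  intro p hp
  rcases h with h | h | h | h <;> simp [CatCone.prod4, h _ (hp _)]

theorem VanOn.slδ_prod4 {l : List V} {a b c d : Coch V} (ha : Van l (cd a)) (hb : Van l (cd b))
    (hc : Van l (cd c)) (hd : Van l (cd d)) : VanOn l (slδ (CatCone.prod4 a b c d)) := by
  intro p hp
  rw [CatCone.slδ_prod4]
  simp [CatCone.prod4, ha _ (hp _), hb _ (hp _), hc _ (hp _), hd _ (hp _)]

theorem MDeg.prod4 {n : ℕ} {i j k m : ℤ} {a b c d : Coch V} (ha : Deg i a) (hb : Deg j b) (hc : Deg k c)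
    (hd : Deg m d) (hn : i + j + k + m + 4 = n) : MDeg n (prod4 a b c d) := by
  intro p hp
  have h1 := ha _ (left_ne_zero_of_mul (left_ne_zero_of_mul hp))
  have h2 := hb _ (right_ne_zero_of_mul (left_ne_zero_of_mul hp))
  have h3 := hc _ (left_ne_zero_of_mul (right_ne_zero_of_mul hp))
  have h4 := hd _ (right_ne_zero_of_mul (right_ne_zero_of_mul hp))
  rw [Fintype.sum_prod_type, Fintype.sum_bool, Fintype.sum_bool, Fintype.sum_bool]
  omega

theorem slM_prod4 (i : U → V) (a b c d : Coch V) :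
    slM i (prod4 a b c d) = prod4 (pb i a) (pb i b) (pb i c) (pb i d) := rfl

theorem slP_fS_prod4 (a b c d : Coch V) : slP fS (prod4 a b c d) = prod4 c d a b := by
  funext p; simp [slP, prod4, fS]; ring
theorem slP_fT_prod4 (a b c d : Coch V) : slP fT (prod4 a b c d) = prod4 b a d c := by
  funext p; simp [slP, prod4, fT]; ring

theorem deg_homF {n : ℤ} {F : MF K4 V} {N : ℕ} (h : MDeg N F) (hn : n + 5 = N) (hN : NF F) :
    Deg n (homF F) := by
  intro l hl
  have hl0 : l ≠ [] := by rintro rfl; exact hl rfl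
  refine ⟨hl0, ?_⟩
  by_cases h4 : N < 4
  · rw [h.eq_zero h4 hN] at hl
    have := homF_add (0 : MF K4 V) 0
    exact absurd (by simpa using congrFun this l) hl
  · have := homF_len (n := N - 4) (by convert h using 1; omega) hN l hl
    omega

theorem Her.van {F : Filter (List V)} (h : Her F) {φ : Coch V} (hφ : ∀ᶠ l in F, φ l = 0) :
    ∀ᶠ l in F, Van l φ := h _ hφ

theorem eqv_ev {A : Filter (List V)} {p : List V → Prop} (h : ∀ᶠ l in A, p l) :
    ∀ᶠ l in comap (List.map (Prod.snd : Bool × V → V)) A, p (l.map Prod.snd) :=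
  h.comap _

theorem ev_nat {a : Coch V} (h : Deg n a) (h0 : a ≠ 0) : 0 ≤ n := by
  by_contra hn
  exact h0 (h.eq_zero (by omega))

/-- Symmetry of the iterated power operation. -/
theorem Zc.pw_pw {a : Coch V} (h : Zc S n a) :
    Coh S.eqv.eqv (4 * n) (CatCone.pw (CatCone.pw a)) (pb sw (CatCone.pw (CatCone.pw a))) := by
  have e1 : psi (prod4 a a a a) = CatCone.pw (CatCone.pw a) := psi_prod4 _ _ _ _
  have e2 : psi' (prod4 a a a a) = pb sw (CatCone.pw (CatCone.pw a)) := psi'_prod4 _ _ _ _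
  rw [← e2, ← e1]
  by_cases h0 : a = 0
  · have : psi (prod4 a a a a) = psi' (prod4 a a a a) := by
      rw [e1, e2, h0]
      have : (CatCone.pw (0 : Coch V)) = 0 := by
        funext l; exact PiF_tens_loc (Or.inl fun _ _ => rfl)
      rw [this]
      have : (CatCone.pw (0 : Coch (Bool × V))) = 0 := by
        funext l; exact PiF_tens_loc (Or.inl fun _ _ => rfl)
      rw [this]; rfl
    exact Coh.of_eq this
  have hn := ev_nat h.deg h0
  have hN : NF (prod4 a a a a) := NF_prod4 h.deg.nil h.deg.nil h.deg.nil h.deg.nil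
  refine ⟨homF (prod4 a a a a), ⟨?_, ?_, ?_⟩, ?_⟩
  · exact deg_homF (N := (4 * n + 4).toNat) (MDeg.prod4 h.deg h.deg h.deg h.deg (by omega)) (by omega) hN
  · refine IsInv.eqv ?_ ?_
    · exact (pb_s_homF _).trans (by rw [slP_fS_prod4])
    · rintro _ (rfl | ⟨i, hi, rfl⟩)
      · exact (pb_t_homF _).trans (by rw [slP_fT_prod4])
      · rw [pb_i_homF, slM_prod4, h.inv i hi]
  · filter_upwards [eqv_ev (eqv_ev (S.hG.van h.rel))] with l hl
    exact homF_loc (VanOn.prod4 (Or.inl hl))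
  · filter_upwards [eqv_ev (eqv_ev (S.hF.van h.cl))] with l hl
    have h1 := congrFun (cd_homF hN) l
    rw [Pi.add_apply, homF_loc (VanOn.slδ_prod4 hl hl hl hl), add_zero] at h1
    exact h1.symm

/-! Cup products. -/

def cup (a b : Coch V) : Coch V := cupF (tens a b)

theorem cup_eq (a b : Coch V) : cup a b = pb (Prod.mk false) (PiF (tens a b)) := by
  funext l; exact (PiF_false _ _).symm

theorem cup_loc {a b : Coch V} {l : List V} (h : Van l a ∨ Van l b) : cup a b l = 0 := by
  rw [cup_eq]
  refine PiF_tens_loc ?_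
  simpa [Van, Function.comp_def] using h

theorem cup_add_left (a b c : Coch V) : cup (a + b) c = cup a c + cup b c := by
  rw [cup_eq, tens_add_left, PiF_add, cup_eq, cup_eq]; rfl
theorem cup_add_right (a b c : Coch V) : cup a (b + c) = cup a b + cup a c := by
  rw [cup_eq, tens_add_right, PiF_add, cup_eq, cup_eq]; rfl
theorem cd_cup {a b : Coch V} (ha : a [] = 0) (hb : b [] = 0) :
    cd (cup a b) = cup (cd a) b + cup a (cd b) := by
  rw [cup_eq, cd_pb, cd_PiF_tens ha hb, cup_eq, cup_eq]; rfl
theorem pb_cup (i : U → V) (a b : Coch V) : pb i (cup a b) = cup (pb i a) (pb i b) := by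
  rw [cup_eq, cup_eq, ← pb_PiF_tens, pb_pb, pb_pb]; rfl
theorem Deg.cup {a b : Coch V} (ha : Deg n a) (hb : Deg m b) : Deg (n + m) (cup a b) := by
  rw [cup_eq]; exact (ha.PiF hb).pb _

structure CupSite (Sa Sb S : Site V) : Prop where
  Fa : S.F ≤ Sa.F
  Fb : S.F ≤ Sb.F
  G : S.G ≤ Sa.G ⊔ Sb.G
  Ia : S.I ⊆ Sa.I
  Ib : S.I ⊆ Sb.I

theorem CupSite.ev (h : CupSite Sa Sb S) {a b : Coch V} (ha : ∀ᶠ l in Sa.G, a l = 0)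
    (hb : ∀ᶠ l in Sb.G, b l = 0) : ∀ᶠ l in S.G, Van l a ∨ Van l b := by
  refine h.G (eventually_sup.2 ⟨?_, ?_⟩)
  · exact (Sa.hG.van ha).mono fun _ h => Or.inl h
  · exact (Sb.hG.van hb).mono fun _ h => Or.inr h

theorem CupSite.eqv (h : CupSite Sa Sb S) : CupSite Sa.eqv Sb.eqv S.eqv where
  Fa := comap_mono h.Fa
  Fb := comap_mono h.Fb
  G := by
    show comap _ _ ≤ comap _ _ ⊔ comap _ _
    rw [← comap_sup]; exact comap_mono h.G
  Ia := Set.insert_subset_insert (Set.image_mono h.Ia)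
  Ib := Set.insert_subset_insert (Set.image_mono h.Ib)

theorem Cc.cup {a b : Coch V} (ha : Cc Sa n a) (hb : Cc Sb m b) (h : CupSite Sa Sb S) :
    Cc S (n + m) (cup a b) :=
  ⟨ha.deg.cup hb.deg, fun i hi => by rw [pb_cup, ha.inv i (h.Ia hi), hb.inv i (h.Ib hi)],
    (h.ev ha.rel hb.rel).mono fun _ hl => cup_loc hl⟩

theorem Zc.cup {a b : Coch V} (ha : Zc Sa n a) (hb : Zc Sb m b) (h : CupSite Sa Sb S) :
    Zc S (n + m) (cup a b) :=
  .of_cc (ha.toCc.cup hb.toCc h) (by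
    filter_upwards [h.Fa (Sa.hF.van ha.cl), h.Fb (Sb.hF.van hb.cl)] with l h1 h2
    rw [cd_cup ha.deg.nil hb.deg.nil, Pi.add_apply, cup_loc (Or.inl h1), cup_loc (Or.inr h2), add_zero])

theorem Bd.cup_left {a b : Coch V} (ha : Bd Sa n a) (hb : Zc Sb m b) (h : CupSite Sa Sb S) :
    Bd S (n + m) (CatCone.cup a b) := by
  obtain ⟨χ, h1, h2⟩ := ha
  refine ⟨CatCone.cup χ b, (h1.cup hb.toCc h).of_eq' (by ring), ?_⟩
  have h3 : ∀ᶠ l in Sa.F, (a + cd χ) l = 0 := h2.mono fun l hl => by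
    rw [Pi.add_apply, hl]; exact CharTwo.add_self_eq_zero _
  filter_upwards [h.Fa (Sa.hF.van h3), h.Fb (Sb.hF.van hb.cl)] with l h4 h5
  have h6 := cup_loc (a := a + cd χ) (b := b) (Or.inl h4)
  rw [cup_add_left, Pi.add_apply] at h6
  rw [cd_cup h1.deg.nil hb.deg.nil, Pi.add_apply, cup_loc (a := χ) (Or.inr h5), add_zero]
  exact CharTwo.add_eq_zero.1 h6

theorem Bd.cup_right {a b : Coch V} (ha : Zc Sa n a) (hb : Bd Sb m b) (h : CupSite Sa Sb S) :
    Bd S (n + m) (CatCone.cup a b) := by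
  obtain ⟨χ, h1, h2⟩ := hb
  refine ⟨CatCone.cup a χ, (ha.toCc.cup h1 h).of_eq' (by ring), ?_⟩
  have h3 : ∀ᶠ l in Sb.F, (b + cd χ) l = 0 := h2.mono fun l hl => by
    rw [Pi.add_apply, hl]; exact CharTwo.add_self_eq_zero _
  filter_upwards [h.Fb (Sb.hF.van h3), h.Fa (Sa.hF.van ha.cl)] with l h4 h5
  have h6 := cup_loc (a := a) (b := b + cd χ) (Or.inr h4)
  rw [cup_add_right, Pi.add_apply] at h6
  rw [cd_cup ha.deg.nil h1.deg.nil, Pi.add_apply, cup_loc (b := χ) (Or.inl h5), zero_add]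
  exact CharTwo.add_eq_zero.1 h6

theorem Coh.cup_left {a a' b : Coch V} (h : Coh Sa n a a') (hb : Zc Sb m b) (hs : CupSite Sa Sb S) :
    Coh S (n + m) (cup a b) (cup a' b) := by
  unfold Coh; rw [← cup_add_left]; exact Bd.cup_left h hb hs
theorem Coh.cup_right {a b b' : Coch V} (ha : Zc Sa n a) (h : Coh Sb m b b') (hs : CupSite Sa Sb S) :
    Coh S (n + m) (cup a b) (cup a b') := by
  unfold Coh; rw [← cup_add_right]; exact Bd.cup_right ha h hs

/-- The Cartan formula for the total square. -/
theorem Zc.pw_cup {a b : Coch V} (ha : Zc Sa n a) (hb : Zc Sb m b) (h : CupSite Sa Sb S) :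
    Coh S.eqv (2 * (n + m)) (CatCone.pw (CatCone.cup a b)) (CatCone.cup (CatCone.pw a) (CatCone.pw b)) := by
  let k : Bool × V → Bool × (Bool × V) := Prod.map id (Prod.mk false)
  have e1 : pb k (psi (prod4 a b a b)) = CatCone.pw (CatCone.cup a b) := by
    rw [psi_prod4, pb_PiF_tens, cup_eq]; rfl
  have e2 : pb k (psi' (prod4 a b a b)) = CatCone.cup (CatCone.pw a) (CatCone.pw b) := by
    rw [psi'_prod4, pb_pb, cup_eq]; rfl
  have hk : ∀ l : List (Bool × V), ((l.map k).map Prod.snd).map Prod.snd = l.map Prod.snd := by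
    intro l; simp only [List.map_map]; rfl
  rw [← e1, ← e2]
  by_cases h0 : prod4 a b a b = 0
  · rw [h0]
    have h1 : psi (0 : MF K4 V) = 0 := by simpa using psi_add (0 : MF K4 V) 0
    have h2 : psi' (0 : MF K4 V) = 0 := by simpa using psi'_add (0 : MF K4 V) 0
    rw [h1, h2]; exact Coh.refl
  have hna : a ≠ 0 := by
    rintro rfl; exact h0 (by funext p; simp [prod4])
  have hnb : b ≠ 0 := by
    rintro rfl; exact h0 (by funext p; simp [prod4])
  have hn := ev_nat ha.deg hna
  have hm := ev_nat hb.deg hnb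
  have hN : NF (prod4 a b a b) := NF_prod4 ha.deg.nil hb.deg.nil ha.deg.nil hb.deg.nil
  refine ⟨pb k (homF (prod4 a b a b)), ⟨?_, ?_, ?_⟩, ?_⟩
  · exact Deg.pb (deg_homF (N := (2 * (n + m) + 4).toNat)
      (MDeg.prod4 ha.deg hb.deg ha.deg hb.deg (by omega)) (by omega) hN) _
  · refine IsInv.eqv ?_ fun i hi => ?_
    · rw [pb_pb, show k ∘ flip₂ = (Prod.map not id) ∘ k from rfl, ← pb_pb, pb_s_homF, slP_fS_prod4]
    · rw [pb_pb, show k ∘ Prod.map id i = (Prod.map id (Prod.map id i)) ∘ k from rfl, ← pb_pb, pb_i_homF,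
        slM_prod4, ha.inv i (h.Ia hi), hb.inv i (h.Ib hi)]
  · filter_upwards [eqv_ev (h.ev ha.rel hb.rel)] with l hl
    refine homF_loc (VanOn.prod4 ?_)
    rw [hk]
    exact hl.imp id Or.inl
  · filter_upwards [eqv_ev (h.Fa (Sa.hF.van ha.cl)), eqv_ev (h.Fb (Sb.hF.van hb.cl))] with l h1 h2
    have h3 := congrFun (cd_homF hN) (l.map k)
    rw [← hk] at h1 h2
    rw [Pi.add_apply, homF_loc (VanOn.slδ_prod4 h1 h2 h1 h2), add_zero] at h3
    rw [cd_pb]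
    exact h3.symm

end

section
open Filter Function

variable {U V W : Type*} {S Sa Sb : Site V} {n m : ℤ}

theorem cup_cons (a b : Coch V) (x : V) (l : List V) :
    cup a b (x :: l) = a [x] * b (x :: l) + cup (sh x a) b l := rfl

theorem prism_smul (f g : V → W) (c : ZMod 2) (φ : Coch W) :
    prism f g (fun l => c * φ l) = fun l => c * prism f g φ l := by
  funext l
  induction l generalizing φ with
  | nil => simp [prism]
  | cons a l ih => simp only [prism_cons, mul_add]; rw [← ih]; rfl

theorem prism_cup (f g : V → W) (a b : Coch W) :
    prism f g (cup a b) = cup (prism f g a) (pb g b) + cup (pb f a) (prism f g b) := by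
  funext l
  induction l generalizing a with
  | nil => rfl
  | cons x l ih =>
    have h1 : sh (f x) (cup a b) = (fun l => a [f x] * sh (f x) b l) + cup (sh (f x) a) b := rfl
    have h2 : pb g (cup (sh (g x) (sh (f x) a)) b) l =
      cup (pb g (sh (g x) (sh (f x) a))) (pb g b) l := by rw [pb_cup]
    rw [prism_cons, h1, prism_add, Pi.add_apply, ih, prism_smul, Pi.add_apply, Pi.add_apply, cup_cons,
      cup_cons, cup_cons, cup_cons, sh_prism, cup_add_left, Pi.add_apply, prism_cons, ← h2, sh_pb]
    simp only [prism, pb, sh, List.map_cons, List.map_nil, add_zero]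
    ring

theorem gy_cup_snd (A : Coch V) {y : Coch (Bool × V)} (hy : pb flip₂ y = y) :
    gy (cup (pb Prod.snd A) y) = cup (pb Prod.snd A) (gy y) := by
  have e1 : pb rz (pb Prod.snd A) = pb Prod.snd A := by rw [pb_pb]; rfl
  have e2 : pb flip₂ (pb Prod.snd A) = pb Prod.snd A := by rw [pb_pb]; rfl
  have e3 : pb flip₂ (pz (pb Prod.snd A)) = pz (pb Prod.snd A) := by
    have := gy_snd A
    rw [gy] at this
    exact (coch_eq_of_add this).symm
  rw [gy, pz, prism_cup, pb_id, e1, pb_add, pb_cup, pb_cup, e2, hy]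
  change cup (pz _) y + cup _ (pz y) + (cup (pb flip₂ (pz _)) y + cup _ _) = _
  rw [e3, gy, cup_add_right]
  have := coch_add_self (cup (pz (pb Prod.snd A)) y)
  change _ + _ + (_ + cup (pb Prod.snd A) (pb flip₂ (pz y))) = _
  linear_combination (exp := 1) this

theorem cf_cup_snd (A : Coch V) {y : Coch (Bool × V)} (hy : pb flip₂ y = y) (j : ℕ) :
    cf j (cup (pb Prod.snd A) y) = cup A (cf j y) := by
  induction j generalizing y with
  | zero => rw [cf_zero, cf_zero, res, pb_cup, ← res, res_snd]; rfl
  | succ j ih => rw [cf_succ, cf_succ, gy_cup_snd A hy, ih (flip_gy _)]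

theorem tcup_cup (h : V → ZMod 2) {x : Coch V} (hx : x [] = 0) (y : Coch V) :
    tcup h (cup x y) = cup (tcup h x) y := by
  funext l
  rcases l with _ | ⟨a, _ | ⟨b, l⟩⟩
  · rfl
  · rw [cup_cons]; simp [tcup, hx, cup, cupF]
  · rw [cup_cons, cup_cons]
    have e0 : tcup h x [a] = 0 := by simp [tcup, hx]
    have e1 : sh a (tcup h x) [b] = (h a + h b) * x [b] := rfl
    have e2 : tcup h (cup x y) (a :: b :: l) = (h a + h b) * cup x y (b :: l) := rfl
    rw [e0, zero_mul, zero_add, e1, e2]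
    have e : sh b (sh a (tcup h x)) = fun l => (h a + h b) * sh b x l := rfl
    rw [e]
    have h2 : cup (fun l => (h a + h b) * sh b x l) y l = (h a + h b) * cup (sh b x) y l := by
      have : tens (fun l => (h a + h b) * sh b x l) y = fun p q => (h a + h b) * tens (sh b x) y p q := by
        funext p q; simp [tens, mul_assoc]
      rw [cup_eq, this, PiF_smul, cup_eq]; rfl
    rw [h2, cup_cons]
    ring

/-- The degree one cocycle with the given potential. -/
def dl (h : V → ZMod 2) : Coch V := tcup h (fun l => if l.length = 1 then 1 else 0)

theorem cup_unit (y : Coch V) (l : List V) (hl : y [] = 0) :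
    cup (fun l => if l.length = 1 then 1 else 0) y l = y l := by
  cases l with
  | nil => exact hl.symm
  | cons a l =>
    rw [cup_cons]
    have h0 : ∀ l : List V, cup (0 : Coch V) y l = 0 := fun l => cup_loc (Or.inl fun _ _ => rfl)
    cases l with
    | nil => simp [cup, cupF]
    | cons b l =>
      rw [cup_cons]
      have : sh b (sh a (fun l : List V => if l.length = 1 then (1 : ZMod 2) else 0)) = 0 := by
        funext l; simp [sh]
      rw [this, h0]; simp [sh]

theorem tcup_eq (h : V → ZMod 2) {y : Coch V} (hy : y [] = 0) : tcup h y = cup (dl h) y := by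
  rw [dl, ← tcup_cup h (by simp)]
  congr 1
  funext l; exact (cup_unit y l hy).symm

def Site.abs (S : Site V) : Site V := ⟨S.F, ⊥, S.I, S.hF, her_bot, bot_le⟩

theorem abs_cup : CupSite S.abs S S :=
  ⟨le_refl _, le_refl _, le_sup_right, subset_refl _, subset_refl _⟩

theorem abs_eqv : S.eqv.abs = S.abs.eqv := by
  unfold Site.abs Site.eqv; congr 1; exact (comap_bot).symm

theorem Zc.sum {ι : Type*} {s : Finset ι} {f : ι → Coch V} (h : ∀ i ∈ s, Zc S n (f i)) : Zc S n (∑ i ∈ s, f i) := by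
  classical
  induction s using Finset.induction_on with
  | empty => exact Zc.zero
  | insert a s ha ih =>
    rw [Finset.sum_insert ha]
    exact (h a (by simp)).add (ih fun i hi => h i (by simp [hi]))

theorem cup_sum_left {ι : Type*} (s : Finset ι) (f : ι → Coch V) (b : Coch V) :
    cup (∑ i ∈ s, f i) b = ∑ i ∈ s, cup (f i) b :=
  map_sum (AddMonoidHom.mk' (fun a => cup a b) fun a a' => cup_add_left a a' b) f s
theorem cf_sum {ι : Type*} (k : ℕ) (s : Finset ι) (f : ι → Coch (Bool × V)) :
    cf k (∑ i ∈ s, f i) = ∑ i ∈ s, cf k (f i) :=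
  map_sum (AddMonoidHom.mk' (cf k) (cf_add k)) f s

theorem Zc.tc_iter {κ : Coch (Bool × V)} (h : Zc S.eqv n κ) (j : ℕ) : Zc S.eqv (n + j) (CatCone.tc^[j] κ) := by
  induction j with
  | zero => simpa using h
  | succ j ih => rw [iterate_succ_apply']; exact ih.tc.of_eq' (by push_cast; ring)

theorem Zc.cf_tc_iter {κ : Coch (Bool × V)} (h : Zc S.eqv n κ) (k i : ℕ) :
    Coh S (n + i - k) (CatCone.cf k (CatCone.tc^[i] κ)) (if i ≤ k then CatCone.cf (k - i) κ else 0) := by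
  induction i generalizing k with
  | zero => simpa using Coh.refl
  | succ i ih =>
    rw [iterate_succ_apply']
    cases k with
    | zero =>
      rw [cf_zero, res_tc]; simpa using Coh.refl
    | succ k =>
      have h1 := (h.tc_iter i).cf_tc k
      have h2 := h1.trans (ih k)
      simp only [Nat.add_le_add_iff_right, Nat.reduceSubDiff]
      convert h2 using 1
      push_cast; ring

/-- The Cartan formula. -/
theorem Zc.dop_cup {a b : Coch V} (ha : Zc Sa n a) (hb : Zc Sb m b) (h : CupSite Sa Sb S) (k : ℕ) :
    Coh S (2 * (n + m) - k) (CatCone.dop k (CatCone.cup a b))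
      (∑ i ∈ Finset.range (k + 1), CatCone.cup (CatCone.dop i a) (CatCone.dop (k - i) b)) := by
  have h1 := (ha.pw_cup hb h).cf k
  refine h1.trans ?_
  set N := max (2 * n + 1).toNat (k + 1) with hN
  have h2 := (Coh.cup_left (ha.pw.expand N (by omega)) hb.pw h.eqv).cf k
  have e : 2 * n + 2 * m - (k : ℤ) = 2 * (n + m) - k := by ring
  rw [e] at h2
  refine h2.trans ?_
  rw [cup_sum_left, cf_sum]
  have hs : ∑ i ∈ Finset.range (k + 1), CatCone.cup (CatCone.dop i a) (CatCone.dop (k - i) b) =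
      ∑ i ∈ Finset.range N, if i ≤ k then CatCone.cup (CatCone.dop i a) (CatCone.dop (k - i) b) else 0 := by
    rw [← Finset.sum_filter]
    refine Finset.sum_congr ?_ fun _ _ => rfl
    ext i; simp; omega
  rw [hs]
  refine Coh.sum fun i _ => ?_
  have ex : ∀ i x, x [] = 0 → CatCone.cup (CatCone.tc^[i] x) (CatCone.pw b) =
      CatCone.tc^[i] (CatCone.cup x (CatCone.pw b)) ∧ CatCone.tc^[i] x [] = 0 := by
    intro i x hx
    induction i with
    | zero => exact ⟨rfl, hx⟩
    | succ i ih =>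
      rw [iterate_succ_apply', iterate_succ_apply', CatCone.tc, ← tcup_cup _ ih.2, ih.1]
      exact ⟨rfl, rfl⟩
  have hx : pb (Prod.snd : Bool × V → V) (CatCone.cf i (CatCone.pw a)) [] = 0 := (ha.pw.cf i).deg.nil
  rw [(ex i _ hx).1]
  have hz : Zc S.eqv (2 * n - i + 2 * m) (CatCone.cup (pb Prod.snd (CatCone.cf i (CatCone.pw a))) (CatCone.pw b)) :=
    Zc.cup (hom_snd.zc (ha.pw.cf i)) hb.pw h.eqv
  have h3 := hz.cf_tc_iter k i
  rw [cf_cup_snd _ (flip_pw b)] at h3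
  convert h3 using 1
  · ring
  · rfl

end

section
open Filter Function

variable {U V W : Type*} {S Sa Sb : Site V} {n m : ℤ}

/-- The generator of the cohomology of `Bool` with its free involution. -/
def tau (V : Type*) : Coch (Bool × V) := dl bit

theorem Zc.tau : Zc S.eqv.abs 1 (tau V) := by
  have h : Zc S.abs.eqv 0 (fun l : List (Bool × V) => if l.length = 1 then (1 : ZMod 2) else 0) := by
    refine ⟨fun l hl => ?_, fun i _ => ?_, ?_, Eventually.of_forall fun l => ?_⟩
    · have h1 : l.length = 1 := by by_contra h; simp [h] at hl
      refine ⟨by rintro rfl; simp at h1, by simp [h1]⟩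
    · funext l; simp [pb]
    · simp [Site.eqv, Site.abs]
    · rcases l with _ | ⟨a, _ | ⟨b, _ | ⟨c, l⟩⟩⟩
      · simp
      · simp [cd_cons, sh]
      · simp [cd_cons, sh]; decide
      · have : sh b (sh a (fun l : List (Bool × V) => if l.length = 1 then (1 : ZMod 2) else 0)) = 0 := by
          funext l; simp [sh]
        have h0 : sh c (0 : Coch (Bool × V)) = 0 := rfl
        simp [cd_cons, this, sh_cd, cd_zero, h0]
        simp [sh]
  rw [abs_eqv]
  exact h.tc.of_eq' (by ring)

theorem Deg.apply {φ : Coch V} (h : Deg n φ) {l : List V} (hl : (l.length : ℤ) ≠ n + 1) : φ l = 0 := by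
  by_contra h'
  exact hl (h l h').2

theorem dop_zero' (a : Coch V) : dop 0 a = cup a a := by
  rw [dop, cf_zero, res]; funext l; exact PiF_false _ l

theorem dop_one_tau : dop 1 (tau V) = tau V := by
  have S : Site V := ⟨⊥, ⊥, ∅, her_bot, her_bot, le_refl _⟩
  have h1 : Zc S.eqv.abs 1 (tau V) := Zc.tau
  have h2 := h1.dop 1
  funext l
  by_cases hl : l.length = 2
  · obtain ⟨⟨x, v⟩, ⟨y, w⟩, rfl⟩ := List.length_eq_two.1 hl
    cases x <;> cases y <;>
    simp [dop, cf_succ, cf_zero, res, pb, gy, pz, prism, sh, flip₂, rz, pw, PiF, tens, cupF, tau, dl, tcup, hd, bit] <;> rfl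
  · rw [h1.deg.apply (by omega), h2.deg.apply (by push_cast; omega)]

theorem dop_tau {i : ℕ} (hi : 2 ≤ i) : dop i (tau V) = 0 := by
  let S : Site V := ⟨⊥, ⊥, ∅, her_bot, her_bot, le_refl _⟩
  have h1 : Zc S.eqv.abs 1 (tau V) := Zc.tau
  have h2 := h1.dop i
  by_cases h : i = 2
  · subst h
    funext l
    by_cases hl : l.length = 1
    · obtain ⟨⟨x, v⟩, rfl⟩ := List.length_eq_one_iff.1 hl
      cases x <;>
      simp [dop, cf_succ, cf_zero, res, pb, gy, pz, prism, sh, flip₂, rz, pw, PiF, tens, cupF, tau, dl, tcup, hd, bit] <;> rfl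
    · exact h2.deg.apply (by push_cast; omega)
  · exact h2.deg.eq_zero (by omega)

theorem tc_eq {κ : Coch (Bool × V)} (h : κ [] = 0) : tc κ = cup (tau V) κ := tcup_eq _ h

/-- The operations on the product with the periodicity generator. -/
theorem Zc.dop_tc {κ : Coch (Bool × V)} (h : Zc S.eqv n κ) (a : ℕ) :
    Coh S.eqv (2 * (n + 1) - a) (CatCone.dop a (CatCone.tc κ))
      (CatCone.tc (CatCone.tc (CatCone.dop a κ)) +
        if 1 ≤ a then CatCone.tc (CatCone.dop (a - 1) κ) else 0) := by
  have h0 := h.deg.nil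
  have hk : ∀ i, CatCone.dop i κ [] = 0 := fun i => (h.dop i).deg.nil
  have h1 := Zc.dop_cup (Zc.tau (S := S)) h abs_cup a
  rw [← tc_eq h0] at h1
  rw [show 1 + n = n + 1 by ring] at h1
  refine h1.trans (Coh.of_eq ?_)
  have e0 : CatCone.cup (CatCone.dop 0 (CatCone.tau V)) (CatCone.dop a κ) =
      CatCone.tc (CatCone.tc (CatCone.dop a κ)) := by
    rw [dop_zero', ← tc_eq (κ := CatCone.tau V) rfl, CatCone.tc, ← tcup_cup _ (by rfl), ← tc_eq (hk a)]
  cases a with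
  | zero => simp [e0]
  | succ a =>
    rw [Finset.sum_range_succ', Finset.sum_range_succ', Finset.sum_eq_zero]
    · simp only [zero_add, dop_one_tau, Nat.sub_zero, e0]
      rw [add_comm, ← tc_eq (hk _)]; simp
    · intro i hi
      rw [dop_tau (by omega)]
      funext l; exact cup_loc (Or.inl fun _ _ => rfl)

/-- The coefficients of the Adem relation. -/
def ec : ℕ → ℕ → ℕ → Bool
  | 0, _, b => b == 0
  | j + 1, a, b => ((2 ≤ b) && ec j a (b - 2)) ^^ ((1 ≤ a && 1 ≤ b) && ec j (a - 1) (b - 1))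

theorem Coh.tc {κ κ' : Coch (Bool × V)} (h : Coh S.eqv n κ κ') :
    Coh S.eqv (n + 1) (CatCone.tc κ) (CatCone.tc κ') := by
  have := Bd.tc h
  rwa [CatCone.tc, tcup_add] at this

theorem Zc.cf_tc' {b : Coch (Bool × V)} (h : Zc S.eqv n b) (j : ℕ) :
    Coh S (n + 1 - j) (CatCone.cf j (CatCone.tc b)) (if 1 ≤ j then CatCone.cf (j - 1) b else 0) := by
  have := h.cf_tc_iter j 1
  simpa using this

theorem Zc.cf_dop_tc {z : Coch V} (h : Zc S n z) (j a b : ℕ) :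
    Coh S (2 * (n + j) - a - b) (CatCone.cf b (CatCone.dop a (CatCone.tc^[j] (pb Prod.snd z))))
      (if ec j a b then CatCone.dop (a + b - 2 * j) z else 0) := by
  induction j generalizing a b with
  | zero =>
    have e : CatCone.dop a (pb (Prod.snd : Bool × V → V) z) = pb Prod.snd (CatCone.dop a z) := (pb_dop _ _ _).symm
    simp only [iterate_zero, id, e]
    refine Coh.of_eq ?_
    cases b with
    | zero => simp [ec, cf_zero, res_snd]
    | succ b =>
      rw [cf_succ, gy_snd]
      have : ∀ b, CatCone.cf b (0 : Coch (Bool × V)) = 0 := fun b => by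
        simpa using cf_add b (0 : Coch (Bool × V)) 0
      simp [ec, this]
  | succ j ih =>
    have hx : Zc S.eqv (n + j) (CatCone.tc^[j] (pb Prod.snd z)) := (hom_snd.zc h).tc_iter j
    rw [iterate_succ_apply']
    set x := CatCone.tc^[j] (pb Prod.snd z)
    have h1 := (hx.dop_tc a).cf b
    rw [cf_add] at h1
    have h2 := ((hx.dop a).tc_iter 2).cf b
    have h3 : Coh S (2 * (n + (j + 1 : ℕ)) - a - b) (CatCone.cf b (CatCone.tc (CatCone.tc (CatCone.dop a x))))
        (if 2 ≤ b then (if ec j a (b - 2) then CatCone.dop (a + b - 2 * (j + 1)) z else 0) else 0) := by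
      have h3 := (hx.dop a).cf_tc_iter b 2
      have e : 2 * (n + j) - a + (2 : ℕ) - b = 2 * (n + (j + 1 : ℕ)) - a - b := by push_cast; ring
      rw [e] at h3
      refine h3.trans ?_
      split_ifs with hb hc
      · have := ih a (b - 2)
        rw [if_pos hc] at this
        rw [show a + b - 2 * (j + 1) = a + (b - 2) - 2 * j by omega]
        convert this using 1
        push_cast [hb]; ring
      · have := ih a (b - 2)
        rw [if_neg hc] at this
        convert this using 1
        push_cast [hb]; ring
      · exact Coh.refl
    have h4 : Coh S (2 * (n + (j + 1 : ℕ)) - a - b)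
        (CatCone.cf b (if 1 ≤ a then CatCone.tc (CatCone.dop (a - 1) x) else 0))
        (if 1 ≤ a ∧ 1 ≤ b then (if ec j (a - 1) (b - 1) then CatCone.dop (a + b - 2 * (j + 1)) z else 0) else 0) := by
      by_cases ha : 1 ≤ a
      · rw [if_pos ha]
        have h3 := (hx.dop (a - 1)).cf_tc' b
        have e : 2 * (n + j) - ((a - 1 : ℕ) : ℤ) + 1 - b = 2 * (n + (j + 1 : ℕ)) - a - b := by push_cast [ha]; ring
        rw [e] at h3
        refine h3.trans ?_
        simp only [ha, true_and]
        split_ifs with hb hc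
        · have := ih (a - 1) (b - 1)
          rw [if_pos hc] at this
          rw [show a + b - 2 * (j + 1) = a - 1 + (b - 1) - 2 * j by omega]
          convert this using 1
          push_cast [hb, ha]; ring
        · have := ih (a - 1) (b - 1)
          rw [if_neg hc] at this
          convert this using 1
          push_cast [hb, ha]; ring
        · exact Coh.refl
      · simp only [ha, false_and, if_false]
        have : ∀ b, CatCone.cf b (0 : Coch (Bool × V)) = 0 := fun b => by
          simpa using cf_add b (0 : Coch (Bool × V)) 0
        rw [this]; exact Coh.refl
    have e : 2 * (n + j + 1) - (a : ℤ) - b = 2 * (n + (j + 1 : ℕ)) - a - b := by push_cast; ring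
    rw [e] at h1
    refine (h1.trans (h3.add h4)).trans (Coh.of_eq ?_)
    have hd := coch_add_self (CatCone.dop (a + b - 2 * (j + 1)) z)
    by_cases h2b : 2 ≤ b <;> by_cases h1b : 1 ≤ b <;> by_cases h1a : 1 ≤ a <;>
      cases hu : ec j a (b - 2) <;> cases hv : ec j (a - 1) (b - 1) <;> simp [ec, h2b, h1b, h1a, hu, hv, hd]

end

section
open Filter Function

variable {U V W : Type*} {S Sa Sb : Site V} {n m : ℤ}

theorem pw_zero : pw (0 : Coch V) = 0 := by
  funext l; exact PiF_tens_loc (Or.inl fun _ _ => rfl)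
theorem cf_zero' (b : ℕ) : cf b (0 : Coch (Bool × V)) = 0 := by
  simpa using cf_add b (0 : Coch (Bool × V)) 0
theorem dop_zero_right (j : ℕ) : dop j (0 : Coch V) = 0 := by rw [dop, pw_zero, cf_zero']

theorem Zc.dop_sum {ι : Type*} {s : Finset ι} {f : ι → Coch V} (h : ∀ i ∈ s, Zc S n (f i)) (j : ℕ) :
    Coh S (2 * n - j) (CatCone.dop j (∑ i ∈ s, f i)) (∑ i ∈ s, CatCone.dop j (f i)) := by
  classical
  induction s using Finset.induction_on with
  | empty => simpa [dop_zero_right] using Coh.refl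
  | insert a s ha ih =>
    rw [Finset.sum_insert ha, Finset.sum_insert ha]
    have hs : ∀ i ∈ s, Zc S n (f i) := fun i hi => h i (by simp [hi])
    exact ((h a (by simp)).dop_add (Zc.sum hs) j).trans (Coh.refl.add (ih hs))

theorem Zc.adem_expand {c : Coch V} (h : Zc S n c) (N : ℕ) (hN : 2 * n < N) (a b : ℕ) :
    Coh S (4 * n - a - b) (CatCone.cf b (CatCone.dop a (CatCone.pw c)))
      (∑ j ∈ Finset.range N, if ec j a b then CatCone.dop (a + b - 2 * j) (CatCone.dop j c) else 0) := by
  have hz : ∀ j ∈ Finset.range N, Zc S.eqv (2 * n) (CatCone.tc^[j] (pb Prod.snd (CatCone.cf j (CatCone.pw c)))) :=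
    fun j _ => ((hom_snd.zc (h.pw.cf j)).tc_iter j).of_eq' (by ring)
  have h1 := ((h.pw.expand N hN).dop h.pw (Zc.sum hz) a).trans (Zc.dop_sum hz a)
  have h2 := h1.cf b
  rw [cf_sum, show 2 * (2 * n) - (a : ℤ) - b = 4 * n - a - b by ring] at h2
  refine h2.trans (Coh.sum fun j _ => ?_)
  have h3 := (h.dop j).cf_dop_tc j a b
  convert h3 using 1
  · ring
  · rfl

theorem pb_sum {ι : Type*} (f : V → W) (s : Finset ι) (g : ι → Coch W) :
    pb f (∑ i ∈ s, g i) = ∑ i ∈ s, pb f (g i) :=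
  map_sum (AddMonoidHom.mk' (pb f) fun a b => pb_add f a b) g s

theorem Zc.cf_sum_tc {z : ℕ → Coch V} {N b : ℕ} (hb : b < N) (h : ∀ i < N, Zc S (n - i) (z i)) :
    Coh S (n - b) (CatCone.cf b (∑ i ∈ Finset.range N, CatCone.tc^[i] (pb Prod.snd (z i)))) (z b) := by
  rw [cf_sum]
  have e : z b = ∑ i ∈ Finset.range N, if i = b then z i else 0 := by simp [hb]
  rw [e]
  refine Coh.sum fun i hi => ?_
  have h1 := (hom_snd.zc (h i (Finset.mem_range.1 hi))).cf_tc_iter b i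
  rw [show n - (i : ℤ) + i - b = n - b by ring] at h1
  refine h1.trans (Coh.of_eq ?_)
  split_ifs with h1 h2 h2
  · subst h2; simp [cf_zero, res_snd]
  · obtain ⟨k, hk⟩ : ∃ k, b - i = k + 1 := ⟨b - i - 1, by omega⟩
    rw [hk, cf_succ, gy_snd, cf_zero']
  · omega
  · rfl

theorem dl_comp (f : V → W) (h : W → ZMod 2) : dl (h ∘ f) = pb f (dl h) := by
  rw [dl, dl, pb_tcup]; congr 1; funext l; simp [pb]

theorem hom_sw : S.eqv.eqv.Hom S.eqv.eqv sw := by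
  have e : (List.map Prod.snd ∘ List.map (Prod.snd) ∘ List.map sw : List (Bool × Bool × V) → List V) =
      List.map Prod.snd ∘ List.map Prod.snd := by
    funext l; simp [sw]
  refine ⟨?_, ?_, ?_⟩
  · refine tendsto_comap_iff.2 (tendsto_comap_iff.2 ?_)
    rw [e]; exact tendsto_comap.comp tendsto_comap
  · refine tendsto_comap_iff.2 (tendsto_comap_iff.2 ?_)
    rw [e]; exact tendsto_comap.comp tendsto_comap
  · rintro _ (rfl | ⟨_, (rfl | ⟨i, hi, rfl⟩), rfl⟩)
    · exact Or.inl ⟨_, Or.inr ⟨_, Or.inl rfl, rfl⟩, fun _ => rfl⟩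
    · exact Or.inl ⟨_, Or.inl rfl, fun _ => rfl⟩
    · exact Or.inl ⟨_, Or.inr ⟨_, Or.inr ⟨i, hi, rfl⟩, rfl⟩, fun _ => rfl⟩

theorem Zc.cf_sw {κ : Coch (Bool × Bool × V)} (h : Zc S.eqv.eqv n κ) (a b : ℕ) :
    Coh S (n - a - b) (CatCone.cf b (CatCone.cf a (pb sw κ))) (CatCone.cf a (CatCone.cf b κ)) := by
  set N := max (n + 1).toNat (b + 1)
  have hb : b < N := by omega
  have h1 := ((hom_sw.coh (h.expand N (by omega))).cf a).cf b
  have hz : ∀ i < N, Zc S (n - a - (i : ℤ)) (CatCone.cf a (CatCone.cf i κ)) := fun i _ =>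
    ((h.cf i).cf a).of_eq' (by ring)
  refine h1.trans ?_
  refine Coh.trans (Coh.of_eq ?_) (Zc.cf_sum_tc hb hz)
  congr 1
  rw [pb_sum, cf_sum]
  refine Finset.sum_congr rfl fun i _ => ?_
  have hy : CatCone.cf i κ [] = 0 := (h.cf i).deg.nil
  have hya : CatCone.cf a (CatCone.cf i κ) [] = 0 := ((h.cf i).cf a).deg.nil
  have hf : pb flip₂ (CatCone.cf i κ) = CatCone.cf i κ := (h.cf i).inv.flip
  generalize CatCone.cf i κ = y at hf hy hya
  have e1 : pb flip₂ (pb (Prod.map id Prod.snd) y) = pb (Prod.map id (Prod.snd : Bool × V → V)) y := by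
    rw [← pb_flip_comm, hf]
  have key : ∀ i : ℕ, pb flip₂ (pb sw (CatCone.tc^[i] (pb Prod.snd y))) = pb sw (CatCone.tc^[i] (pb Prod.snd y)) ∧
      CatCone.cf a (pb sw (CatCone.tc^[i] (pb Prod.snd y))) =
        CatCone.tc^[i] (pb (Prod.snd : Bool × V → V) (CatCone.cf a y)) ∧
      pb sw (CatCone.tc^[i] (pb Prod.snd y)) [] = 0 ∧
      CatCone.tc^[i] (pb (Prod.snd : Bool × V → V) (CatCone.cf a y)) [] = 0 := by
    intro i
    induction i with
    | zero =>
      have e : pb sw (pb Prod.snd y) = pb (Prod.map id (Prod.snd : Bool × V → V)) y := by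
        rw [pb_pb]; rfl
      refine ⟨by simpa [e] using e1, ?_, hy, hya⟩
      simp only [iterate_zero, id, e]
      rw [pb_cf]
    | succ i ih =>
      rw [iterate_succ_apply', iterate_succ_apply', CatCone.tc, pb_tcup]
      have e : (bit ∘ sw : Bool × Bool × V → ZMod 2) = bit ∘ Prod.snd := rfl
      refine ⟨by rw [pb_tcup, ih.1]; rfl, ?_, rfl, rfl⟩
      rw [e, tcup_eq _ ih.2.2.1, dl_comp, cf_cup_snd _ ih.1, ih.2.1, tc_eq ih.2.2.2]; rfl
  exact (key i).2.1

theorem Zc.adem_symm {c : Coch V} (h : Zc S n c) (a b : ℕ) :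
    Coh S (4 * n - a - b) (CatCone.cf b (CatCone.dop a (CatCone.pw c)))
      (CatCone.cf a (CatCone.dop b (CatCone.pw c))) := by
  have h1 := (h.pw_pw.cf a).cf b
  exact h1.trans ((h.pw.pw.of_eq' (by ring)).cf_sw a b)

/-- Vanishing of an iterated operation under sparseness of the cohomology. -/
theorem Zc.adem {c : Coch V} (h : Zc S 6 c)
    (h7 : Bd S 5 (CatCone.dop 7 c)) (hS : ∀ (k : ℤ) (φ : Coch V), k = 7 ∨ k = 9 → Zc S k φ → Bd S k φ) :
    Bd S 10 (CatCone.dop 6 (CatCone.dop 4 c)) := by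
  have hv : ∀ j : ℕ, j = 7 ∨ j = 5 ∨ j = 3 → ∀ i : ℕ, Bd S (2 * (2 * 6 - j) - i) (CatCone.dop i (CatCone.dop j c)) := by
    rintro j (rfl | hj) i
    · exact (h7.of_eq' (by norm_num)).dop i
    · exact (hS _ _ (by omega) (h.dop j)).dop i
  have ht : ∀ a b : ℕ, a + b = 14 → ∀ (f : ℕ → Bool),
      (∀ j < 13, (j = 1 ∨ j = 2 ∨ j = 4 ∨ j = 6) ∧ f j = ec j a b ∨
        ((7 ≤ j ∧ j ≤ 7 ∨ j = 5 ∨ j = 3) ∨ ec j a b = false) ∧ f j = false) →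
      Coh S 10 (CatCone.cf b (CatCone.dop a (CatCone.pw c)))
        (∑ j ∈ Finset.range 13, if f j then CatCone.dop (14 - 2 * j) (CatCone.dop j c) else 0) := by
    intro a b hab f hf
    have h1 := h.adem_expand 13 (by norm_num) a b
    rw [show 4 * 6 - (a : ℤ) - b = 10 by omega] at h1
    refine h1.trans (Coh.sum fun j hj => ?_)
    rw [hab]
    rcases hf j (Finset.mem_range.1 hj) with ⟨_, e⟩ | ⟨e | e, e'⟩
    · rw [e]; exact Coh.refl
    · rw [e']
      simp only [Bool.false_eq_true, if_false]
      split_ifs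
      · exact coh_zero.2 ((hv j (by omega) _).of_eq' (by omega))
      · exact Coh.refl
    · rw [e, e']; exact Coh.refl
  have hs : ∀ a b : ℕ, a + b = 14 → Coh S 10 (CatCone.cf b (CatCone.dop a (CatCone.pw c)))
      (CatCone.cf a (CatCone.dop b (CatCone.pw c))) := by
    intro a b hab
    have := h.adem_symm a b
    rwa [show 4 * 6 - (a : ℤ) - b = 10 by omega] at this
  have c1 := (ht 2 12 rfl (· == 6) (by decide)).symm.trans ((hs 2 12 rfl).trans
    (ht 12 2 rfl (fun j => j == 1 || j == 2) (by decide)))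
  have c2 := (ht 1 13 rfl (fun _ => false) (by decide)).symm.trans ((hs 1 13 rfl).trans
    (ht 13 1 rfl (fun j => j == 1) (by decide)))
  have c3 := (ht 4 10 rfl (· == 6) (by decide)).symm.trans ((hs 4 10 rfl).trans
    (ht 10 4 rfl (fun j => j == 2 || j == 4) (by decide)))
  simp [Finset.sum_range_succ] at c1 c2 c3
  have c4 := (c1.symm.trans c3).add c2
  unfold Coh at c4
  convert c4 using 1
  generalize CatCone.dop 6 (CatCone.dop 4 c) = x
  generalize CatCone.dop 10 (CatCone.dop 2 c) = y
  generalize CatCone.dop 12 (CatCone.dop 1 c) = z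
  funext l
  simp only [Pi.add_apply, Pi.zero_apply]
  grind

end

section
open Filter Function

variable {U V W : Type*} {S Sa Sb : Site V} {n m : ℤ}

section Alternation
variable [LinearOrder V]

/-- The alternation of a cochain. -/
def alt (φ : Coch V) : Coch V := fun l => if l.Nodup then φ (l.insertionSort (· ≤ ·)) else 0

theorem alt_perm (φ : Coch V) {l l' : List V} (h : l.Perm l') : alt φ l = alt φ l' := by
  have : l.insertionSort (· ≤ ·) = l'.insertionSort (· ≤ ·) :=
    List.Perm.eq_of_pairwise (le := (· ≤ ·)) (fun _ _ _ _ h h' => le_antisymm h h') (List.pairwise_insertionSort _ _)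
      (List.pairwise_insertionSort _ _) (((List.perm_insertionSort _ _).trans h).trans (List.perm_insertionSort _ _).symm)
  simp only [alt, this, h.nodup_iff]

theorem cd_perm {ψ : Coch V} (hψ : ∀ l l' : List V, l.Perm l' → ψ l = ψ l') {l l' : List V} (h : l.Perm l') :
    cd ψ l = cd ψ l' := by
  induction h generalizing ψ with
  | nil => rfl
  | cons a h ih =>
    rw [cd_cons, cd_cons, hψ _ _ h, ih (ψ := sh a ψ) fun l l' h => hψ _ _ (h.cons a)]
  | swap a b l =>
    have : sh b (sh a ψ) = sh a (sh b ψ) := by funext l; exact hψ _ _ (List.Perm.swap _ _ _)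
    rw [cd_cons, cd_cons, cd_cons, cd_cons, this]
    simp only [sh]; ring
  | trans h h' ih ih' => exact (ih hψ).trans (ih' hψ)

theorem cd_sublist {φ ψ : Coch V} {l : List V} (h : ∀ p, p.Sublist l → φ p = ψ p) : cd φ l = cd ψ l := by
  induction l generalizing φ ψ with
  | nil => simp
  | cons a l ih =>
    rw [cd_cons, cd_cons, h l (List.sublist_cons_self a l), ih (φ := sh a φ) (ψ := sh a ψ) fun p hp => h _ (hp.cons_cons a)]

theorem cd_alt (φ : Coch V) : cd (alt φ) = alt (cd φ) := by
  funext l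
  by_cases hl : l.Nodup
  · have hp := List.perm_insertionSort (· ≤ ·) l
    rw [cd_perm (fun _ _ => alt_perm φ) hp.symm, alt, if_pos hl]
    refine cd_sublist fun p hs => ?_
    rw [alt, if_pos (hs.nodup (hp.nodup_iff.2 hl))]
    rw [List.Pairwise.insertionSort_eq ((List.pairwise_insertionSort _ _).sublist hs)]
  · rw [alt, if_neg hl]
    obtain ⟨a, ha⟩ : ∃ a, [a, a].Sublist l := by
      by_contra! h; exact hl (List.nodup_iff_sublist.2 h)
    obtain ⟨l', hl'⟩ := ha.exists_perm_append
    rw [cd_perm (fun _ _ => alt_perm φ) hl']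
    have : sh a (sh a (alt φ)) = 0 := by funext l; simp [sh, alt]
    rw [List.cons_append, List.cons_append, List.nil_append, cd_cons, cd_cons, this]
    simp only [sh, cd_zero, Pi.zero_apply, add_zero]
    exact CharTwo.add_self_eq_zero _

theorem alt_add (φ ψ : Coch V) : alt (φ + ψ) = alt φ + alt ψ := by
  funext l; simp only [alt, Pi.add_apply]; split_ifs <;> simp

theorem alt_loc {φ : Coch V} {l : List V} (h : ∀ l', l' ⊆ l → φ l' = 0) : alt φ l = 0 := by
  rw [alt]; split_ifs
  · exact h _ (List.perm_insertionSort _ _).subset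
  · rfl

theorem Zc.alt {φ : Coch V} (h : Zc S n φ) (hI : S.I = ∅) :
    Zc S n (alt φ) ∧ Coh S n φ (CatCone.alt φ) := by
  have hd : Deg n (CatCone.alt φ) := by
    intro l hl
    rw [CatCone.alt] at hl
    split_ifs at hl with hn
    · have := h.deg _ hl
      rw [List.length_insertionSort] at this
      exact ⟨by rintro rfl; exact this.1 rfl, this.2⟩
    · exact absurd rfl hl
  have hi : ∀ φ, IsInv S.I φ := fun φ i hi => by simp [hI] at hi
  refine ⟨⟨hd, hi _, (S.hG _ h.rel).mono fun l hl => alt_loc hl, ?_⟩, ?_⟩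
  · rw [cd_alt]; exact (S.hF _ h.cl).mono fun l hl => alt_loc hl
  let X : Coch V → Coch V := fun φ => φ + CatCone.alt φ
  let H : V → Coch V → Coch V := sh
  have key : cd (homo X H φ) + homo X H (cd φ) = φ + CatCone.alt φ := by
    refine cd_homo (X := X) (H := H) (N := fun _ => True) (e := fun _ _ => 0) (fun F G => ?_) (fun _ _ _ => rfl)
      (fun _ _ _ => trivial) (fun F _ => ?_) (fun F => ?_) (fun m F _ => ?_) (fun _ _ _ => ?_) (fun _ _ _ _ => rfl) trivial
    · simp only [X, alt_add]; abel
    · simp only [X]; rw [cd_add, cd_alt]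
    · simp [X, CatCone.alt]; exact CharTwo.add_self_eq_zero _
    · simp only [H, sh_cd]
      funext l; simp only [Pi.add_apply, Pi.zero_apply]; grind
    · have := alt_add (0 : Coch V) 0
      simp only [X]
      simpa using this
  have hloc : ∀ (φ : Coch V) (l : List V), (∀ l', l' ⊆ l → φ l' = 0) → homo X H φ l = 0 := by
    intro φ l hl
    refine homo_loc (Q := fun φ => ∀ l', l' ⊆ l → φ l' = 0) hl (fun m hm F hF l' hl' => ?_) fun F hF l' hl' => ?_
    · exact hF _ (by simp [hm, hl'])
    · simp only [X, Pi.add_apply]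
      rw [hF _ hl', alt_loc fun p hp => hF _ (List.Subset.trans hp hl'), add_zero]
  refine ⟨homo X H φ, ⟨?_, hi _, (S.hG _ h.rel).mono fun l hl => hloc _ _ hl⟩, (S.hF _ h.cl).mono fun l hl => ?_⟩
  · by_cases hn : n < 0
    · have : φ = 0 := h.deg.eq_zero hn
      have h0 : homo X H φ = 0 := by
        funext l; exact hloc _ _ fun l' _ => by rw [this]; rfl
      rw [h0]; exact Deg.zero
    · obtain ⟨k, rfl⟩ : ∃ k : ℕ, n = k := ⟨n.toNat, by omega⟩
      intro l hl
      have h1 := homo_deg (X := X) (H := H) (D := fun k F => ∀ l, F l ≠ 0 → l.length = k) (fun n m F hF l hl => ?_)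
        (fun m F hF => ?_) (fun n F hF l hl => ?_) (n := k + 1) (F := φ) (fun l hl => by have := h.deg l hl; omega) l hl
      · refine ⟨by rintro rfl; exact hl rfl, by omega⟩
      · have := hF _ hl; simpa using this
      · have : H m F = 0 := by
          funext l
          by_contra h'
          have := hF _ h'
          simp at this
        rw [this]
        refine ⟨?_, fun l hl => absurd rfl hl⟩
        have := alt_add (0 : Coch V) 0
        simp only [X]
        simpa using this
      · simp only [X, Pi.add_apply] at hl
        by_cases h0 : F l = 0
        · rw [h0, zero_add, CatCone.alt] at hl
          split_ifs at hl
          · simpa using hF _ hl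
          · exact absurd rfl hl
        · exact hF _ h0
  · rw [← key, Pi.add_apply, hloc _ _ hl, add_zero]

end Alternation

/-- The fundamental alternating cochain. -/
def fund (N : ℕ) (k : ℕ) : Coch (Fin N) := fun l => if l.length = k ∧ l.Nodup then 1 else 0

theorem dop_alternating {φ : Coch V} {k : ℕ} (h1 : Deg k φ) (h2 : ∀ l l' : List V, l.Perm l' → φ l = φ l')
    (h3 : ∀ l : List V, ¬ l.Nodup → φ l = 0) (hC : dop k (fund (k + 1) (k + 1)) (List.finRange (k + 1)) = 1)
    (l : List V) (hl : l.length = k + 1) : dop k φ l = φ l := by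
  obtain ⟨f, rfl⟩ : ∃ f : Fin (k + 1) → V, l = (List.finRange (k + 1)).map f :=
    ⟨fun i => l.get (i.cast hl.symm), by
      apply List.ext_getElem <;> simp [hl]⟩
  have e : pb f φ = fun w => φ ((List.finRange (k + 1)).map f) * fund (k + 1) (k + 1) w := by
    funext w
    rw [fund]
    split_ifs with hw
    · have : w.Perm (List.finRange (k + 1)) := by
        refine (List.subperm_of_subset hw.2 fun x _ => List.mem_finRange x).perm_of_length_le ?_
        simp [hw.1]
      rw [mul_one]; exact h2 _ _ (this.map f)
    · rw [mul_zero]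
      by_cases hw' : w.length = k + 1
      · exact h3 _ fun hn => hw ⟨hw', hn.of_map f⟩
      · exact h1.apply (by rw [List.length_map]; omega)
  change pb f (dop k φ) _ = _
  rw [pb_dop, e]
  generalize φ ((List.finRange (k + 1)).map f) = c
  have hc : c = 0 ∨ c = 1 := by revert c; decide
  rcases hc with rfl | rfl
  · have : (fun w => 0 * fund (k + 1) (k + 1) w) = (0 : Coch (Fin (k + 1))) := by funext w; simp
    rw [this, dop_zero_right]; rfl
  · simpa using hC

set_option maxRecDepth 100000 in
theorem fund_three : dop 3 (fund 4 4) (List.finRange 4) = 1 := by decide +kernel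

theorem length_four {α : Type*} {l : List α} (hl : l.length = 4) : ∃ a b c d, l = [a, b, c, d] := by
  rcases l with _ | ⟨a, _ | ⟨b, _ | ⟨c, _ | ⟨d, _ | ⟨e, l⟩⟩⟩⟩⟩ <;> simp at hl
  exact ⟨a, b, c, d, rfl⟩

/-- A primitive of the fundamental cochain of the `4`-simplex. -/
def fundPrim : Coch (Fin 5) := fun l => if l.length = 4 ∧ l.Nodup ∧ 4 ∉ l then 1 else 0

theorem fundPrim_face (g : List (Fin 5)) (f : Fin 4 → Fin 5) (hg : (List.finRange 4).map f = g)
    (hf : ∀ a b c d, fundPrim [f a, f b, f c, f d] = 0) : dop 3 fundPrim g = 0 := by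
  rw [← hg]
  change pb f (dop 3 fundPrim) _ = 0
  have : pb f fundPrim = 0 := by
    funext l
    by_cases hl : l.length = 4
    · obtain ⟨a, b, c, d, rfl⟩ := length_four hl
      exact hf a b c d
    · simp [pb, fundPrim, hl]
  rw [pb_dop, this, dop_zero_right]; rfl

theorem fund_four : dop 4 (fund 5 5) (List.finRange 5) = 1 := by
  have hfundPrim : Deg 3 fundPrim := fun l hl => by
    simp only [fundPrim] at hl
    split_ifs at hl with h
    · exact ⟨by rintro rfl; simp at h, by omega⟩
    · exact absurd rfl hl
  have e : cd fundPrim = fund 5 5 := by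
    funext l
    by_cases hl : l.length = 5
    · obtain ⟨a, b, c, d, e, rfl⟩ : ∃ a b c d e, l = [a, b, c, d, e] := by
        rcases l with _ | ⟨a, _ | ⟨b, _ | ⟨c, _ | ⟨d, _ | ⟨e, _ | ⟨f, l⟩⟩⟩⟩⟩⟩ <;> simp at hl
        exact ⟨a, b, c, d, e, rfl⟩
      have : ∀ a b c d e : Fin 5, cd fundPrim [a, b, c, d, e] = fund 5 5 [a, b, c, d, e] := by decide +kernel
      exact this a b c d e
    · rw [hfundPrim.cd.apply (by omega), fund, if_neg (fun h => hl h.1)]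
  let S : Site (Fin 5) := ⟨⊤, 𝓟 {l | ∃ v, v ∉ l}, ∅, her_top,
    her_principal fun _ ⟨v, hv⟩ _ h' => ⟨v, fun h => hv (h' h)⟩, le_top⟩
  have hr : ∀ᶠ l in S.G, cd fundPrim l = 0 := by
    refine eventually_principal.2 fun l ⟨v, hv⟩ => ?_
    rw [e, fund, if_neg]
    rintro ⟨h1, h2⟩
    have : l.Perm (List.finRange 5) :=
      (List.subperm_of_subset h2 fun x _ => List.mem_finRange x).perm_of_length_le (by simp [h1])
    exact hv (this.symm.subset (List.mem_finRange v))
  obtain ⟨ζ, h1, h2⟩ := coh_dop_cd (S := S) (n := 4) hfundPrim (fun i hi => absurd hi (by simp [S])) hr 3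
  have h3 := eventually_top.1 h2 (List.finRange 5)
  have hf : List.finRange 5 = [0, 1, 2, 3, 4] := by decide
  have h4 : cd ζ (List.finRange 5) = 0 := by
    have h5 : ∀ l : List (Fin 5), (∃ v, v ∉ l) → ζ l = 0 := fun l hl => eventually_principal.1 h1.rel l hl
    rw [hf]
    simp only [cd_cons, cd_nil, sh]
    rw [h5 _ (by decide), h5 _ (by decide), h5 _ (by decide), h5 _ (by decide), h5 _ (by decide)]
    simp
  rw [h4, Pi.add_apply, e] at h3
  have h5 : cd (dop 3 fundPrim) (List.finRange 5) = 1 := by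
    have hp : pb Fin.castSucc fundPrim = fund 4 4 := by
      funext l
      by_cases hl : l.length = 4
      · obtain ⟨a, b, c, d, rfl⟩ := length_four hl
        have : ∀ a b c d : Fin 4, pb Fin.castSucc fundPrim [a, b, c, d] = fund 4 4 [a, b, c, d] := by decide +kernel
        exact this a b c d
      · rw [(hfundPrim.pb _).apply (by omega), fund, if_neg fun h => hl h.1]
    have h6 : pb Fin.castSucc (dop 3 fundPrim) (List.finRange 4) = 1 := by
      rw [pb_dop, hp, fund_three]
    have hm : (List.finRange 4).map (Fin.castSucc : Fin 4 → Fin 5) = [0, 1, 2, 3] := by decide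
    have h7 : dop 3 fundPrim [0, 1, 2, 3] = 1 := by rw [← hm]; exact h6
    rw [hf]
    simp only [cd_cons, cd_nil, sh]
    rw [h7, fundPrim_face [1, 2, 3, 4] ![1, 2, 3, 4] (by decide) (by decide +kernel),
      fundPrim_face [0, 2, 3, 4] ![0, 2, 3, 4] (by decide) (by decide +kernel),
      fundPrim_face [0, 1, 3, 4] ![0, 1, 3, 4] (by decide) (by decide +kernel),
      fundPrim_face [0, 1, 2, 4] ![0, 1, 2, 4] (by decide) (by decide +kernel)]
    simp
  rw [h5] at h3
  revert h3
  generalize dop (3 + 1) (fund 5 5) (List.finRange 5) = x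
  revert x; decide

theorem Zc.dop_self {φ : Coch V} {k : ℕ} (h : Zc S k φ) (hI : S.I = ∅)
    (hC : CatCone.dop k (fund (k + 1) (k + 1)) (List.finRange (k + 1)) = 1) :
    Coh S k (CatCone.dop k φ) φ := by
  classical
  letI : LinearOrder V := linearOrderOfSTO (WellOrderingRel (α := V))
  obtain ⟨h1, h2⟩ := h.alt hI
  have h3 := h2.dop h h1 k
  have e : CatCone.dop k (CatCone.alt φ) = CatCone.alt φ := by
    funext l
    by_cases hl : l.length = k + 1
    · refine dop_alternating h1.deg (fun _ _ => alt_perm φ) (fun l hn => ?_) hC l hl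
      rw [CatCone.alt, if_neg hn]
    · rw [h1.deg.apply (by omega), (h1.dop k).deg.apply (by omega)]
  rw [e, show 2 * (k : ℤ) - k = k by ring] at h3
  exact h3.trans h2.symm

end

section
open Filter Function

variable {V W : Type*} {S : Site V} {n : ℤ}

theorem Zc.instability {φ : Coch V} {k : ℕ} (h : Zc S k φ) (hI : S.I = ∅) {j : ℕ} (hj : k < j) :
    Bd S (2 * (k : ℤ) - j) (CatCone.dop j φ) := by
  classical
  letI : LinearOrder V := linearOrderOfSTO (WellOrderingRel (α := V))
  obtain ⟨h1, h2⟩ := h.alt hI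
  have h3 := h2.dop h h1 j
  have e : CatCone.dop j (CatCone.alt φ) = 0 := by
    funext l
    by_cases hl : (l.length : ℤ) = 2 * k - j + 1
    · have e1 : l = (List.finRange l.length).map l.get := by simp
      have e2 : pb l.get (CatCone.alt φ) = 0 := by
        funext m
        simp only [pb, CatCone.alt, Pi.zero_apply]
        by_cases hm : (m.map l.get).Nodup
        · rw [if_pos hm]
          have h5 := (List.Nodup.of_map _ hm).length_le_card
          rw [Fintype.card_fin] at h5
          exact h.deg.apply (by simp; omega)
        · rw [if_neg hm]
      rw [e1]
      change pb l.get (CatCone.dop j (CatCone.alt φ)) _ = _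
      rw [pb_dop, e2, dop_zero_right]; rfl
    · exact (h1.dop j).deg.apply (by push_cast at *; omega)
  rw [e] at h3
  exact coh_zero.1 h3

end

section
open Filter Function Topology

variable {U V W : Type*} {S : Site V} {S' : Site W} {n m : ℤ} {φ ψ χ χ' : Coch V} {A B : Set V}

/-- Lists with entries in a given set. -/
def Lst (A : Set V) : Set (List V) := {l | ∀ x ∈ l, x ∈ A}

theorem Lst.mono {l l' : List V} (h : l ∈ Lst A) (h' : l' ⊆ l) : l' ∈ Lst A := fun x hx => h x (h' hx)

theorem lst_inter {l : List V} : l ∈ Lst (A ∩ B) ↔ l ∈ Lst A ∧ l ∈ Lst B := by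
  simp only [Lst, Set.mem_setOf_eq, Set.mem_inter_iff]
  exact ⟨fun h => ⟨fun x hx => (h x hx).1, fun x hx => (h x hx).2⟩, fun h x hx => ⟨h.1 x hx, h.2 x hx⟩⟩

theorem her_lst : Her (𝓟 (Lst A)) := her_principal fun _ hl _ h => Lst.mono hl h

/-- Sites without symmetries. -/
class Free (S : Site V) : Prop where
  emp : S.I = ∅

theorem Free.inv [h : Free S] (φ : Coch V) : IsInv S.I φ := fun i hi => by
  rw [h.emp] at hi; exact absurd hi (Set.notMem_empty i)

theorem Free.hom [h : Free S] {f : V → W} (tF : Tendsto (List.map f) S.F S'.F)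
    (tG : Tendsto (List.map f) S.G S'.G) : S.Hom S' f :=
  ⟨tF, tG, fun i hi => by rw [h.emp] at hi; exact absurd hi (Set.notMem_empty i)⟩

theorem Site.Hom.comp {S'' : Site U} {f : V → W} {g : W → U} [Free S] (h' : S'.Hom S'' g) (h : S.Hom S' f) :
    S.Hom S'' (g ∘ f) :=
  Free.hom (by rw [← List.map_comp_map]; exact h'.tF.comp h.tF)
    (by rw [← List.map_comp_map]; exact h'.tG.comp h.tG)

theorem Site.Hom.id [Free S] : S.Hom S _root_.id := Free.hom (by simp [tendsto_id]) (by simp [tendsto_id])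

def Site.on (S : Site V) (A : Set V) : Site V :=
  ⟨S.F ⊓ 𝓟 (Lst A), S.G ⊓ 𝓟 (Lst A), S.I, S.hF.inf her_lst, S.hG.inf her_lst, inf_le_inf_right _ S.le⟩

def Site.rel (S : Site V) (A : Set V) : Site V :=
  ⟨S.F, S.G ⊔ S.F ⊓ 𝓟 (Lst A), S.I, S.hF, S.hG.sup (S.hF.inf her_lst), sup_le S.le inf_le_left⟩

instance [h : Free S] : Free (S.on A) := ⟨h.emp⟩
instance [h : Free S] : Free (S.rel A) := ⟨h.emp⟩

theorem ev_on {p : List V → Prop} : (∀ᶠ l in (S.on A).F, p l) ↔ ∀ᶠ l in S.F, l ∈ Lst A → p l :=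
  eventually_inf_principal
theorem ev_onG {p : List V → Prop} : (∀ᶠ l in (S.on A).G, p l) ↔ ∀ᶠ l in S.G, l ∈ Lst A → p l :=
  eventually_inf_principal
theorem ev_rel {p : List V → Prop} :
    (∀ᶠ l in (S.rel A).G, p l) ↔ (∀ᶠ l in S.G, p l) ∧ ∀ᶠ l in S.F, l ∈ Lst A → p l := by
  rw [← eventually_inf_principal]; exact eventually_sup

theorem on_on : (S.on A).on B = S.on (A ∩ B) := by
  have : 𝓟 (Lst A) ⊓ 𝓟 (Lst B) = 𝓟 (Lst (A ∩ B)) := by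
    rw [inf_principal]; congr 1; ext l; exact lst_inter.symm
  simp only [Site.on, inf_assoc, this]

theorem hom_on_of [Free S] {f : V → W} (h : S.Hom S' f) {B : Set W} (hA : Set.MapsTo f A B) :
    (S.on A).Hom (S'.on B) f := by
  have : Tendsto (List.map f) (𝓟 (Lst A)) (𝓟 (Lst B)) := by
    refine tendsto_principal_principal.2 fun l hl x hx => ?_
    obtain ⟨y, hy, rfl⟩ := List.mem_map.1 hx
    exact hA (hl y hy)
  exact Free.hom (h.tF.inf this) (h.tG.inf this)

theorem hom_on [Free S] : (S.on A).Hom S id :=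
  Free.hom (by rw [List.map_id_fun]; exact tendsto_id.mono_left inf_le_left)
    (by rw [List.map_id_fun]; exact tendsto_id.mono_left inf_le_left)

theorem hom_on_mono [Free S] (h : A ⊆ B) : (S.on A).Hom (S.on B) id := hom_on_of Site.Hom.id h

theorem hom_rel [Free S] : S.Hom (S.rel A) id :=
  Free.hom (by rw [List.map_id_fun]; exact tendsto_id)
    (by rw [List.map_id_fun]; exact tendsto_id.mono_right le_sup_left)

theorem Zc.on [Free S] (h : Zc S n φ) (A : Set V) : Zc (S.on A) n φ := by simpa using hom_on.zc h
theorem Bd.on [Free S] (h : Bd S n φ) (A : Set V) : Bd (S.on A) n φ := by simpa using hom_on.bd h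
theorem Coh.on [Free S] (h : Coh S n φ ψ) (A : Set V) : Coh (S.on A) n φ ψ := Bd.on h A
theorem Cc.on [Free S] (h : Cc S n φ) (A : Set V) : Cc (S.on A) n φ := by simpa using hom_on.cc h
theorem Zc.on_mono [Free S] (h : Zc (S.on B) n φ) (hA : A ⊆ B) : Zc (S.on A) n φ := by
  simpa using (hom_on_mono hA).zc h
theorem Bd.on_mono [Free S] (h : Bd (S.on B) n φ) (hA : A ⊆ B) : Bd (S.on A) n φ := by
  simpa using (hom_on_mono hA).bd h
theorem Zc.of_rel [Free S] (h : Zc (S.rel A) n φ) : Zc S n φ := by simpa using hom_rel.zc h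
theorem Bd.of_rel [Free S] (h : Bd (S.rel A) n φ) : Bd S n φ := by simpa using hom_rel.bd h
theorem Zc.mk_rel (h : Zc S n φ) (h' : ∀ᶠ l in S.F, l ∈ Lst A → φ l = 0) : Zc (S.rel A) n φ :=
  ⟨h.deg, h.inv, ev_rel.2 ⟨h.rel, h'⟩, h.cl⟩

open Classical in
/-- Restriction of a cochain to lists in `A`, extended by zero. -/
def cut (A : Set V) (χ : Coch V) : Coch V := fun l => if l ∈ Lst A then χ l else 0

theorem cut_of {l : List V} (h : l ∈ Lst A) : cut A χ l = χ l := if_pos h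
theorem cut_not {l : List V} (h : l ∉ Lst A) : cut A χ l = 0 := if_neg h

theorem cd_congr {l : List V} (h : ∀ l', l' ⊆ l → χ l' = χ' l') : cd χ l = cd χ' l := by
  have : cd (χ + χ') l = 0 := cd_loc fun l' hl' => by rw [Pi.add_apply, h l' hl']; exact CharTwo.add_self_eq_zero _
  rw [cd_add, Pi.add_apply] at this
  exact CharTwo.add_eq_zero.1 this

theorem cd_cut {l : List V} (h : l ∈ Lst A) : cd (cut A χ) l = cd χ l :=
  cd_congr fun _ hl' => cut_of (Lst.mono h hl')

theorem ev_cd {F : Filter (List V)} (hF : Her F) (h : ∀ᶠ l in F, l ∈ Lst A → χ l = χ' l) :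
    ∀ᶠ l in F, l ∈ Lst A → cd χ l = cd χ' l := by
  filter_upwards [hF _ h] with l hl hA
  exact cd_congr fun l' hl' => hl l' hl' (Lst.mono hA hl')

theorem ev_cd' {F : Filter (List V)} (hF : Her F) (h : ∀ᶠ l in F, χ l = χ' l) :
    ∀ᶠ l in F, cd χ l = cd χ' l := by
  filter_upwards [hF _ h] with l hl
  exact cd_congr fun l' hl' => hl l' hl'

theorem Deg.cut (h : Deg n χ) : Deg n (cut A χ) := by
  intro l hl
  by_cases hA : l ∈ Lst A
  · rw [cut_of hA] at hl; exact h l hl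
  · exact absurd (cut_not hA) hl

theorem Cc.of_on [Free S] (h : Cc (S.on A) n χ) : Cc S n (cut A χ) :=
  ⟨h.deg.cut, Free.inv _, by
    filter_upwards [ev_onG.1 h.rel] with l hl
    by_cases hA : l ∈ Lst A
    · rw [cut_of hA, hl hA]
    · exact cut_not hA⟩

/-- A coboundary on a subset can be removed. -/
theorem Bd.lift [Free S] (h : Zc S n φ) (hb : Bd (S.on A) n φ) :
    ∃ φ', Zc (S.rel A) n φ' ∧ Coh S n φ φ' := by
  obtain ⟨χ, h1, h2⟩ := hb
  have h3 := (h1.of_on).bd'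
  refine ⟨φ + cd (cut A χ), (h.add (h1.of_on.cd.of_eq' (by ring))).mk_rel ?_, ?_⟩
  · filter_upwards [ev_on.1 h2] with l hl hA
    rw [Pi.add_apply, hl hA, cd_cut hA]; exact CharTwo.add_self_eq_zero _
  · rw [Coh, ← add_assoc, coch_add_self, zero_add]; exact h3

theorem Bd.mk_rel [Free S] (h : Zc (S.rel A) n φ) (hb : Bd S n φ)
    (hA : ∀ χ, Zc (S.on A) (n - 1) χ → Bd (S.on A) (n - 1) χ) : Bd (S.rel A) n φ := by
  obtain ⟨χ, h1, h2⟩ := hb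
  have h3 : Zc (S.on A) (n - 1) χ := ⟨h1.deg, Free.inv _, (h1.on A).rel, by
    rw [ev_on]
    filter_upwards [h2, (ev_rel.1 h.rel).2] with l h2 h3 hl
    rw [← h2, h3 hl]⟩
  obtain ⟨ξ, h4, h5⟩ := hA χ h3
  refine ⟨χ + cd (cut A ξ), ⟨(h1.add (h4.of_on.cd.toCc.of_eq' (by ring))).deg, Free.inv _, ?_⟩, ?_⟩
  · refine ev_rel.2 ⟨(h1.add (h4.of_on.cd.toCc.of_eq' (by ring))).rel, ?_⟩
    filter_upwards [ev_on.1 h5] with l hl hA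
    rw [Pi.add_apply, cd_cut hA, hl hA]; exact CharTwo.add_self_eq_zero _
  · filter_upwards [h2] with l hl
    rw [cd_add, cd_cd, add_zero, hl]

/-- The lists of a site are eventually contained in one of two subsets. -/
def Thick (S : Site V) (A B : Set V) : Prop := ∀ᶠ l in S.F, l ∈ Lst A ∨ l ∈ Lst B

theorem Thick.on (h : Thick S A B) (C : Set V) : Thick (S.on C) A B := ev_on.2 (h.mono fun _ h _ => h)

theorem glue_aux [Free S] (h : Thick S A B) {χ₁ χ₂ : Coch V} (h1 : Cc (S.on A) n χ₁) (h2 : Cc (S.on B) n χ₂)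
    (he : ∀ᶠ l in S.F, l ∈ Lst A → l ∈ Lst B → χ₁ l = χ₂ l) :
    ∃ χ, Cc S n χ ∧ (∀ᶠ l in S.F, l ∈ Lst A → χ l = χ₁ l) ∧ ∀ᶠ l in S.F, l ∈ Lst B → χ l = χ₂ l := by
  classical
  have e1 : ∀ l, l ∈ Lst A → (if l ∈ Lst A then χ₁ l else χ₂ l) = χ₁ l := fun l hl => if_pos hl
  have e2 : ∀ᶠ l in S.F, l ∈ Lst B → (if l ∈ Lst A then χ₁ l else χ₂ l) = χ₂ l := by
    filter_upwards [he] with l he hB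
    split_ifs with hA
    · exact he hA hB
    · rfl
  refine ⟨fun l => if l ∈ Lst A then χ₁ l else χ₂ l, ⟨fun l hl => ?_, Free.inv _, ?_⟩, Eventually.of_forall e1, e2⟩
  · split_ifs at hl
    · exact h1.deg l hl
    · exact h2.deg l hl
  · filter_upwards [ev_onG.1 h1.rel, ev_onG.1 h2.rel, e2.filter_mono S.le, h.filter_mono S.le] with l h1 h2 e2 h
    rcases h with h | h
    · rw [e1 l h, h1 h]
    · rw [e2 h, h2 h]

theorem Bd.glue_of [Free S] (h : Thick S A B) {χ₁ χ₂ : Coch V} (h1 : Cc (S.on A) (n - 1) χ₁)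
    (h2 : Cc (S.on B) (n - 1) χ₂) (d1 : ∀ᶠ l in S.F, l ∈ Lst A → φ l = cd χ₁ l)
    (d2 : ∀ᶠ l in S.F, l ∈ Lst B → φ l = cd χ₂ l)
    (he : ∀ᶠ l in S.F, l ∈ Lst A → l ∈ Lst B → χ₁ l = χ₂ l) : Bd S n φ := by
  obtain ⟨χ, h3, h4, h5⟩ := glue_aux h h1 h2 he
  refine ⟨χ, h3, ?_⟩
  filter_upwards [h, d1, d2, ev_cd S.hF h4, ev_cd S.hF h5] with l h d1 d2 h4 h5
  rcases h with h | h
  · rw [d1 h, h4 h]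
  · rw [d2 h, h5 h]

/-- Mayer–Vietoris gluing of primitives. -/
theorem Bd.glue [Free S] (h : Thick S A B) {χ₁ χ₂ : Coch V} (h1 : Cc (S.on A) (n - 1) χ₁)
    (h2 : Cc (S.on B) (n - 1) χ₂) (d1 : ∀ᶠ l in S.F, l ∈ Lst A → φ l = cd χ₁ l)
    (d2 : ∀ᶠ l in S.F, l ∈ Lst B → φ l = cd χ₂ l) (he : Coh (S.on (A ∩ B)) (n - 1) χ₁ χ₂) : Bd S n φ := by
  obtain ⟨ξ, h3, h4⟩ := he
  refine Bd.glue_of h (χ₂ := χ₂ + cd (cut (A ∩ B) ξ)) h1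
    (h2.add ((h3.of_on.cd.toCc.of_eq' (by ring)).on B)) d1 ?_ ?_
  · simpa [cd_add, cd_cd] using d2
  · filter_upwards [ev_on.1 h4] with l h hA hB
    have h' := lst_inter.2 ⟨hA, hB⟩
    rw [Pi.add_apply, cd_cut h', ← h h', Pi.add_apply]; grind

/-- Extension by zero of a primitive. -/
theorem Bd.of_rel_on [Free S] (h : Thick S A B) (h1 : ∀ᶠ l in S.F, l ∈ Lst A → φ l = 0)
    (h2 : Bd ((S.on B).rel A) n φ) : Bd S n φ := by
  obtain ⟨χ, h3, h4⟩ := h2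
  obtain ⟨h5, h6⟩ := ev_rel.1 h3.rel
  refine Bd.glue_of h (χ₁ := 0) (χ₂ := χ) Cc.zero ⟨h3.deg, Free.inv _, h5⟩ (by simpa using h1) (ev_on.1 h4) ?_
  filter_upwards [ev_on.1 h6] with l h hA hB
  exact (h hB hA).symm

end

section
open Filter Function Topology Uniformity

variable {U V W X : Type*} {S : Site V} {S' : Site W} {n m k : ℤ} {φ ψ χ χ' : Coch V} {A B : Set V}

/-- Sites without symmetries and without relative part. -/
class Abs (S : Site V) : Prop extends Free S where
  bot : S.G = ⊥

instance [h : Abs S] : Abs (S.on A) := ⟨by simp [Site.on, h.bot]⟩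

theorem Abs.hom [h : Abs S] {f : V → W} (tF : Tendsto (List.map f) S.F S'.F) : S.Hom S' f :=
  Free.hom tF (by rw [h.bot]; exact tendsto_bot)

theorem coh_congr {f g : V → W} {φ : Coch W} (h : ∀ᶠ l in S.F, ∀ x ∈ l, f x = g x) : Coh S n (pb f φ) (pb g φ) :=
  Bd.zero.congr (h.mono fun l hl => by
    have : l.map f = l.map g := List.map_congr_left hl
    rw [Pi.add_apply, pb, pb, this]; exact (CharTwo.add_self_eq_zero _).symm)

/-- Contiguous maps induce cohomologous cochains. -/
theorem coh_contig [Free S] {f g : V → W} {φ : Coch W} (hd : Deg n φ)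
    (h1 : ∀ᶠ l in S.F, ∀ l', l' ⊆ l.map f ++ l.map g → cd φ l' = 0)
    (h2 : ∀ᶠ l in S.G, ∀ l', l' ⊆ l.map f ++ l.map g → φ l' = 0) : Coh S n (pb f φ) (pb g φ) := by
  refine ⟨prism f g φ, ⟨hd.prism, Free.inv _, h2.mono fun l hl => prism_loc hl⟩, ?_⟩
  filter_upwards [h1] with l hl
  rw [← cd_prism, Pi.add_apply, prism_loc hl, add_zero]

/-- The site of small lists in a uniform space. -/
def US (V : Type*) [UniformSpace V] : Site V where
  F := (𝓤 V).lift' fun s => {l | ∀ x ∈ l, ∀ y ∈ l, (x, y) ∈ s}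
  G := ⊥
  I := ∅
  hF := by
    intro p hp
    have hm : Monotone fun s : Set (V × V) => {l : List V | ∀ x ∈ l, ∀ y ∈ l, (x, y) ∈ s} :=
      fun s t h l hl x hx y hy => h (hl x hx y hy)
    rw [Filter.Eventually, mem_lift'_sets hm] at hp ⊢
    obtain ⟨s, hs, h⟩ := hp
    exact ⟨s, hs, fun l hl l' hl' => h fun x hx y hy => hl x (hl' hx) y (hl' hy)⟩
  hG := her_bot
  le := bot_le

instance [UniformSpace V] : Abs (US V) where
  emp := rfl
  bot := rfl

theorem ev_us [UniformSpace V] {p : List V → Prop} :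
    (∀ᶠ l in (US V).F, p l) ↔ ∃ s ∈ 𝓤 V, ∀ l : List V, (∀ x ∈ l, ∀ y ∈ l, (x, y) ∈ s) → p l := by
  have hm : Monotone fun s : Set (V × V) => {l : List V | ∀ x ∈ l, ∀ y ∈ l, (x, y) ∈ s} :=
    fun s t h l hl x hx y hy => h (hl x hx y hy)
  exact mem_lift'_sets hm

/-- The site of small lists in a subset of a uniform space. -/
def CS [UniformSpace V] (K : Set V) : Site V := (US V).on K

instance [UniformSpace V] (K : Set V) : Abs (CS K) := inferInstanceAs (Abs ((US V).on K))

theorem ev_cs [UniformSpace V] {K : Set V} {p : List V → Prop} :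
    (∀ᶠ l in (CS K).F, p l) ↔ ∃ s ∈ 𝓤 V, ∀ l : List V, (∀ x ∈ l, ∀ y ∈ l, (x, y) ∈ s) → l ∈ Lst K → p l := by
  rw [CS, ev_on, ev_us]

theorem hom_cs [UniformSpace V] [UniformSpace W] {K : Set V} {L : Set W} {f : V → W} (hK : IsCompact K)
    (hf : ContinuousOn f K) (hm : Set.MapsTo f K L) : (CS K).Hom (CS L) f := by
  refine Abs.hom fun p hp => ?_
  obtain ⟨s, hs, h⟩ := ev_cs.1 hp
  have h1 := hK.uniformContinuousOn_of_continuous hf hs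
  rw [mem_map, mem_inf_principal] at h1
  refine ev_cs.2 ⟨_, h1, fun l hl hlK => h _ ?_ ?_⟩
  · intro x hx y hy
    obtain ⟨x, hx', rfl⟩ := List.mem_map.1 hx
    obtain ⟨y, hy', rfl⟩ := List.mem_map.1 hy
    exact hl x hx' y hy' ⟨hlK x hx', hlK y hy'⟩
  · intro x hx
    obtain ⟨x, hx', rfl⟩ := List.mem_map.1 hx
    exact hm (hlK x hx')

/-- Points of a site. -/
def Site.Pt (S : Site V) (v : V) : Prop := 𝓟 (Lst {v}) ≤ S.F

theorem Site.Pt.ev {v : V} (h : S.Pt v) {p : List V → Prop} (hp : ∀ᶠ l in S.F, p l) {l : List V}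
    (hl : ∀ x ∈ l, x = v) : p l := h hp hl

theorem Site.Pt.hom {v : V} (h : S.Pt v) {f : V → W} (hf : S.Hom S' f) : S'.Pt (f v) := by
  intro p hp l hl
  have h1 := h.ev (hf.tF.eventually hp) (l := List.replicate l.length v) (by simp)
  rw [List.map_replicate] at h1
  rwa [(List.eq_replicate_iff (l := l)).2 ⟨rfl, hl⟩]

theorem Site.Pt.on {v : V} (h : S.Pt v) (hv : v ∈ A) : (S.on A).Pt v :=
  le_inf h (principal_mono.2 fun l hl x hx => by rw [hl x hx]; exact hv)

theorem pt_cs [UniformSpace V] {K : Set V} {v : V} (hv : v ∈ K) : (CS K).Pt v := by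
  refine Site.Pt.on (fun p hp l hl => ?_) hv
  obtain ⟨s, hs, h⟩ := ev_us.1 hp
  exact h l fun x hx y hy => by rw [hl x hx, hl y hy]; exact refl_mem_uniformity hs

/-- Products of sites. -/
def Site.prod (S : Site V) (S' : Site W) : Site (V × W) where
  F := comap (List.map Prod.fst) S.F ⊓ comap (List.map Prod.snd) S'.F
  G := comap (List.map Prod.fst) S.G ⊓ comap (List.map Prod.snd) S'.F ⊔
    comap (List.map Prod.fst) S.F ⊓ comap (List.map Prod.snd) S'.G
  I := ∅
  hF := (S.hF.comap' _).inf (S'.hF.comap' _)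
  hG := ((S.hG.comap' _).inf (S'.hF.comap' _)).sup ((S.hF.comap' _).inf (S'.hG.comap' _))
  le := sup_le (inf_le_inf_right _ (comap_mono S.le)) (inf_le_inf_left _ (comap_mono S'.le))

instance : Free (S.prod S') := ⟨rfl⟩
instance [h : Abs S] [h' : Abs S'] : Abs (S.prod S') := ⟨by simp [Site.prod, h.bot, h'.bot]⟩

theorem hom_prodMap [Free S] {X : Type*} {T : Site U} {T' : Site X} {f : V → U} {g : W → X} (hf : S.Hom T f)
    (hg : S'.Hom T' g) : (S.prod S').Hom (T.prod T') (Prod.map f g) := by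
  have e1 : (List.map Prod.fst ∘ List.map (Prod.map f g) : List (V × W) → List U) = List.map f ∘ List.map Prod.fst := by
    funext l; simp
  have e2 : (List.map Prod.snd ∘ List.map (Prod.map f g) : List (V × W) → List X) = List.map g ∘ List.map Prod.snd := by
    funext l; simp
  have c1 : ∀ {F : Filter (List V)} {F' : Filter (List U)}, Tendsto (List.map f) F F' →
      Tendsto (List.map (Prod.map f g)) (comap (List.map Prod.fst) F) (comap (List.map Prod.fst) F') := fun h =>
    tendsto_comap_iff.2 (by rw [e1]; exact h.comp tendsto_comap)
  have c2 : ∀ {F : Filter (List W)} {F' : Filter (List X)}, Tendsto (List.map g) F F' →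
      Tendsto (List.map (Prod.map f g)) (comap (List.map Prod.snd) F) (comap (List.map Prod.snd) F') := fun h =>
    tendsto_comap_iff.2 (by rw [e2]; exact h.comp tendsto_comap)
  exact Free.hom ((c1 hf.tF).inf (c2 hg.tF))
    (((c1 hf.tG).inf (c2 hg.tF)).sup_sup ((c1 hf.tF).inf (c2 hg.tG)))

theorem ev_prod {F : Filter (List V)} {F' : Filter (List W)} {p : List (V × W) → Prop}
    (h : ∀ᶠ l in comap (List.map Prod.fst) F ⊓ comap (List.map Prod.snd) F', p l) :
    ∃ (p₁ : List V → Prop) (p₂ : List W → Prop), (∀ᶠ l in F, p₁ l) ∧ (∀ᶠ l in F', p₂ l) ∧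
      ∀ l : List (V × W), p₁ (l.map Prod.fst) → p₂ (l.map Prod.snd) → p l := by
  obtain ⟨q₁, h1, q₂, h2, h⟩ := mem_inf_iff_superset.1 h
  obtain ⟨r₁, h3, h4⟩ := mem_comap.1 h1
  obtain ⟨r₂, h5, h6⟩ := mem_comap.1 h2
  exact ⟨(· ∈ r₁), (· ∈ r₂), h3, h5, fun l hl hl' => h ⟨h4 hl, h6 hl'⟩⟩

theorem hom_into {T : Site U} [Abs S] {f : V → U} {g : V → W} (hf : S.Hom T f) (hg : S.Hom S' g) :
    S.Hom (T.prod S') (fun x => (f x, g x)) := by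
  refine Abs.hom (tendsto_inf.2 ⟨tendsto_comap_iff.2 ?_, tendsto_comap_iff.2 ?_⟩)
  · rw [List.map_comp_map]; exact hf.tF
  · rw [List.map_comp_map]; exact hg.tF

theorem hom_pr [h : Abs S] : (S.prod S').Hom S' Prod.snd :=
  Free.hom (tendsto_comap.mono_left inf_le_right)
    (by simpa [Site.prod, h.bot] using tendsto_comap.mono_left inf_le_right)

theorem hom_pr₁ [h : Abs S'] : (S.prod S').Hom S Prod.fst :=
  Free.hom (tendsto_comap.mono_left inf_le_left)
    (by simpa [Site.prod, h.bot] using tendsto_comap.mono_left inf_le_left)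

theorem hom_swap : (S.prod S').Hom (S'.prod S) Prod.swap := by
  have e1 : (List.map Prod.fst ∘ List.map Prod.swap : List (V × W) → List W) = List.map Prod.snd := by
    funext l; simp
  have e2 : (List.map Prod.snd ∘ List.map Prod.swap : List (V × W) → List V) = List.map Prod.fst := by
    funext l; simp
  have c : ∀ (F : Filter (List V)) (F' : Filter (List W)), Tendsto (List.map Prod.swap)
      (comap (List.map Prod.fst) F ⊓ comap (List.map Prod.snd) F')
      (comap (List.map Prod.fst) F' ⊓ comap (List.map Prod.snd) F) := fun F F' =>
    tendsto_inf.2 ⟨tendsto_comap_iff.2 (by rw [e1]; exact tendsto_comap.mono_left inf_le_right),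
      tendsto_comap_iff.2 (by rw [e2]; exact tendsto_comap.mono_left inf_le_left)⟩
  refine Free.hom (c _ _) ?_
  have := (c S.G S'.F).sup_sup (c S.F S'.G)
  rwa [sup_comm (comap (List.map Prod.fst) S'.F ⊓ _)] at this

theorem hom_slice [Free S'] {v : V} (h : S.Pt v) : S'.Hom (S.prod S') (Prod.mk v) := by
  have e1 : (List.map Prod.fst ∘ List.map (Prod.mk v) : List W → List V) = fun l => List.replicate l.length v := by
    funext l; simp
  have e2 : (List.map Prod.snd ∘ List.map (Prod.mk v) : List W → List W) = id := by
    funext l; simp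
  have c1 : ∀ F : Filter (List W), Tendsto (List.map (Prod.mk v)) F (comap (List.map Prod.fst) S.F) := fun F =>
    tendsto_comap_iff.2 (by
      rw [e1]
      intro p hp
      refine mem_map.2 (univ_mem' fun l => ?_)
      exact h.ev (p := (· ∈ p)) hp (l := List.replicate l.length v) fun x hx => (List.mem_replicate.1 hx).2)
  have c2 : ∀ F : Filter (List W), Tendsto (List.map (Prod.mk v)) F (comap (List.map Prod.snd) F) := fun F =>
    tendsto_comap_iff.2 (by rw [e2]; exact tendsto_id)
  exact Free.hom ((tendsto_inf.2 ⟨c1 _, c2 _⟩)) ((tendsto_inf.2 ⟨c1 _, c2 _⟩).mono_right le_sup_right)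

theorem hom_const [Abs S] {v : V} (h : S.Pt v) [Free S'] :
    (S.prod S').Hom (S.prod S') (fun p => (v, p.2)) := (hom_slice h).comp hom_pr

/-- The unit interval. -/
abbrev UI : Site ℝ := CS (Set.Icc (0 : ℝ) 1)

theorem coh_interval [Free S'] {φ : Coch (ℝ × W)} (h : Zc (UI.prod S') n φ) :
    Coh S' n (pb (Prod.mk 0) φ) (pb (Prod.mk 1) φ) := by
  obtain ⟨p₁, p₂, h1, h2, h3⟩ := ev_prod h.cl
  obtain ⟨q₁, q₂, h4, h5, h6⟩ := ev_prod (eventually_sup.1 h.rel).2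
  obtain ⟨s, hs, h7⟩ := ev_cs.1 (h1.and h4)
  obtain ⟨ε, hε, hs⟩ := Metric.mem_uniformity_dist.1 hs
  have small : ∀ a b : ℝ, a ∈ Set.Icc (0 : ℝ) 1 → b ∈ Set.Icc (0 : ℝ) 1 → dist a b < ε →
      ∀ l : List ℝ, (∀ x ∈ l, x = a ∨ x = b) → p₁ l ∧ q₁ l := by
    intro a b ha hb hab l hl
    refine h7 l (fun x hx y hy => hs ?_) fun x hx => ?_
    · rcases hl x hx with rfl | rfl <;> rcases hl y hy with rfl | rfl <;> 
        first | (rw [dist_self]; exact hε) | exact hab | (rw [dist_comm]; exact hab)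
    · rcases hl x hx with rfl | rfl <;> assumption
  have step : ∀ a b : ℝ, a ∈ Set.Icc (0 : ℝ) 1 → b ∈ Set.Icc (0 : ℝ) 1 → dist a b < ε →
      Coh S' n (pb (Prod.mk a) φ) (pb (Prod.mk b) φ) := by
    intro a b ha hb hab
    have key : ∀ l : List W, ∀ l', l' ⊆ l.map (Prod.mk a) ++ l.map (Prod.mk b) →
        (∀ x ∈ l'.map Prod.fst, x = a ∨ x = b) ∧ l'.map Prod.snd ⊆ l := by
      intro l l' hl'
      refine ⟨fun x hx => ?_, fun x hx => ?_⟩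
      · obtain ⟨y, hy, rfl⟩ := List.mem_map.1 hx
        have := hl' hy
        simp only [List.mem_append, List.mem_map] at this
        rcases this with ⟨z, _, rfl⟩ | ⟨z, _, rfl⟩ <;> simp
      · obtain ⟨y, hy, rfl⟩ := List.mem_map.1 hx
        have := hl' hy
        simp only [List.mem_append, List.mem_map] at this
        rcases this with ⟨z, hz, rfl⟩ | ⟨z, hz, rfl⟩ <;> exact hz
    refine coh_contig h.deg ?_ ?_
    · filter_upwards [S'.hF _ h2] with l hl l' hl'
      exact h3 l' (small a b ha hb hab _ (key l l' hl').1).1 (hl _ (key l l' hl').2)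
    · filter_upwards [S'.hG _ h5] with l hl l' hl'
      exact h6 l' (small a b ha hb hab _ (key l l' hl').1).2 (hl _ (key l l' hl').2)
  obtain ⟨N, hN⟩ := exists_nat_one_div_lt hε
  have hN' : (0 : ℝ) < N + 1 := by positivity
  have ind : ∀ i : ℕ, i ≤ N + 1 → Coh S' n (pb (Prod.mk 0) φ) (pb (Prod.mk ((i : ℝ) / (N + 1))) φ) := by
    intro i
    induction i with
    | zero => intro _; simpa using Coh.refl
    | succ i ih =>
      intro hi
      have hi' : (i : ℝ) + 1 ≤ N + 1 := by exact_mod_cast hi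
      refine (ih (by omega)).trans (step _ _ ⟨by positivity, ?_⟩ ⟨by positivity, ?_⟩ ?_)
      · rw [div_le_one hN']; linarith
      · rw [div_le_one hN']; push_cast; linarith
      · rw [Real.dist_eq, ← sub_div, abs_div, abs_of_pos hN']; push_cast; simpa using hN
  have := ind (N + 1) le_rfl
  rwa [show (((N + 1 : ℕ) : ℝ) / (N + 1)) = 1 by push_cast; exact div_self hN'.ne'] at this

/-- Homotopic maps of sites. -/
def Htpy (S : Site V) (S' : Site W) (f g : V → W) : Prop :=
  ∃ H : V × ℝ → W, (S.prod UI).Hom S' H ∧ ∀ᶠ l in S.F, ∀ x ∈ l, H (x, 0) = f x ∧ H (x, 1) = g x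

theorem hom_assoc {T : Site X} [Free S] {H : V × ℝ → W} (h : (S.prod UI).Hom S' H) [Free T] :
    (UI.prod (S.prod T)).Hom (S'.prod T) (fun p => (H (p.2.1, p.1), p.2.2)) := by
  have c : ∀ (F₁ : Filter (List ℝ)) (F₂ : Filter (List V)) (F₃ : Filter (List X)) (F₄ : Filter (List W)),
      Tendsto (List.map H) (comap (List.map Prod.fst) F₂ ⊓ comap (List.map Prod.snd) F₁) F₄ →
      Tendsto (List.map (fun p : ℝ × V × X => (H (p.2.1, p.1), p.2.2)))
        (comap (List.map Prod.fst) F₁ ⊓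
          comap (List.map Prod.snd) (comap (List.map Prod.fst) F₂ ⊓ comap (List.map Prod.snd) F₃))
        (comap (List.map Prod.fst) F₄ ⊓ comap (List.map Prod.snd) F₃) := by
    intro F₁ F₂ F₃ F₄ h
    have e1 : (List.map Prod.fst ∘ List.map (fun p : ℝ × V × X => (H (p.2.1, p.1), p.2.2))) =
        List.map H ∘ List.map (fun p : ℝ × V × X => (p.2.1, p.1)) := by funext l; simp
    have e2 : (List.map Prod.snd ∘ List.map (fun p : ℝ × V × X => (H (p.2.1, p.1), p.2.2))) =
        List.map Prod.snd ∘ List.map Prod.snd := by funext l; simp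
    refine tendsto_inf.2 ⟨tendsto_comap_iff.2 ?_, tendsto_comap_iff.2 ?_⟩
    · rw [e1]
      refine h.comp (tendsto_inf.2 ⟨tendsto_comap_iff.2 ?_, tendsto_comap_iff.2 ?_⟩)
      · rw [List.map_comp_map]
        exact (((tendsto_comap (f := List.map Prod.fst)).mono_left inf_le_left).comp
          (tendsto_comap (f := List.map Prod.snd))).mono_left inf_le_right |>.congr fun l => by simp
      · rw [List.map_comp_map]; exact tendsto_comap.mono_left inf_le_left
    · rw [e2]
      exact (((tendsto_comap (f := List.map Prod.snd)).mono_left inf_le_right).comp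
          (tendsto_comap (f := List.map Prod.snd))).mono_left inf_le_right
  have hG : Tendsto (List.map H) (comap (List.map Prod.fst) S.G ⊓ comap (List.map Prod.snd) UI.F) S'.G :=
    h.tG.mono_left le_sup_left
  refine Free.hom (c _ _ _ _ h.tF) ?_
  have e : (UI.prod (S.prod T)).G = comap (List.map Prod.fst) UI.F ⊓
      comap (List.map Prod.snd) (comap (List.map Prod.fst) S.G ⊓ comap (List.map Prod.snd) T.F) ⊔
      comap (List.map Prod.fst) UI.F ⊓
      comap (List.map Prod.snd) (comap (List.map Prod.fst) S.F ⊓ comap (List.map Prod.snd) T.G) := by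
    rw [← inf_sup_left, ← comap_sup]
    have : UI.G = ⊥ := Abs.bot
    simp only [Site.prod, this, comap_bot, bot_inf_eq, bot_sup_eq]
  rw [e]
  exact (c _ _ _ _ hG).sup_sup (c _ _ _ _ h.tF)

theorem Htpy.coh_prod [Free S] [Free S'] {T : Site X} [Free T] {f g : V → W} (h : Htpy S S' f g)
    {φ : Coch (W × X)} (hφ : Zc (S'.prod T) n φ) :
    Coh (S.prod T) n (pb (Prod.map f id) φ) (pb (Prod.map g id) φ) := by
  obtain ⟨H, h1, h2⟩ := h
  have h3 := coh_interval ((hom_assoc h1 (T := T)).zc hφ)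
  rw [pb_pb, pb_pb] at h3
  have h4 : ∀ᶠ l in (S.prod T).F, ∀ x ∈ l, H (x.1, 0) = f x.1 ∧ H (x.1, 1) = g x.1 := by
    filter_upwards [((tendsto_comap (f := List.map Prod.fst)).mono_left inf_le_left).eventually h2] with l hl x hx
    exact hl x.1 (List.mem_map_of_mem hx)
  refine ((coh_congr ?_).symm.trans h3).trans (coh_congr ?_)
  · exact h4.mono fun l hl x hx => by simp [(hl x hx).1, Prod.map]
  · exact h4.mono fun l hl x hx => by simp [(hl x hx).2, Prod.map]

theorem Htpy.coh [Free S] [Free S'] {f g : V → W} (h : Htpy S S' f g) {φ : Coch W} (hφ : Zc S' n φ) :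
    Coh S n (pb f φ) (pb g φ) := by
  obtain ⟨H, h1, h2⟩ := h
  have h3 := coh_interval ((h1.comp hom_swap).zc hφ)
  rw [pb_pb, pb_pb] at h3
  refine ((coh_congr ?_).symm.trans h3).trans (coh_congr ?_)
  · exact h2.mono fun l hl x hx => by simp [(hl x hx).1]
  · exact h2.mono fun l hl x hx => by simp [(hl x hx).2]

theorem hom_cs_prod [UniformSpace V] [UniformSpace W] {K : Set V} {L : Set W} :
    ((CS K).prod (CS L)).Hom (CS (K ×ˢ L)) id := by
  refine Abs.hom fun p hp => ?_
  obtain ⟨s, hs, h⟩ := ev_cs.1 hp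
  rw [uniformity_prod] at hs
  obtain ⟨q₁, h1, q₂, h2, hq⟩ := mem_inf_iff_superset.1 hs
  obtain ⟨r₁, h3, h4⟩ := mem_comap.1 h1
  obtain ⟨r₂, h5, h6⟩ := mem_comap.1 h2
  have a1 : ∀ᶠ l in (CS K).F, l ∈ Lst K ∧ ∀ x ∈ l, ∀ y ∈ l, (x, y) ∈ r₁ :=
    ev_cs.2 ⟨r₁, h3, fun l hl hK => ⟨hK, hl⟩⟩
  have a2 : ∀ᶠ l in (CS L).F, l ∈ Lst (L) ∧ ∀ x ∈ l, ∀ y ∈ l, (x, y) ∈ r₂ :=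
    ev_cs.2 ⟨r₂, h5, fun l hl hK => ⟨hK, hl⟩⟩
  have b1 := ((tendsto_comap (f := (List.map Prod.fst : List (V × W) → _))).mono_left
    (inf_le_left (b := comap (List.map Prod.snd) (CS L).F))).eventually a1
  have b2 := ((tendsto_comap (f := (List.map Prod.snd : List (V × W) → _))).mono_left
    (inf_le_right (a := comap (List.map Prod.fst) (CS K).F))).eventually a2
  rw [List.map_id_fun]
  filter_upwards [b1, b2] with l c1 c2
  refine h l (fun x hx y hy => hq ⟨h4 ?_, h6 ?_⟩) fun x hx => ⟨?_, ?_⟩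
  · exact c1.2 _ (List.mem_map_of_mem hx) _ (List.mem_map_of_mem hy)
  · exact c2.2 _ (List.mem_map_of_mem hx) _ (List.mem_map_of_mem hy)
  · exact c1.1 _ (List.mem_map_of_mem hx)
  · exact c2.1 _ (List.mem_map_of_mem hx)

theorem htpy_cs [UniformSpace V] [UniformSpace W] {K : Set V} {L : Set W} {f g : V → W} (hK : IsCompact K)
    (H : V × ℝ → W) (hH : ContinuousOn H (K ×ˢ Set.Icc (0 : ℝ) 1))
    (hm : ∀ x ∈ K, ∀ t ∈ Set.Icc (0 : ℝ) 1, H (x, t) ∈ L) (h0 : ∀ x ∈ K, H (x, 0) = f x)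
    (h1 : ∀ x ∈ K, H (x, 1) = g x) : Htpy (CS K) (CS L) f g := by
  refine ⟨H, ?_, ?_⟩
  · exact (hom_cs (hK.prod isCompact_Icc) hH fun x hx => hm x.1 hx.1 x.2 hx.2).comp hom_cs_prod
  · exact ev_cs.2 ⟨Set.univ, univ_mem, fun l _ hl x hx => ⟨h0 x (hl x hx), h1 x (hl x hx)⟩⟩

end

section
open Filter Function Topology Uniformity

section
variable {U V W X : Type*} {S : Site V} {S' : Site W} {n m k : ℤ} {φ ψ χ χ' : Coch V} {A B : Set V}

theorem comap_lst (f : W → V) : comap (List.map f) (𝓟 (Lst A)) = 𝓟 (Lst (f ⁻¹' A)) := by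
  rw [comap_principal]; congr 1; ext l; simp [Lst]

theorem on_prod : (S.on A).prod S' = (S.prod S').on (Prod.fst ⁻¹' A) := by
  simp only [Site.on, Site.prod, comap_inf, comap_lst, Site.mk.injEq, and_true]
  refine ⟨inf_right_comm _ _ _, ?_⟩
  rw [inf_right_comm, inf_right_comm (comap _ S.F), inf_sup_right]

theorem rel_prod : (S.rel A).prod S' = (S.prod S').rel (Prod.fst ⁻¹' A) := by
  simp only [Site.rel, Site.prod, comap_inf, comap_sup, comap_lst, Site.mk.injEq, true_and, and_true]
  rw [inf_sup_right, sup_right_comm, inf_right_comm]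

theorem prod_on {A : Set W} : S.prod (S'.on A) = (S.prod S').on (Prod.snd ⁻¹' A) := by
  simp only [Site.on, Site.prod, comap_inf, comap_lst, Site.mk.injEq, and_true]
  refine ⟨(inf_assoc _ _ _).symm, ?_⟩
  rw [← inf_assoc, ← inf_assoc, inf_sup_right]

/-- Vanishing of cohomology in one degree. -/
def Hz (S : Site V) (k : ℤ) : Prop := ∀ φ, Zc S k φ → Bd S k φ

theorem Hz.retract [Free S] [Free S'] {f : V → W} {g : W → V} (hf : S.Hom S' f) (hg : S'.Hom S g)
    (h : Htpy S S (g ∘ f) id) (hz : Hz S' k) : Hz S k := fun φ hφ => by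
  have h1 := hf.bd (hz _ (hg.zc hφ))
  rw [pb_pb] at h1
  simpa using (h.coh hφ).symm.bd h1

/-- Contractible sites. -/
def Ctr (S : Site V) : Prop := ∃ a, S.Pt a ∧ Htpy S S id (fun _ => a)

theorem pt_ev {v : V} (hv : S.Pt v) {p : List V → Prop} (hp : ∀ᶠ l in S.F, p l) {F : Filter (List W)} :
    ∀ᶠ l in F, p (List.map (fun _ => v) l) :=
  Eventually.of_forall fun l => hv.ev hp fun x hx => by
    obtain ⟨_, _, rfl⟩ := List.mem_map.1 hx; rfl

theorem hom_pt [Abs S] {v : V} (hv : S.Pt v) : S.Hom S (fun _ => v) :=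
  Abs.hom fun p hp => mem_map.2 (pt_ev hv (p := fun l => l ∈ p) hp)

theorem coh_point [h : Abs S] {v : V} (hv : S.Pt v) (hk : 1 ≤ k) (hφ : Zc S k φ) :
    Bd S k (pb (fun _ => v) φ) := by
  refine ⟨pb (fun _ => v) (sh v φ), ⟨?_, Free.inv _, by rw [h.bot]; exact eventually_bot⟩, ?_⟩
  · intro l hl
    obtain ⟨_, h2⟩ := hφ.deg _ hl
    simp only [List.length_cons, List.length_map] at h2
    push_cast at h2
    refine ⟨?_, by omega⟩
    rintro rfl; simp at h2; omega
  · filter_upwards [pt_ev (W := V) hv hφ.cl (F := S.F)] with l hl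
    rw [cd_pb]
    have h1 : cd φ (v :: List.map (fun _ => v) l) = 0 := hv.ev hφ.cl (by simp)
    rw [cd_cons] at h1
    exact CharTwo.add_eq_zero.1 h1

/-! Cochains pulled back from a point. -/

def Cst (S : Site V) (k : ℤ) (φ : Coch V) : Prop := ∃ v, S.Pt v ∧ Coh S k φ (pb (fun _ => v) φ)

theorem Cst.all [Abs S] (h : Cst S k φ) {w : V} (hw : S.Pt w) : Coh S k φ (pb (fun _ => w) φ) := by
  obtain ⟨v, hv, h⟩ := h
  have := (hom_pt hw).coh h
  rw [pb_pb (fun _ => w)] at this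
  exact h.trans this.symm

theorem Cst.bd [Abs S] (h : Cst S k φ) (hφ : Zc S k φ) (hk : 1 ≤ k) : Bd S k φ := by
  obtain ⟨v, hv, h⟩ := h
  exact h.bd (coh_point hv hk hφ)

theorem Bd.cst [Abs S] {v : V} (hv : S.Pt v) (h : Bd S k φ) : Cst S k φ := ⟨v, hv, Bd.add h ((hom_pt hv).bd h)⟩

theorem Cst.congr [Abs S] (h : Cst S k φ) (he : Coh S k φ ψ) : Cst S k ψ := by
  obtain ⟨v, hv, h⟩ := h
  exact ⟨v, hv, he.symm.trans (h.trans ((hom_pt hv).coh he))⟩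

theorem Cst.add [Abs S] (h : Cst S k φ) (h' : Cst S k ψ) : Cst S k (φ + ψ) := by
  obtain ⟨v, hv, h⟩ := h
  exact ⟨v, hv, h.add (h'.all hv)⟩

theorem Cst.of_map [Abs S] [Abs S'] {f : V → W} {g : W → V} (hf : S.Hom S' f) (hg : S'.Hom S g)
    (h : Htpy S S (g ∘ f) id) (hφ : Zc S k φ) (hc : Cst S' k (pb g φ)) : Cst S k φ := by
  obtain ⟨v, hv, h1⟩ := hc
  have h2 := hf.coh h1
  simp only [pb_pb] at h2
  have h3 := (h.coh hφ).symm.trans h2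
  simp only [pb_id] at h3
  exact ⟨g v, hv.hom hg, h3⟩

theorem Ctr.cst [Abs S] (h : Ctr S) (hφ : Zc S k φ) : Cst S k φ := by
  obtain ⟨v, hv, h⟩ := h
  exact ⟨v, hv, by simpa using h.coh hφ⟩

theorem Ctr.bd [Abs S] (h : Ctr S) (hk : 1 ≤ k) (hφ : Zc S k φ) : Bd S k φ := (h.cst hφ).bd hφ hk

theorem Cst.on [Abs S] (h : Cst S k φ) {v : V} (hv : S.Pt v) (hA : v ∈ A) : Cst (S.on A) k φ :=
  ⟨v, hv.on hA, (h.all hv).on A⟩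

/-- Existence of a nontrivial class. -/
def NC (S : Site V) (k : ℤ) : Prop := ∃ φ, Zc S k φ ∧ ¬ Cst S k φ

theorem NC.map [Abs S] [Abs S'] {f : V → W} {g : W → V} (hf : S.Hom S' f) (hg : S'.Hom S g)
    (h : Htpy S S (g ∘ f) id) (hn : NC S k) : NC S' k := by
  obtain ⟨φ, h1, h2⟩ := hn
  exact ⟨pb g φ, hg.zc h1, fun hc => h2 (hc.of_map hf hg h h1)⟩

/-! Classes on a product which come from the second factor. -/

def Rk (S : Site V) (k : ℤ) (Y : Site W) : Prop := ∀ φ, Zc (S.prod Y) k φ → ∀ v, S.Pt v →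
  Coh (S.prod Y) k φ (pb (fun p => (v, p.2)) φ)

variable {Y : Site W} [Free Y]

theorem Rk.of_pt [Abs S] {v : V} (hv : S.Pt v)
    (h : ∀ φ, Zc (S.prod Y) k φ → Coh (S.prod Y) k φ (pb (fun p => (v, p.2)) φ)) : Rk S k Y := fun φ hφ w hw => by
  have h1 := (hom_const (S' := Y) hw).coh (h φ hφ)
  rw [pb_pb (fun p : V × W => (w, p.2))] at h1
  exact (h φ hφ).trans h1.symm

theorem Ctr.rk [Abs S] (h : Ctr S) : Rk S k Y := by
  obtain ⟨v, hv, h⟩ := h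
  refine Rk.of_pt hv fun φ hφ => ?_
  have := h.coh_prod (T := Y) hφ
  simp only [Prod.map_id, pb_id] at this
  exact this

theorem Rk.dom [Abs S] {S' : Site U} [Abs S'] {f : V → U} {g : U → V} (hf : S.Hom S' f) (hg : S'.Hom S g)
    (h : Htpy S S (g ∘ f) id) (hr : Rk S' k Y) : Rk S k Y := fun φ hφ v hv => by
  have h1 := h.coh_prod (T := Y) hφ
  simp only [Prod.map_id, pb_id] at h1
  have h2 := (hom_prodMap (S' := Y) hf Site.Hom.id).coh (hr _ ((hom_prodMap hg Site.Hom.id).zc hφ) (f v) (hv.hom hf))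
  have h3 := (hom_const (S' := Y) hv).coh h1
  rw [pb_pb] at h3
  rw [pb_pb, pb_pb (fun p : U × W => (f v, p.2)), pb_pb (Prod.map f id)] at h2
  exact h1.symm.trans (h2.trans h3)

theorem coh_empty [h : Free S] (hχ : Deg k χ) (hχ' : Deg k χ') : Coh (S.on (∅ : Set V)) k χ χ' :=
  Bd.zero.congr (ev_on.2 (Eventually.of_forall fun l hl => by
    cases l with
    | nil => simp [hχ.nil, hχ'.nil]
    | cons a l => exact absurd (hl a (by simp)) (Set.notMem_empty a)))

theorem prod_thick (h : Thick S A B) : Thick (S.prod Y) (Prod.fst ⁻¹' A) (Prod.fst ⁻¹' B) := by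
  have := ((tendsto_comap (f := (List.map Prod.fst : List (V × W) → _))).mono_left
        (inf_le_left (b := comap (List.map Prod.snd) Y.F))).eventually h
  refine this.mono fun l hl => ?_
  simpa [Lst] using hl

theorem Rk.mv [Abs S] (ht : Thick S A B) {v : V} (hv : S.Pt v) (hA : v ∈ A) (hB : v ∈ B)
    (h1 : Rk (S.on A) k Y) (h2 : Rk (S.on B) k Y) (h3 : Rk (S.on (A ∩ B)) (k - 1) Y) : Rk S k Y := by
  refine Rk.of_pt hv fun φ hφ => ?_
  set c : V × W → V × W := fun p => (v, p.2) with hc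
  have hcc : c ∘ c = c := rfl
  have key : ∀ C : Set V, v ∈ C → Rk (S.on C) k Y →
      ∃ χ, Cc ((S.prod Y).on (Prod.fst ⁻¹' C)) (k - 1) χ ∧ pb c χ = 0 ∧
        ∀ᶠ l in (S.prod Y).F, l ∈ Lst (Prod.fst ⁻¹' C) → (φ + pb c φ) l = cd χ l := by
    intro C hC h
    have h4 := h φ (by rw [on_prod]; exact hφ.on _) v (hv.on hC)
    obtain ⟨χ, h5, h6⟩ := h4
    have hh := hom_const (S := S.on C) (S' := Y) (hv.on hC)
    refine ⟨χ + pb c χ, ?_, ?_, ?_⟩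
    · rw [← on_prod]; exact h5.add (hh.cc h5)
    · rw [pb_add, pb_pb, hcc, coch_add_self]
    · rw [← ev_on, ← on_prod]
      filter_upwards [h6, hh.tF.eventually h6] with l h7 h8
      have h9 : pb c φ (List.map c l) = φ (List.map c l) := by
        change (pb c (pb c φ)) l = _
        rw [pb_pb, hcc]; rfl
      have h10 : φ (List.map c l) + pb c φ (List.map c l) = cd χ (List.map c l) := h8
      rw [h9, CharTwo.add_self_eq_zero] at h10
      rw [cd_add, cd_pb]
      change _ = cd χ l + cd χ (List.map c l)
      rw [← h10, add_zero]; exact h7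
  obtain ⟨χ₁, a1, b1, c1⟩ := key A hA h1
  obtain ⟨χ₂, a2, b2, c2⟩ := key B hB h2
  refine Bd.glue (prod_thick ht) a1 a2 c1 c2 ?_
  have h5 : Zc ((S.on (A ∩ B)).prod Y) (k - 1) (χ₁ + χ₂) := by
    rw [on_prod]
    have e1 := a1.on (Prod.fst ⁻¹' B)
    have e2 := a2.on (Prod.fst ⁻¹' A)
    rw [on_on] at e1 e2
    rw [Set.inter_comm] at e2
    refine .of_cc (e1.add e2) (ev_on.2 ?_)
    filter_upwards [c1, c2] with l c1 c2 hl
    have hl := lst_inter.1 hl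
    rw [cd_add, Pi.add_apply, ← c1 hl.1, ← c2 hl.2, CharTwo.add_self_eq_zero]
  have h6 := h3 _ h5 v (hv.on ⟨hA, hB⟩)
  rw [on_prod] at h6
  change Coh _ _ _ (pb c (χ₁ + χ₂)) at h6
  rw [pb_add, b1, b2, zero_add] at h6
  exact coh_zero.1 h6

theorem Rk.mv_zero [Abs S] (ht : Thick S A B) (hAB : A ∩ B = ∅) {a b : V} (ha : S.Pt a) (hb : S.Pt b)
    (hA : a ∈ A) (hB : b ∈ B) (h1 : Rk (S.on A) k Y) (h2 : Rk (S.on B) k Y) (h3 : Hz Y k) : Rk S k Y := by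
  have key : ∀ (C : Set V) (v : V), S.Pt v → v ∈ C → Rk (S.on C) k Y → ∀ φ, Zc (S.prod Y) k φ →
      Bd ((S.prod Y).on (Prod.fst ⁻¹' C)) k φ := by
    intro C v hv hC h φ hφ
    have h4 := h φ (by rw [on_prod]; exact hφ.on _) v (hv.on hC)
    have h5 := (hom_pr (S := S.on C) (S' := Y)).bd (h3 _ ((hom_slice hv).zc hφ))
    rw [pb_pb] at h5
    rw [on_prod] at h4 h5
    exact h4.bd h5
  have hz : Hz (S.prod Y) k := by
    intro φ hφ
    obtain ⟨χ₁, c1, d1⟩ := key A a ha hA h1 φ hφ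
    obtain ⟨χ₂, c2, d2⟩ := key B b hb hB h2 φ hφ
    refine Bd.glue (prod_thick ht) c1 c2 (ev_on.1 d1) (ev_on.1 d2) ?_
    rw [← Set.preimage_inter, hAB, Set.preimage_empty]
    exact coh_empty c1.deg c2.deg
  exact fun φ hφ v hv => (hz φ hφ).add (hz _ ((hom_const hv).zc hφ))

theorem Rk.rel_zero [Abs S] {v : V} (hv : S.Pt v) (h : Rk S k Y) : Hz ((S.rel {v}).prod Y) k := by
  intro φ hφ
  rw [rel_prod] at hφ ⊢
  have hh := hom_const (S' := Y) hv
  obtain ⟨χ, h1, h2⟩ := h φ hφ.of_rel v hv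
  set c : V × W → V × W := fun p => (v, p.2) with hc
  have hmem : ∀ l : List (V × W), List.map c l ∈ Lst (Prod.fst ⁻¹' {v}) := by
    intro l x hx
    obtain ⟨y, _, rfl⟩ := List.mem_map.1 hx
    simp [hc]
  have h3 : ∀ᶠ l in (S.prod Y).F, φ (List.map c l) = 0 := by
    filter_upwards [hh.tF.eventually (ev_rel.1 hφ.rel).2] with l hl
    exact hl (hmem l)
  have h4 : ∀ᶠ l in (S.prod Y).F, cd χ (List.map c l) = 0 := by
    filter_upwards [hh.tF.eventually h2, hh.tF.eventually h3, h3] with l h2 h3 h4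
    rw [← h2, Pi.add_apply]
    exact (by rw [h4, show pb c φ (List.map c l) = 0 from h3, add_zero])
  refine ⟨χ + pb c χ, ⟨(h1.add (hh.cc h1)).deg, Free.inv _, ev_rel.2 ⟨(h1.add (hh.cc h1)).rel, ?_⟩⟩, ?_⟩
  · refine Eventually.of_forall fun l hl => ?_
    have : List.map c l = l := by
      conv_rhs => rw [← List.map_id l]
      refine List.map_congr_left fun x hx => ?_
      have : x.1 = v := hl x hx
      simp [hc, ← this]
    rw [Pi.add_apply, pb, this, CharTwo.add_self_eq_zero]
  · filter_upwards [h2, h3, h4] with l h2 h3 h4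
    rw [cd_add, Pi.add_apply, ← h2, cd_pb, Pi.add_apply]
    rw [show pb c φ l = 0 from h3, show pb c (cd χ) l = 0 from h4]; ring

end

end

section
open Filter Function Topology Uniformity

variable {U V W X : Type*} {S : Site V} {S' : Site W} {n m k p q : ℤ} {φ ψ χ χ' : Coch V} {A B : Set V}

theorem Hz.of_unit (hk : k ≠ 0) : Hz (US Unit) k := fun φ hφ => by
  rcases lt_or_ge k 0 with h | h
  · exact hφ.of_deg_neg h
  · have := coh_point (v := ()) (S := US Unit) (fun p hp l hl => by
      obtain ⟨s, hs, h⟩ := ev_us.1 hp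
      exact h l fun x hx y hy => refl_mem_uniformity hs) (by omega : (1 : ℤ) ≤ k) hφ
    rwa [show (fun _ : Unit => ()) = id from rfl, pb_id] at this

theorem pt_unit : (US Unit).Pt () := fun p hp l hl => by
  obtain ⟨s, hs, h⟩ := ev_us.1 hp
  exact h l fun x hx y hy => refl_mem_uniformity hs

theorem Hz.prod_unit [Free S] (h : Hz (S.prod (US Unit)) k) : Hz S k := fun φ hφ => by
  have h1 := (hom_swap.comp (hom_slice (S' := S) pt_unit)).bd (h _ ((hom_pr₁ (S := S) (S' := US Unit)).zc hφ))
  rw [pb_pb] at h1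
  rw [show φ = pb (Prod.fst ∘ Prod.swap ∘ Prod.mk ()) φ from (pb_id φ).symm]
  exact h1

theorem Rk.hz_rel [Abs S] {v : V} (hv : S.Pt v) (h : Rk S k (US Unit)) : Hz (S.rel {v}) k :=
  (h.rel_zero hv).prod_unit

theorem Rk.hz [Abs S] {v : V} (hv : S.Pt v) (h : Rk S k (US Unit)) (hk : k ≠ 0) : Hz S k := fun φ hφ => by
  rcases lt_or_ge k 0 with h' | h'
  · exact hφ.of_deg_neg h'
  · have h1 := (hom_swap.comp (hom_slice (S' := S) pt_unit)).coh
      (h _ ((hom_pr₁ (S := S) (S' := US Unit)).zc hφ) v hv)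
    simp only [pb_pb] at h1
    rw [show Prod.fst ∘ Prod.swap ∘ Prod.mk () = (id : V → V) from rfl, pb_id] at h1
    have h2 : Coh S k φ (pb (fun _ => v) φ) := h1
    exact h2.bd (coh_point hv (by omega) hφ)

/-! External products. -/

def Site.comap (S : Site W) (f : V → W) : Site V :=
  ⟨Filter.comap (List.map f) S.F, Filter.comap (List.map f) S.G, ∅, S.hF.comap' f, S.hG.comap' f, comap_mono S.le⟩

instance {f : V → W} : Free (S'.comap f) := ⟨rfl⟩

theorem hom_comap {f : V → W} : (S'.comap f).Hom S' f := Free.hom tendsto_comap tendsto_comap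

theorem cupsite_prod : CupSite (S.comap Prod.fst) (S'.comap Prod.snd) (S.prod S') :=
  ⟨inf_le_left, inf_le_right, sup_le_sup inf_le_left inf_le_right, le_rfl, le_rfl⟩

def cross (a : Coch V) (b : Coch W) : Coch (V × W) := cup (pb Prod.fst a) (pb Prod.snd b)

theorem pb_cross {V' W' : Type*} {f : V' → V} {g : W' → W} {a : Coch V} {b : Coch W} :
    pb (Prod.map f g) (cross a b) = cross (pb f a) (pb g b) := by
  simp only [cross, pb_cup, pb_pb]; rfl

theorem cross_add_left {a a' : Coch V} {b : Coch W} : cross (a + a') b = cross a b + cross a' b := by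
  rw [cross, pb_add, cup_add_left]; rfl
theorem cross_add_right {a : Coch V} {b b' : Coch W} : cross a (b + b') = cross a b + cross a b' := by
  rw [cross, pb_add, cup_add_right]; rfl

theorem Zc.cross {a : Coch V} {b : Coch W} (ha : Zc S n a) (hb : Zc S' m b) :
    Zc (S.prod S') (n + m) (cross a b) := (hom_comap.zc ha).cup (hom_comap.zc hb) cupsite_prod
theorem Cc.cross {a : Coch V} {b : Coch W} (ha : Cc S n a) (hb : Cc S' m b) :
    Cc (S.prod S') (n + m) (CatCone.cross a b) := (hom_comap.cc ha).cup (hom_comap.cc hb) cupsite_prod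
theorem Coh.cross {a a' : Coch V} {b b' : Coch W} (ha : Zc S n a) (hb : Zc S' m b') (h : Coh S n a a')
    (h' : Coh S' m b b') : Coh (S.prod S') (n + m) (CatCone.cross a b) (CatCone.cross a' b') :=
  (Coh.cup_right (hom_comap.zc ha) (hom_comap.coh h') cupsite_prod).trans
    (Coh.cup_left (hom_comap.coh h) (hom_comap.zc hb) cupsite_prod)
theorem Bd.cross_left {a : Coch V} {b : Coch W} (ha : Bd S n a) (hb : Zc S' m b) :
    Bd (S.prod S') (n + m) (CatCone.cross a b) := (hom_comap.bd ha).cup_left (hom_comap.zc hb) cupsite_prod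
theorem Bd.cross_right {a : Coch V} {b : Coch W} (ha : Zc S n a) (hb : Bd S' m b) :
    Bd (S.prod S') (n + m) (CatCone.cross a b) := Bd.cup_right (hom_comap.zc ha) (hom_comap.bd hb) cupsite_prod

theorem cup_unit_right (y : Coch V) (hy : y [] = 0) :
    cup y (fun l => if l.length = 1 then 1 else 0) = y := by
  funext l
  induction l generalizing y with
  | nil => exact hy.symm
  | cons a l ih =>
    rw [cup_cons]
    cases l with
    | nil => simp [show cup (sh a y) (fun l => if l.length = 1 then 1 else 0) ([] : List V) = 0 from rfl]
    | cons b l =>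
      have : cup (sh a y) (fun l => if l.length = 1 then 1 else 0) (b :: l) = sh a y (b :: l) := by
        by_cases h : sh a y [] = 0
        · exact ih _ h
        · have h1 := ih (sh a y + fun l => if l = [] then sh a y [] else 0) (by simp [CharTwo.add_self_eq_zero])
          rw [cup_add_left, Pi.add_apply, Pi.add_apply] at h1
          have h2 : cup (fun l : List V => if l = [] then sh a y [] else 0) (fun l => if l.length = 1 then 1 else 0) (b :: l) = 0 := by
            rw [cup_cons]
            have : sh b (fun l : List V => if l = [] then sh a y [] else 0) = 0 := by funext l; simp [sh]
            rw [this, cup_loc (a := 0) (Or.inl fun _ _ => rfl)]; simp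
          simpa [h2] using h1
      rw [this]; simp [sh]

theorem deg_zero_pt (h : Deg 0 φ) (v : V) : pb (fun _ : W => v) φ = fun l => if l.length = 1 then φ [v] else 0 := by
  funext l
  match l with
  | [] => simpa [pb] using h.nil
  | [a] => simp [pb]
  | a :: b :: l =>
    by_contra hc
    have := (h (List.map (fun _ => v) (a :: b :: l)) (fun h0 => hc (by rw [pb, h0]; simp))).2
    simp at this; omega

/-- Non-degeneracy of external products. -/
def J {V : Type} (S : Site V) (q : ℤ) : Prop :=
  ∀ {W : Type} (Y : Site W) [Free Y] (p : ℤ) (σ : Coch W) (θ : Coch V) (τ : Coch W), Zc Y p σ → Zc S q θ →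
    Zc Y (p + q) τ → Coh (Y.prod S) (p + q) (cross σ θ) (pb Prod.fst τ) → Bd Y p σ ∨ Cst S q θ

theorem coh_slice {Y : Site W} [Free Y] [Abs S] {v : V} (hv : S.Pt v) {σ τ : Coch W}
    (h : Coh (Y.prod S) n (cross σ φ) (pb Prod.fst τ)) : Coh Y n (cup σ (pb (fun _ => v) φ)) τ := by
  have h1 := (hom_swap.comp (hom_slice (S' := Y) hv)).coh h
  rw [cross, pb_cup, pb_pb, pb_pb, pb_pb (Prod.swap ∘ Prod.mk v) Prod.fst,
    show Prod.fst ∘ Prod.swap ∘ Prod.mk v = (id : W → W) from rfl, pb_id, pb_id] at h1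
  exact h1

theorem J.map {V W : Type} {S : Site V} {S' : Site W} [Abs S] [Abs S'] {f : V → W} {g : W → V} (hf : S.Hom S' f)
    (hg : S'.Hom S g) (h : Htpy S S (g ∘ f) id) (hJ : J S' q) : J S q := by
  intro X Y _ p σ θ τ hσ hθ hτ hc
  have h1 := (hom_prodMap (S := Y) Site.Hom.id hg).coh hc
  rw [pb_cross, pb_pb] at h1
  exact (hJ Y p σ _ τ hσ (hg.zc hθ) hτ (by rw [pb_id] at h1; exact h1)).imp_right fun h2 => h2.of_map hf hg h hθ

theorem hom_free [h : Abs S] {f : V → W} (hf : Tendsto (List.map f) S.F S'.F) : S.Hom S' f := Abs.hom hf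

theorem cupsite_const {Y : Site W} [hY : Free Y] [h : Abs S] {v : V} (hv : S.Pt v) :
    CupSite Y (S.comap fun _ : W => v) Y :=
  ⟨le_rfl, tendsto_iff_comap.1 fun p hp => mem_map.2 (pt_ev hv (p := fun l => l ∈ p) hp), le_sup_left, le_rfl,
    by rw [hY.emp]; exact Set.empty_subset _⟩

theorem J.mv {V : Type} {S : Site V} [Abs S] {A B : Set V} (ht : Thick S A B) {v : V} (hv : S.Pt v) (hA : v ∈ A)
    (hB : v ∈ B) (h1 : Ctr (S.on A)) (h2 : Ctr (S.on B)) (hq : 0 ≤ q) (hJ : J (S.on (A ∩ B)) q) :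
    J S (q + 1) := by
  intro W Y _ p σ θ τ hσ hθ hτ hc
  have hcv := coh_slice hv hc
  have hτ0 : Bd Y (p + (q + 1)) τ := by
    refine hcv.symm.bd ?_
    have := Bd.cup_right hσ ((hom_comap (S' := S) (f := fun _ : W => v)).bd (coh_point hv (by omega) hθ))
      (cupsite_const hv)
    rwa [pb_pb] at this
  obtain ⟨ξ, x1, x2⟩ := hc.bd ((hom_pr₁ (S := Y) (S' := S)).bd hτ0)
  have key : ∀ C : Set V, v ∈ C → Ctr (S.on C) → ∃ χ, Cc (S.on C) q χ ∧ (∀ᶠ l in S.F, l ∈ Lst C → θ l = cd χ l) ∧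
      ∃ τ', Zc Y (p + q) τ' ∧ Coh (Y.prod (S.on C)) (p + q) (cross σ χ + ξ) (pb Prod.fst τ') := by
    intro C hC hctr
    obtain ⟨χ, c1, c2⟩ := hctr.bd (by omega) (hθ.on C)
    rw [add_sub_cancel_right] at c1
    refine ⟨χ, c1, ev_on.1 c2, ?_⟩
    have hz : Zc (Y.prod (S.on C)) (p + q) (cross σ χ + ξ) := by
      have e1 : Cc (Y.prod (S.on C)) (p + q) ξ := by
        rw [prod_on]; exact (x1.of_eq' (by ring)).on _
      refine .of_cc ((hσ.toCc.cross c1).add e1) ?_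
      have hcl := (tendsto_comap (f := (List.map Prod.fst : List (W × V) → _))).mono_left
        (inf_le_left (b := comap (List.map Prod.snd) (S.on C).F)) |>.eventually (Y.hF.van hσ.cl)
      have hθχ := (tendsto_comap (f := (List.map Prod.snd : List (W × V) → _))).mono_left
        (inf_le_right (a := comap (List.map Prod.fst) Y.F)) |>.eventually ((S.on C).hF _ c2)
      have hx : ∀ᶠ l in (Y.prod (S.on C)).F, cross σ θ l = cd ξ l := by
        rw [prod_on, ev_on]; exact x2.mono fun l hl _ => hl
      filter_upwards [hcl, hθχ, hx] with l h1 h2 h3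
      rw [cd_add, Pi.add_apply, ← h3, cross, cross, cd_cup (by exact hσ.deg.nil) (by exact c1.deg.nil), Pi.add_apply,
        cup_loc (Or.inl ?_), zero_add, cd_pb, ← Pi.add_apply, ← cup_add_right, ← pb_add]
      · refine cup_loc (Or.inr fun l' hl' => ?_)
        have := h2 (l'.map Prod.snd) (List.map_subset _ hl')
        rw [pb, Pi.add_apply, this, CharTwo.add_self_eq_zero]
      · rw [cd_pb]
        exact fun l' hl' => h1 _ (List.map_subset _ hl')
    have hr := hctr.rk (k := p + q) (Y := Y) _ (hom_swap.zc hz) v (hv.on hC)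
    have h3 := hom_swap.coh hr
    refine ⟨_, (hom_swap.comp (hom_slice (S' := Y) (hv.on hC))).zc hz, ?_⟩
    simp only [pb_pb] at h3 ⊢
    rw [show (Prod.swap ∘ Prod.swap : W × V → W × V) = id from rfl, pb_id] at h3
    exact h3
  obtain ⟨χ₁, a1, a2, τ₁, a3, a4⟩ := key A hA h1
  obtain ⟨χ₂, b1, b2, τ₂, b3, b4⟩ := key B hB h2
  have e1 := a1.on B
  have e2 := b1.on A
  rw [on_on] at e1 e2
  rw [Set.inter_comm] at e2
  have hz : Zc (S.on (A ∩ B)) q (χ₁ + χ₂) := by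
    refine .of_cc (e1.add e2) (ev_on.2 ?_)
    filter_upwards [a2, b2] with l c1 c2 hl
    have hl := lst_inter.1 hl
    rw [cd_add, Pi.add_apply, ← c1 hl.1, ← c2 hl.2, CharTwo.add_self_eq_zero]
  have hc' : Coh (Y.prod (S.on (A ∩ B))) (p + q) (cross σ (χ₁ + χ₂)) (pb Prod.fst (τ₁ + τ₂)) := by
    rw [prod_on] at a4 b4 ⊢
    have := (a4.on_mono (A := Prod.snd ⁻¹' (A ∩ B)) fun x hx => hx.1).add
      (b4.on_mono (A := Prod.snd ⁻¹' (A ∩ B)) fun x hx => hx.2)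
    rw [add_add_add_comm, add_add_add_comm (CatCone.cross σ χ₁), coch_add_self, add_zero, ← cross_add_right] at this
    exact this
  refine (hJ Y p σ _ _ hσ hz (a3.add b3) hc').imp_right fun hcst => ?_
  have h3 := hcst.all (hv.on ⟨hA, hB⟩)
  have hκ : Zc S q (pb (fun _ => v) (χ₁ + χ₂)) := by
    have := (hom_pt (hv.on (A := A ∩ B) ⟨hA, hB⟩)).zc hz
    refine ⟨this.deg, Free.inv _, by rw [Abs.bot (S := S)]; exact eventually_bot, ?_⟩
    rw [cd_pb]; exact pt_ev (hv.on (A := A ∩ B) ⟨hA, hB⟩) hz.cl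
  refine Bd.cst hv (Bd.glue ht (χ₁ := χ₁) (χ₂ := χ₂ + pb (fun _ => v) (χ₁ + χ₂)) (a1.of_eq' (by ring))
    ((b1.add (hκ.toCc.on B)).of_eq' (by ring)) a2 ?_ ?_)
  · filter_upwards [b2, hκ.cl] with l h1 h2 hl
    rw [cd_add, Pi.add_apply, ← h1 hl, h2, add_zero]
  · rw [add_sub_cancel_right]
    refine Bd.congr h3 (Eventually.of_forall fun l => ?_)
    simp only [Pi.add_apply]; ring

theorem Rk.zero_coh [Abs S] (h : Ctr S) (h0 : Zc S 0 φ) {v : V} (hv : S.Pt v) :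
    ∀ᶠ l in S.F, φ l = pb (fun _ => v) φ l := by
  obtain ⟨χ, h1, h2⟩ := (h.cst h0).all hv
  rw [h1.deg.eq_zero (by norm_num), cd_zero] at h2
  exact h2.mono fun l hl => CharTwo.add_eq_zero.1 hl

theorem J.base {V : Type} {S : Site V} [Abs S] {A B : Set V} (ht : Thick S A B) {a b : V}
    (ha : S.Pt a) (hb : S.Pt b) (hA : a ∈ A) (hB : b ∈ B) (h1 : Ctr (S.on A)) (h2 : Ctr (S.on B)) : J S 0 := by
  intro W Y _ p σ θ τ hσ hθ hτ hc
  by_cases he : θ [a] = θ [b]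
  · right
    have e1 := ev_on.1 (Rk.zero_coh h1 (hθ.on A) (ha.on hA))
    have e2 := ev_on.1 (Rk.zero_coh h2 (hθ.on B) (hb.on hB))
    rw [deg_zero_pt hθ.deg] at e1 e2
    rw [← he] at e2
    refine ⟨a, ha, Bd.zero.congr ?_⟩
    rw [deg_zero_pt hθ.deg]
    filter_upwards [ht, e1, e2] with l h e1 e2
    rw [Pi.add_apply, h.elim e1 e2]; exact (CharTwo.add_self_eq_zero _).symm
  · left
    have h3 := (coh_slice ha hc).trans (coh_slice hb hc).symm
    rw [Coh, ← cup_add_right, deg_zero_pt hθ.deg, deg_zero_pt hθ.deg] at h3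
    have : (fun l : List W => if l.length = 1 then θ [a] else 0) + (fun l => if l.length = 1 then θ [b] else 0)
        = fun l => if l.length = 1 then 1 else 0 := by
      funext l
      rw [Pi.add_apply]
      split_ifs
      · revert he; generalize θ [a] = x; generalize θ [b] = y; revert x y; decide
      · rfl
    rw [this, cup_unit_right _ hσ.deg.nil, add_zero] at h3
    exact h3

/-- Mayer–Vietoris construction of classes. -/
theorem exists_mv [Abs S] (ht : Thick S A B) {σ : Coch V} (hσ : Zc (S.on (A ∩ B)) q σ) :
    ∃ θ, Zc S (q + 1) θ ∧ (∀ᶠ l in S.F, l ∈ Lst A → θ l = cd (cut (A ∩ B) σ) l) ∧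
      ∀ᶠ l in S.F, l ∈ Lst B → θ l = 0 := by
  have h0 : Cc S (q + 1) (cd (cut (A ∩ B) σ)) := (hσ.toCc.of_on).cd.toCc
  obtain ⟨θ, h1, h2, h3⟩ := glue_aux ht (h0.on A) (Cc.zero (S := S.on B)) (by
    filter_upwards [ev_on.1 hσ.cl] with l hl h1 h2
    rw [cd_cut (lst_inter.2 ⟨h1, h2⟩), hl (lst_inter.2 ⟨h1, h2⟩)]; rfl)
  refine ⟨θ, .of_cc h1 ?_, h2, h3⟩
  filter_upwards [ht, ev_cd S.hF h2, ev_cd S.hF h3] with l h h2 h3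
  rcases h with h | h
  · rw [h2 h, cd_cd]; rfl
  · rw [h3 h, cd_zero]; rfl

theorem mv_cst [Abs S] {v : V} (hv : S.Pt v) (hA : v ∈ A) (hB : v ∈ B) (h1 : ∀ φ, Zc (S.on A) q φ → Cst (S.on A) q φ)
    (h2 : ∀ φ, Zc (S.on B) q φ → Cst (S.on B) q φ) {σ θ : Coch V} (hσ : Zc (S.on (A ∩ B)) q σ)
    (h3 : ∀ᶠ l in S.F, l ∈ Lst A → θ l = cd (cut (A ∩ B) σ) l)
    (h4 : ∀ᶠ l in S.F, l ∈ Lst B → θ l = 0) (h5 : Bd S (q + 1) θ) : Cst (S.on (A ∩ B)) q σ := by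
  obtain ⟨ξ, x1, x2⟩ := h5
  rw [add_sub_cancel_right] at x1
  have c1 : Zc (S.on A) q (cut (A ∩ B) σ + ξ) := .of_cc ((hσ.toCc.of_on.add x1).on A) (ev_on.2 (by
    filter_upwards [h3, x2] with l h3 h4 hl
    rw [cd_add, Pi.add_apply, ← h3 hl, h4, CharTwo.add_self_eq_zero]))
  have c2 : Zc (S.on B) q ξ := .of_cc (x1.on B) (ev_on.2 (by
    filter_upwards [h4, x2] with l h3 h4 hl
    rw [← h4, h3 hl]))
  have d1 := (h1 _ c1).on (A := B) (hv.on hA) hB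
  have d2 := (h2 _ c2).on (A := A) (hv.on hB) hA
  rw [on_on] at d1 d2
  rw [Set.inter_comm] at d2
  refine (d1.add d2).congr (Bd.zero.congr (ev_on.2 (Eventually.of_forall fun l hl => ?_)))
  simp only [Pi.add_apply, cut_of hl, Pi.zero_apply]
  grind

theorem NC.mv [Abs S] (ht : Thick S A B) {v : V} (hv : S.Pt v) (hA : v ∈ A) (hB : v ∈ B) (h1 : Ctr (S.on A))
    (h2 : Ctr (S.on B)) (hq : 0 ≤ q) (h : NC (S.on (A ∩ B)) q) : NC S (q + 1) := by
  obtain ⟨σ, s1, s2⟩ := h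
  obtain ⟨θ, t1, t2, t3⟩ := exists_mv ht s1
  exact ⟨θ, t1, fun hc => s2 (mv_cst hv hA hB (fun _ h => h1.cst h) (fun _ h => h2.cst h) s1 t2 t3
    (hc.bd t1 (by omega)))⟩

theorem NC.base [Abs S] (ht : Thick S A B) (hAB : A ∩ B = ∅) {a b : V} (ha : S.Pt a) (hb : S.Pt b) (hA : a ∈ A)
    (hB : b ∈ B) : NC S 0 := by
  classical
  let φ : Coch V := fun l => if l.length = 1 ∧ l ∈ Lst A then 1 else 0
  have hbA : b ∉ A := fun h => hAB.le ⟨h, hB⟩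
  have hd : Deg 0 φ := fun l hl => by
    have h1 : l.length = 1 := by
      by_contra h; exact hl (if_neg fun h' => h h'.1)
    exact ⟨fun h => by simp [h] at h1, by simp [h1]⟩
  refine ⟨φ, ⟨hd, Free.inv _, by rw [Abs.bot (S := S)]; exact eventually_bot, ?_⟩, fun hc => ?_⟩
  · have hv : ∀ l : List V, cd (fun l : List V => if l.length = 1 then (1 : ZMod 2) else 0) l = 0 := by
      intro l
      match l with
      | [] => rfl
      | [a] => simp [cd_cons]
      | [a, b] => simp [cd_cons, sh]; decide
      | a :: b :: c :: l =>
        by_contra h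
        have h1 : Deg 0 (fun l : List V => if l.length = 1 then (1 : ZMod 2) else 0) := fun l hl => by
          have h1 : l.length = 1 := by by_contra h; exact hl (if_neg h)
          exact ⟨fun h => by simp [h] at h1, by simp [h1]⟩
        have := (h1.cd _ h).2
        simp at this; omega
    filter_upwards [ht] with l h
    rcases h with h | h
    · rw [cd_congr (χ' := fun l => if l.length = 1 then 1 else 0) fun l' hl' => ?_, hv]
      simp [φ, Lst.mono h hl']
    · rw [cd_congr (χ' := 0) fun l' hl' => ?_, cd_zero]; · rfl
      refine if_neg fun h' => ?_
      obtain ⟨x, hx⟩ := List.length_eq_one_iff.1 h'.1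
      have h1 := h'.2 x (by simp [hx])
      have h2 := Lst.mono h hl' x (by simp [hx])
      exact absurd (hAB.le ⟨h1, h2⟩) (Set.notMem_empty x)
  · obtain ⟨χ, h1, h2⟩ := hc.all ha
    rw [h1.deg.eq_zero (by norm_num), cd_zero] at h2
    have := hb.ev h2 (l := [b]) (by simp)
    simp [φ, Lst, hbA, hA, pb] at this

end

section
open Filter Function Topology

variable {U V W X : Type*} {S : Site V} {S' : Site W} {n m k : ℤ} {φ ψ χ χ' : Coch V} {h : V → W}

/-- The entries of a list coming from the left summand. -/
def lft (l : List (V ⊕ W)) : List V := l.filterMap Sum.getLeft?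

theorem mem_lft {l : List (V ⊕ W)} {x : V} : x ∈ lft l ↔ Sum.inl x ∈ l := by
  simp [lft, List.mem_filterMap]

theorem lft_mono {l l' : List (V ⊕ W)} (h : l' ⊆ l) : lft l' ⊆ lft l := fun _ hx => mem_lft.2 (h (mem_lft.1 hx))

theorem lft_inl (l : List V) : lft (l.map Sum.inl : List (V ⊕ W)) = l := by
  induction l with
  | nil => rfl
  | cons a l ih => simpa [lft] using ih

theorem lft_inr (l : List W) : lft (l.map Sum.inr : List (V ⊕ W)) = [] := by
  induction l with
  | nil => rfl
  | cons a l ih => simpa [lft] using ih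

theorem lft_map {V' W' : Type*} {α : V → V'} {β : W → W'} (l : List (V ⊕ W)) :
    lft (l.map (Sum.map α β)) = (lft l).map α := by
  induction l with
  | nil => rfl
  | cons a l ih =>
    rcases a with a | a
    · exact congrArg (α a :: ·) ih
    · exact ih

theorem Her.comap_mono {F : Filter (List W)} (h : Her F) {f : List V → List W} (hf : ∀ l l', l' ⊆ l → f l' ⊆ f l) :
    Her (F.comap f) := by
  intro p hp
  rw [eventually_comap] at hp ⊢
  filter_upwards [h _ hp] with l hl a ha l' hl'
  exact hl (f l') (ha ▸ hf _ _ hl') l' rfl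

theorem her_pure : Her (pure [] : Filter (List V)) := by
  intro p hp
  rw [eventually_pure] at *
  intro l' hl'
  rwa [List.subset_nil.1 hl']

def rho (h : V → W) : V ⊕ W → W := Sum.elim h id

/-- The mapping cylinder of a map of sites. -/
def cyl (h : V → W) (S : Site V) (S' : Site W) : Site (V ⊕ W) where
  F := S'.F.comap (List.map (rho h)) ⊓ (S.F ⊔ pure []).comap lft
  G := S'.G.comap (List.map (rho h)) ⊓ (S.G ⊔ pure []).comap lft
  I := ∅
  hF := (S'.hF.comap' _).inf ((S.hF.sup her_pure).comap_mono fun _ _ => lft_mono)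
  hG := (S'.hG.comap' _).inf ((S.hG.sup her_pure).comap_mono fun _ _ => lft_mono)
  le := inf_le_inf (comap_mono S'.le) (comap_mono (sup_le_sup_right S.le _))

/-- The mapping cone of a map of sites. -/
def cone (h : V → W) (S : Site V) (S' : Site W) : Site (V ⊕ W) := (cyl h S S').rel (Set.range Sum.inl)

instance : Free (cyl h S S') := ⟨rfl⟩
instance : Free (cone h S S') := inferInstanceAs (Free ((cyl h S S').rel _))
instance [hS : Abs S'] : Abs (cyl h S S') := ⟨by simp [cyl, hS.bot]⟩

theorem hom_rho : (cyl h S S').Hom S' (rho h) :=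
  Free.hom (tendsto_comap.mono_left inf_le_left) (tendsto_comap.mono_left inf_le_left)

theorem map_rho_inl (l : List V) : (l.map Sum.inl).map (rho h) = l.map h := by rw [List.map_map]; rfl
theorem map_rho_inr (l : List W) : (l.map Sum.inr).map (rho h) = l := by
  rw [List.map_map, show rho h ∘ Sum.inr = id from rfl, List.map_id_fun]; rfl

theorem tendsto_pure_nil {F : Filter (List V)} {G : Filter (List W)} :
    Tendsto (fun _ => []) F (G ⊔ pure []) := (tendsto_pure_pure (fun _ => []) ([] : List W)).mono_right le_sup_right
      |>.comp (tendsto_pure.2 (Eventually.of_forall fun _ => rfl) : Tendsto (fun _ : List V => ([] : List W)) F (pure []))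

theorem hom_inr [Free S'] : S'.Hom (cyl h S S') Sum.inr := by
  refine Free.hom (tendsto_inf.2 ⟨tendsto_comap_iff.2 ?_, tendsto_comap_iff.2 ?_⟩)
    (tendsto_inf.2 ⟨tendsto_comap_iff.2 ?_, tendsto_comap_iff.2 ?_⟩)
  · simp only [Function.comp_def, map_rho_inr]; exact tendsto_id
  · simp only [Function.comp_def, lft_inr]; exact tendsto_pure_nil
  · simp only [Function.comp_def, map_rho_inr]; exact tendsto_id
  · simp only [Function.comp_def, lft_inr]; exact tendsto_pure_nil

theorem hom_inl [Free S] (hh : S.Hom S' h) : S.Hom (cyl h S S') Sum.inl := by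
  refine Free.hom (tendsto_inf.2 ⟨tendsto_comap_iff.2 ?_, tendsto_comap_iff.2 ?_⟩)
    (tendsto_inf.2 ⟨tendsto_comap_iff.2 ?_, tendsto_comap_iff.2 ?_⟩)
  · simp only [Function.comp_def, map_rho_inl]; exact hh.tF
  · simp only [Function.comp_def, lft_inl]; exact tendsto_id.mono_right le_sup_left
  · simp only [Function.comp_def, map_rho_inl]; exact hh.tG
  · simp only [Function.comp_def, lft_inl]; exact tendsto_id.mono_right le_sup_left

theorem hom_cone [Free S'] : S'.Hom (cone h S S') Sum.inr :=
  (hom_rel (S := cyl h S S')).comp (hom_inr (S' := S'))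

theorem ev_inl {p : List V → Prop} (hp : ∀ᶠ l in S.F, p l) (h0 : p []) :
    ∀ᶠ l in (cyl h S S').F, p (lft l) :=
  (tendsto_comap.mono_left inf_le_right : Tendsto lft (cyl h S S').F _).eventually (eventually_sup.2 ⟨hp, by simpa⟩)

theorem ev_inlG {p : List V → Prop} (hp : ∀ᶠ l in S.G, p l) (h0 : p []) :
    ∀ᶠ l in (cyl h S S').G, p (lft l) :=
  (tendsto_comap.mono_left inf_le_right : Tendsto lft (cyl h S S').G _).eventually (eventually_sup.2 ⟨hp, by simpa⟩)

theorem lst_inl {l : List (V ⊕ W)} (hl : l ∈ Lst (Set.range Sum.inl)) : (lft l).map Sum.inl = l := by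
  induction l with
  | nil => rfl
  | cons a l ih =>
    obtain ⟨x, rfl⟩ := hl a (by simp)
    exact congrArg (Sum.inl x :: ·) (ih fun y hy => hl y (by simp [hy]))

theorem map_inl_lst (m : List V) : (m.map Sum.inl : List (V ⊕ W)) ∈ Lst (Set.range Sum.inl) := fun x hx => by
  obtain ⟨y, _, rfl⟩ := List.mem_map.1 hx; exact ⟨y, rfl⟩

theorem map_inr_lft {l : List (V ⊕ W)} {f : V ⊕ W → W} {l' : List (V ⊕ W)}
    (h' : l' ⊆ l.map (fun x => Sum.inr (f x)) ++ l) : lft l' ⊆ lft l := fun x hx => by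
  have := h' (mem_lft.1 hx)
  rcases List.mem_append.1 this with h1 | h1
  · obtain ⟨y, _, hy⟩ := List.mem_map.1 h1; cases hy
  · exact mem_lft.2 h1

theorem tendsto_cyl_her {F : Filter (List W)} {G : Filter (List V)} (hF : Her F) (hG : Her G) {p : List (V ⊕ W) → Prop}
    (hp : ∀ᶠ l in F.comap (List.map (rho h)) ⊓ G.comap lft, p l) :
    ∀ᶠ l in F.comap (List.map (rho h)) ⊓ G.comap lft, ∀ l',
      l' ⊆ l.map (fun x => Sum.inr (rho h x)) ++ l → p l' := by
  obtain ⟨s, hs, t, ht, hst⟩ := mem_inf_iff.1 hp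
  obtain ⟨s', hs', hs⟩ := mem_comap.1 hs
  obtain ⟨t', ht', ht⟩ := mem_comap.1 ht
  have h1 := preimage_mem_comap (m := List.map (rho h)) (hF (· ∈ s') hs')
  have h2 := preimage_mem_comap (m := lft (W := W)) (hG (· ∈ t') ht')
  filter_upwards [mem_inf_of_left h1, mem_inf_of_right h2] with l hl1 hl2 l' hl'
  change l' ∈ {l | p l}
  rw [show {l | p l} = s ∩ t from hst]
  refine ⟨hs (hl1 _ ?_), ht (hl2 _ (map_inr_lft hl'))⟩
  intro x hx
  obtain ⟨y, hy, rfl⟩ := List.mem_map.1 hx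
  rcases List.mem_append.1 (hl' hy) with h3 | h3
  · obtain ⟨z, hz, rfl⟩ := List.mem_map.1 h3
    exact List.mem_map.2 ⟨z, hz, rfl⟩
  · exact List.mem_map.2 ⟨y, h3, rfl⟩

theorem rho_contig {φ : Coch (V ⊕ W)} (hφ : Zc (cyl h S S') n φ) :
    Coh (cyl h S S') n (pb (rho h) (pb Sum.inr φ)) φ := by
  have h1 := coh_contig (S := cyl h S S') (f := fun x => Sum.inr (rho h x)) (g := id) hφ.deg
    (by rw [List.map_id_fun]; exact tendsto_cyl_her S'.hF (S.hF.sup her_pure) hφ.cl)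
    (by rw [List.map_id_fun]; exact tendsto_cyl_her S'.hG (S.hG.sup her_pure) hφ.rel)
  rw [pb_id] at h1
  rwa [pb_pb]

open Classical in
/-- Extension by zero of a cochain along the left inclusion. -/
def ext (w : Coch V) : Coch (V ⊕ W) := fun l => if l ∈ Lst (Set.range Sum.inl) then w (lft l) else 0

theorem pb_ext (w : Coch V) : pb Sum.inl (ext w : Coch (V ⊕ W)) = w := by
  funext l
  simp only [pb, ext, if_pos (map_inl_lst l), lft_inl]

theorem ext_pb (φ : Coch (V ⊕ W)) {l : List (V ⊕ W)} (hl : l ∈ Lst (Set.range Sum.inl)) :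
    ext (pb Sum.inl φ) l = φ l := by
  simp only [ext, if_pos hl, pb, lst_inl hl]

theorem ext_add (w w' : Coch V) : (ext (w + w') : Coch (V ⊕ W)) = ext w + ext w' := by
  funext l
  by_cases hl : l ∈ Lst (Set.range Sum.inl) <;> simp [ext, hl]

theorem ext_zero : (ext (0 : Coch V) : Coch (V ⊕ W)) = 0 := by
  funext l
  by_cases hl : l ∈ Lst (Set.range Sum.inl) <;> simp [ext, hl]

theorem pb_map_ext {V' W' : Type*} {α : V → V'} {β : W → W'} (w : Coch V') :
    pb (Sum.map α β) (ext w) = (ext (pb α w) : Coch (V ⊕ W)) := by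
  funext l
  have : l.map (Sum.map α β) ∈ Lst (Set.range (Sum.inl : V' → V' ⊕ W')) ↔ l ∈ Lst (Set.range (Sum.inl : V → V ⊕ W)) := by
    simp only [Lst, Set.mem_setOf_eq, List.forall_mem_map]
    refine forall₂_congr fun x _ => ?_
    rcases x with x | x <;> simp
  by_cases hl : l ∈ Lst (Set.range (Sum.inl : V → V ⊕ W))
  · simp only [pb, ext, if_pos hl, if_pos (this.2 hl), lft_map]
  · simp only [pb, ext, if_neg hl, if_neg (mt this.1 hl)]

theorem Deg.ext {w : Coch V} (hw : Deg n w) : Deg n (CatCone.ext w : Coch (V ⊕ W)) := fun l hl => by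
  by_cases hA : l ∈ Lst (Set.range Sum.inl)
  · simp only [CatCone.ext, if_pos hA] at hl
    rw [← lst_inl hA]
    simpa using hw _ hl
  · exact absurd (if_neg hA) hl

theorem Cc.ext {w : Coch V} (hw : Cc S n w) : Cc (cyl h S S') n (CatCone.ext w) :=
  ⟨hw.deg.ext, Free.inv _, by
    filter_upwards [ev_inlG hw.rel hw.deg.nil] with l hl
    simp only [CatCone.ext, hl, ite_self]⟩

/-- The connecting map. -/
def del (w : Coch V) : Coch (V ⊕ W) := cd (ext w)

/-- The class on a mapping cone of a cocycle on the target and a primitive on the source. -/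
def brk (h : V → W) (c : Coch W) (w : Coch V) : Coch (V ⊕ W) := pb (rho h) c + del w

theorem ev_inl_iff {φ : Coch (V ⊕ W)} (h0 : φ [] = 0) (hφ : ∀ᶠ l in S.F, pb Sum.inl φ l = 0) :
    ∀ᶠ l in (cyl h S S').F, l ∈ Lst (Set.range Sum.inl) → φ l = 0 := by
  filter_upwards [ev_inl hφ h0] with l hl hA
  rwa [pb, lst_inl hA] at hl

theorem Zc.brk [Free S] {c : Coch W} {w : Coch V} (hc : Zc S' n c) (hw : Cc S (n - 1) w)
    (e : ∀ᶠ l in S.F, pb h c l = cd w l) : Zc (cone h S S') n (brk h c w) := by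
  have h1 : Zc (cyl h S S') n (CatCone.brk h c w) := (hom_rho.zc hc).add ((hw.ext.cd).of_eq' (by ring))
  refine h1.mk_rel (ev_inl_iff h1.deg.nil ?_)
  filter_upwards [e] with l hl
  rw [CatCone.brk, del, pb_add, ← cd_pb, pb_ext, Pi.add_apply, ← hl]
  simp only [pb, map_rho_inl]
  exact CharTwo.add_self_eq_zero _

theorem cone_bd {φ : Coch (V ⊕ W)} (hc : Cc (cyl h S S') (n - 1) φ) (hφ : ∀ᶠ l in S.F, pb Sum.inl φ l = 0) :
    Bd (cone h S S') n (cd φ) :=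
  Cc.bd' ⟨hc.deg, Free.inv _, ev_rel.2 ⟨hc.rel, ev_inl_iff hc.deg.nil hφ⟩⟩

theorem Zc.del {w : Coch V} (hw : Zc S n w) : Zc (cone h S S') (n + 1) (del w) :=
  (hw.toCc.ext.cd).mk_rel (ev_inl_iff hw.deg.ext.cd.nil (by
    filter_upwards [hw.cl] with l hl
    rw [← cd_pb, pb_ext, hl]))

theorem Zc.del' {w : Coch V} (hw : Zc S (n - 1) w) : Zc (cone h S S') n (CatCone.del w) := hw.del.of_eq' (by ring)

theorem del_add (w w' : Coch V) : (del (w + w') : Coch (V ⊕ W)) = del w + del w' := by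
  rw [del, ext_add, cd_add]; rfl

theorem Bd.del {w : Coch V} (hw : Bd S (n - 1) w) (hz : Cc S (n - 1) w) : Bd (cone h S S') n (del w) := by
  obtain ⟨ξ, h1, h2⟩ := hw
  have h3 : CatCone.del w = cd (CatCone.ext w + cd (CatCone.ext ξ) : Coch (V ⊕ W)) := by rw [cd_add, cd_cd, add_zero]; rfl
  rw [h3]
  refine cone_bd (hz.ext.add (h1.ext.cd.toCc.of_eq' (by ring))) ?_
  filter_upwards [h2] with l hl
  rw [pb_add, ← cd_pb, pb_ext, pb_ext, Pi.add_apply, hl]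
  exact CharTwo.add_self_eq_zero _

theorem Coh.del {w w' : Coch V} (hw : Zc S (n - 1) w) (hw' : Zc S (n - 1) w') (e : Coh S (n - 1) w w') :
    Coh (cone h S S') n (CatCone.del w) (CatCone.del w') := by
  rw [Coh, ← del_add]; exact Bd.del e (hw.add hw').toCc

theorem brk_add (c c' : Coch W) (w w' : Coch V) : brk h (c + c') (w + w') = brk h c w + brk h c' w' := by
  rw [brk, brk, brk, pb_add, del_add]; abel

/-- Every class on a mapping cone is represented by a bracket. -/
theorem cone_rep [Free S] [Free S'] (hh : S.Hom S' h) {φ : Coch (V ⊕ W)} (hφ : Zc (cone h S S') n φ) :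
    ∃ w, Cc S (n - 1) w ∧ (∀ᶠ l in S.F, pb h (pb Sum.inr φ) l = cd w l) ∧
      Coh (cone h S S') n φ (brk h (pb Sum.inr φ) w) := by
  have h1 : Zc (cyl h S S') n φ := hφ.of_rel
  obtain ⟨χ, h2, h3⟩ := rho_contig h1
  have h4 : ∀ᶠ l in S.F, pb Sum.inl φ l = 0 := by
    filter_upwards [(hom_inl hh).tF.eventually (ev_rel.1 hφ.rel).2] with l hl
    exact hl (map_inl_lst l)
  refine ⟨pb Sum.inl χ, (hom_inl hh).cc h2, ?_, ?_⟩
  · filter_upwards [h4, (hom_inl hh).tF.eventually h3] with l h4 h3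
    rw [cd_pb]
    change _ = cd χ (l.map Sum.inl)
    rw [← h3, Pi.add_apply, show φ (l.map Sum.inl) = 0 from h4, add_zero]
    simp only [pb, map_rho_inl, List.map_map]; rfl
  · have h5 : Bd (cone h S S') n (cd (χ + ext (pb Sum.inl χ))) := by
      refine cone_bd (h2.add ((hom_inl hh).cc h2).ext) (Eventually.of_forall fun l => ?_)
      rw [pb_add, pb_ext, coch_add_self]; rfl
    refine h5.congr ?_
    filter_upwards [show ∀ᶠ l in (cone h S S').F, _ from h3] with l hl
    rw [cd_add, Pi.add_apply, ← hl, brk]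
    simp only [Pi.add_apply, del]
    ring

theorem cone_of_bd [Free S] [Free S'] (hh : S.Hom S' h) {φ : Coch (V ⊕ W)} (hφ : Zc (cone h S S') n φ)
    (hb : Bd S' n (pb Sum.inr φ)) : ∃ w, Zc S (n - 1) w ∧ Coh (cone h S S') n φ (del w) := by
  obtain ⟨w, h1, h2, h3⟩ := cone_rep hh hφ
  obtain ⟨b, h4, h5⟩ := hb
  have h6 := hh.cc h4
  refine ⟨w + pb h b, Zc.of_cc (h1.add h6) ?_, h3.trans ?_⟩
  · filter_upwards [h2, hh.tF.eventually h5] with l h2 h5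
    rw [cd_add, Pi.add_apply, ← h2, cd_pb]
    change pb Sum.inr φ (l.map h) + cd b (l.map h) = 0
    rw [h5]; exact CharTwo.add_self_eq_zero _
  · have h7 : Bd (cone h S S') n (cd (pb (rho h) b + ext (pb h b))) := by
      refine cone_bd ((hom_rho.cc h4).add h6.ext) (Eventually.of_forall fun l => ?_)
      rw [pb_add, pb_ext, pb_pb]
      exact CharTwo.add_self_eq_zero _
    refine h7.congr ?_
    filter_upwards [(hom_rho (h := h) (S := S) (S' := S')).tF.eventually h5] with l hl
    rw [brk, del_add, cd_add, cd_pb]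
    simp only [Pi.add_apply, pb, del] at hl ⊢
    rw [hl]; grind

theorem del_bd [Free S] [Free S'] (hh : S.Hom S' h) {w : Coch V} (hw : Zc S (n - 1) w) (hb : Bd (cone h S S') n (del w)) :
    ∃ b, Zc S' (n - 1) b ∧ Coh S (n - 1) w (pb h b) := by
  obtain ⟨χ, h1, h2⟩ := hb
  obtain ⟨h3, h4⟩ := ev_rel.1 h1.rel
  have h5 : Zc (cyl h S S') (n - 1) (ext w + χ) := Zc.of_cc (hw.toCc.ext.add ⟨h1.deg, Free.inv _, h3⟩) (by
    filter_upwards [show ∀ᶠ l in (cyl h S S').F, _ from h2] with l hl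
    rw [cd_add, Pi.add_apply, ← hl]; exact CharTwo.add_self_eq_zero _)
  refine ⟨_, hom_inr.zc h5, ?_⟩
  have h6 := (hom_inl hh).coh (rho_contig h5)
  rw [pb_pb, pb_add Sum.inl (ext w), pb_ext] at h6
  refine Coh.trans ?_ h6.symm
  refine Bd.zero.congr ?_
  filter_upwards [(hom_inl hh).tF.eventually h4] with l hl
  simp only [Pi.add_apply]
  have : pb Sum.inl χ l = 0 := hl (map_inl_lst l)
  rw [this]; simp only [Pi.zero_apply]; grind

theorem del_bd' [Free S] [Free S'] (hh : S.Hom S' h) {w : Coch V} (hw : Zc S (n - 1) w) (hb : Bd (cone h S S') n (del w))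
    (hz : Hz S' (n - 1)) : Bd S (n - 1) w := by
  obtain ⟨b, h1, h2⟩ := del_bd hh hw hb
  exact h2.bd (hh.bd (hz b h1))

theorem Hz.cone [Free S] [Free S'] (hh : S.Hom S' h) (h1 : Hz S' n) (h2 : Hz S (n - 1)) : Hz (cone h S S') n := fun φ hφ => by
  obtain ⟨w, h3, h4⟩ := cone_of_bd hh hφ (h1 _ (hom_cone.zc hφ))
  exact h4.bd ((h2 w h3).del h3.toCc)

variable {V' W' : Type*} {T : Site V'} {T' : Site W'} {h' : V' → W'} {α : V → V'} {β : W → W'}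

theorem ev_map_rho (e : ∀ᶠ l in S.F, ∀ x ∈ l, β (h x) = h' (α x)) : ∀ᶠ l in (cyl h S S').F,
    (l.map (Sum.map α β)).map (rho h') = (l.map (rho h)).map β := by
  filter_upwards [ev_inl e (by simp)] with l hl
  rw [List.map_map, List.map_map]
  refine List.map_congr_left fun x hx => ?_
  rcases x with x | x
  · exact (hl x (mem_lft.2 hx)).symm
  · rfl

/-- Maps of mapping cylinders. -/
theorem hom_cyl (hα : S.Hom T α) (hβ : S'.Hom T' β) (e : ∀ᶠ l in S.F, ∀ x ∈ l, β (h x) = h' (α x)) :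
    (cyl h S S').Hom (cyl h' T T') (Sum.map α β) := by
  have h1 := ev_map_rho (S' := S') e
  have h2 := h1.filter_mono (cyl h S S').le
  have h3 : Tendsto (List.map α) (pure []) (pure []) := tendsto_pure_pure _ _
  refine Free.hom (tendsto_inf.2 ⟨tendsto_comap_iff.2 ?_, tendsto_comap_iff.2 ?_⟩)
    (tendsto_inf.2 ⟨tendsto_comap_iff.2 ?_, tendsto_comap_iff.2 ?_⟩)
  · refine Tendsto.congr' (h1.mono fun l hl => hl.symm) ?_
    exact hβ.tF.comp (tendsto_comap.mono_left inf_le_left)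
  · simp only [Function.comp_def, lft_map]
    exact (hα.tF.sup_sup h3).comp (tendsto_comap.mono_left inf_le_right)
  · refine Tendsto.congr' (h2.mono fun l hl => hl.symm) ?_
    exact hβ.tG.comp (tendsto_comap.mono_left inf_le_left)
  · simp only [Function.comp_def, lft_map]
    exact (hα.tG.sup_sup h3).comp (tendsto_comap.mono_left inf_le_right)

theorem hom_map_cone (hα : S.Hom T α) (hβ : S'.Hom T' β) (e : ∀ᶠ l in S.F, ∀ x ∈ l, β (h x) = h' (α x)) :
    (cone h S S').Hom (cone h' T T') (Sum.map α β) := by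
  have h1 := hom_cyl hα hβ e
  refine Free.hom h1.tF ?_
  refine h1.tG.sup_sup (h1.tF.inf (tendsto_principal_principal.2 fun l hl x hx => ?_))
  obtain ⟨y, hy, rfl⟩ := List.mem_map.1 hx
  obtain ⟨z, rfl⟩ := hl y hy
  exact ⟨α z, rfl⟩

theorem pb_map_del (w : Coch V') : pb (Sum.map α β) (del w) = del (pb α w) := by
  rw [del, ← cd_pb, pb_map_ext]; rfl

theorem pb_map_brk (e : ∀ᶠ l in S.F, ∀ x ∈ l, β (h x) = h' (α x)) (c : Coch W') (w : Coch V') :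
    Coh (cone h S S') n (pb (Sum.map α β) (brk h' c w)) (brk h (pb β c) (pb α w)) := by
  refine Bd.zero.congr ?_
  filter_upwards [show ∀ᶠ l in (cone h S S').F, _ from ev_map_rho (S' := S') e] with l hl
  rw [brk, brk, pb_add, pb_map_del]
  simp only [Pi.add_apply, pb, hl, Pi.zero_apply]
  grind

theorem eventually_all_of {p : V → Prop} (hp : ∀ x, p x) : ∀ᶠ l in S.F, ∀ x ∈ l, p x :=
  Eventually.of_forall fun _ x _ => hp x

end

section
open Filter Function Topology

variable {U V W X : Type} {S : Site V} {S' : Site W} {n m k : ℤ} {φ ψ χ χ' : Coch V} {A B : Set V}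

/-- Homotopy domination of sites. -/
def Dmn (S : Site V) (S' : Site W) : Prop := ∃ f g, S.Hom S' f ∧ S'.Hom S g ∧ Htpy S S (g ∘ f) id

theorem Dmn.rk {Y : Site X} [Free Y] [Abs S] [Abs S'] (h : Dmn S S') (hr : Rk S' k Y) : Rk S k Y := by
  obtain ⟨f, g, hf, hg, hh⟩ := h; exact hr.dom hf hg hh

theorem Dmn.nc [Abs S] [Abs S'] (h : Dmn S S') (hr : NC S k) : NC S' k := by
  obtain ⟨f, g, hf, hg, hh⟩ := h; exact hr.map hf hg hh

theorem Dmn.j [Abs S] [Abs S'] (h : Dmn S S') (hr : J S' k) : J S k := by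
  obtain ⟨f, g, hf, hg, hh⟩ := h; exact hr.map hf hg hh

theorem Dmn.hz [Free S] [Free S'] (h : Dmn S S') (hr : Hz S' k) : Hz S k := by
  obtain ⟨f, g, hf, hg, hh⟩ := h; exact hr.retract hf hg hh

theorem cs_on [UniformSpace V] {K L : Set V} : (CS K).on L = CS (K ∩ L) := on_on

theorem htpy_id [UniformSpace V] [UniformSpace W] {K : Set V} {L : Set W} {f g : V → W} (hK : IsCompact K)
    (hf : ContinuousOn f K) (hm : Set.MapsTo f K L) (h : ∀ x ∈ K, f x = g x) : Htpy (CS K) (CS L) f g :=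
  htpy_cs hK (fun p => f p.1) (hf.comp continuousOn_fst fun p hp => hp.1) (fun x hx _ _ => hm hx)
    (fun _ _ => rfl) h

theorem dmn_cs [UniformSpace V] [UniformSpace W] {K : Set V} {L : Set W} (hK : IsCompact K) (hL : IsCompact L)
    {f : V → W} {g : W → V} (hf : ContinuousOn f K) (hfm : Set.MapsTo f K L) (hg : ContinuousOn g L)
    (hgm : Set.MapsTo g L K) (h : Htpy (CS K) (CS K) (g ∘ f) id) : Dmn (CS K) (CS L) :=
  ⟨f, g, hom_cs hK hf hfm, hom_cs hL hg hgm, h⟩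

theorem dmn_cs_id [UniformSpace V] [UniformSpace W] {K : Set V} {L : Set W} (hK : IsCompact K) (hL : IsCompact L)
    {f : V → W} {g : W → V} (hf : ContinuousOn f K) (hfm : Set.MapsTo f K L) (hg : ContinuousOn g L)
    (hgm : Set.MapsTo g L K) (h : ∀ x ∈ K, g (f x) = x) : Dmn (CS K) (CS L) :=
  dmn_cs hK hL hf hfm hg hgm (htpy_id hK (hg.comp hf hfm) (hgm.comp hfm) h)

/-- Sites with the cohomological properties of a sphere. -/
structure Sp (S : Site V) (n : ℕ) : Prop where
  rk : ∀ {W : Type} {k : ℤ} {Y : Site W} [Free Y], Hz Y (k - n) → Rk S k Y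
  nc : NC S n
  j : J S n

theorem Sp.congr [Abs S] [Abs S'] {n : ℕ} (h : Dmn S S') (h' : Dmn S' S) (hs : Sp S' n) : Sp S n :=
  ⟨fun hY => h.rk (hs.rk hY), h'.nc hs.nc, h.j hs.j⟩

theorem Sp.base [Abs S] (ht : Thick S A B) (hAB : A ∩ B = ∅) {a b : V} (ha : S.Pt a) (hb : S.Pt b) (hA : a ∈ A)
    (hB : b ∈ B) (h1 : Ctr (S.on A)) (h2 : Ctr (S.on B)) : Sp S 0 :=
  ⟨fun hY => Rk.mv_zero ht hAB ha hb hA hB h1.rk h2.rk (by simpa using hY), NC.base ht hAB ha hb hA hB,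
    J.base ht ha hb hA hB h1 h2⟩

theorem Sp.mv [Abs S] {n : ℕ} (ht : Thick S A B) {v : V} (hv : S.Pt v) (hA : v ∈ A) (hB : v ∈ B)
    (h1 : Ctr (S.on A)) (h2 : Ctr (S.on B)) (h : Sp (S.on (A ∩ B)) n) : Sp S (n + 1) :=
  ⟨fun hY => Rk.mv ht hv hA hB h1.rk h2.rk (h.rk (by push_cast at hY; rwa [sub_sub, add_comm (1 : ℤ)])),
    by exact_mod_cast NC.mv ht hv hA hB h1 h2 (Int.natCast_nonneg n) h.nc,
    by rw [show ((n + 1 : ℕ) : ℤ) = n + 1 by push_cast; rfl]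
       exact J.mv ht hv hA hB h1 h2 (Int.natCast_nonneg n) h.j⟩

/-- Gauges on a vector space. -/
structure Gauge {E : Type} [NormedAddCommGroup E] [NormedSpace ℝ E] (N : E → ℝ) : Prop where
  cont : Continuous N
  smul : ∀ t : ℝ, 0 ≤ t → ∀ x, N (t • x) = t * N x
  pos : ∀ x, x ≠ 0 → 0 < N x

/-- The unit sphere of a gauge. -/
def un {E : Type} (N : E → ℝ) : Set E := {x | N x = 1}

/-- Radial normalization. -/
def nz {E : Type} [NormedAddCommGroup E] [NormedSpace ℝ E] (N : E → ℝ) (x : E) : E := (N x)⁻¹ • x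

variable {E F : Type} [NormedAddCommGroup E] [NormedSpace ℝ E] [NormedAddCommGroup F] [NormedSpace ℝ F] {N : E → ℝ}
  {M : F → ℝ}

theorem Gauge.zero (h : Gauge N) : N 0 = 0 := by simpa using h.smul 0 le_rfl 0

theorem Gauge.ne (h : Gauge N) {x : E} (hx : x ∈ un N) : x ≠ 0 := by
  rintro rfl; have : N 0 = 1 := hx; rw [h.zero] at this; norm_num at this

theorem Gauge.nz_mem (h : Gauge N) {x : E} (hx : x ≠ 0) : nz N x ∈ un N := by
  have := h.pos x hx
  show N ((N x)⁻¹ • x) = 1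
  rw [h.smul _ (by positivity), inv_mul_cancel₀ this.ne']

theorem nz_of {x : E} (hx : x ∈ un N) : nz N x = x := by
  rw [nz, show N x = 1 from hx, inv_one, one_smul]

theorem Gauge.nz_smul (h : Gauge N) {x : E} (hx : x ∈ un N) {t : ℝ} (ht : 0 < t) : nz N (t • x) = x := by
  rw [nz, h.smul t ht.le, show N x = 1 from hx, mul_one, smul_smul, inv_mul_cancel₀ ht.ne', one_smul]

theorem Gauge.continuousOn_nz (h : Gauge N) : ContinuousOn (nz N) {x | x ≠ 0} :=
  ContinuousOn.smul (h.cont.continuousOn.inv₀ fun x hx => (h.pos x hx).ne') continuousOn_id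

theorem gauge_norm : Gauge (fun x : E => ‖x‖) :=
  ⟨continuous_norm, fun t ht x => by rw [norm_smul, Real.norm_of_nonneg ht], fun _ hx => norm_pos_iff.2 hx⟩

theorem Gauge.compact [FiniteDimensional ℝ E] (h : Gauge N) : IsCompact (un N) := by
  haveI := FiniteDimensional.proper_real E
  have h1 : un N = nz N '' Metric.sphere 0 1 := by
    ext x
    constructor
    · intro hx
      refine ⟨‖x‖⁻¹ • x, ?_, h.nz_smul hx (inv_pos.2 (norm_pos_iff.2 (h.ne hx)))⟩
      simp [norm_smul, h.ne hx]
    · rintro ⟨y, hy, rfl⟩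
      exact h.nz_mem (ne_zero_of_mem_unit_sphere ⟨y, hy⟩)
  rw [h1]
  exact (isCompact_sphere 0 1).image_of_continuousOn (h.continuousOn_nz.mono fun x hx => ne_zero_of_mem_unit_sphere ⟨x, hx⟩)

/-- Normalized straight line homotopies. -/
theorem htpy_nz [UniformSpace V] {K : Set V} {L : Set E} (hN : Gauge N) (hK : IsCompact K) {f g : V → E}
    (hf : ContinuousOn f K) (hg : ContinuousOn g K) (hfm : Set.MapsTo f K (un N)) (hgm : Set.MapsTo g K (un N))
    (h : ∀ x ∈ K, ∀ t ∈ Set.Icc (0 : ℝ) 1, (1 - t) • f x + t • g x ≠ 0 ∧ nz N ((1 - t) • f x + t • g x) ∈ L) :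
    Htpy (CS K) (CS L) f g := by
  refine htpy_cs hK (fun p => nz N ((1 - p.2) • f p.1 + p.2 • g p.1)) ?_ (fun x hx t ht => (h x hx t ht).2)
    (fun x hx => by simp [nz_of (hfm hx)]) (fun x hx => by simp [nz_of (hgm hx)])
  refine hN.continuousOn_nz.comp ?_ fun p hp => (h p.1 hp.1 p.2 hp.2).1
  have h1 : ContinuousOn (fun p : V × ℝ => f p.1) (K ×ˢ Set.Icc (0 : ℝ) 1) := hf.comp continuousOn_fst fun p hp => hp.1
  have h2 : ContinuousOn (fun p : V × ℝ => g p.1) (K ×ˢ Set.Icc (0 : ℝ) 1) := hg.comp continuousOn_fst fun p hp => hp.1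
  exact ((continuousOn_const.sub continuousOn_snd).smul h1).add (continuousOn_snd.smul h2)

/-- Gauge spheres of the same dimension are equivalent. -/
theorem dmn_linear [FiniteDimensional ℝ E] [FiniteDimensional ℝ F] (hN : Gauge N) (hM : Gauge M)
    (L : E ≃L[ℝ] F) : Dmn (CS (un N)) (CS (un M)) := by
  have key : ∀ {E F : Type} [NormedAddCommGroup E] [NormedSpace ℝ E] [NormedAddCommGroup F] [NormedSpace ℝ F]
      {N : E → ℝ} {M : F → ℝ} (_ : Gauge N) (_ : Gauge M) (L : E ≃L[ℝ] F), ContinuousOn (fun x => nz M (L x)) (un N) ∧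
      Set.MapsTo (fun x => nz M (L x)) (un N) (un M) := by
    intro E F _ _ _ _ N M hN hM L
    have h1 : ∀ x ∈ un N, L x ≠ 0 := fun x hx => by simpa using hN.ne hx
    exact ⟨hM.continuousOn_nz.comp L.continuous.continuousOn h1, fun x hx => hM.nz_mem (h1 x hx)⟩
  obtain ⟨a, b⟩ := key hN hM L
  obtain ⟨c, d⟩ := key hM hN L.symm
  refine dmn_cs_id hN.compact hM.compact a b c d fun x hx => ?_
  have h1 : L x ≠ 0 := by simpa using hN.ne hx
  simp only [nz, map_smul, ContinuousLinearEquiv.symm_apply_apply]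
  exact hN.nz_smul hx (inv_pos.2 (hM.pos _ h1))

end

section
open Filter Function Topology

variable {U V W X : Type} {S : Site V} {S' : Site W} {n m k : ℤ} {φ ψ χ χ' : Coch V} {A B : Set V}
variable {E F : Type} [NormedAddCommGroup E] [NormedSpace ℝ E] [NormedAddCommGroup F] [NormedSpace ℝ F] {N : E → ℝ}
  {M : F → ℝ}

theorem ev_mem_cs [UniformSpace V] {K : Set V} : ∀ᶠ l in (CS K).F, l ∈ Lst K :=
  ev_cs.2 ⟨Set.univ, univ_mem, fun _ _ h => h⟩

theorem ev_close [UniformSpace V] {K : Set V} (hK : IsCompact K) {f : V → ℝ} (hf : ContinuousOn f K) {δ : ℝ}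
    (hδ : 0 < δ) : ∀ᶠ l in (CS K).F, ∀ x ∈ l, ∀ y ∈ l, |f x - f y| < δ := by
  have h1 : ∀ᶠ l in (CS (Set.univ : Set ℝ)).F, ∀ x ∈ l, ∀ y ∈ l, |x - y| < δ :=
    ev_cs.2 ⟨{p | dist p.1 p.2 < δ}, Metric.dist_mem_uniformity hδ, fun l h _ x hx y hy => h x hx y hy⟩
  filter_upwards [(hom_cs hK hf (Set.mapsTo_univ _ _)).tF h1] with l hl x hx y hy
  exact hl _ (List.mem_map_of_mem hx) _ (List.mem_map_of_mem hy)

theorem thick_cs [UniformSpace V] {K : Set V} (hK : IsCompact K) {f : V → ℝ} (hf : ContinuousOn f K) {a b : ℝ}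
    (hab : a < b) : Thick (CS K) {x | f x ≤ b} {x | a ≤ f x} := by
  filter_upwards [ev_close hK hf (sub_pos.2 hab)] with l hl
  by_contra h
  rw [not_or] at h
  obtain ⟨h1, h2⟩ := h
  simp only [Lst, Set.mem_setOf_eq, not_forall, not_le] at h1 h2
  obtain ⟨x, hx, h1⟩ := h1
  obtain ⟨y, hy, h2⟩ := h2
  have := (abs_lt.1 (hl x hx y hy)).2
  linarith

/-- The gauge on `ℝ × E` suspending a gauge on `E`. -/
def gs (N : E → ℝ) (p : ℝ × E) : ℝ := √(p.1 ^ 2 + N p.2 ^ 2)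

theorem Gauge.nonneg (h : Gauge N) (x : E) : 0 ≤ N x := by
  rcases eq_or_ne x 0 with rfl | hx
  · exact h.zero.ge
  · exact (h.pos x hx).le

theorem Gauge.gs (h : Gauge N) : Gauge (gs N) where
  cont := by have := h.cont; unfold CatCone.gs; fun_prop
  smul t ht p := by
    simp only [CatCone.gs, Prod.smul_fst, Prod.smul_snd, smul_eq_mul, h.smul t ht, mul_pow, ← mul_add]
    rw [Real.sqrt_mul (sq_nonneg t), Real.sqrt_sq ht]
  pos p hp := Real.sqrt_pos.2 <| by
    by_cases h1 : p.1 = 0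
    · have h2 : p.2 ≠ 0 := fun h2 => hp (Prod.ext h1 h2)
      have := h.pos _ h2
      positivity
    · positivity

theorem mem_un_gs {p : ℝ × E} : p ∈ un (gs N) ↔ p.1 ^ 2 + N p.2 ^ 2 = 1 := by
  show √_ = 1 ↔ _
  rw [Real.sqrt_eq_one]

/-- The two caps of a suspension. -/
def cap (E : Type) (ε : ℝ) : Set (ℝ × E) := {p | -(1 / 2) ≤ ε * p.1}

theorem Gauge.nz_cap (h : Gauge N) {ε : ℝ} (hε : ε ^ 2 = 1) {p : ℝ × E} (hp : p ≠ 0)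
    (h' : 0 ≤ ε * p.1 ∨ 3 * p.1 ^ 2 ≤ N p.2 ^ 2) : nz (CatCone.gs N) p ∈ cap E ε := by
  have h1 := h.gs.pos p hp
  show -(1 / 2) ≤ ε * ((CatCone.gs N p)⁻¹ * p.1)
  have h3 : -(1 / 2) * CatCone.gs N p ≤ ε * p.1 := by
    rcases h' with h' | h'
    · linarith
    · have h2 : CatCone.gs N p ^ 2 = p.1 ^ 2 + N p.2 ^ 2 := Real.sq_sqrt (by positivity)
      have : (ε * p.1) ^ 2 ≤ (1 / 2 * CatCone.gs N p) ^ 2 := by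
        rw [mul_pow, mul_pow, h2, hε]; linarith
      have := (abs_le_of_sq_le_sq' this (by positivity)).1
      linarith
  rw [mul_left_comm, inv_mul_eq_div, le_div_iff₀ h1]
  linarith

theorem Gauge.pt [FiniteDimensional ℝ E] (h : Gauge N) {ε : ℝ} (hε : ε ^ 2 = 1) : (CS (un (CatCone.gs N))).Pt (ε, 0) :=
  pt_cs (mem_un_gs.2 (by simp [h.zero, hε]))

theorem Gauge.ctr [FiniteDimensional ℝ E] (h : Gauge N) {ε : ℝ} (hε : ε ^ 2 = 1) :
    Ctr ((CS (un (CatCone.gs N))).on (cap E ε)) := by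
  have hεc : ((ε, 0) : ℝ × E) ∈ cap E ε := by show _ ≤ ε * ε; nlinarith
  refine ⟨(ε, 0), (h.pt hε).on hεc, ?_⟩
  have h0 : ((ε, 0) : ℝ × E) ∈ un (CatCone.gs N) := mem_un_gs.2 (by simp [h.zero, hε])
  rw [cs_on]
  have hcl : IsClosed (cap E ε) := isClosed_le continuous_const (continuous_const.mul continuous_fst)
  refine htpy_cs (h.gs.compact.inter_right hcl) (fun p => nz (CatCone.gs N) ((1 - p.2) • p.1 + p.2 • (ε, 0))) ?_ ?_ ?_ ?_
  all_goals
    have key : ∀ x ∈ un (CatCone.gs N) ∩ cap E ε, ∀ t ∈ Set.Icc (0 : ℝ) 1,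
        (1 - t) • x + t • ((ε, 0) : ℝ × E) ≠ 0 ∧ nz (CatCone.gs N) ((1 - t) • x + t • (ε, 0)) ∈ cap E ε := by
      rintro ⟨r, v⟩ ⟨hx, hc⟩ t ⟨t0, t1⟩
      have hx' := mem_un_gs.1 hx
      have hc' : -(1 / 2) ≤ ε * r := hc
      simp only at hx'
      have hne : (1 - t) • (r, v) + t • ((ε, 0) : ℝ × E) ≠ 0 := by
        intro h0
        have e1 : (1 - t) * r + t * ε = 0 := by simpa using congrArg Prod.fst h0
        have e2 : 1 - t = 0 ∨ v = 0 := by simpa using congrArg Prod.snd h0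
        rcases e2 with e2 | rfl
        · obtain rfl : t = 1 := by linarith
          norm_num at e1; rw [e1] at hε; norm_num at hε
        · rw [h.zero] at hx'
          have : (r - ε) * (r + ε) = 0 := by nlinarith
          rcases mul_eq_zero.1 this with h3 | h3
          · obtain rfl : r = ε := by linarith
            have : r = 0 := by linarith
            rw [this] at hε; norm_num at hε
          · obtain rfl : r = -ε := by linarith
            nlinarith
      refine ⟨hne, h.nz_cap hε hne ?_⟩
      by_cases h1 : 0 ≤ ε * ((1 - t) * r + t * ε)
      · left; simpa using h1
      · right
        have e : N ((1 - t) • v) = (1 - t) * N v := h.smul _ (by linarith) v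
        simp only [Prod.smul_mk, Prod.mk_add_mk, smul_zero, add_zero, smul_eq_mul, e]
        have h2 : ε * ((1 - t) * r + t * ε) = (1 - t) * (ε * r) + t := by linear_combination t * hε
        rw [h2] at h1
        have hq : ((1 - t) * r + t * ε) ^ 2 = ((1 - t) * (ε * r) + t) ^ 2 := by rw [← h2, mul_pow, hε, one_mul]
        have h3 : ((1 - t) * (ε * r) + t) ^ 2 ≤ ((1 - t) * (ε * r)) ^ 2 := by nlinarith
        have h4 : ((1 - t) * (ε * r)) ^ 2 ≤ ((1 - t) * (1 / 2)) ^ 2 := by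
          apply sq_le_sq'
          · nlinarith
          · nlinarith
        have h5 : (ε * r) ^ 2 = r ^ 2 := by rw [mul_pow, hε, one_mul]
        rw [hq]
        have h6 : (1 - t) ^ 2 * (N v ^ 2) = (1 - t) ^ 2 - ((1 - t) * (ε * r)) ^ 2 := by
          rw [mul_pow, h5]; linear_combination (1 - t) ^ 2 * hx'
        nlinarith
  · refine h.gs.continuousOn_nz.comp (by fun_prop) fun p hp => (key p.1 hp.1 p.2 hp.2).1
  · exact fun x hx t ht => ⟨h.gs.nz_mem (key x hx t ht).1, (key x hx t ht).2⟩
  · intro x hx; simp [nz_of hx.1]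
  · intro x hx; simp [nz_of h0]

theorem Gauge.thick [FiniteDimensional ℝ E] (h : Gauge N) : Thick (CS (un (CatCone.gs N))) (cap E 1) (cap E (-1)) := by
  have := thick_cs h.gs.compact (f := Prod.fst) continuous_fst.continuousOn (a := -(1 / 2)) (b := 1 / 2) (by norm_num)
  refine this.mono fun l hl => hl.symm.imp (fun hl x hx => ?_) (fun hl x hx => ?_)
  · have := Set.mem_setOf_eq ▸ hl x hx
    show _ ≤ 1 * x.1; linarith
  · have := Set.mem_setOf_eq ▸ hl x hx
    show _ ≤ -1 * x.1; linarith

theorem cap_inter {p : ℝ × E} (hp : p ∈ un (gs N)) (hc : p ∈ cap E 1 ∩ cap E (-1)) : 3 / 4 ≤ N p.2 ^ 2 ∧ p.1 ^ 2 ≤ 1 / 4 := by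
  have h1 : _ ≤ 1 * p.1 := hc.1
  have h2 : _ ≤ -1 * p.1 := hc.2
  have h3 := mem_un_gs.1 hp
  have : p.1 ^ 2 ≤ 1 / 4 := by nlinarith
  exact ⟨by linarith, this⟩

theorem isClosed_cap {ε : ℝ} : IsClosed (cap E ε) := isClosed_le continuous_const (continuous_const.mul continuous_fst)

theorem band_ne (h : Gauge N) {p : ℝ × E} (hp : p ∈ un (gs N) ∩ (cap E 1 ∩ cap E (-1))) : p.2 ≠ 0 := by
  have := (cap_inter hp.1 hp.2).1
  intro h0; rw [h0, h.zero] at this; norm_num at this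

theorem band_maps (h : Gauge N) : ContinuousOn (fun p : ℝ × E => nz N p.2) (un (gs N) ∩ (cap E 1 ∩ cap E (-1))) ∧
    Set.MapsTo (fun p : ℝ × E => nz N p.2) (un (gs N) ∩ (cap E 1 ∩ cap E (-1))) (un N) :=
  ⟨h.continuousOn_nz.comp continuousOn_snd fun _ hp => band_ne h hp, fun _ hp => h.nz_mem (band_ne h hp)⟩

theorem band_incl : Set.MapsTo (fun v : E => ((0 : ℝ), v)) (un N) (un (gs N) ∩ (cap E 1 ∩ cap E (-1))) := by
  intro v hv
  refine ⟨mem_un_gs.2 ?_, ?_, ?_⟩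
  · simp [show N v = 1 from hv]
  · show _ ≤ (1 : ℝ) * 0; norm_num
  · show _ ≤ (-1 : ℝ) * 0; norm_num

theorem htpy_band [FiniteDimensional ℝ E] (h : Gauge N) :
    Htpy (CS (un (gs N) ∩ (cap E 1 ∩ cap E (-1)))) (CS (un (gs N) ∩ (cap E 1 ∩ cap E (-1))))
      ((fun v : E => ((0 : ℝ), v)) ∘ fun p : ℝ × E => nz N p.2) id := by
  have hK := h.gs.compact.inter_right ((isClosed_cap (E := E) (ε := 1)).inter (isClosed_cap (E := E) (ε := -1)))
  refine htpy_nz h.gs hK ?_ continuousOn_id ?_ (fun _ hp => hp.1) ?_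
  · exact Continuous.comp_continuousOn (g := fun v : E => ((0 : ℝ), v)) (by fun_prop) (band_maps h).1
  · exact fun p hp => (band_incl ((band_maps h).2 hp)).1
  · rintro ⟨r, v⟩ hp t ⟨t0, t1⟩
    obtain ⟨h1, h2⟩ := cap_inter hp.1 hp.2
    have hv := h.pos v (band_ne h hp)
    have h0 := mem_un_gs.1 hp.1
    simp only at h1 h2 h0
    have hvn : N v ≤ 1 := by nlinarith
    have e : (1 - t) • ((fun v : E => ((0 : ℝ), v)) ∘ fun p : ℝ × E => nz N p.2) (r, v) + t • id (r, v) =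
        (t * r, ((1 - t) * (N v)⁻¹ + t) • v) := by
      simp [nz, add_smul, mul_smul]
    have hc : 0 < (1 - t) * (N v)⁻¹ + t := by
      have : 0 < (N v)⁻¹ := inv_pos.2 hv
      rcases t0.eq_or_lt with rfl | t0
      · simpa
      · have : 0 ≤ (1 - t) * (N v)⁻¹ := mul_nonneg (by linarith) this.le
        linarith
    have hne : ((t * r, ((1 - t) * (N v)⁻¹ + t) • v) : ℝ × E) ≠ 0 := fun h0 => by
      have := congrArg Prod.snd h0
      simp [hc.ne', band_ne h hp] at this
    rw [e]
    have hin : 3 * (t * r) ^ 2 ≤ N (((1 - t) * (N v)⁻¹ + t) • v) ^ 2 := by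
      rw [h.smul _ hc.le, add_mul, mul_assoc, inv_mul_cancel₀ hv.ne']
      have : (t * r) ^ 2 ≤ 1 / 4 := by rw [mul_pow]; nlinarith [mul_nonneg t0 t0, sq_nonneg r]
      have : N v ≤ (1 - t) * 1 + t * N v := by nlinarith
      nlinarith
    exact ⟨hne, h.gs.nz_mem hne, h.nz_cap (by norm_num) hne (.inr hin), h.nz_cap (by norm_num) hne (.inr hin)⟩

theorem dmn_band [FiniteDimensional ℝ E] (h : Gauge N) :
    Dmn ((CS (un (gs N))).on (cap E 1 ∩ cap E (-1))) (CS (un N)) := by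
  rw [cs_on]
  have hK := h.gs.compact.inter_right ((isClosed_cap (E := E) (ε := 1)).inter (isClosed_cap (E := E) (ε := -1)))
  exact dmn_cs hK h.compact (band_maps h).1 (band_maps h).2 (by fun_prop) band_incl (htpy_band h)

theorem dmn_band' [FiniteDimensional ℝ E] (h : Gauge N) :
    Dmn (CS (un N)) ((CS (un (gs N))).on (cap E 1 ∩ cap E (-1))) := by
  rw [cs_on]
  have hK := h.gs.compact.inter_right ((isClosed_cap (E := E) (ε := 1)).inter (isClosed_cap (E := E) (ε := -1)))
  exact dmn_cs_id h.compact hK (by fun_prop) band_incl (band_maps h).1 (band_maps h).2 fun x hx => nz_of hx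

theorem Gauge.nonempty [Nontrivial E] (h : Gauge N) : ∃ v, v ∈ un N :=
  let ⟨v, hv⟩ := exists_ne (0 : E); ⟨_, h.nz_mem hv⟩

theorem Sp.gs [FiniteDimensional ℝ E] [Nontrivial E] (h : Gauge N) {n : ℕ} (hs : Sp (CS (un N)) n) :
    Sp (CS (un (CatCone.gs N))) (n + 1) := by
  obtain ⟨v, hv⟩ := h.nonempty
  have := band_incl hv
  exact Sp.mv h.thick (pt_cs this.1) this.2.1 this.2.2 (h.ctr (by norm_num)) (h.ctr (by norm_num))
    (hs.congr (dmn_band h) (dmn_band' h))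

theorem sp_zero : Sp (CS (un (fun x : ℝ => ‖x‖))) 0 := by
  have hc := (gauge_norm (E := ℝ)).compact
  have h1 : ((1 : ℝ)) ∈ un (fun x : ℝ => ‖x‖) := by simp [un]
  have h2 : ((-1 : ℝ)) ∈ un (fun x : ℝ => ‖x‖) := by simp [un]
  have hu : ∀ x ∈ un (fun x : ℝ => ‖x‖), x = 1 ∨ x = -1 := fun x hx => eq_or_eq_neg_of_abs_eq hx
  have ht : Thick (CS (un (fun x : ℝ => ‖x‖))) {1} {-1} := by
    have := thick_cs hc (f := id) continuousOn_id (a := -(1 / 2)) (b := 1 / 2) (by norm_num)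
    filter_upwards [this, ev_mem_cs] with l h1 h2
    refine h1.symm.imp (fun h x hx => (hu x (h2 x hx)).resolve_right ?_)
      (fun h x hx => (hu x (h2 x hx)).resolve_left ?_) <;> rintro rfl <;> have := h _ hx <;>
      simp only [Set.mem_setOf_eq, id] at this <;> norm_num at this
  have hct : ∀ a ∈ un (fun x : ℝ => ‖x‖), Ctr ((CS (un (fun x : ℝ => ‖x‖))).on {a}) := by
    intro a ha
    refine ⟨a, (pt_cs ha).on rfl, ?_⟩
    rw [cs_on]
    exact htpy_id (hc.inter_right isClosed_singleton) continuousOn_id (Set.mapsTo_id _) fun x hx => hx.2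
  refine Sp.base ht (by ext x; simp; rintro rfl; norm_num) (pt_cs h1) (pt_cs h2) rfl rfl (hct _ h1) (hct _ h2)

theorem sp_un (n : ℕ) : ∀ {E : Type} [NormedAddCommGroup E] [NormedSpace ℝ E] [FiniteDimensional ℝ E] {N : E → ℝ},
    Gauge N → Module.finrank ℝ E = n + 1 → Sp (CS (un N)) n := by
  induction n with
  | zero =>
    intro E _ _ _ N hN h
    let L : E ≃L[ℝ] ℝ := ContinuousLinearEquiv.ofFinrankEq (by simpa using h)
    exact sp_zero.congr (dmn_linear hN gauge_norm L) (dmn_linear gauge_norm hN L.symm)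
  | succ n ih =>
    intro E _ _ _ N hN h
    let L : E ≃L[ℝ] ℝ × (Fin (n + 1) → ℝ) := ContinuousLinearEquiv.ofFinrankEq (by simp [h]; omega)
    have hg := gauge_norm (E := Fin (n + 1) → ℝ)
    exact ((ih hg (by simp)).gs hg).congr (dmn_linear hN hg.gs L) (dmn_linear hg.gs hN L.symm)

end

section
open Filter Function Topology

variable {U V W X : Type} {S : Site V} {S' : Site W} {n m k : ℤ} {φ ψ χ χ' : Coch V}
variable {E F : Type} [NormedAddCommGroup E] [NormedSpace ℝ E] [NormedAddCommGroup F] [NormedSpace ℝ F] {N : E → ℝ}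
  {M : F → ℝ} {A : Set E} {B : Set F} {α : E → F}

/-- A concrete model of the mapping cone of a map between subsets of vector spaces. -/
def cn (A : Set E) (B : Set F) (α : E → F) : Set (E × F × ℝ) :=
  {z | (∃ a ∈ A, ∃ t ∈ Set.Icc (0 : ℝ) 1, z = ((t * (1 - t)) • a, t • α a, t)) ∨ ∃ y ∈ B, z = (0, y, 1)}

theorem cn_compact (hA : IsCompact A) (hB : IsCompact B) (hα : ContinuousOn α A) : IsCompact (cn A B α) := by
  have e : cn A B α = (fun x : E × ℝ => ((x.2 * (1 - x.2)) • x.1, x.2 • α x.1, x.2)) '' (A ×ˢ Set.Icc (0 : ℝ) 1) ∪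
      (fun y => ((0 : E), y, (1 : ℝ))) '' B := by
    ext z
    simp only [cn, Set.mem_setOf_eq, Set.mem_union, Set.mem_image, Set.mem_prod, Prod.exists]
    refine or_congr ⟨?_, ?_⟩ ⟨?_, ?_⟩
    · rintro ⟨a, ha, t, ht, rfl⟩; exact ⟨a, t, ⟨ha, ht⟩, rfl⟩
    · rintro ⟨a, t, ⟨ha, ht⟩, rfl⟩; exact ⟨a, ha, t, ht, rfl⟩
    · rintro ⟨y, hy, rfl⟩; exact ⟨y, hy, rfl⟩
    · rintro ⟨y, hy, rfl⟩; exact ⟨y, hy, rfl⟩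
  rw [e]
  refine ((hA.prod isCompact_Icc).image_of_continuousOn ?_).union (hB.image (by fun_prop))
  have h1 : ContinuousOn (fun x : E × ℝ => α x.1) (A ×ˢ Set.Icc (0 : ℝ) 1) :=
    hα.comp continuousOn_fst fun p hp => hp.1
  exact ContinuousOn.prodMk (by fun_prop) ((continuousOn_snd.smul h1).prodMk continuousOn_snd)

theorem cn_mem (hα : Set.MapsTo α A B) {a : E} (ha : a ∈ A) {s : ℝ} (hs : s ∈ Set.Icc (0 : ℝ) 1) {p : E} {q : F}
    (hp : p = (s * (1 - s)) • a) (hq : q = s • α a) : (p, q, s) ∈ cn A B α :=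
  .inl ⟨a, ha, s, hs, by rw [hp, hq]⟩

theorem cn_one {y : F} (hy : y ∈ B) : ((0 : E), y, (1 : ℝ)) ∈ cn A B α := .inr ⟨y, hy, rfl⟩

/-- The part of the cone near the target. -/
def cnM (E F : Type) : Set (E × F × ℝ) := {z | 1 / 3 ≤ z.2.2}
/-- The part of the cone near the apex. -/
def cnD (E F : Type) : Set (E × F × ℝ) := {z | z.2.2 ≤ 2 / 3}

theorem isClosed_cnM : IsClosed (cnM E F) := isClosed_le continuous_const (by fun_prop)
theorem isClosed_cnD : IsClosed (cnD E F) := isClosed_le (by fun_prop) continuous_const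

theorem thick_cn (hA : IsCompact A) (hB : IsCompact B) (hα : ContinuousOn α A) :
    Thick (CS (cn A B α)) (cnD E F) (cnM E F) :=
  thick_cs (cn_compact hA hB hα) (f := fun z : E × F × ℝ => z.2.2) (by fun_prop) (by norm_num)

/-- Retraction of the part near the target. -/
def cnR (z : E × F × ℝ) : F := z.2.2⁻¹ • z.2.1

theorem cnR_cont : ContinuousOn (cnR : E × F × ℝ → F) (cn A B α ∩ cnM E F) :=
  ContinuousOn.smul (ContinuousOn.inv₀ (by fun_prop) fun z hz => (by linarith [show 1 / 3 ≤ z.2.2 from hz.2] : 0 < z.2.2).ne')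
    (by fun_prop)

theorem cnR_maps (hα : Set.MapsTo α A B) : Set.MapsTo (cnR : E × F × ℝ → F) (cn A B α ∩ cnM E F) B := by
  rintro z ⟨⟨a, ha, t, ht, rfl⟩ | ⟨y, hy, rfl⟩, hz⟩
  · have : 1 / 3 ≤ t := hz
    simp only [cnR, smul_smul]
    rw [inv_mul_cancel₀ (by linarith : 0 < t).ne', one_smul]
    exact hα ha
  · simpa [cnR]

theorem cn_top : Set.MapsTo (fun y : F => ((0 : E), y, (1 : ℝ))) B (cn A B α ∩ cnM E F) :=
  fun y hy => ⟨cn_one hy, by show (1 : ℝ) / 3 ≤ 1; norm_num⟩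

theorem dmn_cnM (hA : IsCompact A) (hB : IsCompact B) (hα : ContinuousOn α A) (hm : Set.MapsTo α A B) :
    Dmn ((CS (cn A B α)).on (cnM E F)) (CS B) := by
  rw [cs_on]
  have hK := (cn_compact hA hB hα).inter_right (isClosed_cnM (E := E) (F := F))
  refine dmn_cs hK hB cnR_cont (cnR_maps hm) (g := fun y => (0, y, 1)) (by fun_prop) cn_top ?_
  refine htpy_cs hK (fun x => ((x.2 * ((x.1.2.2 + (1 - x.2) * (1 - x.1.2.2)) * x.1.2.2⁻¹)) • x.1.1,
    ((x.1.2.2 + (1 - x.2) * (1 - x.1.2.2)) * x.1.2.2⁻¹) • x.1.2.1, x.1.2.2 + (1 - x.2) * (1 - x.1.2.2))) ?_ ?_ ?_ ?_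
  · have h1 : ContinuousOn (fun x : (E × F × ℝ) × ℝ => x.1.2.2⁻¹) ((cn A B α ∩ cnM E F) ×ˢ Set.Icc 0 1) :=
      ContinuousOn.inv₀ (by fun_prop) fun z hz => (by linarith [show 1 / 3 ≤ z.1.2.2 from hz.1.2] : 0 < z.1.2.2).ne'
    fun_prop
  · rintro z ⟨⟨a, ha, t, ht, rfl⟩ | ⟨y, hy, rfl⟩, hz⟩ l ⟨l0, l1⟩
    · have h1 : 1 / 3 ≤ t := hz
      have h2 : t ≤ 1 := ht.2
      have h3 : t ≠ 0 := by linarith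
      have h4 : 0 ≤ (1 - l) * (1 - t) := mul_nonneg (by linarith) (by linarith)
      have h5 : (1 - l) * (1 - t) ≤ 1 * (1 - t) := by gcongr <;> linarith
      refine ⟨cn_mem hm ha ⟨by simp only; linarith, by simp only; linarith⟩ ?_ ?_, by show _ ≤ t + _; linarith⟩
      · simp only [smul_smul]; congr 1; field_simp; ring
      · simp only [smul_smul]; congr 1; field_simp
    · simp only [smul_zero, sub_self, mul_zero, add_zero, inv_one, mul_one, one_smul]
      exact cn_top hy
  · rintro z hz
    simp [cnR]
  · rintro z hz
    have : z.2.2 ≠ 0 := (by linarith [show 1 / 3 ≤ z.2.2 from hz.2] : 0 < z.2.2).ne'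
    simp [this]

theorem dmn_cnM' (hA : IsCompact A) (hB : IsCompact B) (hα : ContinuousOn α A) (hm : Set.MapsTo α A B) :
    Dmn (CS B) ((CS (cn A B α)).on (cnM E F)) := by
  rw [cs_on]
  have hK := (cn_compact hA hB hα).inter_right (isClosed_cnM (E := E) (F := F))
  exact dmn_cs_id hB hK (by fun_prop) cn_top cnR_cont (cnR_maps hm) fun x hx => by simp [cnR]

theorem cn_apex (hm : Set.MapsTo α A B) (hne : A.Nonempty) : ((0 : E), (0 : F), (0 : ℝ)) ∈ cn A B α ∩ cnD E F :=
  let ⟨_, ha⟩ := hne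
  ⟨cn_mem hm ha ⟨le_rfl, zero_le_one⟩ (by simp) (by simp), by show (0 : ℝ) ≤ _; norm_num⟩

theorem ctr_cnD (hA : IsCompact A) (hB : IsCompact B) (hα : ContinuousOn α A) (hm : Set.MapsTo α A B)
    (hne : A.Nonempty) : Ctr ((CS (cn A B α)).on (cnD E F)) := by
  rw [cs_on]
  have hK := (cn_compact hA hB hα).inter_right (isClosed_cnD (E := E) (F := F))
  refine ⟨(0, 0, 0), pt_cs (cn_apex hm hne), ?_⟩
  refine htpy_cs hK (fun x => (((1 - x.2) * ((1 - (1 - x.2) * x.1.2.2) * (1 - x.1.2.2)⁻¹)) • x.1.1,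
    (1 - x.2) • x.1.2.1, (1 - x.2) * x.1.2.2)) ?_ ?_ ?_ ?_
  · have h1 : ContinuousOn (fun x : (E × F × ℝ) × ℝ => (1 - x.1.2.2)⁻¹) ((cn A B α ∩ cnD E F) ×ˢ Set.Icc 0 1) :=
      ContinuousOn.inv₀ (by fun_prop) fun z hz =>
        (by linarith [show z.1.2.2 ≤ 2 / 3 from hz.1.2] : 0 < 1 - z.1.2.2).ne'
    fun_prop
  · rintro z ⟨⟨a, ha, t, ht, rfl⟩ | ⟨y, hy, rfl⟩, hz⟩ l ⟨l0, l1⟩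
    · have h1 : t ≤ 2 / 3 := hz
      have h2 : 0 ≤ t := ht.1
      have h3 : 1 - t ≠ 0 := by linarith
      have h4 : 0 ≤ (1 - l) * t := mul_nonneg (by linarith) (by linarith)
      have h5 : (1 - l) * t ≤ 1 * t := by gcongr; linarith
      refine ⟨cn_mem hm ha ⟨h4, by linarith⟩ ?_ ?_, by show (1 - l) * t ≤ _; linarith⟩
      · simp only [smul_smul]; congr 1; field_simp
      · exact (mul_smul _ _ _).symm
    · have : (1 : ℝ) ≤ 2 / 3 := hz
      norm_num at this
  · rintro z hz
    have : 1 - z.2.2 ≠ 0 := (by linarith [show z.2.2 ≤ 2 / 3 from hz.2] : 0 < 1 - z.2.2).ne'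
    simp [this]
  · rintro z hz
    simp

/-- Projection of the middle part to the source. -/
def cnP (z : E × F × ℝ) : E := (z.2.2 * (1 - z.2.2))⁻¹ • z.1

theorem cn_mid {z : E × F × ℝ} (hz : z ∈ cnD E F ∩ cnM E F) : 0 < z.2.2 ∧ 0 < 1 - z.2.2 :=
  ⟨by linarith [show 1 / 3 ≤ z.2.2 from hz.2], by linarith [show z.2.2 ≤ 2 / 3 from hz.1]⟩

theorem cnP_cont : ContinuousOn (cnP : E × F × ℝ → E) (cn A B α ∩ (cnD E F ∩ cnM E F)) :=
  ContinuousOn.smul (ContinuousOn.inv₀ (by fun_prop) fun _ hz => (mul_pos (cn_mid hz.2).1 (cn_mid hz.2).2).ne')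
    (by fun_prop)

theorem cnP_eq {a : E} {t : ℝ} (h0 : 0 < t) (h1 : 0 < 1 - t) {q : F} : cnP ((t * (1 - t)) • a, q, t) = a := by
  simp only [cnP, smul_smul]
  rw [inv_mul_cancel₀ (mul_pos h0 h1).ne', one_smul]

theorem cnP_maps : Set.MapsTo (cnP : E × F × ℝ → E) (cn A B α ∩ (cnD E F ∩ cnM E F)) A := by
  rintro z ⟨⟨a, ha, t, ht, rfl⟩ | ⟨y, hy, rfl⟩, hz⟩
  · rwa [cnP_eq (cn_mid hz).1 (cn_mid hz).2]
  · have := (cn_mid hz).2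
    norm_num at this

/-- The section of `cnP`. -/
def cnS (α : E → F) (a : E) : E × F × ℝ := ((1 / 2 * (1 - 1 / 2) : ℝ) • a, (1 / 2 : ℝ) • α a, 1 / 2)

theorem cnS_maps (hm : Set.MapsTo α A B) : Set.MapsTo (cnS α) A (cn A B α ∩ (cnD E F ∩ cnM E F)) :=
  fun a ha => ⟨cn_mem hm ha ⟨by norm_num, by norm_num⟩ rfl rfl, by show (1 / 2 : ℝ) ≤ _; norm_num,
    by show _ ≤ (1 / 2 : ℝ); norm_num⟩

theorem cnS_cont (hα : ContinuousOn α A) : ContinuousOn (cnS α) A := by unfold cnS; fun_prop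

theorem dmn_cnP (hA : IsCompact A) (hB : IsCompact B) (hα : ContinuousOn α A) (hm : Set.MapsTo α A B) :
    Dmn ((CS (cn A B α)).on (cnD E F ∩ cnM E F)) (CS A) := by
  rw [cs_on]
  have hK := (cn_compact hA hB hα).inter_right ((isClosed_cnD (E := E) (F := F)).inter isClosed_cnM)
  refine dmn_cs hK hA cnP_cont cnP_maps (cnS_cont hα) (cnS_maps hm) ?_
  refine htpy_cs hK (fun x => (((1 / 2 + x.2 * (x.1.2.2 - 1 / 2)) * (1 - (1 / 2 + x.2 * (x.1.2.2 - 1 / 2))) *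
    (x.1.2.2 * (1 - x.1.2.2))⁻¹) • x.1.1, ((1 / 2 + x.2 * (x.1.2.2 - 1 / 2)) * x.1.2.2⁻¹) • x.1.2.1,
    1 / 2 + x.2 * (x.1.2.2 - 1 / 2))) ?_ ?_ ?_ ?_
  · have h1 : ContinuousOn (fun x : (E × F × ℝ) × ℝ => (x.1.2.2 * (1 - x.1.2.2))⁻¹)
        ((cn A B α ∩ (cnD E F ∩ cnM E F)) ×ˢ Set.Icc 0 1) :=
      ContinuousOn.inv₀ (by fun_prop) fun z hz => (mul_pos (cn_mid hz.1.2).1 (cn_mid hz.1.2).2).ne'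
    have h2 : ContinuousOn (fun x : (E × F × ℝ) × ℝ => x.1.2.2⁻¹)
        ((cn A B α ∩ (cnD E F ∩ cnM E F)) ×ˢ Set.Icc 0 1) :=
      ContinuousOn.inv₀ (by fun_prop) fun z hz => (cn_mid hz.1.2).1.ne'
    fun_prop
  · rintro z ⟨⟨a, ha, t, ht, rfl⟩ | ⟨y, hy, rfl⟩, hz⟩ l ⟨l0, l1⟩
    · obtain ⟨h0, h1⟩ := cn_mid hz
      have h2 : t ≤ 2 / 3 := hz.1
      have h3 : 1 / 3 ≤ t := hz.2
      simp only at h0 h1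
      have h4 : l * (t - 1 / 2) ≤ 1 / 6 := by nlinarith
      have h5 : -(1 / 6) ≤ l * (t - 1 / 2) := by nlinarith
      refine ⟨cn_mem hm ha ⟨by simp only; linarith, by simp only; linarith⟩ ?_ ?_, by show 1 / 2 + l * (t - 1 / 2) ≤ _; linarith,
        by show _ ≤ 1 / 2 + l * (t - 1 / 2); linarith⟩
      · simp only [smul_smul]; congr 1; field_simp
      · simp only [smul_smul]; congr 1; field_simp
    · have := (cn_mid hz).2
      norm_num at this
  · rintro z ⟨⟨a, ha, t, ht, rfl⟩ | ⟨y, hy, rfl⟩, hz⟩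
    · obtain ⟨h0, h1⟩ := cn_mid hz
      simp only at h0 h1
      simp only [comp_apply, cnP_eq h0 h1, cnS, smul_smul]
      refine Prod.ext ?_ (Prod.ext ?_ ?_) <;> simp only
      · congr 1; field_simp; ring
      · congr 1; field_simp; ring
      · ring
    · have := (cn_mid hz).2
      norm_num at this
  · rintro z hz
    obtain ⟨h0, h1⟩ := cn_mid hz.2
    refine Prod.ext ?_ (Prod.ext ?_ ?_)
    · have : (z.2.2 * (1 - z.2.2)) * (z.2.2 * (1 - z.2.2))⁻¹ = 1 := mul_inv_cancel₀ (mul_pos h0 h1).ne'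
      simp only [one_mul, add_sub_cancel, this, one_smul, id]
    · simp [h0.ne']
    · simp

theorem dmn_cnP' (hA : IsCompact A) (hB : IsCompact B) (hα : ContinuousOn α A) (hm : Set.MapsTo α A B) :
    Dmn (CS A) ((CS (cn A B α)).on (cnD E F ∩ cnM E F)) := by
  rw [cs_on]
  have hK := (cn_compact hA hB hα).inter_right ((isClosed_cnD (E := E) (F := F)).inter isClosed_cnM)
  exact dmn_cs_id hA hK (cnS_cont hα) (cnS_maps hm) cnP_cont cnP_maps fun a _ =>
    cnP_eq (by norm_num) (by norm_num)

theorem rk_cn (hA : IsCompact A) (hB : IsCompact B) (hα : ContinuousOn α A) (hm : Set.MapsTo α A B)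
    (hne : A.Nonempty) {a b : ℕ} (hSA : Sp (CS A) a) (hSB : Sp (CS B) b) {Y : Site X} [Free Y]
    (h1 : Hz Y (k - b)) (h2 : Hz Y (k - (a + 1))) : Rk (CS (cn A B α)) k Y := by
  obtain ⟨x, hx⟩ := hne
  have := cnS_maps hm hx
  refine Rk.mv (thick_cn hA hB hα) (pt_cs this.1) this.2.1 this.2.2 (ctr_cnD hA hB hα hm ⟨x, hx⟩).rk
    ((dmn_cnM hA hB hα hm).rk (hSB.rk h1)) ((dmn_cnP hA hB hα hm).rk (hSA.rk ?_))
  rwa [sub_sub, add_comm]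

end

section
open Filter Function Topology

variable {U V W X : Type} {S : Site V} {S' : Site W} {n m k : ℤ} {φ ψ χ χ' : Coch V} {h : V → W}

theorem cupsite_self : CupSite S S S := ⟨le_rfl, le_rfl, le_sup_left, le_rfl, le_rfl⟩

theorem cupsite_rel {A : Set V} : CupSite S (S.rel A) (S.rel A) := ⟨le_rfl, le_rfl, le_sup_right, le_rfl, le_rfl⟩

theorem cupsite_rel_left {A : Set V} : CupSite (S.rel A) S (S.rel A) := ⟨le_rfl, le_rfl, le_sup_left, le_rfl, le_rfl⟩

theorem pb_inl_ext_rho (a : Coch W) : pb Sum.inl (pb (rho h) a : Coch (V ⊕ W)) = pb h a := by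
  rw [pb_pb]; rfl

theorem brk_coh [Free S] [Free S'] (hh : S.Hom S' h) (y : Coch W) (w : Coch V) {a : Coch W} (ha : Cc S' (n - 1) a) :
    Coh (cone h S S') n (brk h y w) (brk h (y + cd a) (w + pb h a)) := by
  unfold Coh
  have e : brk h y w + brk h (y + cd a) (w + pb h a) = cd (pb (rho h) a + ext (pb h a)) := by
    rw [brk_add, ← add_assoc, coch_add_self, zero_add, cd_add, cd_pb]; rfl
  rw [e]
  refine cone_bd ((hom_rho.cc ha).add (hh.cc ha).ext) (Eventually.of_forall fun l => ?_)
  rw [pb_add, pb_ext, pb_inl_ext_rho, coch_add_self]; rfl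

theorem Bd.lift' [Free S] {A : Set V} (hb : Bd (S.on A) n φ) :
    ∃ a, Cc S (n - 1) a ∧ ∀ᶠ l in S.F, l ∈ Lst A → (φ + cd a) l = 0 := by
  obtain ⟨χ, h1, h2⟩ := hb
  refine ⟨cut A χ, h1.of_on, ?_⟩
  filter_upwards [ev_on.1 h2] with l hl hA
  rw [Pi.add_apply, hl hA, cd_cut hA, CharTwo.add_self_eq_zero]

/-- The product of two brackets whose bases have zero product. -/
theorem brk_cup [Free S] [Free S'] (hh : S.Hom S' h) {y₁ y₂ : Coch W} {w₁ w₂ : Coch V} (hy1 : Zc S' n y₁)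
    (hy2 : Zc S' n y₂) (hw1 : Cc S (n - 1) w₁) (hw2 : Cc S (n - 1) w₂) (e1 : ∀ᶠ l in S.F, pb h y₁ l = cd w₁ l)
    (e2 : ∀ᶠ l in S.F, pb h y₂ l = cd w₂ l) (h0 : ∀ᶠ l in S'.F, cup y₁ y₂ l = 0) :
    Zc S (2 * n - 1) (cup w₁ (pb h y₂)) ∧
    Coh (cone h S S') (2 * n) (cup (brk h y₁ w₁) (brk h y₂ w₂)) (del (cup w₁ (pb h y₂))) := by
  have n1 := hw1.deg.nil
  have n2 := hw2.deg.nil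
  have hz : Zc S (2 * n - 1) (cup w₁ (pb h y₂)) := by
    refine Zc.of_cc ((hw1.cup (hh.cc hy2.toCc) cupsite_self).of_eq' (by ring)) ?_
    rw [cd_cup n1 (hh.zc hy2).deg.nil]
    filter_upwards [S.hF.van (hh.zc hy2).cl, S.hF _ e1, hh.tF h0] with l a1 a2 a3
    have a4 : cup (cd w₁ + pb h y₁) (pb h y₂) l = 0 :=
      cup_loc (.inl fun p hp => by rw [Pi.add_apply, a2 p hp, CharTwo.add_self_eq_zero])
    rw [cup_add_left, Pi.add_apply, ← pb_cup, show pb h (cup y₁ y₂) l = 0 from a3, add_zero] at a4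
    rw [Pi.add_apply, a4, cup_loc (.inr a1), add_zero]
  refine ⟨hz, ?_⟩
  have r1 := (hom_rho (S := S) (S' := S') (h := h)).zc hy1
  have r2 := (hom_rho (S := S) (S' := S') (h := h)).zc hy2
  have c1 : Zc (cyl h S S') n (brk h y₁ w₁) := r1.add ((hw1.ext.cd).of_eq' (by ring))
  have hX : Cc (cyl h S S') (2 * n - 1) (cup (brk h y₁ w₁) (ext w₂) + cup (ext w₁) (pb (rho h) y₂) +
      ext (cup w₁ (pb h y₂))) :=
    (((c1.toCc.cup hw2.ext cupsite_self).of_eq' (by ring)).add ((hw1.ext.cup r2.toCc cupsite_self).of_eq' (by ring))).add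
      hz.toCc.ext
  have hb := cone_bd (n := 2 * n) hX (by
    filter_upwards [S.hF _ e1] with l a1
    rw [pb_add, pb_add, pb_cup, pb_cup, pb_ext, pb_ext, pb_ext, pb_inl_ext_rho, add_assoc, coch_add_self, add_zero]
    refine cup_loc (.inl fun p hp => ?_)
    rw [brk, pb_add, pb_inl_ext_rho, del, ← cd_pb, pb_ext, Pi.add_apply, a1 p hp, CharTwo.add_self_eq_zero])
  refine hb.congr ?_
  filter_upwards [show ∀ᶠ l in (cone h S S').F, _ from (cyl h S S').hF.van c1.cl,
    show ∀ᶠ l in (cone h S S').F, _ from (cyl h S S').hF.van r2.cl,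
    show ∀ᶠ l in (cone h S S').F, _ from (hom_rho (S := S) (S' := S') (h := h)).tF h0] with l a1 a2 a3
  rw [cd_add, cd_add, cd_cup c1.deg.nil hw2.deg.ext.nil, cd_cup hw1.deg.ext.nil r2.deg.nil]
  have e : cup (brk h y₁ w₁) (brk h y₂ w₂) = pb (rho h) (cup y₁ y₂) + cup (cd (ext w₁)) (pb (rho h) y₂) +
      cup (brk h y₁ w₁) (cd (ext w₂)) := by
    rw [show brk h y₂ w₂ = pb (rho h) y₂ + cd (ext w₂) from rfl, cup_add_right]
    congr 1
    rw [brk, cup_add_left, pb_cup]; rfl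
  rw [e]
  simp only [Pi.add_apply, del]
  rw [cup_loc (.inl a1), cup_loc (.inr a2), show pb (rho h) (cup y₁ y₂) l = 0 from a3]
  ring

/-- Splitting a class with vanishing square over two halves of the target. -/
theorem cone_halves [Abs S] [Abs S'] (hh : S.Hom S' h) {A B : Set W} (ht : Thick S' A B) (hA : Hz (S'.on A) n)
    (hB : Hz (S'.on B) n) (hz : Hz S' (2 * n - 1)) {c : Coch (V ⊕ W)} (hc : Zc (cone h S S') n c)
    (h0 : Bd (cone h S S') (2 * n) (cup c c)) :
    ∃ y₁ y₂ w₁, Zc S' n y₁ ∧ Zc S' n y₂ ∧ Coh S' n (pb Sum.inr c) y₁ ∧ Coh S' n (pb Sum.inr c) y₂ ∧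
      (∀ᶠ l in S'.F, l ∈ Lst A → y₁ l = 0) ∧ (∀ᶠ l in S'.F, l ∈ Lst B → y₂ l = 0) ∧ Cc S (n - 1) w₁ ∧
      (∀ᶠ l in S.F, pb h y₁ l = cd w₁ l) ∧ Zc S (2 * n - 1) (cup w₁ (pb h y₂)) ∧ Bd S (2 * n - 1) (cup w₁ (pb h y₂)) := by
  obtain ⟨w, h1, h2, h3⟩ := cone_rep hh hc
  have hy := hom_cone.zc hc
  set y := pb Sum.inr c
  obtain ⟨a1, p1, q1⟩ := (hA y (hy.on A)).lift'
  obtain ⟨a2, p2, q2⟩ := (hB y (hy.on B)).lift'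
  have hy1 : Zc S' n (y + cd a1) := hy.add (p1.cd.of_eq' (by ring))
  have hy2 : Zc S' n (y + cd a2) := hy.add (p2.cd.of_eq' (by ring))
  have hw1 := h1.add (hh.cc p1)
  have hw2 := h1.add (hh.cc p2)
  have e1 : ∀ᶠ l in S.F, pb h (y + cd a1) l = cd (w + pb h a1) l := by
    filter_upwards [h2] with l hl
    rw [pb_add, cd_add, Pi.add_apply, Pi.add_apply, hl, cd_pb]
  have e2 : ∀ᶠ l in S.F, pb h (y + cd a2) l = cd (w + pb h a2) l := by
    filter_upwards [h2] with l hl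
    rw [pb_add, cd_add, Pi.add_apply, Pi.add_apply, hl, cd_pb]
  obtain ⟨hzz, hcoh⟩ := brk_cup hh hy1 hy2 hw1 hw2 e1 e2 (by
    filter_upwards [S'.hF _ q1, S'.hF _ q2, ht] with l b1 b2 b3
    rcases b3 with b3 | b3
    · exact cup_loc (.inl fun p hp => b1 p hp (Lst.mono b3 hp))
    · exact cup_loc (.inr fun p hp => b2 p hp (Lst.mono b3 hp)))
  have k1 := h3.trans (brk_coh hh y w p1)
  have k2 := h3.trans (brk_coh hh y w p2)
  have k3 : Coh (cone h S S') (2 * n) (cup c c) (cup (brk h (y + cd a1) (w + pb h a1)) (brk h (y + cd a2) (w + pb h a2))) :=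
    ((Coh.cup_left k1 hc cupsite_self).trans (Coh.cup_right (Zc.brk hy1 hw1 e1) k2 cupsite_self)).of_eq' (by ring)
  refine ⟨_, _, _, hy1, hy2, ?_, ?_, q1, q2, hw1, e1, hzz, ?_⟩
  · show Bd _ _ _; rw [← add_assoc, coch_add_self, zero_add]; exact p1.bd'
  · show Bd _ _ _; rw [← add_assoc, coch_add_self, zero_add]; exact p2.bd'
  · exact del_bd' (n := 2 * n) hh hzz ((k3.trans hcoh).symm.bd h0) hz

end

section
open Filter Function Topology

variable {U V W X : Type} {S : Site V} {S' : Site W} {n m k : ℤ} {φ ψ χ χ' : Coch V} {h : V → W} {A : Set V} {B : Set W}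

theorem hom_on_ev [Free S] (hh : S.Hom S' h) (hA : ∀ᶠ l in S.F, ∀ x ∈ l, x ∈ A → h x ∈ B) :
    (S.on A).Hom (S'.on B) h := by
  have e : ∀ᶠ l in S.F ⊓ 𝓟 (Lst A), l.map h ∈ Lst B := eventually_inf_principal.2 (hA.mono fun l hl hA x hx => by
    obtain ⟨y, hy, rfl⟩ := List.mem_map.1 hx
    exact hl y hy (hA y hy))
  exact Free.hom (tendsto_inf.2 ⟨hh.tF.mono_left inf_le_left, tendsto_principal.2 e⟩)
    (tendsto_inf.2 ⟨hh.tG.mono_left inf_le_left, tendsto_principal.2 (e.filter_mono (inf_le_inf_right _ S.le))⟩)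

theorem hom_rel_ev [Free S] (hh : S.Hom S' h) (hA : ∀ᶠ l in S.F, ∀ x ∈ l, x ∈ A → h x ∈ B) :
    (S.rel A).Hom (S'.rel B) h :=
  Free.hom hh.tF (tendsto_sup.2 ⟨hh.tG.mono_right le_sup_left, (hom_on_ev hh hA).tF.mono_right le_sup_right⟩)

theorem on_rel {A B : Set V} : (S.on A).rel B = (S.rel B).on A := by
  simp only [Site.on, Site.rel, Site.mk.injEq, and_true, true_and]
  rw [inf_sup_right, inf_right_comm]

theorem prod_rel : S.prod (S'.rel B) = (S.prod S').rel (Prod.snd ⁻¹' B) := by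
  simp only [Site.rel, Site.prod, comap_inf, comap_sup, comap_lst, Site.mk.injEq, true_and, and_true]
  rw [inf_sup_left, ← sup_assoc, inf_assoc]

theorem pb_congr {f g : V → W} {c : Coch W} {l : List V} (h : ∀ x ∈ l, f x = g x) : pb f c l = pb g c l := by
  rw [pb, pb, List.map_congr_left h]

/-- A primitive that bounds on `A` can be made to vanish on `A`. -/
theorem bd_rel [Free S] (h1 : Cc S (n - 1) χ) (h2 : ∀ᶠ l in S.F, φ l = cd χ l) (h3 : Bd (S.on A) (n - 1) χ) :
    Bd (S.rel A) n φ := by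
  obtain ⟨a, p, q⟩ := h3.lift'
  have := h1.add (p.cd.of_eq' (m := n - 1) (by ring)).toCc
  exact ⟨χ + cd a, ⟨this.deg, Free.inv _, ev_rel.2 ⟨this.rel, q⟩⟩, h2.mono fun l hl => by rw [cd_add, cd_cd, add_zero, hl]⟩

/-- The classical Hopf invariant argument for a map which is a product over one half of the target and has a section
over the other half. -/
theorem hopf_abs {T : Site U} [Abs S] [Abs S'] [Abs T] (hh : S.Hom S' h) {A B : Set W} (ht : Thick S' A B)
    (hn : 2 ≤ n) (hA : Ctr (S'.on A)) (hB : Hz (S'.on B) n) (hz : Hz S' (2 * n - 1))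
    (hPB : Hz (S.on (h ⁻¹' B)) (2 * n - 2)) {Ψ : U × W → V} (hΨ : (T.prod (S'.on A)).Hom (S.on (h ⁻¹' A)) Ψ)
    {Φ : V → U × W} (hΦ : (S.on (h ⁻¹' A)).Hom (T.prod (S'.on A)) Φ)
    (e1 : ∀ᶠ l in (T.prod (S'.on A)).F, ∀ x ∈ l, h (Ψ x) = x.2)
    (e2 : ∀ᶠ l in (S.on (h ⁻¹' A)).F, ∀ x ∈ l, Ψ (Φ x) = x) (hJ : J (S'.on (A ∩ B)) (n - 1))
    {s : W → V} (hs : (S'.on B).Hom S s) (e3 : ∀ᶠ l in (S'.on B).F, ∀ x ∈ l, h (s x) = x)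
    {c : Coch (V ⊕ W)} (hc : Zc (cone h S S') n c) (h0 : Bd (cone h S S') (2 * n) (cup c c)) :
    Bd S' n (pb Sum.inr c) := by
  obtain ⟨y₁, y₂, w, z1, z2, c1, c2, v1, v2, hw, hyw, hzz, hb⟩ :=
    cone_halves hh ht (fun φ hφ => hA.bd (by lia) hφ) hB hz hc h0
  have hwA : Zc (S.on (h ⁻¹' A)) (n - 1) w := Zc.of_cc (hw.on _) (ev_on.2 (by
    filter_upwards [hyw, hh.tF v1] with l a1 a2 a3
    rw [← a1]
    refine a2 fun x hx => ?_
    obtain ⟨y, hy, rfl⟩ := List.mem_map.1 hx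
    exact a3 y hy))
  have hzr : Zc (S.rel (h ⁻¹' B)) (2 * n - 1) (cup w (pb h y₂)) := hzz.mk_rel (by
    filter_upwards [S.hF _ (hh.tF v2)] with l a1 a2
    refine cup_loc (.inr fun p hp => a1 p hp fun x hx => ?_)
    obtain ⟨y, hy, rfl⟩ := List.mem_map.1 hx
    exact a2 y (hp hy))
  have hbr : Bd (S.rel (h ⁻¹' B)) (2 * n - 1) (cup w (pb h y₂)) :=
    Bd.mk_rel hzr hb fun χ hχ => (hPB χ (hχ.of_eq' (by ring))).of_eq' (by ring)
  have y2L : Zc ((S'.on A).rel B) n y₂ := (z2.on A).mk_rel (ev_on.2 (v2.mono fun l h _ => h))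
  obtain ⟨a, ha, -⟩ := id hA
  set Z := S'.on A with hZ
  have hr : Free Z := inferInstance
  have hw2 := hΨ.zc hwA
  -- the fibre component of the primitive
  have hsw : ∀ (k : ℤ) (φ : Coch (U × W)), Zc (T.prod Z) k φ → ∃ σ, Zc T k σ ∧ Coh (T.prod Z) k φ (pb Prod.fst σ) := by
    intro k φ hφ
    have g1 : (T.prod Z).Hom (Z.prod T) Prod.swap := hom_swap
    have g2 : (Z.prod T).Hom (T.prod Z) Prod.swap := hom_swap
    refine ⟨pb (fun u => (u, a)) φ, (g2.comp (hom_slice ha)).zc hφ, ?_⟩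
    have := g1.coh (hA.rk _ (g2.zc hφ) a ha)
    simp only [pb_pb] at this ⊢
    rw [show (Prod.swap ∘ Prod.swap : U × W → U × W) = id from rfl, pb_id] at this
    exact this
  obtain ⟨σ, hσ, hσw⟩ := hsw _ _ hw2
  have hcr : Bd (T.prod (Z.rel B)) (2 * n - 1) (cross σ y₂) := by
    have g : ((T.prod Z).rel (Prod.snd ⁻¹' B)).Hom ((S.rel (h ⁻¹' B)).on (h ⁻¹' A)) Ψ := by
      rw [← on_rel]
      exact hom_rel_ev hΨ (e1.mono fun l hl x hx (hB : x.2 ∈ B) => show h (Ψ x) ∈ B from hl x hx ▸ hB)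
    have b1 := (g.bd (hbr.on _)).congr (ψ := cup (pb Ψ w) (pb Prod.snd y₂)) (e1.mono fun l hl => by
      rw [pb_cup, pb_pb, ← sub_eq_zero, CharTwo.sub_eq_add, ← Pi.add_apply, ← cup_add_right]
      exact cup_loc (.inr fun p hp => by
        rw [Pi.add_apply, pb_congr (f := h ∘ Ψ) (g := Prod.snd) fun x hx => hl x (hp hx), CharTwo.add_self_eq_zero]))
    have b2 := Coh.cup_left hσw ((hom_comap (f := (Prod.snd : U × W → W))).zc y2L) (S := T.prod (Z.rel B))
      ⟨le_rfl, inf_le_right, sup_le_sup le_sup_left inf_le_right, le_rfl, le_rfl⟩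
    rw [prod_rel] at b2 ⊢
    exact Bd.of_eq' (b2.symm.bd (b1.of_eq' (by ring))) (by ring)
  obtain ⟨κ, k1, k2⟩ := hcr
  obtain ⟨ζ, ζ1, ζ2⟩ := hA.bd (by lia) (z2.on A)
  have hk0 : ∀ᶠ l in (T.prod (Z.on B)).F, κ l = 0 :=
    k1.rel.filter_mono ((inf_le_inf_left _ (comap_mono le_sup_right)).trans le_sup_right)
  have hcz : Zc (T.prod Z) (2 * n - 2) (cross σ ζ + κ) := by
    refine Zc.of_cc (((hσ.toCc.cross ζ1).of_eq' (by ring)).add ((⟨k1.deg, Free.inv _, k1.rel.filter_mono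
      (sup_le_sup le_rfl (inf_le_inf_left _ (comap_mono le_sup_left)))⟩ : Cc (T.prod Z) _ κ).of_eq' (by ring))) ?_
    filter_upwards [k2, (T.prod Z).hF.van (hom_pr₁.zc hσ).cl, (T.prod Z).hF _ ((hom_pr (S := T)).tF ζ2)] with l a1 a2 a3
    rw [cd_add, Pi.add_apply, ← a1, cross, cross, cd_cup (hσ.deg.pb _).nil (ζ1.deg.pb _).nil, Pi.add_apply, cup_loc (.inl a2),
      zero_add, ← Pi.add_apply, ← cup_add_right]
    refine cup_loc (.inr fun p hp => ?_)
    rw [cd_pb, ← pb_add, pb, Pi.add_apply, show y₂ _ = cd ζ _ from a3 p hp, CharTwo.add_self_eq_zero]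
  obtain ⟨τ, hτ, hτw⟩ : ∃ τ, Zc T (2 * n - 2) τ ∧ Coh (T.prod Z) (2 * n - 2) (cross σ ζ + κ) (pb Prod.fst τ) :=
    hsw _ _ hcz
  have hζB : Zc (Z.on B) (n - 1) ζ := Zc.of_cc (ζ1.on _) (ev_on.2 (by
    filter_upwards [ζ2, ev_on (A := A).2 (v2.mono fun l h _ => h)] with l a1 a2 a3
    rw [← a1, a2 a3]))
  have hJ' : Coh (T.prod (Z.on B)) (n - 1 + (n - 1)) (cross σ ζ) (pb Prod.fst τ) := by
    have := hτw.on (Prod.snd ⁻¹' B)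
    rw [← prod_on] at this
    exact ((this.of_eq' (by ring)).congr (hk0.mono fun l hl => by simp [hl]))
  rw [hZ, on_on] at hζB hJ'
  rcases hJ T (n - 1) σ ζ τ hσ hζB (hτ.of_eq' (by ring)) hJ' with hb | hb
  · have b1 : Bd (S.on (h ⁻¹' A)) (n - 1) w := by
      have := hΦ.bd (hσw.bd (hom_pr₁.bd hb))
      rw [pb_pb] at this
      exact this.congr (e2.mono fun l hl => by rw [pb_congr (f := Ψ ∘ Φ) (g := id) hl, pb_id])
    have b2 : Bd ((S'.on B).on A) (n - 1) (pb s w) :=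
      (hom_on_ev hs (e3.mono fun l hl x hx (hA : x ∈ A) => show h (s x) ∈ A from (hl x hx).symm ▸ hA)).bd b1
    have b3 := bd_rel (hs.cc hw) (φ := y₁) (by
      filter_upwards [hs.tF hyw, e3] with l a1 a2
      rw [cd_pb, pb, ← show pb h y₁ (l.map s) = cd w (l.map s) from a1, show pb h y₁ (l.map s) = pb (h ∘ s) y₁ l by
        simp [pb], pb_congr (f := h ∘ s) (g := id) a2, pb_id]) b2
    exact c1.bd (Bd.of_rel_on ht v1 b3)
  · have b1 := bd_rel ζ1 ζ2 (by rw [hZ, on_on]; exact hb.bd hζB (by lia))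
    exact c2.bd (Bd.of_rel_on (ht.mono fun l hl => hl.symm) v2 b1)

end

section
open Filter Function Topology

variable {V : Type} {S : Site V} {k : ℤ} {K : Type} [NormedDivisionRing K] [NormedAlgebra ℝ K]

/-- The Euclidean norm of a pair. -/
def pn (p : K × K) : ℝ := √(‖p.1‖ ^ 2 + ‖p.2‖ ^ 2)

/-- The Hopf construction. -/
def hop (p : K × K) : ℝ × K := (‖p.1‖ ^ 2 - ‖p.2‖ ^ 2, (2 : ℝ) • (p.1 * p.2))

theorem gauge_pn : Gauge (pn (K := K)) where
  cont := by unfold pn; fun_prop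
  smul t ht p := by
    simp only [pn, Prod.smul_fst, Prod.smul_snd, norm_smul, Real.norm_of_nonneg ht, mul_pow, ← mul_add]
    rw [Real.sqrt_mul (sq_nonneg t), Real.sqrt_sq ht]
  pos p hp := by
    refine Real.sqrt_pos.2 ?_
    by_contra h
    have h1 : ‖p.1‖ = 0 := by nlinarith [sq_nonneg ‖p.1‖, sq_nonneg ‖p.2‖]
    have h2 : ‖p.2‖ = 0 := by nlinarith [sq_nonneg ‖p.1‖, sq_nonneg ‖p.2‖]
    exact hp (Prod.ext (norm_eq_zero.1 h1) (norm_eq_zero.1 h2))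

theorem mem_un_pn {p : K × K} : p ∈ un pn ↔ ‖p.1‖ ^ 2 + ‖p.2‖ ^ 2 = 1 := by
  show √_ = 1 ↔ _
  rw [Real.sqrt_eq_one]

theorem continuous_hop : Continuous (hop (K := K)) := by unfold hop; fun_prop

theorem hop_maps : Set.MapsTo (hop (K := K)) (un pn) (un (gs (fun x : K => ‖x‖))) := fun p hp => by
  have := mem_un_pn.1 hp
  rw [mem_un_gs]
  show (‖p.1‖ ^ 2 - ‖p.2‖ ^ 2) ^ 2 + ‖(2 : ℝ) • (p.1 * p.2)‖ ^ 2 = 1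
  rw [norm_smul, norm_mul, Real.norm_two]
  linear_combination (‖p.1‖ ^ 2 + ‖p.2‖ ^ 2 + 1) * this

theorem isClosed_hop {ε : ℝ} : IsClosed (hop ⁻¹' cap K ε) := (isClosed_cap (E := K) (ε := ε)).preimage continuous_hop

variable [FiniteDimensional ℝ K]

theorem hom_hop : (CS (un (pn (K := K)))).Hom (CS (un (gs (fun x : K => ‖x‖)))) hop :=
  hom_cs gauge_pn.compact continuous_hop.continuousOn hop_maps

theorem hopf_low {p : K × K} (hp : p ∈ un pn ∩ hop ⁻¹' cap K (-1)) : 1 / 2 ≤ ‖p.2‖ := by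
  have h1 := mem_un_pn.1 hp.1
  have h2 : -(1 / 2) ≤ -1 * (‖p.1‖ ^ 2 - ‖p.2‖ ^ 2) := hp.2
  nlinarith [norm_nonneg p.2]

theorem hopf_high {p : K × K} (hp : p ∈ un pn ∩ hop ⁻¹' cap K 1) : 1 / 2 ≤ ‖p.1‖ := by
  have h1 := mem_un_pn.1 hp.1
  have h2 : -(1 / 2) ≤ 1 * (‖p.1‖ ^ 2 - ‖p.2‖ ^ 2) := hp.2
  nlinarith [norm_nonneg p.1]

theorem dmn_low : Dmn ((CS (un (pn (K := K)))).on (hop ⁻¹' cap K (-1))) (CS (un (fun x : K => ‖x‖))) := by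
  rw [cs_on]
  have hK : IsCompact (un (pn (K := K)) ∩ hop ⁻¹' cap K (-1)) :=
    gauge_pn.compact.inter_right isClosed_hop
  have hne : ∀ p ∈ un (pn (K := K)) ∩ hop ⁻¹' cap K (-1), p.2 ≠ 0 := fun p hp =>
    norm_pos_iff.1 (by linarith [hopf_low hp])
  have c1 : ContinuousOn (fun p : K × K => nz (fun x : K => ‖x‖) p.2) (un pn ∩ hop ⁻¹' cap K (-1)) :=
    gauge_norm.continuousOn_nz.comp continuousOn_snd hne
  have m2 : Set.MapsTo (fun c : K => ((0 : K), c)) (un fun x : K => ‖x‖) (un pn ∩ hop ⁻¹' cap K (-1)) := fun c hc => by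
    have : ‖c‖ = 1 := hc
    refine ⟨mem_un_pn.2 (by simp [this]), ?_⟩
    show -(1 / 2) ≤ -1 * (‖(0 : K)‖ ^ 2 - ‖c‖ ^ 2)
    rw [this, norm_zero]; norm_num
  have m1 : Set.MapsTo (fun p : K × K => nz (fun x : K => ‖x‖) p.2) (un pn ∩ hop ⁻¹' cap K (-1)) (un fun x : K => ‖x‖) :=
    fun p hp => gauge_norm.nz_mem (hne p hp)
  refine dmn_cs hK gauge_norm.compact c1 m1 (by fun_prop) m2 ?_
  refine htpy_nz gauge_pn hK (ContinuousOn.comp (t := Set.univ) (by fun_prop) c1 (fun _ _ => trivial)) continuousOn_id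
    (fun p hp => (m2 (m1 hp)).1) (fun p hp => hp.1) fun p hp t ht => ?_
  have hp0 := norm_pos_iff.2 (hne p hp)
  set q := (1 - t) • ((0 : K), nz (fun x : K => ‖x‖) p.2) + t • p
  have hc : 0 < (1 - t) * ‖p.2‖⁻¹ + t ∧ t ≤ (1 - t) * ‖p.2‖⁻¹ + t := by
    have h1 := inv_pos.2 hp0
    have h2 := mul_nonneg (sub_nonneg.2 ht.2) h1.le
    refine ⟨?_, by linarith⟩
    rcases ht.1.eq_or_lt with h | h
    · rw [← h]; linarith
    · linarith
  have q1 : q.1 = t • p.1 := by simp [q]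
  have q2 : q.2 = ((1 - t) * ‖p.2‖⁻¹ + t) • p.2 := by simp [q, nz, add_smul, smul_smul]
  have hq : q ≠ 0 := fun h => by
    rw [h] at q2
    exact smul_ne_zero hc.1.ne' (hne p hp) q2.symm
  refine ⟨hq, gauge_pn.nz_mem hq, ?_⟩
  have h1 := mem_un_pn.1 (gauge_pn.nz_mem hq)
  have hN := inv_pos.2 (gauge_pn.pos q hq)
  show -(1 / 2) ≤ -1 * (‖(nz pn q).1‖ ^ 2 - ‖(nz pn q).2‖ ^ 2)
  have h3 := hp.2
  have h4 : -(1 / 2) ≤ -1 * (‖p.1‖ ^ 2 - ‖p.2‖ ^ 2) := hp.2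
  have h5 := mem_un_pn.1 hp.1
  have h6 : ‖(nz pn q).1‖ ^ 2 ≤ 3 * ‖(nz pn q).2‖ ^ 2 := by
    rw [nz, Prod.smul_fst, Prod.smul_snd, q1, q2]
    simp only [norm_smul, mul_pow, Real.norm_of_nonneg ht.1, Real.norm_of_nonneg hc.1.le]
    have := pow_le_pow_left₀ ht.1 hc.2 2
    have h7 : t ^ 2 * ‖p.1‖ ^ 2 ≤ 3 * (((1 - t) * ‖p.2‖⁻¹ + t) ^ 2 * ‖p.2‖ ^ 2) := by nlinarith [sq_nonneg ‖p.2‖, sq_nonneg t]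
    nlinarith [sq_nonneg ‖(pn q)⁻¹‖]
  linarith

theorem Sp.hz [Abs S] {n : ℕ} (hs : Sp S n) {v : V} (hv : S.Pt v) (h1 : k ≠ n) (h2 : k ≠ 0) : Hz S k :=
  (hs.rk (Hz.of_unit (sub_ne_zero.2 h1))).hz hv h2

/-- The inverse of the trivialization over the upper half. -/
def hopU (p : K × (ℝ × K)) : K × K :=
  (√((1 + p.2.1) / 2) • p.1, ((1 / 2 : ℝ) * (√((1 + p.2.1) / 2))⁻¹) • (p.1⁻¹ * p.2.2))

/-- The section over the lower half. -/
def hopL (p : ℝ × K) : K × K := (((1 / 2 : ℝ) * (√((1 - p.1) / 2))⁻¹) • p.2, √((1 - p.1) / 2) • 1)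

theorem hopf {n : ℕ} (hn : 2 ≤ n) (hK : Module.finrank ℝ K = n) {c : Coch (K × K ⊕ ℝ × K)}
    (hc : Zc (cone hop (CS (un (pn (K := K)))) (CS (un (gs (fun x : K => ‖x‖))))) n c)
    (h0 : Bd (cone hop (CS (un (pn (K := K)))) (CS (un (gs (fun x : K => ‖x‖))))) (2 * n) (cup c c)) :
    Bd (CS (un (gs (fun x : K => ‖x‖)))) n (pb Sum.inr c) := by
  obtain ⟨m, rfl⟩ : ∃ m, n = m + 1 := ⟨n - 1, by lia⟩
  have s1 : Sp (CS (un (fun x : K => ‖x‖))) m := sp_un m gauge_norm hK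
  have s2 : Sp (CS (un (gs (fun x : K => ‖x‖)))) (m + 1) := sp_un (m + 1) gauge_norm.gs (by simp [hK, add_comm])
  have p2 : (CS (un (gs (fun x : K => ‖x‖)))).Pt ((1 : ℝ), (0 : K)) := gauge_norm.pt (by norm_num)
  have p1 : (CS (un (fun x : K => ‖x‖))).Pt (1 : K) := pt_cs (by simp [un])
  have hU : IsCompact (un (gs (fun x : K => ‖x‖)) ∩ cap K 1) := gauge_norm.gs.compact.inter_right isClosed_cap
  have hL : IsCompact (un (gs (fun x : K => ‖x‖)) ∩ cap K (-1)) := gauge_norm.gs.compact.inter_right isClosed_cap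
  have hPU : IsCompact (un (pn (K := K)) ∩ hop ⁻¹' cap K 1) := gauge_pn.compact.inter_right isClosed_hop
  have hT : IsCompact (un (fun x : K => ‖x‖)) := gauge_norm.compact
  have key : ∀ r : ℝ, 1 / 2 ≤ r → 0 < √(r / 2) ∧ √(r / 2) ^ 2 = r / 2 := fun r hr =>
    ⟨Real.sqrt_pos.2 (by linarith), Real.sq_sqrt (by linarith)⟩
  have eU : ∀ p : K × (ℝ × K), ‖p.1‖ = 1 → p.2 ∈ un (gs (fun x : K => ‖x‖)) ∩ cap K 1 →
      hop (hopU p) = p.2 ∧ hopU p ∈ un pn := fun p h1 h2 => by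
    have h3 : -(1 / 2) ≤ 1 * p.2.1 := h2.2
    obtain ⟨h4, h5⟩ := key (1 + p.2.1) (by linarith)
    have h6 := mem_un_gs.1 h2.1
    have h7 : p.1 ≠ 0 := norm_pos_iff.1 (by linarith)
    set α := √((1 + p.2.1) / 2) with hα
    have n1 : ‖(hopU p).1‖ ^ 2 = (1 + p.2.1) / 2 := by
      simp only [hopU, norm_smul, ← hα, h1, Real.norm_of_nonneg h4.le, mul_one, h5]
    have n2 : ‖(hopU p).2‖ ^ 2 = (1 - p.2.1) / 2 := by
      have h8 : ‖p.2.2‖ ^ 2 = (1 - p.2.1) * (1 + p.2.1) := by linear_combination h6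
      have h9 : 1 + p.2.1 ≠ 0 := by linarith
      simp only [hopU, norm_smul, norm_mul, norm_inv, ← hα, h1, Real.norm_of_nonneg h4.le, inv_one, one_mul,
        mul_pow, inv_pow, h5, h8, Real.norm_of_nonneg (show (0 : ℝ) ≤ 1 / 2 by norm_num)]
      field_simp
    refine ⟨Prod.ext ?_ ?_, mem_un_pn.2 (by rw [n1, n2]; ring)⟩
    · show ‖(hopU p).1‖ ^ 2 - ‖(hopU p).2‖ ^ 2 = _
      rw [n1, n2]; ring
    · show (2 : ℝ) • ((α • p.1) * (((1 / 2 : ℝ) * α⁻¹) • (p.1⁻¹ * p.2.2))) = p.2.2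
      rw [smul_mul_smul_comm, smul_smul, mul_inv_cancel_left₀ h7]
      rw [show (2 : ℝ) * (α * (1 / 2 * α⁻¹)) = 1 by field_simp, one_smul]
  have eL : ∀ p ∈ un (gs (fun x : K => ‖x‖)) ∩ cap K (-1), hop (hopL p) = p ∧ hopL p ∈ un pn := fun p h2 => by
    have h3 : -(1 / 2) ≤ -1 * p.1 := h2.2
    obtain ⟨h4, h5⟩ := key (1 - p.1) (by linarith)
    have h6 := mem_un_gs.1 h2.1
    set α := √((1 - p.1) / 2) with hα
    have n1 : ‖(hopL p).2‖ ^ 2 = (1 - p.1) / 2 := by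
      simp only [hopL, norm_smul, ← hα, norm_one, Real.norm_of_nonneg h4.le, mul_one, h5]
    have n2 : ‖(hopL p).1‖ ^ 2 = (1 + p.1) / 2 := by
      have h8 : ‖p.2‖ ^ 2 = (1 - p.1) * (1 + p.1) := by linear_combination h6
      have h9 : 1 - p.1 ≠ 0 := by linarith
      simp only [hopL, norm_smul, norm_mul, norm_inv, ← hα, Real.norm_of_nonneg h4.le,
        mul_pow, inv_pow, h5, h8, Real.norm_of_nonneg (show (0 : ℝ) ≤ 1 / 2 by norm_num)]
      field_simp
    refine ⟨Prod.ext ?_ ?_, mem_un_pn.2 (by rw [n1, n2]; ring)⟩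
    · show ‖(hopL p).1‖ ^ 2 - ‖(hopL p).2‖ ^ 2 = _
      rw [n1, n2]; ring
    · show (2 : ℝ) • ((((1 / 2 : ℝ) * α⁻¹) • p.2) * (α • 1)) = p.2
      rw [smul_mul_smul_comm, smul_smul, mul_one]
      rw [show (2 : ℝ) * ((1 / 2 * α⁻¹) * α) = 1 by field_simp, one_smul]
  have hprod : ((CS (un (fun x : K => ‖x‖))).prod ((CS (un (gs (fun x : K => ‖x‖)))).on (cap K 1))).Hom
      (CS (un (fun x : K => ‖x‖) ×ˢ (un (gs (fun x : K => ‖x‖)) ∩ cap K 1))) id := by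
    rw [cs_on]; exact hom_cs_prod
  have cU : ContinuousOn (hopU (K := K)) (un (fun x : K => ‖x‖) ×ˢ (un (gs (fun x : K => ‖x‖)) ∩ cap K 1)) := by
    have c0 : ContinuousOn (fun p : K × ℝ × K => √((1 + p.2.1) / 2)) (un (fun x : K => ‖x‖) ×ˢ (un (gs (fun x : K => ‖x‖)) ∩ cap K 1)) := by
      fun_prop
    refine (c0.smul continuousOn_fst).prodMk ((continuousOn_const.mul (c0.inv₀ fun p hp => ?_)).smul
      ((continuousOn_fst.inv₀ fun p hp => ?_).mul (by fun_prop)))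
    · have : -(1 / 2) ≤ 1 * p.2.1 := hp.2.2
      exact (key _ (by linarith)).1.ne'
    · exact gauge_norm.ne hp.1
  have cL : ContinuousOn (hopL (K := K)) (un (gs (fun x : K => ‖x‖)) ∩ cap K (-1)) := by
    have c0 : ContinuousOn (fun p : ℝ × K => √((1 - p.1) / 2)) (un (gs (fun x : K => ‖x‖)) ∩ cap K (-1)) := by
      fun_prop
    refine ((continuousOn_const.mul (c0.inv₀ fun p hp => ?_)).smul continuousOn_snd).prodMk (c0.smul continuousOn_const)
    have : -(1 / 2) ≤ -1 * p.1 := hp.2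
    exact (key _ (by linarith)).1.ne'
  have hfst : ∀ p ∈ un (pn (K := K)) ∩ hop ⁻¹' cap K 1, p.1 ≠ 0 := fun p hp =>
    norm_pos_iff.1 (by linarith [hopf_high hp])
  refine hopf_abs (T := CS (un (fun x : K => ‖x‖))) (A := cap K 1) (B := cap K (-1)) (Ψ := hopU)
    (Φ := fun p => (nz (fun x : K => ‖x‖) p.1, hop p)) (s := hopL) hom_hop gauge_norm.thick (by exact_mod_cast hn)
    (gauge_norm.ctr (by norm_num)) (fun φ hφ => (gauge_norm.ctr (by norm_num)).bd (by push_cast; lia) hφ)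
    (s2.hz p2 (by push_cast; lia) (by push_cast; lia))
    (dmn_low.hz (s1.hz p1 (by push_cast; lia) (by push_cast; lia))) ?_ ?_ ?_ ?_ ?_ ?_ ?_ hc h0
  · have := (hom_cs (L := un pn ∩ hop ⁻¹' cap K 1) (hT.prod hU) cU fun p hp =>
      ⟨(eU p hp.1 hp.2).2, by rw [Set.mem_preimage, (eU p hp.1 hp.2).1]; exact hp.2.2⟩).comp hprod
    rw [cs_on (K := un pn)]; exact this
  · rw [cs_on, cs_on]
    exact hom_into (hom_cs hPU (gauge_norm.continuousOn_nz.comp continuousOn_fst hfst)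
      fun p hp => gauge_norm.nz_mem (hfst p hp)) (hom_cs hPU continuous_hop.continuousOn fun p hp => ⟨hop_maps hp.1, hp.2⟩)
  · have := hprod.tF.eventually ev_mem_cs
    filter_upwards [this] with l hl p hp
    have := hl p (by simpa using hp)
    exact (eU p this.1 this.2).1
  · rw [cs_on]
    filter_upwards [ev_mem_cs] with l hl p hp
    have h1 := mem_un_pn.1 (hl p hp).1
    have h2 := norm_pos_iff.2 (hfst p (hl p hp))
    have h3 : √((1 + (hop p).1) / 2) = ‖p.1‖ := by
      rw [Real.sqrt_eq_iff_eq_sq _ h2.le] <;> simp only [hop]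
      · linarith
      · nlinarith
    refine Prod.ext ?_ ?_ <;> simp only [hopU, h3, nz]
    · rw [smul_smul, mul_inv_cancel₀ h2.ne', one_smul]
    · have h4 : (‖p.1‖⁻¹ • p.1)⁻¹ = ‖p.1‖ • p.1⁻¹ := inv_eq_of_mul_eq_one_right (by
        rw [smul_mul_smul_comm, inv_mul_cancel₀ h2.ne', mul_inv_cancel₀ (hfst p (hl p hp)), one_smul])
      show ((1 / 2 : ℝ) * ‖p.1‖⁻¹) • ((‖p.1‖⁻¹ • p.1)⁻¹ * (2 : ℝ) • (p.1 * p.2)) = p.2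
      rw [h4, smul_mul_smul_comm, smul_smul, inv_mul_cancel_left₀ (hfst p (hl p hp)),
        show (1 / 2 : ℝ) * ‖p.1‖⁻¹ * (‖p.1‖ * 2) = 1 by field_simp, one_smul]
  · have : J ((CS (un (gs (fun x : K => ‖x‖)))).on (cap K 1 ∩ cap K (-1))) m := (dmn_band gauge_norm).j s1.j
    rwa [show (((m + 1 : ℕ) : ℤ) - 1) = m by push_cast; ring]
  · rw [cs_on]
    exact hom_cs hL cL fun p hp => (eL p hp).2
  · rw [cs_on]
    filter_upwards [ev_mem_cs] with l hl p hp
    exact (eL p (hl p hp)).1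

end

section
open Filter Function Topology

variable {U V W X : Type} {S : Site V} {S' : Site W} {n m k : ℤ} {φ ψ χ χ' : Coch V} {h : V → W} {T : Site U} {T' : Site X}

theorem cone_on {A : Set W} : (cone h S S').on (rho h ⁻¹' A) = cone h (S.on (h ⁻¹' A)) (S'.on A) := by
  have key : ∀ (P : Filter (List W)) (Q : Filter (List V)),
      (P.comap (List.map (rho h)) ⊓ (Q ⊔ pure []).comap lft) ⊓ 𝓟 (Lst (rho h ⁻¹' A)) =
      (P ⊓ 𝓟 (Lst A)).comap (List.map (rho h)) ⊓ (Q ⊓ 𝓟 (Lst (h ⁻¹' A)) ⊔ pure []).comap lft := fun P Q => by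
    have e1 : Q ⊓ 𝓟 (Lst (h ⁻¹' A)) ⊔ pure [] = (Q ⊔ pure []) ⊓ 𝓟 (Lst (h ⁻¹' A)) := by
      rw [inf_sup_right, inf_eq_left.2 (show pure [] ≤ _ from le_principal_iff.2 fun x hx => by simp at hx)]
    have e2 : 𝓟 (Lst (rho h ⁻¹' A)) ≤ comap lft (𝓟 (Lst (h ⁻¹' A))) := by
      rw [comap_principal]
      exact principal_mono.2 fun l hl x hx => hl _ (mem_lft.1 hx)
    rw [e1, comap_inf, comap_inf, comap_lst, inf_inf_inf_comm, inf_eq_left.2 e2]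
  have e : (cyl h S S').on (rho h ⁻¹' A) = cyl h (S.on (h ⁻¹' A)) (S'.on A) := by
    simp only [cyl, Site.on, key]
  rw [cone, ← on_rel, e]; rfl

/-- If `Sq¹` vanishes on a class of degree three in the mapping cone of a suspension, its restriction to the target is
determined by a class of degree two in the mapping cone of the desuspended map whose square vanishes. -/
theorem susp_abs [Abs S] [Abs S'] (hh : S.Hom S' h) {A B : Set W} (ht : Thick S' A B)
    (hA : ∀ k : ℤ, 2 ≤ k → Hz (S'.on A) k) (hB : ∀ k : ℤ, 2 ≤ k → Hz (S'.on B) k)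
    (hA' : ∀ k : ℤ, 2 ≤ k → Hz (S.on (h ⁻¹' A)) k) (hB' : ∀ k : ℤ, 2 ≤ k → Hz (S.on (h ⁻¹' B)) k)
    {c : Coch (V ⊕ W)} (hc : Zc (cone h S S') 3 c) (h0 : Bd (cone h S S') 5 (dop 1 c))
    (hp : ∀ χ, Zc ((cone h S S').on (rho h ⁻¹' (A ∩ B))) 2 χ → Bd ((cone h S S').on (rho h ⁻¹' (A ∩ B))) 4 (cup χ χ) →
      Bd (S'.on (A ∩ B)) 2 (pb Sum.inr χ)) : Bd S' 3 (pb Sum.inr c) := by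
  set K := cone h S S' with hK
  set A₁ := rho h ⁻¹' A
  set B₁ := rho h ⁻¹' B
  have kA : ∀ k : ℤ, 3 ≤ k → Hz (K.on A₁) k := fun k hk => by
    rw [hK, cone_on]; exact Hz.cone (hom_on_of hh fun _ h => h) (hA _ (by lia)) (hA' _ (by lia))
  have kB : ∀ k : ℤ, 3 ≤ k → Hz (K.on B₁) k := fun k hk => by
    rw [hK, cone_on]; exact Hz.cone (hom_on_of hh fun _ h => h) (hB _ (by lia)) (hB' _ (by lia))
  obtain ⟨c', h1, h2⟩ := Bd.lift hc (kB 3 le_rfl _ (hc.on _))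
  have h1' : Zc K 3 c' := h1.of_rel
  have h3 : Bd K 5 (dop 1 c') := Coh.bd ((h2.dop hc h1' 1).symm.of_eq' (by ring)) h0
  have h4 : Bd (K.rel B₁) 5 (dop 1 c') := Bd.mk_rel ((h1.dop 1).of_eq' (by ring)) h3 fun χ hχ => kB _ (by lia) _ hχ
  obtain ⟨χ, q1, q2⟩ := kA 3 le_rfl _ (h1'.on A₁)
  have q1' : Cc (K.on A₁) 2 χ := q1
  have z1 : Zc ((K.on A₁).rel B₁) 3 c' := by rw [on_rel]; exact h1.on A₁
  have hv := (ev_rel.1 h1.rel).2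
  have e1 : ∀ᶠ l in (K.on A₁).F, l ∈ Lst B₁ → cd χ l = 0 := by
    filter_upwards [q2, ev_on.2 (hv.mono fun _ h _ => h)] with l a1 a2 a3
    rw [← a1, a2 a3]
  have z2 : Zc ((K.on A₁).rel B₁) 3 (cd χ) := (q1.cd.of_eq' (by ring)).mk_rel e1
  have x1 : Coh ((K.on A₁).rel B₁) 5 (dop 1 c') (dop 1 (cd χ)) :=
    (Coh.dop (Bd.congr (Bd.zero) (by filter_upwards [q2] with l a1; rw [Pi.add_apply, a1]; exact (CharTwo.add_self_eq_zero _).symm)) z1 z2 1).of_eq' (by ring)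
  have x2 := coh_dop_cd (S := (K.on A₁).rel B₁) (n := 3) q1'.deg (Free.inv _) z2.rel 0
  rw [dop_zero'] at x2
  have x3 : Bd ((K.on A₁).rel B₁) 5 (dop 1 c') := by rw [on_rel]; exact h4.on A₁
  obtain ⟨ξ, y1, y2⟩ := Coh.bd (Coh.trans (Coh.symm (Bd.of_eq' (m := 5) x2 (by norm_num))) x1.symm) x3
  have y3 := ev_rel.1 y1.rel
  have y4 : Cc (K.on A₁) 4 ξ := ⟨y1.deg, Free.inv _, y3.1⟩
  have z3 : Zc (K.on A₁) 4 (CatCone.cup χ χ + ξ) :=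
    Zc.of_cc (((q1'.cup q1' cupsite_self).of_eq' (by ring)).add y4) (by
      filter_upwards [y2] with l a1
      rw [cd_add, Pi.add_apply, a1, CharTwo.add_self_eq_zero])
  have z4 : Bd ((K.on A₁).on B₁) 4 (CatCone.cup χ χ) := Bd.congr ((kA 4 (by norm_num) _ z3).on B₁) (ev_on.2 (by
    filter_upwards [y3.2] with l a1 a2
    rw [Pi.add_apply, a1 a2, add_zero]))
  have z5 : Zc ((K.on A₁).on B₁) 2 χ := Zc.of_cc (q1'.on B₁) (ev_on.2 e1)
  rw [on_on] at z4 z5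
  have hr : (S'.on A).Hom (K.on A₁) Sum.inr := hom_on_of hom_cone fun _ h => h
  have z6 := hp χ z5 z4
  rw [← on_on] at z6
  refine Coh.bd (hom_cone.coh h2) (Bd.of_rel_on (A := B) (B := A) (ht.mono fun _ h => h.symm) ?_
    (bd_rel (χ := pb Sum.inr χ) (hr.cc q1) ?_ z6))
  · filter_upwards [(hom_cone (h := h) (S := S) (S' := S')).tF hv] with l a1 a2
    exact a1 fun x hx => by obtain ⟨y, hy, rfl⟩ := List.mem_map.1 hx; exact a2 y hy
  · filter_upwards [hr.tF q2] with l a1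
    rw [cd_pb]; exact a1

end

section
open Filter Function Topology Quaternion

theorem Coh.of_ev {V : Type*} {S : Site V} {n : ℤ} {φ ψ : Coch V} (e : ∀ᶠ l in S.F, φ l = ψ l) : Coh S n φ ψ :=
  Bd.zero.congr (e.mono fun l hl => by rw [Pi.add_apply, hl]; exact (CharTwo.add_self_eq_zero _).symm)

theorem continuous_inv_smul {E F : Type*} [TopologicalSpace E] [NormedAddCommGroup F] [NormedSpace ℝ F]
    {N k : E → ℝ} (hN : Continuous N) (hk : Continuous k) {f : E → F} (hf : Continuous f) (hb : ∀ c, ‖f c‖ ≤ N c ^ 2 * k c) :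
    Continuous fun c => (N c)⁻¹ • f c := by
  refine continuous_iff_continuousAt.2 fun c => ?_
  by_cases hc : N c = 0
  · show Tendsto _ _ (𝓝 ((N c)⁻¹ • f c))
    rw [hc, inv_zero, zero_smul]
    refine squeeze_zero_norm (a := fun c => |N c| * k c) (fun c => ?_) (by simpa [hc] using (show Continuous fun c => |N c| * k c by fun_prop).tendsto c)
    rw [norm_smul, norm_inv, Real.norm_eq_abs]
    rcases (abs_nonneg (N c)).eq_or_lt with h | h
    · rw [← h]; simp
    · calc _ ≤ |N c|⁻¹ * (N c ^ 2 * k c) := by have := hb c; gcongr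
        _ = |N c| * k c := by rw [← sq_abs]; field_simp
  · exact (hN.continuousAt.inv₀ hc).smul hf.continuousAt

/-- The quaternions as pairs of complex numbers. -/
def zw (c : ℍ[ℝ]) : ℂ × ℂ := (⟨c.re, c.imI⟩, ⟨c.imK, -c.imJ⟩)
def wz (p : ℂ × ℂ) : ℍ[ℝ] := ⟨p.1.re, p.1.im, -p.2.im, p.2.re⟩

theorem zw_wz (p : ℂ × ℂ) : zw (wz p) = p := by simp [zw, wz]

theorem norm_sq_quat (c : ℍ[ℝ]) : ‖c‖ ^ 2 = c.re ^ 2 + c.imI ^ 2 + c.imJ ^ 2 + c.imK ^ 2 := by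
  rw [sq, ← Quaternion.normSq_eq_norm_mul_self, Quaternion.normSq_def']

theorem norm_sq_complex (z : ℂ) : ‖z‖ ^ 2 = z.re ^ 2 + z.im ^ 2 := by
  rw [Complex.sq_norm, Complex.normSq_apply]; ring

theorem pn_zw (c : ℍ[ℝ]) : pn (zw c) = ‖c‖ := by
  rw [pn, Real.sqrt_eq_iff_eq_sq (by positivity) (norm_nonneg _), norm_sq_quat, norm_sq_complex, norm_sq_complex]
  simp only [zw]; ring

theorem continuous_zw : Continuous zw := by
  refine Continuous.prodMk ?_ ?_ <;> refine Complex.equivRealProdCLM.symm.continuous.comp (Continuous.prodMk ?_ ?_)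
  · exact Quaternion.continuous_re
  · exact Quaternion.continuous_imI
  · exact Quaternion.continuous_imK
  · exact Quaternion.continuous_imJ.neg

theorem continuous_wz : Continuous wz := by
  have : wz = fun p : ℂ × ℂ => (Quaternion.linearIsometryEquivTuple.symm (WithLp.toLp 2 ![p.1.re, p.1.im, -p.2.im, p.2.re])) := by
    ext p <;> rfl
  rw [this]
  refine (LinearIsometryEquiv.continuous _).comp ((PiLp.continuous_toLp 2 _).comp (continuous_pi fun i => ?_))
  fin_cases i <;> simp <;> fun_prop

/-- The gauge of `ℝ × ℂ`. -/
def gc : ℝ × ℂ → ℝ := gs fun z : ℂ => ‖z‖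

theorem gauge_gc : Gauge gc := gauge_norm.gs

theorem gs_hop {K : Type} [NormedDivisionRing K] [NormedAlgebra ℝ K] (p : K × K) : gs (fun x : K => ‖x‖) (hop p) = pn p ^ 2 := by
  have : 0 ≤ ‖p.1‖ ^ 2 + ‖p.2‖ ^ 2 := by positivity
  rw [pn, Real.sq_sqrt this, gs, Real.sqrt_eq_iff_eq_sq (by positivity) this]
  show (‖p.1‖ ^ 2 - ‖p.2‖ ^ 2) ^ 2 + ‖(2 : ℝ) • (p.1 * p.2)‖ ^ 2 = _
  rw [norm_smul, norm_mul, Real.norm_two]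
  ring

theorem gc_hop (p : ℂ × ℂ) : gc (hop p) = pn p ^ 2 := gs_hop p

theorem le_gs {E : Type} [NormedAddCommGroup E] (p : ℝ × E) : ‖p‖ ≤ gs (fun x : E => ‖x‖) p := by
  refine max_le ?_ ?_ <;> refine Real.le_sqrt_of_sq_le ?_
  · rw [Real.norm_eq_abs, sq_abs]; nlinarith [sq_nonneg ‖p.2‖]
  · nlinarith [sq_nonneg p.1]

/-- The suspension of the complex Hopf map. -/
def sp (p : ℝ × ℍ[ℝ]) : ℝ × (ℝ × ℂ) := (p.1, ‖p.2‖⁻¹ • hop (zw p.2))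

theorem continuous_sp : Continuous sp :=
  continuous_fst.prodMk ((continuous_inv_smul continuous_norm continuous_one (continuous_hop.comp continuous_zw) fun c =>
    (le_gs _).trans (by rw [comp_apply, gs_hop, pn_zw, Pi.one_apply, mul_one])).comp continuous_snd)

theorem gc_sp (p : ℝ × ℍ[ℝ]) : gc (sp p).2 = ‖p.2‖ := by
  rw [sp, gauge_gc.smul _ (by positivity), gc_hop, pn_zw, sq, ← mul_assoc, inv_mul_mul_self]

theorem sp_maps : Set.MapsTo sp (un (gs (fun c : ℍ[ℝ] => ‖c‖))) (un (gs gc)) := fun p hp => by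
  rw [mem_un_gs] at *
  rwa [gc_sp]

theorem hom_sp : (CS (un (gs (fun c : ℍ[ℝ] => ‖c‖)))).Hom (CS (un (gs gc))) sp :=
  hom_cs gauge_norm.gs.compact continuous_sp.continuousOn sp_maps

theorem susp {c : Coch (ℝ × ℍ[ℝ] ⊕ ℝ × (ℝ × ℂ))}
    (hc : Zc (cone sp (CS (un (gs (fun c : ℍ[ℝ] => ‖c‖)))) (CS (un (gs gc)))) 3 c)
    (h0 : Bd (cone sp (CS (un (gs (fun c : ℍ[ℝ] => ‖c‖)))) (CS (un (gs gc)))) 5 (dop 1 c)) :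
    Bd (CS (un (gs gc))) 3 (pb Sum.inr c) := by
  refine susp_abs hom_sp gauge_gc.thick (fun k hk φ hφ => (gauge_gc.ctr (by norm_num)).bd (by lia) hφ)
    (fun k hk φ hφ => (gauge_gc.ctr (by norm_num)).bd (by lia) hφ)
    (fun k hk φ hφ => (gauge_norm.ctr (N := fun c : ℍ[ℝ] => ‖c‖) (ε := 1) (by norm_num)).bd (by lia) hφ)
    (fun k hk φ hφ => (gauge_norm.ctr (N := fun c : ℍ[ℝ] => ‖c‖) (ε := -1) (by norm_num)).bd (by lia) hφ)
    hc h0 fun χ h1 h2 => ?_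
  have hi : (CS (un (pn (K := ℂ)))).Hom ((CS (un (gs (fun c : ℍ[ℝ] => ‖c‖)))).on (sp ⁻¹' (cap (ℝ × ℂ) 1 ∩ cap (ℝ × ℂ) (-1))))
      fun p => ((0 : ℝ), wz p) := by
    rw [cs_on]
    refine hom_cs gauge_pn.compact (by have := continuous_wz; fun_prop) fun p hp => ?_
    refine band_incl (N := fun c : ℍ[ℝ] => ‖c‖) ?_
    show ‖wz p‖ = 1
    rw [← pn_zw, zw_wz]; exact hp
  have hj : (CS (un gc)).Hom ((CS (un (gs gc))).on (cap (ℝ × ℂ) 1 ∩ cap (ℝ × ℂ) (-1))) fun v => ((0 : ℝ), v) := by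
    rw [cs_on]
    exact hom_cs gauge_gc.compact (by fun_prop) band_incl
  have hF := hom_map_cone (h := hop) (h' := sp) hi hj (by
    filter_upwards [ev_mem_cs] with l hl p hp
    have : pn p = 1 := hl p hp
    show (0, hop p) = ((0 : ℝ), ‖wz p‖⁻¹ • hop (zw (wz p)))
    rw [← pn_zw, zw_wz, this, inv_one, one_smul])
  rw [cone_on] at h1 h2
  have h3 := hopf (n := 2) le_rfl Complex.finrank_real_complex (hF.zc h1) (by
    have := hF.bd h2; rw [pb_cup] at this; exact Bd.of_eq' this (by norm_num))
  rw [pb_pb] at h3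
  have hb := band_maps gauge_gc
  have hK := gauge_gc.gs.compact.inter_right ((isClosed_cap (E := ℝ × ℂ) (ε := 1)).inter (isClosed_cap (E := ℝ × ℂ) (ε := -1)))
  have hz : Zc (CS (un (gs gc) ∩ (cap (ℝ × ℂ) 1 ∩ cap (ℝ × ℂ) (-1)))) 2 (pb Sum.inr χ) := by
    rw [← cs_on]; exact (hom_cone).zc h1
  rw [cs_on]
  have h4 := (hom_cs hK hb.1 hb.2).bd h3
  have h5 := (htpy_band gauge_gc).coh hz
  rw [pb_pb] at h4
  simp only [pb_pb, pb_id] at h5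
  exact Coh.bd h5.symm h4

end

section
open Filter Function Topology

variable {U V W X : Type} {S : Site V} {S' : Site W} {Y : Site X} {n m k : ℤ} {φ ψ : Coch V} {h : V → W}

/-- The distributivity map for mapping cylinders. -/
def dist (p : (V ⊕ W) × X) : (V × X) ⊕ (W × X) := Sum.map (·, p.2) (·, p.2) p.1

theorem lft_dist_fst (l : List ((V ⊕ W) × X)) : (lft (l.map dist)).map Prod.fst = lft (l.map Prod.fst) := by
  induction l with
  | nil => rfl
  | cons a l ih =>
    obtain ⟨a | a, x⟩ := a
    · exact congrArg (a :: ·) ih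
    · exact ih

theorem lft_dist_snd (l : List ((V ⊕ W) × X)) : (lft (l.map dist)).map Prod.snd ⊆ l.map Prod.snd := by
  intro x hx
  obtain ⟨y, hy, rfl⟩ := List.mem_map.1 hx
  obtain ⟨⟨a | a, x⟩, hz, e⟩ := List.mem_map.1 (mem_lft.1 hy) <;> cases e
  exact List.mem_map.2 ⟨_, hz, rfl⟩

theorem tendsto_dist {F : Filter (List V)} {G : Filter (List X)} (hG : Her G) :
    Tendsto (lft ∘ List.map (dist (V := V) (W := W)))
      (((F ⊔ pure []).comap lft).comap (List.map Prod.fst) ⊓ G.comap (List.map Prod.snd))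
      ((F.comap (List.map Prod.fst) ⊓ G.comap (List.map Prod.snd)) ⊔ pure []) := by
  intro p hp
  obtain ⟨h1, h2⟩ := eventually_sup.1 hp
  obtain ⟨p₁, p₂, a1, a2, a3⟩ := ev_prod h1
  refine mem_map.2 ?_
  have b1 : ∀ᶠ l in F ⊔ pure [], l = [] ∨ p₁ l :=
    eventually_sup.2 ⟨a1.mono fun _ h => .inr h, by rw [eventually_pure]; exact .inl rfl⟩
  filter_upwards [mem_inf_of_left (preimage_mem_comap (preimage_mem_comap b1)),
    mem_inf_of_right (preimage_mem_comap (hG _ a2))] with l hl1 hl2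
  have e := lft_dist_fst l
  rcases hl1 with hl1 | hl1
  · rw [hl1, List.map_eq_nil_iff] at e
    show lft (l.map dist) ∈ p
    rw [e]; exact eventually_pure.1 h2
  · exact a3 _ (e ▸ hl1) (hl2 _ (lft_dist_snd l))

theorem hom_dist [Free Y] : ((cyl h S S').prod Y).Hom (cyl (Prod.map h id) (S.prod Y) (S'.prod Y)) dist := by
  have e : rho (Prod.map h id) ∘ dist = (Prod.map (rho h) id : _ → W × X) := by
    funext ⟨a, x⟩; cases a <;> rfl
  have hr := hom_prodMap (hom_rho (h := h) (S := S) (S' := S')) (Site.Hom.id (S := Y))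
  have e' : List.map (rho (Prod.map h id)) ∘ List.map (dist (V := V) (W := W) (X := X)) = List.map (Prod.map (rho h) id) := by
    rw [List.map_comp_map, e]
  refine Free.hom (tendsto_inf.2 ⟨tendsto_comap_iff.2 (e' ▸ hr.tF), tendsto_comap_iff.2 ?_⟩)
    (tendsto_inf.2 ⟨tendsto_comap_iff.2 (e' ▸ hr.tG), tendsto_comap_iff.2 ?_⟩)
  · exact (tendsto_dist Y.hF).mono_left (inf_le_inf_right _ (comap_mono inf_le_right))
  · refine tendsto_sup.2 ⟨?_, ?_⟩
    · exact (tendsto_dist Y.hF).mono_left (inf_le_inf_right _ (comap_mono inf_le_right)) |>.mono_right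
        (sup_le_sup_right le_sup_left _)
    · exact (tendsto_dist Y.hG).mono_left (inf_le_inf_right _ (comap_mono inf_le_right)) |>.mono_right
        (sup_le_sup_right le_sup_right _)

theorem hom_dist_cone [Free Y] : ((cone h S S').prod Y).Hom (cone (Prod.map h id) (S.prod Y) (S'.prod Y)) dist := by
  rw [cone, rel_prod]
  refine hom_rel_ev hom_dist (eventually_all_of ?_)
  rintro ⟨_, x⟩ ⟨v, rfl⟩
  exact ⟨(v, x), rfl⟩

theorem dist_inl : dist ∘ Prod.map Sum.inl id = (Sum.inl : V × X → (V × X) ⊕ (W × X)) := rfl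

/-- A primitive on the product of a cylinder and a site bounds in the relative site when it bounds on the left end. -/
theorem cone_prod_bd [Free Y] {φ χ : Coch ((V ⊕ W) × X)} (h1 : Cc ((cyl h S S').prod Y) (n - 1) χ)
    (h2 : ∀ᶠ l in ((cyl h S S').prod Y).F, φ l = cd χ l)
    (h3 : Bd (S.prod Y) (n - 1) (pb (Prod.map Sum.inl id) χ)) : Bd ((cone h S S').prod Y) n φ := by
  rw [cone, rel_prod]
  refine bd_rel h1 h2 ?_
  obtain ⟨b, h4, h5⟩ := h3
  refine ⟨pb dist (ext b), (hom_dist.cc h4.ext).on _, ev_on.2 ?_⟩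
  have h6 := hom_dist.tF (ev_inl (h := Prod.map h id) (S' := S'.prod Y) h5 (by simp [pb, h1.deg.nil, h4.deg.cd.nil]))
  filter_upwards [h6] with l hl hA
  have e : l = (lft (l.map dist)).map (Prod.map Sum.inl id) := by
    clear hl
    induction l with
    | nil => rfl
    | cons a l ih =>
      obtain ⟨⟨v, hv⟩, h7⟩ := List.forall_mem_cons.1 hA
      obtain ⟨_, x⟩ := a
      cases hv
      exact congrArg (_ :: ·) (ih h7)
  have e' : l.map dist = (lft (l.map dist)).map Sum.inl := by
    conv_lhs => rw [e, List.map_map, dist_inl]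
  have h8 : pb (Prod.map Sum.inl id) χ (lft (l.map dist)) = _ := hl
  rw [pb, ← e] at h8
  have h9 : cd b = pb (Sum.inl : _ → _ ⊕ W × X) (cd (ext b)) := by rw [← cd_pb, pb_ext]
  rw [h8, h9, cd_pb]
  exact congrArg (cd (ext b)) e'.symm

def Ctg (F : Filter (List V)) (f : V → V) : Prop :=
  ∀ p : List V → Prop, (∀ᶠ l in F, p l) → ∀ᶠ l in F, ∀ l', l' ⊆ l.map f ++ l → p l'

theorem Ctg.inf {F G : Filter (List V)} {f : V → V} (hF : Ctg F f) (hG : Ctg G f) : Ctg (F ⊓ G) f := by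
  intro p hp
  rw [eventually_inf] at *
  obtain ⟨s, hs, t, ht, hst⟩ := hp
  exact ⟨_, hF _ hs, _, hG _ ht, fun l hl l' hl' => hst _ ⟨hl.1 l' hl', hl.2 l' hl'⟩⟩

theorem Ctg.comap {F : Filter (List W)} {g : W → W} (hF : Ctg F g) {f : V → V} {q : V → W} (e : ∀ x, q (f x) = g (q x)) :
    Ctg (F.comap (List.map q)) f := by
  intro p hp
  rw [eventually_comap] at *
  filter_upwards [hF _ hp] with l hl a ha l' hl'
  refine hl (l'.map q) (fun x hx => ?_) l' rfl
  obtain ⟨y, hy, rfl⟩ := List.mem_map.1 hx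
  rcases List.mem_append.1 (hl' hy) with h | h
  · obtain ⟨z, hz, rfl⟩ := List.mem_map.1 h
    rw [e]
    exact List.mem_append_left _ (List.mem_map.2 ⟨q z, ha ▸ List.mem_map.2 ⟨z, hz, rfl⟩, rfl⟩)
  · exact List.mem_append_right _ (ha ▸ List.mem_map.2 ⟨y, h, rfl⟩)

theorem Ctg.of_her {F : Filter (List V)} (h : Her F) : Ctg F id := fun p hp => (h p hp).mono fun l hl l' hl' =>
  hl l' fun x hx => by simpa using hl' hx

/-- Cocycles on the product of a cylinder and a site are pulled back from the target. -/
theorem rho_contig_prod {φ : Coch ((V ⊕ W) × X)} (hφ : Zc ((cyl h S S').prod Y) n φ) :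
    Coh ((cyl h S S').prod Y) n (pb (Prod.map (rho h) id) (pb (Prod.map Sum.inr id) φ)) φ := by
  have c : ∀ {F : Filter (List W)} {G : Filter (List V)} {G' : Filter (List X)}, Her F → Her G → Her G' →
      Ctg ((F.comap (List.map (rho h)) ⊓ G.comap lft).comap (List.map Prod.fst) ⊓ G'.comap (List.map Prod.snd))
        (Prod.map (Sum.inr ∘ rho h) id) := fun h1 h2 h3 =>
    ((show Ctg _ (Sum.inr ∘ rho h) from fun p hp => by
      simpa only [Function.comp_def] using tendsto_cyl_her h1 h2 hp).comap (f := Prod.map (Sum.inr ∘ rho h) id) (q := Prod.fst) fun _ => rfl).inf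
      ((Ctg.of_her h3).comap (f := Prod.map (Sum.inr ∘ rho h) id) (q := Prod.snd) fun _ => rfl)
  have h1 := coh_contig (S := (cyl h S S').prod Y) (f := Prod.map (Sum.inr ∘ rho h) id) (g := id) hφ.deg
    (by rw [List.map_id_fun]; exact c S'.hF (S.hF.sup her_pure) Y.hF _ hφ.cl)
    (by
      rw [List.map_id_fun]
      obtain ⟨h2, h3⟩ := eventually_sup.1 hφ.rel
      exact eventually_sup.2 ⟨c S'.hG (S.hG.sup her_pure) Y.hF _ h2, c S'.hF (S.hF.sup her_pure) Y.hG _ h3⟩)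
  rw [pb_id] at h1
  rwa [pb_pb]

theorem bd_of_cone_prod [Free S] [Free S'] [Free Y] (hh : S.Hom S' h) {χ : Coch ((V ⊕ W) × X)}
    (h1 : Cc ((cyl h S S').prod Y) (n - 1) χ) (h2 : Bd ((cone h S S').prod Y) n (cd χ))
    (hz : Hz (S'.prod Y) (n - 1)) : Bd (S.prod Y) (n - 1) (pb (Prod.map Sum.inl id) χ) := by
  rw [cone, rel_prod] at h2
  obtain ⟨ξ, h3, h4⟩ := h2
  obtain ⟨h5, h6⟩ := ev_rel.1 h3.rel
  have z : Zc ((cyl h S S').prod Y) (n - 1) (χ + ξ) := Zc.of_cc (h1.add ⟨h3.deg, Free.inv _, h5⟩) (by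
    have h4' : ∀ᶠ l in ((cyl h S S').prod Y).F, cd χ l = cd ξ l := h4
    filter_upwards [h4'] with l hl
    rw [cd_add, Pi.add_apply, hl, CharTwo.add_self_eq_zero])
  have hp : (S.prod Y).Hom ((cyl h S S').prod Y) (Prod.map Sum.inl id) := hom_prodMap (hom_inl hh) .id
  have hq : ((cyl h S S').prod Y).Hom (S'.prod Y) (Prod.map (rho h) id) := hom_prodMap hom_rho .id
  have hr : (S'.prod Y).Hom ((cyl h S S').prod Y) (Prod.map Sum.inr id) := hom_prodMap hom_inr .id
  refine (hp.bd ((rho_contig_prod z).symm.bd (hq.bd (hz _ (hr.zc z))))).congr ?_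
  have h8 : Tendsto (List.map (Prod.map Sum.inl id)) (S.prod Y).F
      (((cyl h S S').prod Y).F ⊓ 𝓟 (Lst (Prod.fst ⁻¹' Set.range Sum.inl))) :=
    tendsto_inf.2 ⟨hp.tF, tendsto_principal.2 (Eventually.of_forall fun l x hx => by
      obtain ⟨y, -, rfl⟩ := List.mem_map.1 hx; exact ⟨y.1, rfl⟩)⟩
  filter_upwards [h8.eventually (eventually_inf_principal.2 h6)] with l hl
  exact (congrArg (χ (l.map (Prod.map Sum.inl id)) + ·) hl).trans (add_zero _)

end

section
open Filter Function Topology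

variable {U V W X : Type} {S : Site V} {S' : Site W} {Y : Site X} {n m k : ℤ} {φ ψ : Coch V} {h : V → W}

/-- The Cartan formula when only one term survives. -/
theorem Zc.dop_cup_eq {Sa Sb S : Site V} {a b : Coch V} (ha : Zc Sa n a) (hb : Zc Sb m b) (hs : CupSite Sa Sb S) (k i : ℕ)
    (hi : i ≤ k) (h : ∀ j ≤ k, j ≠ i → Bd Sa (2 * n - j) (CatCone.dop j a) ∨
      Bd Sb (2 * m - (k - j : ℕ)) (CatCone.dop (k - j) b)) :
    Coh S (2 * (n + m) - k) (CatCone.dop k (CatCone.cup a b)) (CatCone.cup (CatCone.dop i a) (CatCone.dop (k - i) b)) := by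
  refine (ha.dop_cup hb hs k).trans ?_
  have h1 : Coh S (2 * (n + m) - k) (∑ j ∈ Finset.range (k + 1), CatCone.cup (CatCone.dop j a) (CatCone.dop (k - j) b))
      (∑ j ∈ Finset.range (k + 1), if j = i then CatCone.cup (CatCone.dop i a) (CatCone.dop (k - i) b) else 0) := by
    refine Coh.sum fun j hj => ?_
    have hj : j ≤ k := by simpa [Nat.lt_succ_iff] using hj
    split_ifs with e
    · subst e; exact Coh.refl
    · refine coh_zero.2 ?_
      rcases h j hj e with h | h
      · exact Bd.of_eq' (h.cup_left (hb.dop _) hs) (by push_cast [hj]; ring)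
      · exact Bd.of_eq' (Bd.cup_right (ha.dop _) h hs) (by push_cast [hj]; ring)
  rwa [Finset.sum_ite_eq', if_pos (by simpa [Nat.lt_succ_iff] using hi)] at h1

theorem pb_inr_ext (w : Coch V) (h0 : w [] = 0) : pb Sum.inr (ext w : Coch (V ⊕ W)) = 0 := by
  funext l
  simp only [pb, ext, lft_inr, h0, ite_self]; rfl

theorem pb_inr_brk (c : Coch W) (w : Coch V) (h0 : w [] = 0) : pb Sum.inr (brk h c w) = c := by
  rw [brk, pb_add, del, ← cd_pb, pb_inr_ext w h0, cd_zero, add_zero, pb_pb]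
  exact pb_id c

theorem cd_cross_ev {u : Coch X} (hu : Zc Y m u) : ∀ᶠ l in (S.prod Y).F, ∀ a : Coch V, a [] = 0 →
    cd (cross a u) l = cross (cd a) u l := by
  filter_upwards [(inf_le_right : (S.prod Y).F ≤ _) (preimage_mem_comap (Y.hF.van hu.cl))] with l hl a ha
  rw [cross, cd_cup (by simpa [pb] using ha) (by simpa [pb] using hu.deg.nil), cross, Pi.add_apply,
    cup_loc (a := pb Prod.fst a) (.inr ?_), add_zero, cd_pb]
  intro p hp
  rw [cd_pb]
  exact hl _ (List.map_subset _ hp)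

/-- The bracket of a product is the product with a bracket. -/
theorem cross_brk [Free S] [Free S'] [Free Y] (hh : S.Hom S' h) {c : Coch W} {u : Coch X} {v : Coch V} {w : Coch (V × X)}
    (hu : Zc Y m u) (hv : Cc S (n - 1) v) (ev : ∀ᶠ l in S.F, pb h c l = cd v l)
    (hw : Cc (S.prod Y) (n + m - 1) w) (ew : ∀ᶠ l in (S.prod Y).F, pb (Prod.map h id) (cross c u) l = cd w l)
    (hz : Hz (S.prod Y) (n + m - 1)) :
    Coh ((cone h S S').prod Y) (n + m) (pb dist (brk (Prod.map h id) (cross c u) w)) (cross (brk h c v) u) := by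
  have c1 : Cc ((cyl h S S').prod Y) (n + m - 1) (cross (ext v) u) := (hv.ext.cross hu.toCc).of_eq' (by ring)
  refine cone_prod_bd (χ := pb dist (ext w) + cross (ext v) u) ((hom_dist.cc hw.ext).add c1) ?_ ?_
  · filter_upwards [cd_cross_ev hu] with l hl
    rw [cd_add, Pi.add_apply, Pi.add_apply, hl _ hv.deg.ext.nil, brk, brk, pb_add, cross_add_left, pb_pb, del, cd_pb,
      show rho (Prod.map h id) ∘ dist = (Prod.map (rho h) id : _ → W × X) by funext ⟨a, x⟩; cases a <;> rfl, pb_cross, pb_id]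
    simp only [Pi.add_apply, del]
    grind
  · rw [pb_add, pb_pb, dist_inl, pb_ext, pb_cross, pb_ext, pb_id]
    refine hz _ (Zc.of_cc (hw.add ((hv.cross hu.toCc).of_eq' (by ring))) ?_)
    filter_upwards [cd_cross_ev hu, ew, (inf_le_left : (S.prod Y).F ≤ _) (preimage_mem_comap (S.hF _ ev))] with l h1 h2 h3
    rw [cd_add, Pi.add_apply, h1 _ hv.deg.nil, ← h2, pb_cross, pb_id, ← Pi.add_apply, ← cross_add_left]
    refine cup_loc (.inl fun p hp => ?_)
    have := h3 (p.map Prod.fst) (List.map_subset _ hp)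
    rw [pb, Pi.add_apply, this, CharTwo.add_self_eq_zero]

end

section
open Filter Function Topology

variable {U V W X : Type} {S : Site V} {S' : Site W} {n m k : ℤ} {φ ψ : Coch V} {h : V → W}

/-- `y` is obtained from `u` by the functional operation associated with `Sq²`. -/
def IsY (S : Site V) (S' : Site W) (h : V → W) (u : Coch W) (y : Coch V) : Prop :=
  Zc S 4 y ∧ ∃ v, Cc S 2 v ∧ (∀ᶠ l in S.F, pb h u l = cd v l) ∧ Coh (cone h S S') 5 (dop 1 (brk h u v)) (del y)

theorem IsY.exists [Free S] [Free S'] (hh : S.Hom S' h) (h1 : Hz S' 5) (h2 : Hz S 3) {u : Coch W} (hu : Zc S' 3 u) :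
    ∃ y, IsY S S' h u y := by
  obtain ⟨v, hv, ev⟩ := h2 _ (hh.zc hu)
  have hc : Zc (cone h S S') 3 (brk h u v) := Zc.brk hu (hv.of_eq' (by ring)) ev
  obtain ⟨y, hy, e⟩ := cone_of_bd (n := 5) hh ((hc.dop 1).of_eq' (by ring)) (h1 _ ((hom_cone.zc (hc.dop 1)).of_eq' (by ring)))
  exact ⟨y, hy.of_eq' (by ring), v, hv.of_eq' (by ring), ev, e⟩

theorem IsY.unique [Free S] [Free S'] (hh : S.Hom S' h) (h1 : Hz S' 4) (h2 : Hz S 2) {u : Coch W} (hu : Zc S' 3 u)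
    {y y' : Coch V} (hy : IsY S S' h u y) (hy' : IsY S S' h u y') : Coh S 4 y y' := by
  obtain ⟨a, v, hv, ev, e⟩ := hy
  obtain ⟨a', v', hv', ev', e'⟩ := hy'
  have hc : Zc (cone h S S') 3 (brk h u v) := Zc.brk hu (hv.of_eq' (by ring)) ev
  have hc' : Zc (cone h S S') 3 (brk h u v') := Zc.brk hu (hv'.of_eq' (by ring)) ev'
  have h3 : Zc S 2 (v + v') := Zc.of_cc (hv.add hv') (by
    filter_upwards [ev, ev'] with l h h'
    rw [cd_add, Pi.add_apply, ← h, ← h', CharTwo.add_self_eq_zero])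
  have h4 : Coh (cone h S S') 3 (brk h u v) (brk h u v') := by
    unfold Coh
    rw [← brk_add, coch_add_self, brk, pb_zero, zero_add]
    exact Bd.del (n := 3) (h2 _ h3) h3.toCc
  have h5 : Coh (cone h S S') 5 (dop 1 (brk h u v)) (dop 1 (brk h u v')) := Bd.of_eq' (m := 5) (h4.dop hc hc' 1) (by ring)
  have h6 := e.symm.trans (h5.trans e')
  unfold Coh at h6
  rw [← del_add] at h6
  exact del_bd' (n := 5) hh ((a.add a').of_eq' (by ring)) h6 h1

variable {V' W' : Type} {T : Site V'} {T' : Site W'} {h' : V' → W'} {α : V → V'} {β : W → W'}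

theorem IsY.pull (hα : S.Hom T α) (hβ : S'.Hom T' β) (e : ∀ᶠ l in S.F, ∀ x ∈ l, β (h x) = h' (α x)) [Free S] [Free S']
    {u : Coch W'} {y : Coch V'} (hu : Zc T' 3 u) (hy : IsY T T' h' u y) [Free T] : IsY S S' h (pb β u) (pb α y) := by
  obtain ⟨a, v, hv, ev, e1⟩ := hy
  have h1 := hom_map_cone hα hβ e
  have hc : Zc (cone h' T T') 3 (brk h' u v) := Zc.brk hu (hv.of_eq' (by ring)) ev
  have ev' : ∀ᶠ l in S.F, pb h (pb β u) l = cd (pb α v) l := by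
    filter_upwards [hα.tF ev, e] with l hl hl'
    rw [cd_pb, pb_pb, pb_congr (f := β ∘ h) hl', ← comp_def, ← pb_pb]
    exact hl
  refine ⟨hα.zc a, pb α v, hα.cc hv, ev', ?_⟩
  have h2 := h1.coh e1
  rw [pb_dop, pb_map_del] at h2
  exact Coh.trans (Coh.symm (Bd.of_eq' (m := 5) ((pb_map_brk e u v).dop (h1.zc hc)
    (Zc.brk (hβ.zc hu) ((hα.cc hv).of_eq' (by ring)) ev') 1) (by ring))) h2

theorem IsY.htpy [Abs S] [Abs S'] {f g : V → W} {u : Coch W} (hH : Htpy S S' f g) (hu : Zc S' 3 u) (h5 : Hz S' 5)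
    (h4 : Hz S' 4) (h3 : Hz S 3) (h2 : Hz S 2) (hf : S.Hom S' f) (hg : S.Hom S' g) {y y' : Coch V} (hy : IsY S S' f u y)
    (hy' : IsY S S' g u y') : Coh S 4 y y' := by
  obtain ⟨H, h1, e⟩ := hH
  have q : Hz (UI.prod S) 3 := fun φ hφ => by
    have h0 : UI.Pt 0 := pt_cs (by simp)
    have hc : Ctr UI := ⟨0, h0, htpy_cs isCompact_Icc (fun p => (1 - p.2) * p.1) (by fun_prop)
      (fun x hx t ht => ⟨by nlinarith [hx.1, hx.2, ht.1, ht.2], by nlinarith [hx.1, hx.2, ht.1, ht.2]⟩) (by simp) (by simp)⟩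
    refine Coh.bd (hc.rk φ hφ 0 h0) ?_
    have := (hom_pr (S := UI)).bd (h3 _ ((hom_slice h0).zc hφ))
    rwa [pb_pb] at this
  obtain ⟨z, hz⟩ := IsY.exists (h1.comp hom_swap) h5 q hu
  have key : ∀ t ∈ Set.Icc (0 : ℝ) 1, ∀ f' : V → W, S.Hom S' f' → (∀ᶠ l in S.F, ∀ x ∈ l, H (x, t) = f' x) → ∀ y',
      IsY S S' f' u y' → Coh S 4 (pb (Prod.mk t) z) y' := fun t ht f' hf' e' y' hy => by
    have := IsY.pull (h := f') (hom_slice (S := UI) (pt_cs ht)) (Site.Hom.id (S := S')) (by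
      filter_upwards [e'] with l hl x hx
      exact (hl x hx).symm) hu hz
    rw [pb_id] at this
    exact this.unique hf' h4 h2 hu hy
  exact (key 0 (by simp) f hf (e.mono fun l h x hx => (h x hx).1) y hy).symm.trans
    ((coh_interval hz.1).trans (key 1 (by simp) g hg (e.mono fun l h x hx => (h x hx).2) y' hy'))

end

section
open Filter Function Topology

variable {V W : Type} {Q Qr : Site V} {Xr : Site W} {f g : V → W} {u : Coch W}

/-- The gluing of `(f, g)` and `f × 1`. -/
def glu (f g : V → W) : V ⊕ V × W → W × W := Prod.map f id ∘ rho (fun q => (q, g q))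

/-- The mapping cone of the graph of `g`. -/
def grf (g : V → W) (Q Qr : Site V) (Xr : Site W) : Site (V ⊕ V × W) := cone (fun q => (q, g q)) Q (Qr.prod Xr)

instance [Free Q] : Free (grf g Q Qr Xr) := inferInstanceAs (Free (cone _ _ _))

theorem hom_glu [Free Q] [Free Qr] [Free Xr] (hf : Qr.Hom Xr f)
    (ht : Tendsto (List.map fun q => (f q, g q)) Q.F (Xr.prod Xr).G) (h0 : ∀ p ∈ (Xr.prod Xr).G, [] ∈ p) : (grf g Q Qr Xr).Hom (Xr.prod Xr) (glu f g) := by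
  have h1 : (cyl (fun q => (q, g q)) Q (Qr.prod Xr)).Hom (Xr.prod Xr) (glu f g) :=
    Site.Hom.comp (hom_prodMap hf Site.Hom.id) hom_rho
  refine Free.hom (S := cone _ _ _) h1.tF fun p hp => ?_
  refine ev_rel.2 ⟨h1.tG hp, ?_⟩
  filter_upwards [ev_inl (p := fun l => l.map (fun q => (f q, g q)) ∈ p) (ht hp) (h0 p hp)] with l hl hA
  rw [← lst_inl hA, List.map_map]
  exact hl

theorem glu_inr [Free Q] [Free Qr] [Free Xr] {w : Coch (V ⊕ V × W)} {κ : Coch (V ⊕ V × W)} {y : Coch V}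
    (hf : Qr.Hom Xr f) (hF : (grf g Q Qr Xr).Hom (Xr.prod Xr) (glu f g))
    (hu : Zc Xr 3 u) (hw : Cc (grf g Q Qr Xr) 5 w)
    (ew : ∀ᶠ l in (grf g Q Qr Xr).F, pb (glu f g) (cross u u) l = cd w l) (hκ : Zc (grf g Q Qr Xr) 7 κ)
    (eκ : Coh (cone (glu f g) (grf g Q Qr Xr) (Xr.prod Xr)) 8 (dop 4 (brk (glu f g) (cross u u) w)) (del κ))
    (hy : IsY Qr Xr f u y) (hX : ∀ k, k ≠ 3 → k < 8 → Hz Xr k) (hP : Hz (Qr.prod Xr) 5) (hT : Hz (Xr.prod Xr) 7) :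
    Coh (Qr.prod Xr) 7 (pb Sum.inr κ) (cross y u) := by
  obtain ⟨hy, v, hv, ev, e1⟩ := hy
  have hũ : Zc (cone f Qr Xr) 3 (brk f u v) := Zc.brk hu (hv.of_eq' (by ring)) ev
  have hc : Zc (cone (glu f g) (grf g Q Qr Xr) (Xr.prod Xr)) 6 (brk (glu f g) (cross u u) w) :=
    Zc.brk ((hu.cross hu).of_eq' (by ring)) (hw.of_eq' (by ring)) ew
  have h2 : (cone (Prod.map f id) (Qr.prod Xr) (Xr.prod Xr)).Hom (cone (glu f g) (grf g Q Qr Xr) (Xr.prod Xr))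
      (Sum.map Sum.inr id) := hom_map_cone hom_cone Site.Hom.id (Eventually.of_forall fun _ _ _ => rfl)
  have h1 : ((cone f Qr Xr).prod Xr).Hom _ dist := hom_dist_cone
  have k1 := h1.coh (pb_map_brk (n := 6) (S := Qr.prod Xr) (S' := Xr.prod Xr) (h := Prod.map f id) (h' := glu f g)
    (α := Sum.inr) (β := id) (Eventually.of_forall fun _ _ _ => rfl) (cross u u) w)
  rw [pb_id] at k1
  have ew' : ∀ᶠ l in (Qr.prod Xr).F, pb (Prod.map f id) (cross u u) l = cd (pb Sum.inr w) l := by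
    filter_upwards [hom_cone.tF ew] with l hl
    rw [cd_pb, ← show pb Sum.inr (pb (glu f g) (cross u u)) = pb (Prod.map f id) (cross u u) by rw [pb_pb]; rfl]
    exact hl
  have k2 : Coh ((cone f Qr Xr).prod Xr) 6 (pb dist (brk (Prod.map f id) (cross u u) (pb Sum.inr w))) (cross (brk f u v) u) :=
    cross_brk (n := 3) (m := 3) hf hu (hv.of_eq' (by ring)) ev ((hom_cone.cc hw).of_eq' (by ring)) ew' hP
  have hx : Zc ((cone f Qr Xr).prod Xr) 6 (cross (brk f u v) u) := (hũ.cross hu).of_eq' (by ring)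
  have k3 : Coh ((cone f Qr Xr).prod Xr) 8 _ _ := Bd.of_eq' ((k1.trans k2).dop (h1.zc (h2.zc hc)) hx 4) (by norm_num)
  have k4 : Coh ((cone f Qr Xr).prod Xr) 8 (dop 4 (cross (brk f u v) u)) (cross (dop 1 (brk f u v)) (dop 3 u)) := by
    have := Zc.dop_cup_eq (hom_comap.zc hũ) (hom_comap.zc hu) cupsite_prod 4 1 (by norm_num) fun j hj hj1 => .inr (by
      rw [← pb_dop]
      exact hom_comap.bd (hX _ (by omega) (by omega) _ (hu.dop _)))
    rw [← pb_dop, ← pb_dop] at this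
    exact Bd.of_eq' this (by norm_num)
  have k5 : Coh ((cone f Qr Xr).prod Xr) 8 (cross (dop 1 (brk f u v)) (dop 3 u)) (cross (del y) u) :=
    Coh.cross (n := 5) (m := 3) ((hũ.dop 1).of_eq' (by ring)) hu e1 (hu.dop_self (k := 3) Free.emp fund_three)
  have k6 := h1.coh (h2.coh eκ)
  rw [pb_dop, pb_dop, pb_map_del] at k6
  have k7 := (Coh.symm k6).trans (k3.trans (k4.trans k5))
  have k8 : Bd ((cone f Qr Xr).prod Xr) 8 (cd (pb dist (ext (pb Sum.inr κ)) + cross (ext y) u)) := by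
    refine Bd.congr k7 ?_
    filter_upwards [show ∀ᶠ l in ((cone f Qr Xr).prod Xr).F, _ from cd_cross_ev (S := cyl f Qr Xr) hu] with l hl
    rw [cd_add]
    simp only [Pi.add_apply]
    rw [hl _ hy.deg.ext.nil, cd_pb]
    rfl
  have k9 := bd_of_cone_prod hf (n := 8) (Cc.add ((hom_dist.cc (hom_cone.zc hκ).toCc.ext).of_eq' (by ring))
    ((hy.toCc.ext.cross hu.toCc).of_eq' (by ring))) k8 hT
  rwa [pb_add, pb_pb, dist_inl, pb_ext, pb_cross, pb_ext, pb_id] at k9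

end

section
open Filter Function Topology

variable {V W : Type} {Q Qr : Site V} {Xr : Site W} {f g : V → W} {u : Coch W}

/-- The projection of the cone of a graph to the source. -/
def gpr (g : V → W) : V ⊕ V × W → V := Prod.fst ∘ rho fun q => (q, g q)

theorem tendsto_gpr : (cyl (fun q => (q, g q)) Q (Qr.prod Xr)).F ≤ (Qr.comap (gpr g)).F := by
  refine inf_le_left.trans ((comap_mono (inf_le_left : (Qr.prod Xr).F ≤ _)).trans ?_)
  rw [comap_comap, List.map_comp_map]; rfl

theorem tendsto_gsnd : Tendsto (List.map (Sum.map id Prod.snd)) (cyl (fun q => (q, g q)) Q (Qr.prod Xr)).F (cyl g Q Xr).F := by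
  have e : List.map (rho g) ∘ List.map (Sum.map id Prod.snd) = List.map Prod.snd ∘ List.map (rho fun q : V => (q, g q)) := by
    rw [List.map_comp_map, List.map_comp_map]; congr 1; funext x; cases x <;> rfl
  refine tendsto_inf.2 ⟨tendsto_comap_iff.2 ?_, tendsto_comap_iff.2 ?_⟩
  · rw [e]
    exact (tendsto_comap.mono_left (inf_le_right : (Qr.prod Xr).F ≤ _)).comp (tendsto_comap.mono_left inf_le_left)
  · simp only [comp_def, lft_map, List.map_id]
    exact tendsto_comap.mono_left inf_le_right

theorem cupsite_grf [hQ : Abs Q] : CupSite (Qr.comap (gpr g)) ((cone g Q Xr).comap (Sum.map id Prod.snd)) (grf g Q Qr Xr) where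
  Fa := tendsto_gpr
  Fb := tendsto_iff_comap.1 tendsto_gsnd
  Ia := le_rfl
  Ib := le_rfl
  G := by
    have e : List.map (rho g) ∘ List.map (Sum.map id Prod.snd) = List.map Prod.snd ∘ List.map (rho fun q : V => (q, g q)) := by
      rw [List.map_comp_map, List.map_comp_map]; congr 1; funext x; cases x <;> rfl
    refine sup_le ?_ (le_sup_of_le_right ?_)
    · show comap _ (_ ⊔ _) ⊓ _ ≤ _
      rw [comap_sup, inf_sup_right]
      refine sup_le_sup ?_ (tendsto_iff_comap.1 (Tendsto.mono_right (y := (cyl g Q Xr).G) ?_ le_sup_left))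
      · refine inf_le_left.trans ((comap_mono inf_le_left).trans ?_)
        rw [comap_comap, List.map_comp_map]; rfl
      · refine tendsto_inf.2 ⟨tendsto_comap_iff.2 ?_, tendsto_comap_iff.2 ?_⟩
        · rw [e]
          exact (tendsto_comap.mono_left inf_le_right).comp (tendsto_comap.mono_left inf_le_left)
        · simp only [comp_def, lft_map, List.map_id]
          exact tendsto_comap.mono_left inf_le_right
    · refine tendsto_iff_comap.1 (Tendsto.mono_right (y := (cyl g Q Xr).F ⊓ 𝓟 (Lst (Set.range Sum.inl))) ?_ le_sup_right)
      refine tendsto_inf.2 ⟨tendsto_gsnd.mono_left inf_le_left, (tendsto_principal_principal.2 fun l hl x hx => ?_).mono_left inf_le_right⟩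
      obtain ⟨y, hy, rfl⟩ := List.mem_map.1 hx
      obtain ⟨z, rfl⟩ := hl y hy
      exact ⟨z, rfl⟩

theorem dop_glu [Abs Q] [Free Qr] [Free Xr] {κ : Coch (V ⊕ V × W)} {y y' : Coch V} (hi : Q.Hom Qr id)
    (hg : Q.Hom Xr g) (hu : Zc Xr 3 u) (hκ : Zc (grf g Q Qr Xr) 7 κ) (e : Coh (Qr.prod Xr) 7 (pb Sum.inr κ) (cross y u))
    (hy : Zc Qr 4 y) (hy' : IsY Q Xr g u y') (hQ : Hz Q 6) (h5 : Hz Qr 5) (h6 : Hz Qr 6) :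
    Coh (grf g Q Qr Xr) 9 (dop 5 κ) (del (cup y y')) := by
  obtain ⟨hy', v, hv, ev, e1⟩ := hy'
  have hũ : Zc (cone g Q Xr) 3 (brk g u v) := Zc.brk hu (hv.of_eq' (by ring)) ev
  have hs := cupsite_grf (g := g) (Q := Q) (Qr := Qr) (Xr := Xr)
  have ha := (hom_comap (f := gpr g)).zc hy
  have hb := (hom_comap (f := Sum.map id (Prod.snd : V × W → W))).zc hũ
  set a := pb (gpr g) y with ea
  set b := pb (Sum.map id (Prod.snd : V × W → W)) (brk g u v) with eb
  have hk : Zc (grf g Q Qr Xr) 7 (cup a b) := (ha.cup hb hs).of_eq' (by ring)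
  have hgr : Q.Hom (Qr.prod Xr) (fun q => (q, g q)) := hom_into hi hg
  have k1 : Coh (grf g Q Qr Xr) 7 κ (cup a b) := by
    have h1 : pb Sum.inr (κ + cup a b) = pb Sum.inr κ + cross y u := by
      rw [pb_add, pb_cup, ea, eb, pb_pb, pb_pb, show Sum.map id Prod.snd ∘ Sum.inr = Sum.inr ∘ (Prod.snd : V × W → W) from rfl,
        ← pb_pb _ Sum.inr, pb_inr_brk _ _ hv.deg.nil]; rfl
    obtain ⟨w, hw, h2⟩ := cone_of_bd (S := Q) (n := 7) hgr (hκ.add hk) (h1 ▸ e)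
    exact h2.bd ((hQ w (hw.of_eq' (by ring)) |>.of_eq' (by ring)).del hw.toCc)
  have k2 : Coh (grf g Q Qr Xr) 9 (dop 5 κ) (dop 5 (cup a b)) := Bd.of_eq' (k1.dop hκ hk 5) (by norm_num)
  have k3 : Coh (grf g Q Qr Xr) 9 (dop 5 (cup a b)) (cup (dop 4 a) (dop 1 b)) := by
    refine Bd.of_eq' (Zc.dop_cup_eq ha hb hs 5 4 (by norm_num) fun j hj hj4 => ?_) (by norm_num)
    interval_cases j
    · exact .inr (Bd.of_eq' (Zc.instability (k := 3) hb rfl (j := 5) (by norm_num)) (by norm_num))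
    · exact .inr (Bd.of_eq' (Zc.instability (k := 3) hb rfl (j := 4) (by norm_num)) (by norm_num))
    · refine .inl ?_
      rw [ea, ← pb_dop]
      exact hom_comap.bd (Bd.of_eq' (h6 _ ((hy.dop 2).of_eq' (by norm_num))) (by norm_num))
    · refine .inl ?_
      rw [ea, ← pb_dop]
      exact hom_comap.bd (Bd.of_eq' (h5 _ ((hy.dop 3).of_eq' (by norm_num))) (by norm_num))
    · exact absurd rfl hj4
    · exact .inl (Bd.of_eq' (Zc.instability (k := 4) ha rfl (j := 5) (by norm_num)) (by norm_num))
  have k4 : Coh (grf g Q Qr Xr) 9 (cup (dop 4 a) (dop 1 b)) (cup a (dop 1 b)) :=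
    Bd.of_eq' (Coh.cup_left (Zc.dop_self (k := 4) ha rfl fund_four) (hb.dop 1) hs) (by norm_num)
  have k5 : Coh (grf g Q Qr Xr) 9 (cup a (dop 1 b)) (cup a (del y')) := by
    have := hom_comap (f := Sum.map id (Prod.snd : V × W → W)) |>.coh e1
    rw [pb_dop, pb_map_del, pb_id] at this
    exact Bd.of_eq' (Coh.cup_right ha this hs) (by norm_num)
  refine k2.trans (k3.trans (k4.trans (k5.trans ?_)))
  have c1 : Cc (cyl (fun q => (q, g q)) Q (Qr.prod Xr)) 8 (cup a (ext y')) :=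
    (ha.toCc.cup hy'.toCc.ext ⟨tendsto_gpr, le_rfl, le_sup_right, le_rfl, le_rfl⟩).of_eq' (by ring)
  have hyQ : Zc Q 4 y := by simpa using hi.zc hy
  have c2 : Cc Q 8 (cup y y') := (hyQ.cup hy' cupsite_self).toCc.of_eq' (by ring)
  refine (cone_bd (n := 9) ((c1.add c2.ext).of_eq' (by ring)) (Eventually.of_forall fun l => ?_)).congr ?_
  · rw [pb_add, pb_cup, pb_ext, pb_ext, ea, pb_pb, show gpr g ∘ Sum.inl = id from rfl, pb_id]
    exact CharTwo.add_self_eq_zero _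
  · filter_upwards [show ∀ᶠ l in (grf g Q Qr Xr).F, Van l (cd a) from hs.Fa (Site.hF _ |>.van ha.cl)] with l hl
    rw [cd_add, cd_cup ha.deg.nil hy'.deg.ext.nil, Pi.add_apply, Pi.add_apply, cup_loc (a := cd a) (.inl hl), zero_add]
    rfl

end

section
open Filter Function Topology

variable {V W : Type} {Q Qr : Site V} {Xr : Site W} {f g : V → W} {u : Coch W}

theorem cup_bd [Abs Q] [Free Qr] [Free Xr] {y y' : Coch V} (hi : Q.Hom Qr id) (hf : Qr.Hom Xr f) (hg : Q.Hom Xr g)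
    (ht : Tendsto (List.map fun q => (f q, g q)) Q.F (Xr.prod Xr).G) (h0 : ∀ p ∈ (Xr.prod Xr).G, [] ∈ p)
    (hu : Zc Xr 3 u) (hy : IsY Qr Xr f u y) (hy' : IsY Q Xr g u y')
    (hX : ∀ k, k ≠ 3 → k < 8 → Hz Xr k) (hQ : ∀ k, 0 < k → k ≠ 4 → k < 8 → Hz Q k)
    (hQr : ∀ k, k ≠ 4 → k < 8 → Hz Qr k) (hP : ∀ k, k ≠ 7 → k < 11 → Hz (Qr.prod Xr) k)
    (hT : ∀ k, k ≠ 6 → k < 11 → Hz (Xr.prod Xr) k) : Bd Q 8 (cup y y') := by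
  have hF := hom_glu (g := g) hf ht h0
  have hgr : Q.Hom (Qr.prod Xr) (fun q => (q, g q)) := hom_into hi hg
  have hN : ∀ k, k = 6 ∨ k = 8 → Hz (grf g Q Qr Xr) k := fun k hk =>
    Hz.cone hgr (hP k (by omega) (by omega)) (hQ _ (by omega) (by omega) (by omega))
  have hC : ∀ (k : ℤ) φ, k = 7 ∨ k = 9 → Zc (cone (glu f g) (grf g Q Qr Xr) (Xr.prod Xr)) k φ → Bd _ k φ := fun k φ hk =>
    Hz.cone hF (hT k (by omega) (by omega)) (hN _ (by omega)) φ
  have huu : Zc (Xr.prod Xr) 6 (cross u u) := (hu.cross hu).of_eq' (by ring)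
  obtain ⟨w, hw, ew⟩ := hN 6 (.inl rfl) _ (hF.zc huu)
  have hc : Zc (cone (glu f g) (grf g Q Qr Xr) (Xr.prod Xr)) 6 (brk (glu f g) (cross u u) w) := Zc.brk huu hw ew
  have hd : Zc (cone (glu f g) (grf g Q Qr Xr) (Xr.prod Xr)) 8 (dop 4 (brk (glu f g) (cross u u) w)) :=
    (hc.dop 4).of_eq' (by norm_num)
  obtain ⟨κ, hκ, eκ⟩ := cone_of_bd hF hd (hT 8 (by norm_num) (by norm_num) _ (hom_cone.zc hd))
  replace hκ : Zc (grf g Q Qr Xr) 7 κ := hκ.of_eq' (by norm_num)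
  have e5 := dop_glu hi hg hu hκ (glu_inr hf hF hu (hw.of_eq' (by norm_num)) ew hκ eκ hy hX (hP 5 (by norm_num) (by norm_num))
    (hT 7 (by norm_num) (by norm_num))) hy.1 hy' (hQ 6 (by norm_num) (by norm_num) (by norm_num)) (hQr 5 (by norm_num) (by norm_num))
    (hQr 6 (by norm_num) (by norm_num))
  have hA := Zc.adem hc (Bd.of_eq' (Zc.instability (k := 6) hc Free.emp (j := 7) (by norm_num)) (by norm_num)) hC
  have hdel : Zc (cone (glu f g) (grf g Q Qr Xr) (Xr.prod Xr)) 8 (del κ) := hκ.del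
  have k1 : Coh (cone (glu f g) (grf g Q Qr Xr) (Xr.prod Xr)) 10 (dop 6 (dop 4 (brk (glu f g) (cross u u) w))) (dop 6 (del κ)) :=
    Bd.of_eq' (eκ.dop hd hdel 6) (by norm_num)
  have k2 : Coh (cone (glu f g) (grf g Q Qr Xr) (Xr.prod Xr)) 10 (dop 6 (del κ)) (cd (dop 5 (ext κ))) :=
    Bd.of_eq' (coh_dop_cd (n := 8) hκ.deg.ext (Free.inv _) hdel.rel 5) (by norm_num)
  have h5 : Zc (grf g Q Qr Xr) 9 (dop 5 κ) := (hκ.dop 5).of_eq' (by norm_num)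
  have k3 : Coh (cone (glu f g) (grf g Q Qr Xr) (Xr.prod Xr)) 10 (cd (dop 5 (ext κ))) (del (dop 5 κ)) := by
    unfold Coh
    rw [del, ← cd_add]
    refine cone_bd ((Cc.of_eq' (hκ.toCc.ext.pw.cf 5) (by norm_num)).add (h5.toCc.ext.of_eq' (by norm_num)))
      (Eventually.of_forall fun l => ?_)
    rw [pb_add, pb_ext, pb_dop, pb_ext]
    exact congrFun (coch_add_self (dop 5 κ)) l
  have k4 := del_bd' hF (n := 10) h5 ((Coh.symm (k1.trans (k2.trans k3))).bd hA) (hT 9 (by norm_num) (by norm_num))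
  have hyQ : Zc Q 4 y := by simpa using hi.zc hy.1
  exact del_bd' (n := 9) hgr ((hyQ.cup hy'.1 cupsite_self).of_eq' (by norm_num)) (e5.symm.bd k4) (hP 8 (by norm_num) (by norm_num))

/-- The contradiction hypothesis on category forces the square of the functional class to vanish. -/
theorem sq_bd {X : Site W} [Abs X] [Abs Q] {x₀ : W} {q₀ : V} {ψ : V → W} (hx : X.Pt x₀) (hq : Q.Pt q₀)
    (hX : ∀ (U : Type) (Y : Site U) [Free Y] k, Hz Y (k - 3) → Hz Y (k - 8) → Rk X k Y)
    (hQ : ∀ (U : Type) (Y : Site U) [Free Y] k, Hz Y (k - 4) → Hz Y (k - 8) → Rk Q k Y)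
    (hf : Q.Hom X f) (hg : Q.Hom X g) (hψ : Q.Hom X ψ) (f0 : f q₀ = x₀)
    (ht : ∀ᶠ l in Q.F, (∀ x ∈ l, f x = x₀) ∨ ∀ x ∈ l, g x = x₀) (hfψ : Htpy Q X f ψ) (hgψ : Htpy Q X g ψ)
    {u : Coch W} (hu : Zc X 3 u) : ∃ u' y, Zc X 3 u' ∧ Coh X 3 u u' ∧ IsY Q X ψ u' y ∧ Bd Q 8 (cup y y) := by
  have zX : ∀ k, k ≠ 3 → k ≠ 8 → Hz (X.rel {x₀}) k := fun k _ _ =>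
    (hX _ _ k (Hz.of_unit (by omega)) (Hz.of_unit (by omega))).hz_rel hx
  have zX' : ∀ k, k ≠ 3 → k ≠ 8 → k ≠ 0 → Hz X k := fun k _ _ h0 =>
    (hX _ _ k (Hz.of_unit (by omega)) (Hz.of_unit (by omega))).hz hx h0
  have zQ : ∀ k, k ≠ 4 → k ≠ 8 → Hz (Q.rel {q₀}) k := fun k _ _ =>
    (hQ _ _ k (Hz.of_unit (by omega)) (Hz.of_unit (by omega))).hz_rel hq
  have zQ' : ∀ k, k ≠ 4 → k ≠ 8 → k ≠ 0 → Hz Q k := fun k _ _ h0 =>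
    (hQ _ _ k (Hz.of_unit (by omega)) (Hz.of_unit (by omega))).hz hq h0
  have zT : ∀ k, k ≠ 6 → k < 11 → Hz ((X.rel {x₀}).prod (X.rel {x₀})) k := fun k _ _ =>
    (hX _ _ k (zX _ (by omega) (by omega)) (zX _ (by omega) (by omega))).rel_zero hx
  have zP : ∀ k, k ≠ 7 → k < 11 → Hz ((Q.rel {q₀}).prod (X.rel {x₀})) k := fun k _ _ =>
    (hQ _ _ k (zX _ (by omega) (by omega)) (zX _ (by omega) (by omega))).rel_zero hq
  have hi : Q.Hom (Q.rel {q₀}) id := hom_rel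
  have hj : X.Hom (X.rel {x₀}) id := hom_rel
  have hf' : (Q.rel {q₀}).Hom (X.rel {x₀}) f := hom_rel_ev hf (Eventually.of_forall fun l x _ hx => by
    rw [Set.mem_singleton_iff.1 hx, f0]; rfl)
  have hg' : Q.Hom (X.rel {x₀}) g := hj.comp hg
  have key : ∀ {h : V → W}, Q.Hom X h → Tendsto (List.map h) (Q.F ⊓ 𝓟 {l | ∀ x ∈ l, h x = x₀}) (X.rel {x₀}).G := fun hh =>
    (tendsto_inf.2 ⟨hh.tF.mono_left inf_le_left, (tendsto_principal_principal.2 fun l hl y hy => by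
      obtain ⟨x, hx, rfl⟩ := List.mem_map.1 hy; exact hl x hx).mono_left inf_le_right⟩).mono_right le_sup_right
  have ht' : Tendsto (List.map fun q => (f q, g q)) Q.F ((X.rel {x₀}).prod (X.rel {x₀})).G := by
    have h1 : Q.F ≤ Q.F ⊓ 𝓟 {l | ∀ x ∈ l, f x = x₀} ⊔ Q.F ⊓ 𝓟 {l | ∀ x ∈ l, g x = x₀} := by
      rw [← inf_sup_left, sup_principal]; exact le_inf le_rfl (le_principal_iff.2 ht)
    refine Tendsto.mono_left (tendsto_sup.2 ⟨Tendsto.mono_right ?_ le_sup_left, Tendsto.mono_right ?_ le_sup_right⟩) h1 <;>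
      refine tendsto_inf.2 ⟨tendsto_comap_iff.2 ?_, tendsto_comap_iff.2 ?_⟩ <;> rw [List.map_comp_map]
    exacts [key hf, hg.tF.mono_left inf_le_left, hf.tF.mono_left inf_le_left, key hg]
  have hnil : (pure [] : Filter (List W)) ≤ X.F := le_trans (pure_le_principal _ |>.2 (by simp [Lst])) hx
  have h0 : ∀ p ∈ ((X.rel {x₀}).prod (X.rel {x₀})).G, [] ∈ p := fun p hp => by
    have : (pure [] : Filter (List (W × W))) ≤ ((X.rel {x₀}).prod (X.rel {x₀})).G :=
      le_sup_of_le_left (le_inf (map_le_iff_le_comap.1 (by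
        rw [map_pure]; exact le_sup_of_le_right (le_inf hnil (pure_le_principal _ |>.2 (by simp [Lst]))))) (map_le_iff_le_comap.1 (by
        rw [map_pure]; exact hnil)))
    exact this hp
  have hb : Bd (X.on {x₀}) 3 u := by
    have := coh_congr (S := X.on {x₀}) (n := 3) (f := id) (g := fun _ => x₀) (φ := u)
      (ev_on.2 (Eventually.of_forall fun l hl x hx => hl x hx))
    rw [pb_id] at this
    exact this.bd (coh_point (hx.on rfl) (by norm_num) (hu.on _))
  obtain ⟨u', hu', e⟩ := Bd.lift hu hb
  have hu₀ : Zc X 3 u' := hu'.of_rel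
  obtain ⟨y, hy⟩ := IsY.exists (S := Q) (S' := X) hψ (zX' 5 (by norm_num) (by norm_num) (by norm_num))
    (zQ' 3 (by norm_num) (by norm_num) (by norm_num)) hu₀
  obtain ⟨y₁, hy₁⟩ := IsY.exists hf' (zX 5 (by norm_num) (by norm_num)) (zQ 3 (by norm_num) (by norm_num)) hu'
  obtain ⟨y₂, hy₂⟩ := IsY.exists hg' (zX 5 (by norm_num) (by norm_num)) (zQ' 3 (by norm_num) (by norm_num) (by norm_num)) hu'
  have hb := cup_bd hi hf' hg' ht' h0 hu' hy₁ hy₂ (fun k _ _ => zX k (by omega) (by omega)) (fun k _ _ _ => zQ' k (by omega) (by omega) (by omega))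
    (fun k _ _ => zQ k (by omega) (by omega)) zP zT
  have cmp : ∀ {h : V → W} {z : Coch V}, Q.Hom X h → Htpy Q X h ψ → IsY Q X h u' z → Coh Q 4 y z := fun hh hH hz =>
    Coh.symm (IsY.htpy hH hu₀ (zX' 5 (by norm_num) (by norm_num) (by norm_num)) (zX' 4 (by norm_num) (by norm_num) (by norm_num))
      (zQ' 3 (by norm_num) (by norm_num) (by norm_num)) (zQ' 2 (by norm_num) (by norm_num) (by norm_num)) hh hψ hz hy)
  have e₁ : Coh Q 4 y y₁ := cmp hf hfψ (by
    simpa only [pb_id] using IsY.pull (h := f) hi hj (Eventually.of_forall fun _ _ _ => rfl) hu' hy₁)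
  have e₂ : Coh Q 4 y y₂ := cmp hg hgψ (by
    simpa only [pb_id] using IsY.pull (h := g) Site.Hom.id hj (Eventually.of_forall fun _ _ _ => rfl) hu' hy₂)
  have hy₁' : Zc Q 4 y₁ := by simpa using hi.zc hy₁.1
  refine ⟨u', y, hu₀, e, hy, Coh.bd (ψ := cup y₁ y₂) ?_ hb⟩
  exact Bd.of_eq' ((Coh.cup_left e₁ hy.1 cupsite_self).trans (Coh.cup_right hy₁' e₂ cupsite_self)) (by norm_num)

end

section
open Filter Function Topology Quaternion

section
variable {E F : Type} [NormedAddCommGroup E] [NormedSpace ℝ E] [NormedAddCommGroup F] [NormedSpace ℝ F]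
  {A : Set E} {B : Set F} {α : E → F} {k : ℤ}

theorem cn_ext (hA : IsCompact A) (hB : IsCompact B) (hα : ContinuousOn α A) (hm : Set.MapsTo α A B) {φ : Coch F}
    (hφ : Zc (CS B) k φ) (hz : Hz (CS A) k) :
    ∃ u, Zc (CS (cn A B α)) k u ∧ Coh (CS B) k (pb (fun y => ((0 : E), y, (1 : ℝ))) u) φ := by
  have hK := cn_compact hA hB hα
  have hr : ((CS (cn A B α)).on (cnM E F)).Hom (CS B) cnR := by
    rw [cs_on]; exact hom_cs (hK.inter_right isClosed_cnM) cnR_cont (cnR_maps hm)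
  have hb : (CS B).Hom ((CS (cn A B α)).on (cnM E F)) fun y => ((0 : E), y, (1 : ℝ)) := by
    rw [cs_on]; exact hom_cs hB (by fun_prop) cn_top
  have h1 := hr.zc hφ
  have h2 : Bd (((CS (cn A B α)).on (cnM E F)).on (cnD E F)) k (pb cnR φ) := by
    have h := h1.on (cnD E F)
    rw [cs_on, cs_on, Set.inter_assoc, Set.inter_comm (cnM E F), ← cs_on] at h ⊢
    exact (dmn_cnP hA hB hα hm).hz hz _ h
  obtain ⟨a, h3, h4⟩ := Bd.lift' h2
  have h5 : Zc ((CS (cn A B α)).on (cnM E F)) k (pb cnR φ + cd a) := h1.add (h3.cd.of_eq' (by ring))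
  obtain ⟨u, h6, h7, h8⟩ := glue_aux (n := k) (thick_cn hA hB hα) (χ₁ := 0) (χ₂ := pb cnR φ + cd a) Cc.zero h5.toCc (by
    filter_upwards [ev_on.1 h4] with l h hD hM
    exact (h hM hD).symm)
  refine ⟨u, .of_cc h6 ?_, ?_⟩
  · filter_upwards [thick_cn hA hB hα, ev_cd (CS (cn A B α)).hF h7, ev_cd (CS (cn A B α)).hF h8, ev_on.1 h5.cl] with l h d m h5
    rcases h with h | h
    · rw [d h, cd_zero]; rfl
    · rw [m h, h5 h]
  · refine Bd.congr ((hb.cc h3).bd') ?_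
    filter_upwards [hb.tF (ev_on.2 h8)] with l h
    have e : pb (fun y => ((0 : E), y, (1 : ℝ))) (pb cnR φ) l = φ l := by
      rw [pb_pb]; simp only [comp_def, cnR, inv_one, one_smul]; exact congrFun (pb_id φ) l
    have h' : pb (fun y => ((0 : E), y, (1 : ℝ))) u l = pb (fun y => ((0 : E), y, (1 : ℝ))) (pb cnR φ + cd a) l := h
    rw [Pi.add_apply, h', pb_add, Pi.add_apply, e, cd_pb, add_comm (φ l), add_assoc, CharTwo.add_self_eq_zero, add_zero]
end

/-- The model of the quaternionic projective plane. -/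
def QP : Set ((ℍ[ℝ] × ℍ[ℝ]) × (ℝ × ℍ[ℝ]) × ℝ) := cn (un pn) (un (gs fun c : ℍ[ℝ] => ‖c‖)) hop

theorem sp7 : Sp (CS (un (pn (K := ℍ[ℝ])))) 7 := sp_un 7 gauge_pn (by
  rw [Module.finrank_prod, Quaternion.finrank_eq_four])
theorem sp4 : Sp (CS (un (gs fun c : ℍ[ℝ] => ‖c‖))) 4 := sp_un 4 gauge_norm.gs (by
  rw [Module.finrank_prod, Quaternion.finrank_eq_four, Module.finrank_self])
theorem sp3 : Sp (CS (un (gs gc))) 3 := sp_un 3 gauge_gc.gs (by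
  rw [Module.finrank_prod, Module.finrank_prod, Complex.finrank_real_complex, Module.finrank_self])

theorem pt3 : (CS (un (gs gc))).Pt ((1 : ℝ), (0 : ℝ × ℂ)) := gauge_gc.pt (by norm_num)

theorem un_pn_ne : (un (pn (K := ℍ[ℝ]))).Nonempty := ⟨(1, 0), mem_un_pn.2 (by simp)⟩

theorem pt7 : (CS (un (pn (K := ℍ[ℝ])))).Pt (1, 0) := pt_cs (mem_un_pn.2 (by simp))

/-- The characteristic map of the top cell. -/
def chm (x : ℍ[ℝ] × ℍ[ℝ]) : (ℍ[ℝ] × ℍ[ℝ]) × (ℝ × ℍ[ℝ]) × ℝ := ((1 - pn x) • x, (pn x)⁻¹ • hop x, pn x)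

theorem continuous_chm : Continuous chm := by
  have hp := gauge_pn (K := ℍ[ℝ]).cont
  refine Continuous.prodMk (by fun_prop) (Continuous.prodMk ?_ hp)
  exact continuous_inv_smul hp continuous_one continuous_hop fun x => (le_gs _).trans (by rw [gs_hop, Pi.one_apply, mul_one])

/-- The closed ball of a gauge. -/
def bl : Set (ℍ[ℝ] × ℍ[ℝ]) := {x | pn x ≤ 1}

theorem bl_compact : IsCompact bl := by
  have e : bl = (fun p : ℝ × (ℍ[ℝ] × ℍ[ℝ]) => p.1 • p.2) '' (Set.Icc (0 : ℝ) 1 ×ˢ un pn) := by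
    ext x
    constructor
    · intro hx
      rcases eq_or_ne x 0 with rfl | h
      · exact ⟨(0, (1, 0)), ⟨by simp, mem_un_pn.2 (by simp)⟩, by simp⟩
      · exact ⟨(pn x, nz pn x), ⟨⟨(gauge_pn.pos x h).le, hx⟩, gauge_pn.nz_mem h⟩, by
          simp [nz, smul_smul, (gauge_pn.pos x h).ne']⟩
    · rintro ⟨⟨t, a⟩, ⟨ht, ha⟩, rfl⟩
      show pn (t • a) ≤ 1
      rw [gauge_pn.smul t ht.1, show pn a = 1 from ha, mul_one]; exact ht.2
  rw [e]
  exact (isCompact_Icc.prod gauge_pn.compact).image (by fun_prop)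

theorem hop_smul {K : Type} [NormedDivisionRing K] [NormedAlgebra ℝ K] (t : ℝ) (x : K × K) : hop (t • x) = t ^ 2 • hop x := by
  refine Prod.ext ?_ ?_
  · simp [hop, norm_smul, mul_pow]; ring
  · simp [hop, smul_smul]; ring_nf

theorem chm_maps : Set.MapsTo chm bl QP := fun x hx => by
  rcases eq_or_ne x 0 with rfl | h
  · exact cn_mem hop_maps (mem_un_pn.2 (by simp) : ((1, 0) : ℍ[ℝ] × ℍ[ℝ]) ∈ un pn) ⟨gauge_pn.nonneg _, hx⟩ (by simp [gauge_pn.zero])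
      (by simp [gauge_pn.zero])
  · have h1 := (gauge_pn.pos x h).ne'
    refine cn_mem hop_maps (gauge_pn.nz_mem h) ⟨gauge_pn.nonneg _, hx⟩ ?_ ?_
    · rw [nz, smul_smul]; congr 1; field_simp
    · rw [nz, hop_smul, smul_smul]; congr 1; field_simp

theorem hopf_y {y : Coch ((ℍ[ℝ] × ℍ[ℝ]) × (ℝ × ℍ[ℝ]) × ℝ)} (hy : Zc (CS QP) 4 y) (h : Bd (CS QP) 8 (cup y y)) :
    Bd (CS (un (gs fun c : ℍ[ℝ] => ‖c‖))) 4 (pb (fun b => (0, b, 1)) y) := by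
  have hk : (CS bl).Hom (CS QP) chm := hom_cs bl_compact continuous_chm.continuousOn chm_maps
  have hD : Ctr (CS bl) := ⟨0, pt_cs (by simp [bl, gauge_pn.zero]), htpy_cs bl_compact (fun x => (1 - x.2) • x.1) (by fun_prop)
    (fun x hx t ht => by
      show pn ((1 - t) • x) ≤ 1
      rw [gauge_pn.smul _ (by linarith [ht.2])]
      exact mul_le_one₀ (by linarith [ht.1]) (gauge_pn.nonneg _) hx) (by simp) (by simp)⟩
  obtain ⟨w, hw, ew⟩ := hD.bd (by norm_num) (hk.zc hy)
  have hc : Zc (cone chm (CS bl) (CS QP)) 4 (brk chm y w) := Zc.brk hy hw ew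
  obtain ⟨w', h1, h2⟩ := cone_of_bd (n := 8) hk ((hc.cup hc cupsite_self).of_eq' (by norm_num)) (by
    rwa [pb_cup, pb_inr_brk y w hw.deg.nil])
  have h3 := h2.bd (Bd.del (n := 8) (hD.bd (by norm_num) h1) h1.toCc)
  have hj := hom_map_cone (h := hop) (h' := chm)
    (hom_cs (L := bl) gauge_pn.compact continuousOn_id fun x (hx : pn x = 1) => hx.le)
    (hom_cs (K := un (gs fun c : ℍ[ℝ] => ‖c‖)) (L := QP) gauge_norm.gs.compact (f := fun b => ((0 : ℍ[ℝ] × ℍ[ℝ]), b, (1 : ℝ))) (by fun_prop) fun b hb => cn_one hb) (by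
      filter_upwards [ev_mem_cs] with l hl x hx
      have : pn x = 1 := hl x hx
      simp [chm, this])
  have h4 := hopf (n := 4) (by norm_num) Quaternion.finrank_eq_four (hj.zc hc) (by
    have := hj.bd h3
    rw [pb_cup] at this; exact Bd.of_eq' this (by norm_num))
  have e : pb (Sum.map id (fun b : ℝ × ℍ[ℝ] => ((0 : ℍ[ℝ] × ℍ[ℝ]), b, (1 : ℝ))) ∘ Sum.inr) (brk chm y w) = pb (fun b => (0, b, 1)) y :=
    (pb_pb (fun b : ℝ × ℍ[ℝ] => ((0 : ℍ[ℝ] × ℍ[ℝ]), b, (1 : ℝ))) Sum.inr (brk chm y w)).symm.trans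
      (by rw [pb_inr_brk y w hw.deg.nil])
  rw [pb_pb, e] at h4
  exact h4

end

section
open Filter Function Topology Quaternion

theorem no_cat {α : ℍ[ℝ] × ℍ[ℝ] → ℝ × (ℝ × ℂ)} (hα : ContinuousOn α (un pn)) (hm : Set.MapsTo α (un pn) (un (gs gc)))
    {f g ψ : (ℍ[ℝ] × ℍ[ℝ]) × (ℝ × ℍ[ℝ]) × ℝ → (ℍ[ℝ] × ℍ[ℝ]) × (ℝ × (ℝ × ℂ)) × ℝ} {x₀ : (ℍ[ℝ] × ℍ[ℝ]) × (ℝ × (ℝ × ℂ)) × ℝ}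
    (hx : x₀ ∈ cn (un pn) (un (gs gc)) α) (hf : ContinuousOn f QP) (hg : ContinuousOn g QP) (hψ : ContinuousOn ψ QP)
    (mf : Set.MapsTo f QP (cn (un pn) (un (gs gc)) α)) (mg : Set.MapsTo g QP (cn (un pn) (un (gs gc)) α))
    (mψ : Set.MapsTo ψ QP (cn (un pn) (un (gs gc)) α))
    (ht : ∀ q ∈ QP, {z | f z = x₀} ∈ 𝓝[QP] q ∨ {z | g z = x₀} ∈ 𝓝[QP] q)
    (hfψ : Htpy (CS QP) (CS (cn (un pn) (un (gs gc)) α)) f ψ) (hgψ : Htpy (CS QP) (CS (cn (un pn) (un (gs gc)) α)) g ψ)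
    (he : ∀ y ∈ un (gs fun c : ℍ[ℝ] => ‖c‖), ψ (0, y, 1) = (0, sp y, 1)) : False := by
  have cH : ContinuousOn (hop (K := ℍ[ℝ])) (un pn) := continuous_hop.continuousOn
  have kX := cn_compact gauge_pn.compact gauge_gc.gs.compact hα
  have kQ : IsCompact QP := cn_compact gauge_pn.compact gauge_norm.gs.compact cH
  have q0 : ((0 : ℍ[ℝ] × ℍ[ℝ]), (0 : ℝ × ℍ[ℝ]), (0 : ℝ)) ∈ QP := (cn_apex hop_maps un_pn_ne).1
  wlog f0 : f (0, 0, 0) = x₀ generalizing f g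
  · refine this hg hf mg mf (fun q hq => (ht q hq).symm) hgψ hfψ ?_
    rcases ht _ q0 with h | h
    · exact absurd (show _ ∈ {z | f z = x₀} from mem_of_mem_nhdsWithin q0 h) f0
    · have := mem_of_mem_nhdsWithin q0 h
      exact this
  obtain ⟨θ, hθ, nθ⟩ := sp3.nc
  obtain ⟨u, hu, eu⟩ := cn_ext gauge_pn.compact gauge_gc.gs.compact hα hm hθ
    (sp7.hz pt7 (by norm_num) (by norm_num))
  have ht' : ∀ᶠ l in (CS QP).F, (∀ x ∈ l, f x = x₀) ∨ ∀ x ∈ l, g x = x₀ := by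
    classical
    obtain ⟨s, hs, h⟩ := lebesgue_number_lemma_nhdsWithin (K := QP)
      (U := fun q => if {z | f z = x₀} ∈ 𝓝[QP] q then {z | f z = x₀} else {z | g z = x₀}) kQ fun q hq => by
        split_ifs with h
        · exact h
        · exact (ht q hq).resolve_left h
    refine ev_cs.2 ⟨s, hs, fun l hl hK => ?_⟩
    rcases l with _ | ⟨x, l⟩
    · simp
    obtain ⟨q, hq⟩ := h x (hK x (by simp))
    have h2 : ∀ y ∈ x :: l, y ∈ if {z | f z = x₀} ∈ 𝓝[QP] q then {z | f z = x₀} else {z | g z = x₀} := fun y hy =>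
      hq ⟨hl x (by simp) y hy, hK y hy⟩
    split_ifs at h2
    · exact .inl h2
    · exact .inr h2
  obtain ⟨u', y, hu', e', hy, hb⟩ := sq_bd (pt_cs hx) (pt_cs q0)
    (fun U Y _ k h1 h2 => rk_cn gauge_pn.compact gauge_gc.gs.compact hα hm un_pn_ne sp7 sp3 h1 h2)
    (fun U Y _ k h1 h2 => rk_cn gauge_pn.compact gauge_norm.gs.compact cH hop_maps un_pn_ne sp7 sp4 h1 h2)
    (hom_cs kQ hf mf) (hom_cs kQ hg mg) (hom_cs kQ hψ mψ) f0 ht' hfψ hgψ hu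
  have hβ : (CS (un (gs gc))).Hom (CS (cn (un pn) (un (gs gc)) α)) fun y => ((0 : ℍ[ℝ] × ℍ[ℝ]), y, (1 : ℝ)) :=
    hom_cs gauge_gc.gs.compact (by fun_prop) fun _ h => cn_one h
  have hY := IsY.pull (h := sp) (h' := ψ) (hom_cs (K := un (gs fun c : ℍ[ℝ] => ‖c‖)) (L := QP) gauge_norm.gs.compact
    (f := fun b => ((0 : ℍ[ℝ] × ℍ[ℝ]), b, (1 : ℝ))) (by fun_prop) fun b hb => cn_one hb) hβ (by
      filter_upwards [ev_mem_cs] with l hl x hx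
      exact (he x (hl x hx)).symm) hu' hy
  obtain ⟨h1, v, hv, ev, h2⟩ := hY
  have h3 := susp (Zc.brk (n := 3) (hβ.zc hu') hv ev) (h2.bd (Bd.del (n := 5) (hopf_y hy.1 hb) h1.toCc))
  rw [pb_inr_brk _ _ hv.deg.nil] at h3
  exact nθ (Bd.cst pt3 (eu.symm.bd ((hβ.coh e').bd h3)))

end

section
open Filter Function Topology unitInterval

section
variable {E F : Type} [NormedAddCommGroup E] [NormedSpace ℝ E] [NormedAddCommGroup F] [NormedSpace ℝ F]

theorem un_homeo {N : E → ℝ} {M : F → ℝ} (hN : Gauge N) (hM : Gauge M) (L : E ≃L[ℝ] F) : Nonempty (un N ≃ₜ un M) := by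
  have key : ∀ {E F : Type} [NormedAddCommGroup E] [NormedSpace ℝ E] [NormedAddCommGroup F] [NormedSpace ℝ F]
      {N : E → ℝ} {M : F → ℝ} (_ : Gauge N) (_ : Gauge M) (L : E ≃L[ℝ] F), ∃ f : C(un N, un M), ∀ x, (f x : F) = nz M (L x) := by
    intro E F _ _ _ _ N M hN hM L
    have h1 : ∀ x : un N, L x ≠ 0 := fun x hx => hN.ne x.2 (by simpa using hx)
    exact ⟨⟨fun x => ⟨nz M (L x), hM.nz_mem (h1 x)⟩, by
      refine Continuous.subtype_mk (hM.continuousOn_nz.comp_continuous (by fun_prop) h1) _⟩, fun _ => rfl⟩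
  have inv : ∀ {E F : Type} [NormedAddCommGroup E] [NormedSpace ℝ E] [NormedAddCommGroup F] [NormedSpace ℝ F]
      {N : E → ℝ} {M : F → ℝ} (_ : Gauge N) (_ : Gauge M) (L : E ≃L[ℝ] F) (x : un N), nz N (L.symm (nz M (L x))) = x := by
    intro E F _ _ _ _ N M hN hM L x
    have h1 : L x ≠ 0 := fun hx => hN.ne x.2 (by simpa using hx)
    simp only [nz, map_smul, ContinuousLinearEquiv.symm_apply_apply]
    exact hN.nz_smul x.2 (inv_pos.2 (hM.pos _ h1))
  obtain ⟨f, hf⟩ := key hN hM L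
  obtain ⟨g, hg⟩ := key hM hN L.symm
  exact ⟨⟨⟨f, g, fun x => Subtype.ext (by rw [hg, hf, inv hN hM L]), fun x => Subtype.ext (by
    rw [hf, hg]; exact inv hM hN L.symm x)⟩, f.continuous, g.continuous⟩⟩
end

theorem surjective_projCube (n : ℕ) : Surjective (projCube n) := Quot.mk_surjective
theorem isQuotientMap_projCube (n : ℕ) : IsQuotientMap (projCube n) := isQuotientMap_quot_mk

theorem projCube_boundary {n : ℕ} {x y : Fin n → I} (hx : x ∈ Cube.boundary (Fin n)) (hy : y ∈ Cube.boundary (Fin n)) :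
    projCube n x = projCube n y := Quot.sound ⟨hx, hy⟩

/-- The centred coordinates of a cube. -/
def ctd {n : ℕ} (x : Fin n → I) (i : Fin n) : ℝ := 2 * x i - 1

theorem ctd_le {n : ℕ} (x : Fin n → I) : ‖ctd x‖ ≤ 1 :=
  (pi_norm_le_iff_of_nonneg zero_le_one).2 fun i => abs_le.2 ⟨by have := (x i).2.1; simp only [ctd]; linarith, by
    have := (x i).2.2; simp only [ctd]; linarith⟩

theorem ctd_boundary {n : ℕ} (x : Fin n → I) : ‖ctd x‖ = 1 ↔ x ∈ Cube.boundary (Fin n) := by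
  rw [← not_iff_not, ← ne_eq, ← (ctd_le x).lt_iff_ne, pi_norm_lt_iff zero_lt_one]
  simp only [Cube.boundary, Set.mem_setOf_eq, not_exists, not_or]
  refine forall_congr' fun i => ?_
  rw [Real.norm_eq_abs, abs_lt, ← ne_eq, ← ne_eq, ← unitInterval.pos_iff_ne_zero, ← unitInterval.lt_one_iff_ne_one, ← Subtype.coe_lt_coe,
    ← Subtype.coe_lt_coe]
  simp only [ctd, Set.Icc.coe_zero, Set.Icc.coe_one]
  constructor <;> rintro ⟨h1, h2⟩ <;> constructor <;> linarith

theorem ctd_inj {n : ℕ} {x y : Fin n → I} (h : ctd x = ctd y) : x = y := by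
  ext i
  have := congrFun h i
  simp only [ctd] at this
  linarith

theorem exists_ctd {n : ℕ} {z : Fin n → ℝ} (h : ‖z‖ ≤ 1) : ∃ x, ctd x = z := by
  have := fun i => abs_le.1 ((norm_le_pi_norm z i).trans h)
  exact ⟨fun i => ⟨(1 + z i) / 2, by linarith [this i], by linarith [this i]⟩, by ext i; simp only [ctd]; ring⟩

/-- The standard map of the cube onto the sphere. -/
def rnd {n : ℕ} (x : Fin n → I) : ℝ × (Fin n → ℝ) :=
  (2 * ‖ctd x‖ ^ 2 - 1, (2 * √(1 - ‖ctd x‖ ^ 2)) • ctd x)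

theorem rnd_mem {n : ℕ} (x : Fin n → I) : rnd x ∈ un (gs fun v : Fin n → ℝ => ‖v‖) := by
  have h : 0 ≤ 1 - ‖ctd x‖ ^ 2 := by have := ctd_le x; have := norm_nonneg (ctd x); nlinarith
  rw [mem_un_gs, rnd, norm_smul, Real.norm_of_nonneg (by positivity), mul_pow, mul_pow, Real.sq_sqrt h]
  ring

theorem rnd_eq {n : ℕ} {x y : Fin n → I} (h : rnd x = rnd y) :
    x = y ∨ x ∈ Cube.boundary (Fin n) ∧ y ∈ Cube.boundary (Fin n) := by
  obtain ⟨h1, h2⟩ := Prod.ext_iff.1 h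
  have h3 : ‖ctd x‖ = ‖ctd y‖ := by
    rw [← sq_eq_sq₀ (norm_nonneg _) (norm_nonneg _)]; simp only [rnd] at h1; linarith
  rcases (ctd_le x).lt_or_eq with h4 | h4
  · left
    have : 0 < 1 - ‖ctd y‖ ^ 2 := by have := norm_nonneg (ctd x); nlinarith
    simp only [rnd, h3] at h2
    exact ctd_inj (smul_right_injective _ (by positivity) h2)
  · exact .inr ⟨(ctd_boundary x).1 h4, (ctd_boundary y).1 (h3 ▸ h4)⟩

theorem exists_rnd {n : ℕ} (hn : 0 < n) {p : ℝ × (Fin n → ℝ)} (hp : p ∈ un (gs fun v : Fin n → ℝ => ‖v‖)) : ∃ x, rnd x = p := by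
  obtain ⟨s, v⟩ := p
  rw [mem_un_gs] at hp
  have hs := abs_le_one_iff_mul_self_le_one.2 (show s * s ≤ 1 by nlinarith [sq_nonneg ‖v‖])
  rw [abs_le] at hs
  rcases hs.2.lt_or_eq with h | rfl
  · have h0 : 0 < √(2 * (1 - s)) := Real.sqrt_pos.2 (by linarith)
    have h1 : ‖(√(2 * (1 - s)))⁻¹ • v‖ ^ 2 = (1 + s) / 2 := by
      rw [norm_smul, norm_inv, Real.norm_of_nonneg h0.le, mul_pow, inv_pow, Real.sq_sqrt (by linarith),
        show ‖v‖ ^ 2 = (1 - s) * (1 + s) by simp only at hp; linarith]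
      have : 1 - s ≠ 0 := by linarith
      field_simp
    obtain ⟨x, hx⟩ := exists_ctd (z := (√(2 * (1 - s)))⁻¹ • v) (by
      rw [← sq_le_one_iff₀ (norm_nonneg _), h1]; linarith)
    refine ⟨x, Prod.ext ?_ ?_⟩
    · simp only [rnd, hx, h1]; ring
    · simp only [rnd, hx, h1, smul_smul]
      have : 2 * √(1 - (1 + s) / 2) = √(2 * (1 - s)) := by
        rw [show 2 * (1 - s) = 2 ^ 2 * (1 - (1 + s) / 2) by ring, Real.sqrt_mul (by norm_num), Real.sqrt_sq (by norm_num)]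
      rw [this, mul_inv_cancel₀ h0.ne', one_smul]
  · have : v = 0 := by simpa using hp
    have h1 := (ctd_boundary (n := n) fun _ => 0).2 ⟨⟨0, hn⟩, .inl rfl⟩
    exact ⟨fun _ => 0, by simp only [rnd, h1, this]; norm_num⟩

theorem continuous_rnd {n : ℕ} : Continuous (rnd (n := n)) := by
  have : Continuous (ctd (n := n)) := by unfold ctd; fun_prop
  unfold rnd; fun_prop

instance (n : ℕ) : CompactSpace (Sph n) := inferInstanceAs (CompactSpace (Quot _))

theorem sph_homeo {E : Type} [NormedAddCommGroup E] [NormedSpace ℝ E] [FiniteDimensional ℝ E] {N : E → ℝ} (hN : Gauge N) {n : ℕ}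
    (hn : 0 < n) (hE : Module.finrank ℝ E = n + 1) : Nonempty (Sph n ≃ₜ un N) := by
  obtain ⟨e⟩ := un_homeo (gauge_norm (E := Fin n → ℝ)).gs hN (ContinuousLinearEquiv.ofFinrankEq (by
    rw [hE, Module.finrank_prod, Module.finrank_self, Module.finrank_fin_fun, add_comm]))
  have hc : ∀ x y : Fin n → I, x ∈ Cube.boundary (Fin n) ∧ y ∈ Cube.boundary (Fin n) → (⟨rnd x, rnd_mem x⟩ :
      un (gs fun v : Fin n → ℝ => ‖v‖)) = ⟨rnd y, rnd_mem y⟩ := fun x y h => Subtype.ext (by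
    have h1 := (ctd_boundary x).2 h.1
    have h2 := (ctd_boundary y).2 h.2
    simp [rnd, h1, h2])
  have h1 : Continuous (Quot.lift _ hc : Sph n → _) := continuous_quot_lift hc (continuous_rnd.subtype_mk _)
  have h2 : Bijective (Quot.lift _ hc : Sph n → _) := by
    constructor
    · rintro ⟨x⟩ ⟨y⟩ h
      rcases rnd_eq (congrArg Subtype.val h) with rfl | h
      · rfl
      · exact projCube_boundary h.1 h.2
    · rintro ⟨p, hp⟩
      obtain ⟨x, rfl⟩ := exists_rnd hn hp
      exact ⟨projCube n x, rfl⟩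
  exact ⟨(Continuous.homeoOfEquivCompactToT2 (f := Equiv.ofBijective _ h2) h1).trans e⟩

end

section
open Filter Function Topology unitInterval

variable {X : Type*} [TopologicalSpace X] {n : ℕ}

theorem descend {Φ : I × (Fin n → I) → X} (hc : Continuous Φ)
    (h : ∀ s, ∀ x ∈ Cube.boundary (Fin n), ∀ y ∈ Cube.boundary (Fin n), Φ (s, x) = Φ (s, y)) :
    ∃ Ψ : C(I × Sph n, X), ∀ s x, Ψ (s, projCube n x) = Φ (s, x) := by
  refine ⟨⟨fun p => Quot.lift (fun x => Φ (p.1, x)) (fun x y hxy => h p.1 x hxy.1 y hxy.2) p.2, ?_⟩, fun s x => rfl⟩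
  exact (isQuotientMap_projCube n).continuous_lift_prod_right hc

theorem zero_mem_boundary (hn : 0 < n) : (fun _ => 0 : Fin n → I) ∈ Cube.boundary (Fin n) := ⟨⟨0, hn⟩, .inl rfl⟩

theorem homotopic_of_cube {f g : C(Sph n, X)} {Φ : I × (Fin n → I) → X} (hc : Continuous Φ)
    (h : ∀ s, ∀ x ∈ Cube.boundary (Fin n), ∀ y ∈ Cube.boundary (Fin n), Φ (s, x) = Φ (s, y))
    (h0 : ∀ x, Φ (0, x) = f (projCube n x)) (h1 : ∀ x, Φ (1, x) = g (projCube n x)) : f.Homotopic g := by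
  obtain ⟨Ψ, hΨ⟩ := descend hc h
  refine ⟨⟨Ψ, fun x => ?_, fun x => ?_⟩⟩ <;> obtain ⟨x, rfl⟩ := surjective_projCube n x
  · exact (hΨ 0 x).trans (h0 x)
  · exact (hΨ 1 x).trans (h1 x)

/-- Maps of spheres can be made to preserve base points. -/
theorem exists_based (hn : 0 < n) (f : C(Sph n, X)) {x₀ : X} (γ : Path (f (sbase n)) x₀) :
    ∃ f' : C(Sph n, X), f.Homotopic f' ∧ f' (sbase n) = x₀ := by
  classical
  let κ : (Fin n → ℝ) → Fin n → I := fun w i => Set.projIcc 0 1 zero_le_one ((1 + w i) / 2)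
  have hκ : ∀ w, 1 ≤ ‖w‖ → κ w ∈ Cube.boundary (Fin n) := fun w hw => by
    rw [← not_lt, pi_norm_lt_iff zero_lt_one] at hw
    push Not at hw
    obtain ⟨i, hi⟩ := hw
    refine ⟨i, (le_abs.1 hi).symm.imp (fun h => ?_) fun h => ?_⟩
    · exact Set.projIcc_of_le_left _ (by linarith)
    · exact Set.projIcc_of_right_le _ (by linarith)
  have hκ' : ∀ x, κ (ctd x) = x := fun x => by
    ext i
    simp only [κ, ctd]
    rw [show (1 + (2 * (x i : ℝ) - 1)) / 2 = x i by ring, Set.projIcc_val]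
  have hb : ∀ x ∈ Cube.boundary (Fin n), f (projCube n x) = f (sbase n) := fun x hx =>
    congrArg f (projCube_boundary hx (zero_mem_boundary hn))
  let G : (Fin n → ℝ) → X := fun w => if ‖w‖ ≤ 1 then f (projCube n (κ w)) else γ.extend (‖w‖ - 1)
  have hG : Continuous G := by
    refine Continuous.if_le ?_ ?_ continuous_norm continuous_const fun w hw => ?_
    · refine f.continuous.comp ((projCube n).continuous.comp (continuous_pi fun i => continuous_projIcc.comp (by fun_prop)))
    · exact γ.continuous_extend.comp (by fun_prop)
    · rw [hb _ (hκ w hw.ge), hw, sub_self, γ.extend_zero]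
  have hG' : ∀ w, 1 ≤ ‖w‖ → G w = γ.extend (‖w‖ - 1) := fun w hw => by
    rcases hw.eq_or_lt with h | h
    · rw [← h, sub_self, γ.extend_zero, ← hb _ (hκ w hw)]; exact if_pos h.ge
    · exact if_neg h.not_ge
  have hn' : ∀ (s : I) x, x ∈ Cube.boundary (Fin n) → ‖(1 + (s : ℝ)) • ctd x‖ = 1 + s := fun s x hx => by
    rw [norm_smul, (ctd_boundary x).2 hx, mul_one, Real.norm_of_nonneg (by linarith [s.2.1])]
  have hc : Continuous fun p : I × (Fin n → I) => G ((1 + (p.1 : ℝ)) • ctd p.2) := hG.comp (by unfold ctd; fun_prop)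
  have hd : ∀ (s : I), ∀ x ∈ Cube.boundary (Fin n), G ((1 + (s : ℝ)) • ctd x) = γ s := fun s x hx => by
    rw [hG' _ ((hn' s x hx).symm ▸ by linarith [s.2.1]), hn' s x hx, add_sub_cancel_left]
    exact γ.extend_apply s.2
  obtain ⟨Ψ, hΨ⟩ := descend hc fun s x hx y hy => (hd s x hx).trans (hd s y hy).symm
  refine ⟨Ψ.comp ⟨fun x => (1, x), by fun_prop⟩, ⟨⟨Ψ, fun x => ?_, fun x => rfl⟩⟩, ?_⟩
  · obtain ⟨x, rfl⟩ := surjective_projCube n x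
    refine (hΨ 0 x).trans ?_
    simp only [Set.Icc.coe_zero, add_zero, one_smul]
    rw [show G (ctd x) = _ from if_pos (ctd_le x), hκ']
  · exact (hΨ 1 _).trans ((hd 1 _ (zero_mem_boundary hn)).trans γ.target)

/-- Postcomposition of generalized loops. -/
def gmap {Y : Type*} [TopologicalSpace Y] {y : Y} (g : C(Y, X)) (D : GenLoop (Fin n) Y y) : GenLoop (Fin n) X (g y) :=
  ⟨g.comp D.1, fun z hz => congrArg g (D.2 z hz)⟩

theorem generates_lift (hn : 0 < n) {g : C(Sph n, X)} (hg : GeneratesPi hn g) (c : HomotopyGroup (Fin n) X (g (sbase n))) :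
    ∃ D : GenLoop (Fin n) (Sph n) (sbase n), c = Quotient.mk _ (gmap g D) := by
  classical
  haveI : Nonempty (Fin n) := ⟨⟨0, hn⟩⟩
  let i : Fin n := ⟨0, hn⟩
  let S : Subgroup (HomotopyGroup (Fin n) X (g (sbase n))) :=
    { carrier := {c | ∃ D : GenLoop (Fin n) (Sph n) (sbase n), c = Quotient.mk _ (gmap g D)}
      mul_mem' := by
        rintro _ _ ⟨D, rfl⟩ ⟨D', rfl⟩
        refine ⟨GenLoop.transAt i D' D, (HomotopyGroup.mul_spec (i := i)).trans (congrArg _ (GenLoop.ext _ _ fun y => ?_))⟩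
        exact (apply_ite g _ _ _).symm
      one_mem' := ⟨GenLoop.const, HomotopyGroup.one_def⟩
      inv_mem' := by
        rintro _ ⟨D, rfl⟩
        exact ⟨GenLoop.symmAt i D, HomotopyGroup.inv_spec⟩ }
  have h1 : sphereClass hn g ∈ S := ⟨⟨projCube n, fun y hy => projCube_boundary hy (zero_mem_boundary hn)⟩, rfl⟩
  have h2 : S = ⊤ := top_le_iff.1 (by rw [← hg]; exact (Subgroup.zpowers_le).2 h1)
  exact (h2 ▸ Subgroup.mem_top c : c ∈ S)

/-- Every map of a sphere factors through a generator. -/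
theorem generates_factor (hn : 0 < n) [PathConnectedSpace X] {g : C(Sph n, X)} (hg : GeneratesPi hn g) (f : C(Sph n, X)) :
    ∃ d : C(Sph n, Sph n), f.Homotopic (g.comp d) := by
  obtain ⟨f', h1, h2⟩ := exists_based hn f (PathConnectedSpace.somePath _ (g (sbase n)))
  obtain ⟨D, hD⟩ := generates_lift hn hg (Quotient.mk _ ⟨f'.comp (projCube n), fun y hy =>
    (congrArg f' (projCube_boundary hy (zero_mem_boundary hn))).trans h2⟩)
  obtain ⟨H⟩ := Quotient.exact hD
  obtain ⟨d, hd⟩ := descend (Φ := fun p : I × (Fin n → I) => D p.2) (by fun_prop) fun s x hx y hy => by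
    exact (D.2 x hx).trans (D.2 y hy).symm
  refine ⟨d.comp ⟨fun x => (0, x), by fun_prop⟩, h1.trans (homotopic_of_cube (Φ := H) H.continuous ?_ ?_ ?_)⟩
  · intro s x hx y hy
    rw [H.eq_fst s hx, H.eq_fst s hy]
    exact congrArg f' (projCube_boundary hx hy)
  · exact fun x => H.apply_zero x
  · intro x
    refine (H.apply_one x).trans ?_
    exact congrArg g (hd 0 x).symm

instance (n : ℕ) : PathConnectedSpace (Sph n) :=
  ((surjective_projCube n).comp (Surjective.piMap fun _ => Set.projIcc_surjective zero_le_one)).pathConnectedSpace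
    ((projCube n).continuous.comp (continuous_pi fun i => continuous_projIcc.comp (continuous_apply i)))

end

section
open Filter Function Topology unitInterval Quaternion

/-- The gauge of `ℍ × (ℝ × ℂ)`, whose unit sphere is a model of `S⁶`. -/
def g6 (p : ℍ[ℝ] × (ℝ × ℂ)) : ℝ := √(‖p.1‖ ^ 2 + gc p.2 ^ 2)

theorem gauge_g6 : Gauge g6 where
  cont := by have := gauge_gc.cont; unfold g6; fun_prop
  smul t ht p := by
    simp only [g6, Prod.smul_fst, Prod.smul_snd, norm_smul, Real.norm_of_nonneg ht, gauge_gc.smul t ht, mul_pow, ← mul_add]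
    rw [Real.sqrt_mul (sq_nonneg t), Real.sqrt_sq ht]
  pos p hp := Real.sqrt_pos.2 <| by
    by_cases h1 : p.1 = 0
    · have := gauge_gc.pos _ fun h2 => hp (Prod.ext h1 h2)
      positivity
    · positivity

theorem mem_un_g6 {p : ℍ[ℝ] × (ℝ × ℂ)} : p ∈ un g6 ↔ ‖p.1‖ ^ 2 + gc p.2 ^ 2 = 1 := by
  show √_ = 1 ↔ _
  rw [Real.sqrt_eq_one]

/-- The purely imaginary quaternions. -/
def imq (w : ℝ × ℂ) : ℍ[ℝ] := ⟨0, w.1, w.2.re, w.2.im⟩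

@[simp] theorem imq_re (w : ℝ × ℂ) : (imq w).re = 0 := rfl
@[simp] theorem imq_imI (w : ℝ × ℂ) : (imq w).imI = w.1 := rfl
@[simp] theorem imq_imJ (w : ℝ × ℂ) : (imq w).imJ = w.2.re := rfl
@[simp] theorem imq_imK (w : ℝ × ℂ) : (imq w).imK = w.2.im := rfl

def cnj (a : ℍ[ℝ]) (w : ℝ × ℂ) : ℝ × ℂ :=
  ((a * imq w * star a).imI, ⟨(a * imq w * star a).imJ, (a * imq w * star a).imK⟩)

theorem imq_cnj (a : ℍ[ℝ]) (w : ℝ × ℂ) : imq (cnj a w) = a * imq w * star a := by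
  refine QuaternionAlgebra.ext ?_ rfl rfl rfl
  simp; ring

theorem norm_imq (w : ℝ × ℂ) : ‖imq w‖ = gc w := by
  rw [gc, gs, eq_comm, Real.sqrt_eq_iff_eq_sq (by positivity) (norm_nonneg _), norm_sq_quat, norm_sq_complex]
  simp; ring

theorem gc_cnj (a : ℍ[ℝ]) (w : ℝ × ℂ) : gc (cnj a w) = ‖a‖ ^ 2 * gc w := by
  rw [← norm_imq, imq_cnj, norm_mul, norm_mul, norm_star, norm_imq]; ring

theorem imq_hop (c : ℍ[ℝ]) : imq (hop (zw c)) = c * imq (1, 0) * star c := by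
  have h1 : ‖(zw c).1‖ ^ 2 = c.re ^ 2 + c.imI ^ 2 := norm_sq_complex _
  have h2 : ‖(zw c).2‖ ^ 2 = c.imK ^ 2 + (-c.imJ) ^ 2 := norm_sq_complex _
  have e1 : (zw c).1.re = c.re := rfl
  have e2 : (zw c).1.im = c.imI := rfl
  have e3 : (zw c).2.re = c.imK := rfl
  have e4 : (zw c).2.im = -c.imJ := rfl
  ext <;> simp [hop, h1, h2, e1, e2, e3, e4] <;> ring

theorem imq_inj {v w : ℝ × ℂ} (h : imq v = imq w) : v = w := by
  have := QuaternionAlgebra.ext_iff.1 h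
  exact Prod.ext this.2.1 (Complex.ext this.2.2.1 this.2.2.2)

theorem cnj_smul (a : ℍ[ℝ]) (t : ℝ) (w : ℝ × ℂ) : cnj a (t • w) = t • cnj a w := by
  refine Prod.ext ?_ (Complex.ext ?_ ?_) <;> simp [cnj] <;> ring

theorem cnj_hop (a b : ℍ[ℝ]) : cnj a (hop (zw b)) = hop (zw (a * b)) :=
  imq_inj (by rw [imq_cnj, imq_hop, imq_hop, star_mul]; noncomm_ring)

theorem continuous_cnj : Continuous fun p : ℍ[ℝ] × (ℝ × ℂ) => cnj p.1 p.2 := by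
  have hc : Continuous imq := by
    have : imq = fun w => wz (⟨0, w.1⟩, ⟨w.2.im, -w.2.re⟩) := by ext w <;> simp [wz]
    rw [this]
    refine continuous_wz.comp (Continuous.prodMk ?_ ?_) <;> refine Complex.equivRealProdCLM.symm.continuous.comp (Continuous.prodMk ?_ ?_) <;> fun_prop
  have h1 : Continuous fun p : ℍ[ℝ] × (ℝ × ℂ) => p.1 * imq p.2 * star p.1 := by fun_prop
  refine (Quaternion.continuous_imI.comp h1).prodMk (Complex.equivRealProdCLM.symm.continuous.comp (Continuous.prodMk ?_ ?_))
  · exact Quaternion.continuous_imJ.comp h1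
  · exact Quaternion.continuous_imK.comp h1

def ω₀ (p : ℍ[ℝ] × (ℝ × ℂ)) : ℝ × (ℝ × ℂ) := (‖p.1‖ ^ 2 - gc p.2 ^ 2, (2 : ℝ) • ‖p.1‖⁻¹ • cnj p.1 p.2)

def η₀ (p : ℍ[ℝ] × ℍ[ℝ]) : ℍ[ℝ] × (ℝ × ℂ) := (p.1, (sp (0, p.2)).2)

theorem continuous_ω₀ : Continuous ω₀ := by
  have := gauge_gc.cont
  refine Continuous.prodMk (by fun_prop) (.fun_const_smul (continuous_inv_smul (N := fun p : ℍ[ℝ] × (ℝ × ℂ) => ‖p.1‖)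
    (k := fun p => gc p.2) (by fun_prop) (by fun_prop) continuous_cnj fun p => ?_) _)
  exact (le_gs _).trans (gc_cnj _ _).le

theorem continuous_η₀ : Continuous η₀ :=
  continuous_fst.prodMk (continuous_snd.comp (continuous_sp.comp (by fun_prop)))

theorem maps_ω₀ : Set.MapsTo ω₀ (un g6) (un (gs gc)) := fun p hp => by
  rw [mem_un_g6] at hp
  have h0 := gauge_gc.nonneg p.2
  rw [mem_un_gs, ω₀, gauge_gc.smul _ (by norm_num), gauge_gc.smul _ (by positivity), gc_cnj]
  rcases eq_or_ne ‖p.1‖ 0 with h | h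
  · rw [h] at hp ⊢; have : gc p.2 ^ 2 = 1 := by linarith
    simp [this]
  · rw [show ‖p.1‖⁻¹ * (‖p.1‖ ^ 2 * gc p.2) = ‖p.1‖ * gc p.2 by field_simp]
    linear_combination (‖p.1‖ ^ 2 + gc p.2 ^ 2 + 1) * hp

theorem maps_η₀ : Set.MapsTo η₀ (un pn) (un g6) := fun p hp => by
  rw [mem_un_g6, η₀, gc_sp]
  exact mem_un_pn.1 hp

theorem ω₀_η₀ (p : ℍ[ℝ] × ℍ[ℝ]) : ω₀ (η₀ p) = sp (hop p) := by
  refine Prod.ext ?_ ?_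
  · show ‖p.1‖ ^ 2 - gc (sp (0, p.2)).2 ^ 2 = _
    rw [gc_sp]; rfl
  · show (2 : ℝ) • ‖p.1‖⁻¹ • cnj p.1 (‖p.2‖⁻¹ • hop (zw p.2)) = ‖(2 : ℝ) • (p.1 * p.2)‖⁻¹ • hop (zw ((2 : ℝ) • (p.1 * p.2)))
    have : zw ((2 : ℝ) • (p.1 * p.2)) = (2 : ℝ) • zw (p.1 * p.2) := by
      refine Prod.ext (Complex.ext ?_ ?_) (Complex.ext ?_ ?_) <;> simp [zw] <;> ring
    rw [cnj_smul, cnj_hop, this, hop_smul, norm_smul, norm_mul, smul_smul, smul_smul, smul_smul, Real.norm_two]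
    congr 1
    rw [mul_inv, mul_inv]; ring

end

section
open Filter Function Topology unitInterval Quaternion

section
variable {A X : Type*} [TopologicalSpace A] [TopologicalSpace X]

def cinl (f : A → X) : C(X, MappingCone f) := ⟨fun x => Quot.mk _ (Sum.inl x), continuous_quot_mk.comp continuous_inl⟩
def cinr (f : A → X) : C(A × I, MappingCone f) := ⟨fun x => Quot.mk _ (Sum.inr x), continuous_quot_mk.comp continuous_inr⟩

theorem cinr_one {f : A → X} (a : A) : cinr f (a, 1) = cinl f (f a) := Quot.sound (.inl ⟨a, rfl, rfl⟩)
theorem cinr_zero {f : A → X} (a b : A) : cinr f (a, 0) = cinr f (b, 0) := Quot.sound (.inr ⟨a, b, rfl, rfl⟩)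

theorem cone_null [Nonempty A] (f : C(A, X)) : ((cinl f).comp f).Nullhomotopic :=
  ⟨cinr f (Classical.arbitrary A, 0), ⟨⟨(cinr f).comp ⟨fun p => (p.2, σ p.1), by fun_prop⟩, fun a => by
    simpa using cinr_one a, fun a => by simpa using cinr_zero a _⟩⟩⟩
end

def ω₁ : C(un g6, un (gs gc)) :=
  ⟨fun p => ⟨ω₀ p, maps_ω₀ p.2⟩, (continuous_ω₀.comp continuous_subtype_val).subtype_mk _⟩
def η₁ : C(un (pn (K := ℍ[ℝ])), un g6) :=
  ⟨fun p => ⟨η₀ p, maps_η₀ p.2⟩, (continuous_η₀.comp continuous_subtype_val).subtype_mk _⟩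

theorem null_model {η : C(Sph 7, Sph 6)} {ω : C(Sph 6, Sph 3)} (hη : GeneratesPi (by norm_num) η)
    (hω : GeneratesPi (by norm_num) ω) (θ : C(un (gs gc), Sph 3)) :
    ((cinl fun x => ω (η x)).comp (θ.comp (ω₁.comp η₁))).Nullhomotopic := by
  obtain ⟨θ7⟩ := sph_homeo (gauge_pn (K := ℍ[ℝ])) (n := 7) (by norm_num) (by
    rw [Module.finrank_prod, Quaternion.finrank_eq_four])
  obtain ⟨θ6⟩ := sph_homeo gauge_g6 (n := 6) (by norm_num) (by
    rw [Module.finrank_prod, Module.finrank_prod, Quaternion.finrank_eq_four, Complex.finrank_real_complex, Module.finrank_self])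
  obtain ⟨d6, h6⟩ := generates_factor _ hω ((θ.comp ω₁).comp (θ6 : C(Sph 6, un g6)))
  obtain ⟨d7, h7⟩ := generates_factor _ hη (d6.comp ((θ6.symm : C(un g6, Sph 6)).comp (η₁.comp (θ7 : C(Sph 7, _)))))
  have h1 : ((cinl fun x => ω (η x)).comp (θ.comp (ω₁.comp η₁))).Homotopic
      (((cinl fun x => ω (η x)).comp (ω.comp η)).comp (d7.comp (θ7.symm : C(un (pn (K := ℍ[ℝ])), Sph 7)))) := by
    have a := (ContinuousMap.Homotopic.refl (cinl fun x => ω (η x))).comp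
      (h6.comp (.refl ((θ6.symm : C(un g6, Sph 6)).comp η₁)))
    have b := (ContinuousMap.Homotopic.refl ((cinl fun x => ω (η x)).comp ω)).comp
      (h7.comp (.refl (θ7.symm : C(un (pn (K := ℍ[ℝ])), Sph 7))))
    convert! a.trans (?_ : ContinuousMap.Homotopic _ _) using 1
    · ext x; simp
    · convert! b using 1
      ext x; simp
  obtain ⟨y, hy⟩ := cone_null (ω.comp η)
  exact ⟨y, h1.trans (hy.comp (.refl _))⟩

end

section
open Filter Function Topology unitInterval Quaternion

theorem exists_push {Q C : Type} [TopologicalSpace Q] [NormalSpace Q] [TopologicalSpace C] [PathConnectedSpace C]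
    (ψ : C(Q, C)) (x₀ : C) {U : Set C} (hU : IsOpen U)
    (hn : (⟨Subtype.val, continuous_subtype_val⟩ : C(U, C)).Nullhomotopic) {W : Set Q} (hW : IsClosed W)
    (hWU : W ⊆ ψ ⁻¹' U) : ∃ f : C(Q, C), ψ.Homotopic f ∧ ∀ q ∈ W, f q = x₀ := by
  obtain hE | hE := isEmpty_or_nonempty U
  · exact ⟨ψ, .refl _, fun q hq => (hE.false ⟨_, hWU hq⟩).elim⟩
  obtain ⟨y, hy⟩ := hn
  obtain ⟨H⟩ := hy.trans (ContinuousMap.homotopic_const_iff.2 (PathConnectedSpace.joined y x₀))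
  obtain ⟨O, hO, hWO, hOU⟩ := normal_exists_closure_subset hW (hU.preimage ψ.continuous) hWU
  obtain ⟨ρ, h0, h1, hI⟩ := exists_continuous_zero_one_of_isClosed hO.isClosed_compl hW
    (Set.disjoint_left.2 fun q hq hw => hq (hWO hw))
  let r : I × Q → I := fun p => p.1 * ⟨ρ p.2, hI _⟩
  have hr : Continuous r := by fun_prop
  let P : Set (I × Q) := Prod.snd ⁻¹' (ψ ⁻¹' U)
  classical
  let F : I × Q → C := fun p => if h : ψ p.2 ∈ U then H (r p, ⟨ψ p.2, h⟩) else ψ p.2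
  have e : ∀ p : I × Q, p.2 ∉ O → F p = ψ p.2 := fun p hp => by
    have : r p = 0 := by
      have := h0 hp
      ext; simp_all [r]
    simp only [F]; split_ifs with h
    · rw [this]; exact H.map_zero_left _
    · rfl
  have hF : Continuous F := continuous_iff_continuousAt.2 fun p => by
    by_cases h : ψ p.2 ∈ U
    · have hP : IsOpen P := (hU.preimage ψ.continuous).preimage continuous_snd
      refine ContinuousOn.continuousAt (s := P) ?_ (hP.mem_nhds h)
      rw [continuousOn_iff_continuous_domRestrict]
      have : P.domRestrict F = fun z : P => H (r z.1, ⟨ψ z.1.2, z.2⟩) := funext fun z => dif_pos z.2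
      rw [this]; fun_prop
    · have : ∀ᶠ z : I × Q in 𝓝 p, F z = ψ z.2 := by
        filter_upwards [(isClosed_closure.isOpen_compl.preimage continuous_snd).mem_nhds
          (fun hc => h (hOU hc) : p ∈ Prod.snd ⁻¹' (closure O)ᶜ)] with z hz
        exact e z fun hz' => hz (subset_closure hz')
      exact (ψ.continuous.comp continuous_snd).continuousAt.congr (this.mono fun _ h => h.symm)
  refine ⟨⟨fun q => F (1, q), by fun_prop⟩, ⟨⟨⟨F, hF⟩, fun q => ?_, fun q => rfl⟩⟩, fun q hq => ?_⟩
  · have : r (0, q) = 0 := by simp [r]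
    simp only [F]; split_ifs with h
    · rw [this]; exact H.map_zero_left _
    · rfl
  · have : r (1, q) = 1 := by
      have := h1 hq
      ext; simp_all [r]
    simp only [F, ContinuousMap.coe_mk, dif_pos (show ψ (1, q).2 ∈ U from hWU hq), this]
    exact H.map_one_left _

theorem exists_pair {Q C : Type} [TopologicalSpace Q] [NormalSpace Q] [TopologicalSpace C]
    [PathConnectedSpace C] (hC : CatCover C 2) (ψ : C(Q, C)) (x₀ : C) : ∃ f g : C(Q, C), f.Homotopic ψ ∧
      g.Homotopic ψ ∧ ∀ q, (∀ᶠ z in 𝓝 q, f z = x₀) ∨ ∀ᶠ z in 𝓝 q, g z = x₀ := by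
  obtain ⟨U, hU, hc, hn⟩ := hC
  have c : ∀ q, ψ q ∈ U 0 ∨ ψ q ∈ U 1 := fun q => by
    have := hc.ge (Set.mem_univ (ψ q))
    simpa using this
  obtain ⟨O, hO, h1, h2⟩ := normal_exists_closure_subset ((hU 1).preimage ψ.continuous).isClosed_compl
    ((hU 0).preimage ψ.continuous) fun q hq => (c q).resolve_right hq
  obtain ⟨O', hO', h3, h4⟩ := normal_exists_closure_subset hO.isClosed_compl
    ((hU 1).preimage ψ.continuous) fun q hq => by_contra fun h => hq (h1 h)
  obtain ⟨f, hf, ef⟩ := exists_push ψ x₀ (hU 0) (hn 0) isClosed_closure h2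
  obtain ⟨g, hg, eg⟩ := exists_push ψ x₀ (hU 1) (hn 1) isClosed_closure h4
  refine ⟨f, g, hf.symm, hg.symm, fun q => ?_⟩
  by_cases h : q ∈ O
  · exact .inl (mem_of_superset (hO.mem_nhds h) fun z hz => ef z (subset_closure hz))
  · exact .inr (mem_of_superset (hO'.mem_nhds (h3 h)) fun z hz => eg z (subset_closure hz))

instance {A X : Type*} [TopologicalSpace A] [TopologicalSpace X] [PathConnectedSpace A] [PathConnectedSpace X]
    (f : A → X) : PathConnectedSpace (MappingCone f) := by
  let a₀ := Classical.arbitrary A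
  haveI := isPathConnected_iff_pathConnectedSpace.1 ((convex_Icc (0 : ℝ) 1).isPathConnected ⟨0, by simp⟩)
  refine ⟨⟨cinr f (a₀, 1)⟩, ?_⟩
  have : ∀ z, Joined z (cinr f (a₀, 1)) := by
    rintro ⟨x | p⟩
    · rw [cinr_one]; exact (PathConnectedSpace.joined x (f a₀)).map (cinl f).continuous
    · exact ⟨((PathConnectedSpace.somePath p.1 a₀).prod (PathConnectedSpace.somePath p.2 1)).map (cinr f).continuous⟩
  exact fun x y => (this x).trans (this y).symm

theorem cn_lift {E F Y : Type} [NormedAddCommGroup E] [NormedSpace ℝ E] [NormedAddCommGroup F] [NormedSpace ℝ F]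
    [TopologicalSpace Y] {A : Set E} {B : Set F} {h : E → F} (hA : IsCompact A) (hB : IsCompact B)
    (hc : ContinuousOn h A) (hm : Set.MapsTo h A B) (K : C(A × I, Y)) (m : C(B, Y))
    (h0 : ∀ a b, K (a, 0) = K (b, 0)) (h1 : ∀ a : A, K (a, 1) = m ⟨h a, hm a.2⟩) :
    ∃ ψ : C(cn A B h, Y), ∀ y : B, ψ ⟨(0, y, 1), cn_one y.2⟩ = m y := by
  haveI := isCompact_iff_compactSpace.1 hA
  haveI := isCompact_iff_compactSpace.1 hB
  have hc' : Continuous fun a : A => h a := hc.comp_continuous continuous_subtype_val fun a => a.2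
  let q : C((A × I) ⊕ B, cn A B h) := ⟨Sum.elim
    (fun p => ⟨(((p.2 : ℝ) * (1 - p.2)) • (p.1 : E), (p.2 : ℝ) • h p.1, p.2), cn_mem hm p.1.2 p.2.2 rfl rfl⟩)
    (fun y => ⟨(0, y, 1), cn_one y.2⟩), by
      refine Continuous.sumElim (.subtype_mk ?_ _) (.subtype_mk ?_ _)
      · have : Continuous fun p : A × I => h p.1 := hc'.comp continuous_fst
        refine .prodMk ?_ (.prodMk (.smul (by fun_prop) this) ?_) <;> fun_prop
      · fun_prop⟩
  have hq : IsQuotientMap q := by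
    refine q.continuous.isClosedMap.isQuotientMap q.continuous ?_
    rintro ⟨z, ⟨a, ha, t, ht, rfl⟩ | ⟨y, hy, rfl⟩⟩
    · exact ⟨.inl (⟨a, ha⟩, ⟨t, ht⟩), rfl⟩
    · exact ⟨.inr ⟨y, hy⟩, rfl⟩
  let g : C((A × I) ⊕ B, Y) := ⟨Sum.elim K m, K.continuous.sumElim m.continuous⟩
  have key : ∀ a a' : A, ∀ t t' : I, q (.inl (a, t)) = q (.inl (a', t')) → K (a, t) = K (a', t') := by
    intro a a' t t' e
    have e := congrArg Subtype.val e
    simp only [q, ContinuousMap.coe_mk, Sum.elim_inl, Prod.mk.injEq] at e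
    obtain ⟨e1, e2, e3⟩ := e
    obtain rfl := Subtype.ext e3
    rcases eq_or_ne t 0 with rfl | t0
    · exact h0 _ _
    rcases eq_or_ne t 1 with rfl | t1
    · rw [h1, h1]; congr 2; simpa using e2
    · have : (t : ℝ) * (1 - t) ≠ 0 := mul_ne_zero (fun h => t0 (Subtype.ext h))
        (sub_ne_zero.2 fun h => t1 (Subtype.ext h.symm))
      rw [Subtype.ext (smul_right_injective E this e1)]
  have k2 : ∀ (a : A) (t : I) (y : B), q (.inl (a, t)) = q (.inr y) → K (a, t) = m y := by
    intro a t y e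
    have e := congrArg Subtype.val e
    simp only [q, ContinuousMap.coe_mk, Sum.elim_inl, Sum.elim_inr, Prod.mk.injEq] at e
    obtain ⟨e1, e2, e3⟩ := e
    obtain rfl : t = 1 := Subtype.ext e3
    rw [h1]; congr 2; simpa using e2
  have hg : FactorsThrough g q := by
    rintro (⟨a, t⟩ | y) (⟨a', t'⟩ | y') e
    · exact key _ _ _ _ e
    · exact k2 _ _ _ e
    · exact (k2 _ _ _ e.symm).symm
    · have e := congrArg Subtype.val e
      simp only [q, ContinuousMap.coe_mk, Sum.elim_inr, Prod.mk.injEq] at e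
      exact congrArg m (Subtype.ext e.2.1)
  exact ⟨hq.lift g hg, fun y => congrArg (fun f => f (.inr y)) (hq.lift_comp g hg)⟩

end

section
open Filter Function Topology unitInterval Quaternion

section
variable {V W : Type*}

open Classical in
def zext [Zero W] {K : Set V} (u : K → W) (v : V) : W := if h : v ∈ K then u ⟨v, h⟩ else 0

theorem zext_of_mem [Zero W] {K : Set V} (u : K → W) {v : V} (h : v ∈ K) : zext u v = u ⟨v, h⟩ := dif_pos h

theorem continuousOn_zext [TopologicalSpace V] [TopologicalSpace W] [Zero W] {K : Set V} {u : K → W}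
    (hu : Continuous u) : ContinuousOn (zext u) K := by
  rw [continuousOn_iff_continuous_domRestrict]
  exact hu.congr fun x => (zext_of_mem u x.2).symm

theorem htpy_zext {C : Type*} [UniformSpace V] [UniformSpace W] [Zero W] [TopologicalSpace C] {K : Set V}
    {L : Set W} (hK : IsCompact K) (χ : C(C, W)) (hχ : ∀ z, χ z ∈ L) {f g : C(K, C)} (h : f.Homotopic g) :
    Htpy (CS K) (CS L) (zext fun z => χ (f z)) (zext fun z => χ (g z)) := by
  obtain ⟨H⟩ := h
  let G : V × ℝ → W := fun p => zext (fun z : K => χ (H (Set.projIcc 0 1 zero_le_one p.2, z))) p.1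
  have e : ∀ p : V × ℝ, ∀ h : p.1 ∈ K, G p = χ (H (Set.projIcc 0 1 zero_le_one p.2, ⟨p.1, h⟩)) :=
    fun p h => zext_of_mem _ h
  refine htpy_cs hK G ?_ (fun x hx t _ => by rw [e _ hx]; exact hχ _) (fun x hx => ?_) fun x hx => ?_
  · rw [continuousOn_iff_continuous_domRestrict]
    refine Continuous.congr (f := fun p : ↥(K ×ˢ Set.Icc (0 : ℝ) 1) =>
      χ (H (Set.projIcc 0 1 zero_le_one p.1.2, ⟨p.1.1, p.2.1⟩))) ?_ fun p => (e p.1 p.2.1).symm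
    refine χ.continuous.comp (H.continuous.comp (.prodMk (continuous_projIcc.comp ?_) ?_)) <;> fun_prop
  · rw [e _ hx, zext_of_mem _ hx]; simp
  · rw [e _ hx, zext_of_mem _ hx]; simp
end

theorem not_catCover_two {η : C(Sph 7, Sph 6)} {ω : C(Sph 6, Sph 3)} (hη : GeneratesPi (by norm_num) η)
    (hω : GeneratesPi (by norm_num) ω) : ¬ CatCover (MappingCone fun x => ω (η x)) 2 := by
  intro hC
  obtain ⟨θ7⟩ := sph_homeo (gauge_pn (K := ℍ[ℝ])) (n := 7) (by norm_num) (by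
    rw [Module.finrank_prod, Quaternion.finrank_eq_four])
  obtain ⟨θ3⟩ := sph_homeo gauge_gc.gs (n := 3) (by norm_num) (by
    rw [Module.finrank_prod, Module.finrank_prod, Complex.finrank_real_complex, Module.finrank_self])
  obtain ⟨y, ⟨H⟩⟩ := null_model hη hω (θ3.symm : C(un (gs gc), Sph 3))
  have hP : IsCompact (un (pn (K := ℍ[ℝ]))) := gauge_pn.compact
  have hN : IsCompact (un (gs fun c : ℍ[ℝ] => ‖c‖)) := gauge_norm.gs.compact
  have hQ : IsCompact QP := cn_compact hP hN continuous_hop.continuousOn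
  haveI := isCompact_iff_compactSpace.1 hQ
  let m : C(un (gs fun c : ℍ[ℝ] => ‖c‖), MappingCone fun x => ω (η x)) :=
    (cinl fun x => ω (η x)).comp ((θ3.symm : C(un (gs gc), Sph 3)).comp
      ⟨fun y => ⟨sp y, sp_maps y.2⟩, (continuous_sp.comp continuous_subtype_val).subtype_mk _⟩)
  have h1 : ∀ a : un (pn (K := ℍ[ℝ])), H (0, a) = m ⟨hop a, hop_maps a.2⟩ := fun a => by
    have : ω₁ (η₁ a) = ⟨sp (hop a), sp_maps (hop_maps a.2)⟩ := Subtype.ext (ω₀_η₀ _)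
    rw [H.apply_zero, ContinuousMap.comp_apply, ContinuousMap.comp_apply, ContinuousMap.comp_apply, this]
    rfl
  obtain ⟨ψ, hψ⟩ := cn_lift (h := hop) hP hN continuous_hop.continuousOn hop_maps
    ⟨fun p => H (σ p.2, p.1), by fun_prop⟩ m (fun a b => by simp) fun a => by simpa using h1 a
  let α : ℍ[ℝ] × ℍ[ℝ] → ℝ × (ℝ × ℂ) := zext fun a : un (pn (K := ℍ[ℝ])) => (θ3 (ω (η (θ7.symm a))) : ℝ × (ℝ × ℂ))
  have eα : ∀ a, α (θ7 a) = θ3 (ω (η a)) := fun a => by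
    simp only [α]; rw [zext_of_mem _ (θ7 a).2]; simp
  have hα : ContinuousOn α (un pn) := continuousOn_zext (by fun_prop)
  have hm : Set.MapsTo α (un pn) (un (gs gc)) := fun a ha => by
    simp only [α]; rw [zext_of_mem _ ha]; exact Subtype.prop _
  let χ : C(MappingCone fun x => ω (η x), (ℍ[ℝ] × ℍ[ℝ]) × (ℝ × (ℝ × ℂ)) × ℝ) :=
    ⟨Quot.lift (Sum.elim (fun y => (0, (θ3 y : ℝ × (ℝ × ℂ)), 1)) fun p => (((p.2 : ℝ) * (1 - p.2)) • (θ7 p.1 : ℍ[ℝ] × ℍ[ℝ]),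
      (p.2 : ℝ) • (θ3 (ω (η p.1)) : ℝ × (ℝ × ℂ)), (p.2 : ℝ))) (by
        rintro _ _ (⟨a, rfl, rfl⟩ | ⟨a, b, rfl, rfl⟩) <;> simp),
      continuous_quot_lift _ (by
        refine Continuous.sumElim ?_ ?_ <;> fun_prop)⟩
  have hχ : ∀ z, χ z ∈ cn (un pn) (un (gs gc)) α := by
    rintro ⟨y | p⟩
    · exact cn_one (θ3 y).2
    · exact cn_mem hm (θ7 p.1).2 p.2.2 rfl (by rw [eα])
  obtain ⟨f, g, hf, hg, ht⟩ := exists_pair hC ψ y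
  have hn : ∀ f : C(QP, MappingCone fun x => ω (η x)), ∀ q : QP, (∀ᶠ z in 𝓝 q, f z = y) →
      {z | zext (fun z => χ (f z)) z = χ y} ∈ 𝓝[QP] q.1 := by
    intro f q h
    rw [nhds_subtype_eq_comap_nhdsWithin, eventually_comap] at h
    filter_upwards [h, self_mem_nhdsWithin] with z hz hz'
    rw [zext_of_mem _ hz', hz ⟨z, hz'⟩ rfl]
  have hmz : ∀ f : C(QP, MappingCone fun x => ω (η x)),
      Set.MapsTo (zext fun z => χ (f z)) QP (cn (un pn) (un (gs gc)) α) := fun f z hz => by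
    rw [zext_of_mem _ hz]; exact hχ _
  have hcz : ∀ f : C(QP, MappingCone fun x => ω (η x)), ContinuousOn (zext fun z => χ (f z)) QP :=
    fun f => continuousOn_zext (by fun_prop)
  refine no_cat hα hm (hχ y) (hcz f) (hcz g) (hcz ψ) (hmz f) (hmz g) (hmz ψ)
    (fun q hq => (ht ⟨q, hq⟩).imp (hn f _) (hn g _)) (htpy_zext hQ χ hχ hf) (htpy_zext hQ χ hχ hg) fun x hx => ?_
  refine (zext_of_mem (K := QP) _ (cn_one hx)).trans ((congrArg χ (hψ ⟨x, hx⟩)).trans ?_)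
  exact congrArg (fun u : ℝ × (ℝ × ℂ) => ((0 : ℍ[ℝ] × ℍ[ℝ]), u, (1 : ℝ))) (by simp)

end

section
open Filter Function Topology unitInterval Quaternion

section
variable {A X Z : Type*} [TopologicalSpace A] [TopologicalSpace X] [TopologicalSpace Z]

theorem continuous_cone_lift {f : A → X} {U : Set (MappingCone f)} (hU : IsOpen U) (G : I × MappingCone f → Z)
    (hl : ∀ s x, cinl f x ∈ U → ContinuousAt (fun p : I × X => G (p.1, cinl f p.2)) (s, x))
    (hr : ∀ s x, cinr f x ∈ U → ContinuousAt (fun p : I × A × I => G (p.1, cinr f p.2)) (s, x)) :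
    Continuous fun p : I × U => G (p.1, p.2) := by
  have hq : IsQuotientMap (Quot.mk (coneRel f)) := isQuotientMap_quot_mk
  refine (hq.restrictPreimage_isOpen hU).continuous_lift_prod_right (g := fun p : I × U => G (p.1, p.2)) ?_
  rw [continuous_iff_continuousAt]
  rintro ⟨s, z, hz⟩
  have h2 : ContinuousAt (fun p : I × (Quot.mk (coneRel f) ⁻¹' U) => (p.1, (p.2 : X ⊕ A × I))) (s, ⟨z, hz⟩) := by
    fun_prop
  let g : I × (X ⊕ A × I) → Z := fun p => G (p.1, Quot.mk _ p.2)
  suffices h : ContinuousAt g (s, z) from h.comp (f := fun p : I × (Quot.mk (coneRel f) ⁻¹' U) => (p.1, (p.2 : X ⊕ A × I)))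
    (x := (s, ⟨z, hz⟩)) h2
  obtain x | x := z
  · exact (IsOpenEmbedding.id.prodMap IsOpenEmbedding.inl).continuousAt_iff (x := (s, x)).1 (hl s x hz)
  · exact (IsOpenEmbedding.id.prodMap IsOpenEmbedding.inr).continuousAt_iff (x := (s, x)).1 (hr s x hz)

def coneLift (f : A → X) {Y : Type*} (u : X → Y) (v : A × I → Y) (h1 : ∀ a, v (a, 1) = u (f a))
    (h0 : ∀ a b, v (a, 0) = v (b, 0)) : MappingCone f → Y :=
  Quot.lift (Sum.elim u v) (by rintro _ _ (⟨a, rfl, rfl⟩ | ⟨a, b, rfl, rfl⟩); exacts [h1 a, h0 a b])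

theorem null_openCone [Nonempty A] (f : A → X) : ∃ U : Set (MappingCone f), IsOpen U ∧ (∀ p, p.2 ≠ 1 → cinr f p ∈ U) ∧
    (⟨Subtype.val, continuous_subtype_val⟩ : C(U, MappingCone f)).Nullhomotopic := by
  let U : Set (MappingCone f) := coneLift f (fun _ => False) (fun p => p.2 ≠ 1) (by simp) (by simp)
  have hU : IsOpen U := isOpen_sum_iff.2 ⟨isOpen_empty, isOpen_ne.preimage continuous_snd⟩
  refine ⟨U, hU, fun p hp => hp, ?_⟩
  let c := cinr f (Classical.arbitrary A, 0)
  let G : I × MappingCone f → MappingCone f := fun p =>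
    coneLift f (fun _ => c) (fun x => if x.2 ≠ 1 then cinr f (x.1, σ p.1 * x.2) else c) (by simp)
      (fun a b => by simp [cinr_zero a b]) p.2
  have hG : Continuous fun p : I × U => G (p.1, p.2) := by
    refine continuous_cone_lift hU G (fun _ _ h => h.elim) fun s x hx => ?_
    refine ContinuousAt.congr (f := fun p : I × A × I => cinr f (p.2.1, σ p.1 * p.2.2)) (by fun_prop) ?_
    filter_upwards [(isOpen_ne.preimage (by fun_prop : Continuous fun p : I × A × I => p.2.2)).mem_nhds hx] with p hp
    exact (if_pos hp).symm
  refine ⟨c, ⟨⟨⟨_, hG⟩, ?_, ?_⟩⟩⟩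
  · rintro ⟨⟨x | x⟩, hx⟩
    · exact hx.elim
    · exact (if_pos hx).trans (by simp; rfl)
  · rintro ⟨⟨x | x⟩, hx⟩
    · exact hx.elim
    · exact (if_pos hx).trans (by simpa using cinr_zero _ _)

theorem null_collar [Nonempty X] (f : C(A, X)) {V : Set X} (hV : IsOpen V)
    (hn : (⟨Subtype.val, continuous_subtype_val⟩ : C(V, X)).Nullhomotopic) :
    ∃ U : Set (MappingCone f), IsOpen U ∧ (∀ x ∈ V, cinl f x ∈ U) ∧
    (⟨Subtype.val, continuous_subtype_val⟩ : C(U, MappingCone f)).Nullhomotopic := by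
  let U : Set (MappingCone f) := coneLift f (· ∈ V) (fun p => p.2 ≠ 0 ∧ f p.1 ∈ V) (by simp) (by simp)
  have o : IsOpen {p : A × I | p.2 ≠ 0 ∧ f p.1 ∈ V} :=
    (isOpen_ne.preimage continuous_snd).inter (hV.preimage (by fun_prop : Continuous fun p : A × I => f p.1))
  have hU : IsOpen U := isOpen_sum_iff.2 ⟨hV, o⟩
  refine ⟨U, hU, fun x hx => hx, ?_⟩
  let x₀ := Classical.arbitrary X
  have e : ∀ s, ∀ x : A × I, f x.1 ∈ V → x.2 ≠ 0 → ∀ᶠ p in 𝓝 ((s, x) : I × A × I), p.2.2 ≠ 0 := fun s x _ hx =>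
    (isOpen_ne.preimage (by fun_prop : Continuous fun p : I × A × I => p.2.2)).mem_nhds hx
  let r : MappingCone f → X := coneLift f id (fun p => if p.2 = 0 then x₀ else f p.1) (by simp) (by simp)
  have hr : Continuous fun p : I × U => r p.2 := by
    refine continuous_cone_lift hU (fun p => r p.2) (fun _ _ _ => continuousAt_snd) fun s x hx => ?_
    refine ContinuousAt.congr (f := fun p : I × A × I => f p.2.1) (by fun_prop) ?_
    filter_upwards [e s x hx.2 hx.1] with p hp
    exact (if_neg hp).symm
  have mr : ∀ z ∈ U, r z ∈ V := by
    rintro ⟨x | x⟩ hx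
    · exact hx
    · exact Set.mem_of_eq_of_mem (if_neg hx.1) hx.2
  let G : I × MappingCone f → MappingCone f := fun p =>
    coneLift f (cinl f) (fun x => if x.2 = 0 then cinl f x₀ else cinr f (x.1, p.1 ⊔ x.2)) 
      (fun a => by simpa [sup_eq_right.2 le_one'] using cinr_one a) (by simp) p.2
  have hG : Continuous fun p : I × U => G (p.1, p.2) := by
    refine continuous_cone_lift hU G (fun _ _ _ => (cinl f).continuous.continuousAt.comp continuousAt_snd) fun s x hx => ?_
    refine ContinuousAt.congr (f := fun p : I × A × I => cinr f (p.2.1, p.1 ⊔ p.2.2)) (by fun_prop) ?_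
    filter_upwards [e s x hx.2 hx.1] with p hp
    exact (if_neg hp).symm
  let r' : C(U, V) := ⟨fun z => ⟨r z, mr z z.2⟩, (hr.comp (.prodMk_right (0 : I))).subtype_mk _⟩
  obtain ⟨y, hy⟩ := (hn.comp_left r').comp_right (cinl f)
  refine ⟨y, .trans ⟨⟨⟨_, hG⟩, ?_, ?_⟩⟩ hy⟩
  · rintro ⟨⟨x | x⟩, hx⟩
    · rfl
    · exact (if_neg hx.1).trans (by simp; rfl)
  · rintro ⟨⟨x | x⟩, hx⟩
    · rfl
    · refine (if_neg hx.1).trans (Eq.trans ?_ (congrArg (cinl f) (if_neg hx.1).symm))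
      simpa [sup_eq_left.2 (le_one' (t := x.2))] using cinr_one x.1

theorem catCover_cone [Nonempty A] [Nonempty X] (f : C(A, X)) {k : ℕ} (h : CatCover X k) :
    CatCover (MappingCone f) (k + 1) := by
  obtain ⟨V, hV, hc, hn⟩ := h
  obtain ⟨U, hU, hm, hu⟩ := null_openCone f
  choose U' hU' hm' hu' using fun i => null_collar f (hV i) (hn i)
  refine ⟨Fin.cons U U', Fin.cases hU hU', Set.eq_univ_of_forall ?_, Fin.cases hu hu'⟩
  have hl : ∀ x, cinl f x ∈ ⋃ i, (Fin.cons U U' : Fin (k + 1) → Set (MappingCone f)) i := fun x => by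
    obtain ⟨i, hi⟩ := Set.mem_iUnion.1 (hc.ge (Set.mem_univ x))
    exact Set.mem_iUnion.2 ⟨i.succ, hm' i x hi⟩
  rintro ⟨x | ⟨a, t⟩⟩
  · exact hl x
  · by_cases ht : t = 1
    · subst ht
      exact Set.mem_of_eq_of_mem (cinr_one a) (hl (f a))
    · exact Set.mem_iUnion.2 ⟨0, hm _ ht⟩

theorem catCover_homeo {k : ℕ} (θ : A ≃ₜ X) (h : CatCover X k) : CatCover A k := by
  obtain ⟨V, hV, hc, hn⟩ := h
  refine ⟨fun i => θ ⁻¹' V i, fun i => (hV i).preimage θ.continuous, by rw [← Set.preimage_iUnion, hc, Set.preimage_univ],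
    fun i => ?_⟩
  convert! ((hn i).comp_left ⟨fun z : θ ⁻¹' V i => ⟨θ z, z.2⟩, by fun_prop⟩).comp_right (θ.symm : C(X, A)) using 1
  ext z; simp
end

theorem catCover_sphere : CatCover (un fun x : ℍ[ℝ] => ‖x‖) 2 := by
  have key : ∀ p : ℍ[ℝ], ‖p‖ = 1 →
      (⟨Subtype.val, continuous_subtype_val⟩ : C({x : un fun x : ℍ[ℝ] => ‖x‖ | (x : ℍ[ℝ]) ≠ p}, _)).Nullhomotopic := by
    intro p hp
    let L : I × {x : un fun x : ℍ[ℝ] => ‖x‖ | (x : ℍ[ℝ]) ≠ p} → ℍ[ℝ] := fun z =>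
      (1 - z.1 : ℝ) • z.2.1.1 - (z.1 : ℝ) • p
    have hL : ∀ z, L z ≠ 0 := by
      rintro ⟨s, ⟨x, hx⟩, hxp⟩ e
      have hx : ‖x‖ = 1 := hx
      have e : (1 - s : ℝ) • x = (s : ℝ) • p := sub_eq_zero.1 e
      have n := congrArg norm e
      rw [norm_smul, norm_smul, hx, hp, Real.norm_of_nonneg s.2.1, Real.norm_of_nonneg (sub_nonneg.2 s.2.2)] at n
      rw [show (1 - s : ℝ) = s by linarith] at e
      exact hxp (smul_right_injective _ (show (s : ℝ) ≠ 0 by intro h; rw [h] at n; norm_num at n) e)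
    have hc : Continuous fun z => nz (fun x : ℍ[ℝ] => ‖x‖) (L z) :=
      gauge_norm.continuousOn_nz.comp_continuous (by fun_prop) hL
    refine ⟨⟨-p, by simpa [un] using hp⟩, ⟨⟨⟨fun z => ⟨_, gauge_norm.nz_mem (hL z)⟩, hc.subtype_mk _⟩, fun x => ?_, fun x => ?_⟩⟩⟩
    · exact Subtype.ext (by simpa [L] using nz_of x.1.2)
    · exact Subtype.ext (by simpa [L] using nz_of (N := fun x : ℍ[ℝ] => ‖x‖) (x := -p) (by simpa [un] using hp))
  have o : ∀ p : ℍ[ℝ], IsOpen {x : un fun x : ℍ[ℝ] => ‖x‖ | (x : ℍ[ℝ]) ≠ p} := fun p =>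
    isOpen_ne.preimage continuous_subtype_val
  refine ⟨![{x | (x : ℍ[ℝ]) ≠ 1}, {x | (x : ℍ[ℝ]) ≠ -1}], Fin.forall_fin_two.2 ⟨o 1, o (-1)⟩, Set.eq_univ_of_forall fun x => ?_,
    Fin.forall_fin_two.2 ⟨key 1 (by simp), key (-1) (by simp)⟩⟩
  by_cases h : (x : ℍ[ℝ]) = 1
  · refine Set.mem_iUnion.2 ⟨1, ?_⟩
    show (x : ℍ[ℝ]) ≠ -1
    rw [h]; intro h
    have := congrArg QuaternionAlgebra.re h
    norm_num at this
  · exact Set.mem_iUnion.2 ⟨0, h⟩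

theorem catCover_three (f : C(Sph 7, Sph 3)) : CatCover (MappingCone f) 3 := by
  obtain ⟨θ⟩ := sph_homeo (gauge_norm (E := ℍ[ℝ])) (n := 3) (by norm_num) Quaternion.finrank_eq_four
  exact catCover_cone f (catCover_homeo θ catCover_sphere)

end

end CatCone

open unitInterval Topology

/-- Let `η : S⁷ → S⁶` and `ω : S⁶ → S³` generate `π₇(S⁶)` and `π₆(S³)`
respectively, and let `X = C_α` be the mapping cone of `α = ω ∘ η`.  Then
`cat(X) = 2`:  `X` admits a cover by three open sets whose inclusions are
null-homotopic, but no such cover by two open sets. -/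
theorem cat_cone_eq_two (η : C(Sph 7, Sph 6)) (ω : C(Sph 6, Sph 3))
    (hη : GeneratesPi (by norm_num) η) (hω : GeneratesPi (by norm_num) ω) :
    CatCover (MappingCone fun x => ω (η x)) 3 ∧
      ¬ CatCover (MappingCone fun x => ω (η x)) 2 :=
  ⟨CatCone.catCover_three (ω.comp η), CatCone.not_catCover_two hη hω⟩

end
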